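/- If G is a finite simple graph in which every vertex has degree 2 or degree 3, and G has exactly k connected components, then 10·γ_r(G) ≤ 5·n_2(G) + 4·n_3(G) + 5·k, where n_2(G) and n_3(G) denote the numbers of vertices of degree 2 and degree 3 in G. -/

import Mathlib

/-- `S` is a restrained dominating set of `G`: every vertex not in `S` has a
neighbor in `S` (domination) and also a neighbor not in `S` (restraint). -/
def IsRestrainedDomSet {V : Type*} (G : SimpleGraph V) (S : Set V) : Prop :=
  (∀ v ∉ S, ∃ u ∈ S, G.Adj v u) ∧ (∀ v ∉ S, ∃ u ∉ S, G.Adj v u)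

/-- The restrained domination number of a finite graph: the minimum cardinality
of a restrained dominating set. -/
noncomputable def restrainedDominationNumber {V : Type*} [Fintype V] (G : SimpleGraph V) : ℕ :=
  sInf {n : ℕ | ∃ S : Set V, IsRestrainedDomSet G S ∧ S.ncard = n}

namespace RDom
/-! ### Combinatorial data structures

The functions below are evaluated by the kernel, therefore they are written with recursors. -/

/-- A node of a shape: type, number of normal edges leaving, number of bad edges leaving, and
the list of indices of neighbours inside the shape. -/
abbrev Node := ℕ × ℕ × ℕ × List ℕ

/-- if-then-else -/
def bi {α : Type} (b : Bool) (x y : α) : α := @Bool.rec (fun _ => α) y x b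
def an (a b : Bool) : Bool := @Bool.rec (fun _ => Bool) false b a
def oo (a b : Bool) : Bool := @Bool.rec (fun _ => Bool) b true a

/-- Weight of a vertex with remaining degree `d` and flags `s`, `u`. -/
def Wn (d : ℕ) (s u : Bool) : ℕ :=
  bi (Nat.beq d 0) (bi (an s u) 0 20)
    (bi (Nat.beq d 1) (bi s (bi u 2 7) 12) (bi (Nat.beq d 2) (bi s 5 10) 8))

def hexd (x t : ℕ) : ℕ := Nat.mod (Nat.div x (Nat.pow 16 t)) 16
/-- weight, degree and flags of the six vertex types -/
def tW (t : ℕ) : ℕ := hexd 2913704 t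
def tR (t : ℕ) : ℕ := hexd 1118755 t
def tS (t : ℕ) : Bool := Nat.beq (hexd 1052928 t) 1
def tU (t : ℕ) : Bool := Nat.beq (hexd 1114112 t) 1

def memB (i : ℕ) (l : List ℕ) : Bool :=
  @List.rec ℕ (fun _ => Bool) false (fun a _ ih => oo (Nat.beq i a) ih) l

/-- length -/
def len {α : Type} (l : List α) : ℕ := @List.rec α (fun _ => ℕ) 0 (fun _ _ ih => Nat.succ ih) l

/-- Update old nodes when a node with index `n` is attached. -/
def updNodes (n : ℕ) (nbB nbO : List ℕ) (l : List Node) : ℕ → List Node :=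
  @List.rec Node (fun _ => ℕ → List Node) (fun _ => [])
    (fun x _ ih i =>
      (bi (memB i nbB) (x.1, x.2.1, Nat.pred x.2.2.1, n :: x.2.2.2)
        (bi (memB i nbO) (x.1, Nat.pred x.2.1, x.2.2.1, n :: x.2.2.2) x)) :: ih (Nat.succ i)) l

def addNode (d : List Node) (ty : ℕ) (nbB nbO : List ℕ) (out bad : ℕ) : List Node :=
  updNodes (len d) nbB nbO d 0 ++ [(ty, out, bad, nbB ++ nbO)]

def shiftNode (n : ℕ) (x : Node) : Node := (x.1, x.2.1, x.2.2.1, x.2.2.2.map (Nat.add n))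

def mergeS (a b : List Node) : List Node := a ++ b.map (shiftNode (len a))

def twoS (a b : List Node) : List Node :=
  addNode (mergeS a b) 0 [Nat.pred (len a), Nat.pred (Nat.add (len a) (len b))] [] 0 1

/-- Forcing evaluation (these are identities, they only speed up kernel evaluation). -/
def fN {β : Type} (n : ℕ) (k : ℕ → β) : β :=
  @Nat.rec (fun _ => β) (k 0) (fun m _ => k (Nat.succ m)) n
def fL {β : Type} (l : List ℕ) : (List ℕ → β) → β :=
  @List.rec ℕ (fun _ => (List ℕ → β) → β) (fun k => k [])
    (fun a _ ih k => fN a fun a' => ih fun l' => k (a' :: l')) l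
def fS {β : Type} (l : List Node) : (List Node → β) → β :=
  @List.rec Node (fun _ => (List Node → β) → β) (fun k => k [])
    (fun x _ ih k => fN x.1 fun a => fN x.2.1 fun b => fN x.2.2.1 fun c => fL x.2.2.2 fun d =>
      ih fun l' => k ((a, b, c, d) :: l')) l

/-- apply a function to the top of a stack -/
def onTop (f : List Node → List Node) (st : List (List Node)) : List (List Node) :=
  @List.rec _ (fun _ => List (List Node)) [] (fun d r _ => fS (f d) fun x => x :: r) st

def addOne (t : ℕ) (d : List Node) : List Node := addNode d t [Nat.pred (len d)] [] 0 1
def addOut (d : List Node) : List Node := addNode d 0 [Nat.pred (len d)] [] 1 1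
def addRecv (i : ℕ) (d : List Node) : List Node := addNode d 0 [Nat.pred (len d)] [i] 0 1
def addArc (d : List Node) : List Node := addNode d 0 [Nat.pred (len d)] [] 0 2
def addEnd (t : ℕ) (d : List Node) : List Node := addNode d t [Nat.pred (len d)] [] 0 0

/-- One step of the decoder. -/
def stepD (g : ℕ) (st : List (List Node)) : List (List Node) :=
  bi (Nat.ble 16 g) (onTop (addRecv (Nat.sub g 16)) st)
  (bi (Nat.beq g 6) (onTop (addOne 1) st)
  (bi (Nat.beq g 7) (onTop (addOne 2) st)
  (bi (Nat.beq g 8) (onTop addOut st)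
  (bi (Nat.beq g 9) (@List.rec _ (fun _ => List (List Node)) [] (fun d r _ => onTop (fun d' => twoS d' d) r) st)
  (bi (Nat.beq g 10) (onTop addArc st)
  (bi (Nat.ble 11 g) ([(Nat.sub g 10, 0, 2, [])] :: st)
    ([(Nat.pred g, Nat.pred (tR (Nat.pred g)), 1, [])] :: st)))))))

def decA (f : ℕ) : ℕ → List (List Node) :=
  @Nat.rec (fun _ => ℕ → List (List Node)) (fun _ => [])
    (fun _ ih c => bi (Nat.beq c 0) [] (fN (Nat.mod c 32) fun g => stepD g (ih (Nat.div c 32)))) f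

def decode (c : ℕ) : List Node := (decA 20 c).headD []

/-- State (0 = N, 1 = S, 2 = U) of node `j` in mask `m`. -/
def dig (m j : ℕ) : ℕ := Nat.mod (Nat.div m (Nat.pow 3 j)) 3

def cnt (m s : ℕ) (l : List ℕ) : ℕ :=
  @List.rec ℕ (fun _ => ℕ) 0 (fun j _ ih => bi (Nat.beq (dig m j) s) (Nat.succ ih) ih) l

/-- validity, positive and negative part of the contribution of a node -/
def ndOk (t s ns nu : ℕ) : Bool :=
  bi (Nat.beq s 2) (an (oo (tS t) (Nat.ble 1 ns)) (oo (tU t) (Nat.ble 1 nu))) true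
def ndP (t out s : ℕ) : ℕ := bi (Nat.beq s 1) (Nat.add (tW t) (Nat.mul 3 out)) (tW t)
def ndM (t out b s ns nu : ℕ) : ℕ :=
  bi (Nat.beq s 0) (Wn (Nat.sub (Nat.sub (tR t) ns) nu) (oo (tS t) (Nat.ble 1 ns)) (oo (tU t) (Nat.ble 1 nu)))
    (bi (Nat.beq s 1) (Nat.add 20 (Nat.mul 2 b)) (Nat.mul 2 (Nat.add out b)))

/-- number of extra neighbours of node `i` in state `s` because of the parent in state `md`
(`md = 3` means external) -/
def exS (n i md s : ℕ) : ℕ := bi (Nat.beq md s) (bi (Nat.beq (Nat.succ i) n) 1 0) 0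
def bdv (md b : ℕ) : ℕ := bi (Nat.beq md 3) b 0

/-- value check -/
def valA (n m md lo : ℕ) (l : List Node) : ℕ → ℕ → ℕ → Bool :=
  @List.rec Node (fun _ => ℕ → ℕ → ℕ → Bool) (fun _ P M => Nat.ble (Nat.add M lo) (Nat.add P 64))
    (fun x _ ih i P M =>
      fN (dig m i) fun s => fN (Nat.add (cnt m 1 x.2.2.2) (exS n i md 1)) fun ns =>
      fN (Nat.add (cnt m 2 x.2.2.2) (exS n i md 2)) fun nu =>
      an (ndOk x.1 s ns nu) (fN (Nat.add P (ndP x.1 x.2.1 s)) fun P' =>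
        fN (Nat.add M (ndM x.1 x.2.1 (bdv md x.2.2.1) s ns nu)) fun M' => ih (Nat.succ i) P' M')) l

def isBase (n i md out bad : ℕ) : Bool :=
  oo (Nat.ble 1 out) (oo (Nat.ble 1 (bdv md bad)) (an (Nat.beq md 0) (Nat.beq (Nat.succ i) n)))

def bitv (R i : ℕ) : Bool := Nat.beq (Nat.mod (Nat.div R (Nat.pow 2 i)) 2) 1

def anyR (R : ℕ) (l : List ℕ) : Bool :=
  @List.rec ℕ (fun _ => Bool) false (fun j _ ih => oo (bitv R j) ih) l

def up1 (n m md i : ℕ) (x : Node) (R : ℕ) : ℕ :=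
  bi (an (Nat.beq (dig m i) 0) (bi (bitv R i) false
    (oo (isBase n i md x.2.1 x.2.2.1) (anyR R x.2.2.2)))) (Nat.add R (Nat.pow 2 i)) R

def passU (n m md : ℕ) (l : List Node) : ℕ → ℕ → ℕ :=
  @List.rec Node (fun _ => ℕ → ℕ → ℕ) (fun _ R => R)
    (fun x _ ih i R => fN (up1 n m md i x R) fun R' => ih (Nat.succ i) R') l

def passD (n m md : ℕ) (l : List Node) : ℕ → ℕ → ℕ :=
  @List.rec Node (fun _ => ℕ → ℕ → ℕ) (fun _ R => R)
    (fun x _ ih i R => fN (ih (Nat.succ i) R) fun R' => up1 n m md i x R') l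

def allR (m R k : ℕ) : Bool :=
  @Nat.rec (fun _ => Bool) true (fun i ih => an (oo (Nat.ble 1 (dig m i)) (bitv R i)) ih) k

def fullB (m k : ℕ) : Bool :=
  @Nat.rec (fun _ => Bool) true (fun i ih => an (Nat.ble 1 (dig m i)) ih) k

def reachOk (d : List Node) (n m md : ℕ) : Bool :=
  oo (fullB m n) (fN (passD n m md d 0 0) fun R1 => oo (allR m R1 n)
    (fN (passU n m md d 0 R1) fun R2 => oo (allR m R2 n)
      (fN (passD n m md d 0 R2) fun R3 => fN (passU n m md d 0 R3) fun R4 => allR m R4 n)))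

/-- full check with threshold `lo` (offset 64). -/
def chk (d : List Node) (m md lo : ℕ) : Bool :=
  fN (len d) fun n => an (valA n m md lo d 0 0 0) (reachOk d n m md)

def allZero (l : List Node) : Bool :=
  @List.rec Node (fun _ => Bool) true (fun x _ ih => an (Nat.beq x.2.1 0) ih) l

/-- external reduction check -/
def chkE (z : Bool) (d : List Node) (m : ℕ) : Bool :=
  fN (len d) fun n => an (Nat.ble 1 m) (an (Nat.ble (Nat.succ m) (Nat.pow 3 n))
    (fN (bi (an (Nat.beq (dig m (Nat.pred n)) 1) z) 65 64) fun lo => chk d m 3 lo))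
/-- closing check -/
def chkF (d : List Node) (m : ℕ) : Bool := an (fullB m (len d)) (chk d m 3 54)

def natsEq (l : List ℕ) : List ℕ → Bool :=
  @List.rec ℕ (fun _ => List ℕ → Bool) (fun l' => @List.rec ℕ (fun _ => Bool) true (fun _ _ _ => false) l')
    (fun a _ ih l' => @List.rec ℕ (fun _ => Bool) false (fun b t _ => an (Nat.beq a b) (ih t)) l') l
def nodeEq (x y : Node) : Bool :=
  an (Nat.beq x.1 y.1) (an (Nat.beq x.2.1 y.2.1) (an (Nat.beq x.2.2.1 y.2.2.1) (natsEq x.2.2.2 y.2.2.2)))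
def shEq (l : List Node) : List Node → Bool :=
  @List.rec Node (fun _ => List Node → Bool) (fun l' => @List.rec Node (fun _ => Bool) true (fun _ _ _ => false) l')
    (fun a _ ih l' => @List.rec Node (fun _ => Bool) false (fun b t _ => an (nodeEq a b) (ih t)) l') l

/-- code of an entry -/
def enC (e : List ℕ) : ℕ := @List.rec ℕ (fun _ => ℕ) 0 (fun c _ _ => c) e
/-- group of an entry -/
def enG (e : List ℕ) : ℕ := enC e.tail

def lookC (c : ℕ) (l : List (List ℕ)) : Bool :=
  @List.rec (List ℕ) (fun _ => Bool) false (fun e _ ih => oo (Nat.beq (enC e) c) ih) l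

def all2 {α : Type} (p : α → ℕ → Bool) (l : List α) : List ℕ → Bool :=
  @List.rec α (fun _ => List ℕ → Bool) (fun _ => true)
    (fun a _ ih l' => @List.rec ℕ (fun _ => Bool) false (fun b t _ => an (p a b) (ih t)) l') l

/-- indices with positive out, starting with index `i` -/
def outIdx (l : List Node) : ℕ → List ℕ :=
  @List.rec Node (fun _ => ℕ → List ℕ) (fun _ => [])
    (fun x _ ih i => bi (Nat.ble 1 x.2.1) (i :: ih (Nat.succ i)) (ih (Nat.succ i))) l
/-- indices with positive bad, starting with index `i` -/
def badIdx (l : List Node) : ℕ → List ℕ :=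
  @List.rec Node (fun _ => ℕ → List ℕ) (fun _ => [])
    (fun x _ ih i => bi (Nat.ble 1 x.2.2.1) (i :: ih (Nat.succ i)) (ih (Nat.succ i))) l
/-- remove an index -/
def remB (n : ℕ) (l : List ℕ) : List ℕ :=
  @List.rec ℕ (fun _ => List ℕ) [] (fun a _ ih => bi (Nat.beq a n) ih (a :: ih)) l

/-- `i` is the only index with nonzero out, which is one -/
def zeroBut (i : ℕ) (l : List Node) : ℕ → Bool :=
  @List.rec Node (fun _ => ℕ → Bool) (fun _ => true)
    (fun x _ ih j => an (oo (Nat.beq x.2.1 0) (an (Nat.beq i j) (Nat.beq x.2.1 1))) (ih (Nat.succ j))) l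

abbrev SExt := ℕ × ℕ × List Node

def recvs (tag c : ℕ) (d : List Node) : List SExt :=
  (remB (Nat.pred (len d)) (outIdx d 0)).map fun i => (tag, Nat.add (Nat.mul c 32) (Nat.add 16 i), addRecv i d)

def extsL (c : ℕ) (d : List Node) : List SExt :=
  (0, Nat.add (Nat.mul c 32) 6, addOne 1 d) :: (0, Nat.add (Nat.mul c 32) 7, addOne 2 d) ::
  (0, Nat.add (Nat.mul c 32) 8, addOut d) :: (1, Nat.add (Nat.mul c 32) 10, addArc d) ::
  (recvs 0 c d ++ bi (allZero d) [(2, 0, addEnd 3 d), (2, 0, addEnd 4 d), (2, 0, addEnd 5 d)] [])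

/-- closing an arc: the last node of `x` and another node with positive bad are joined to a
new node. -/
def closeY (x : List Node) : List SExt :=
  fN (Nat.pred (len x)) fun n =>
  (remB n (badIdx x 0)).flatMap fun c0 =>
    bi (allZero x) [(2, 0, addNode x 1 [n, c0] [] 0 0), (2, 0, addNode x 2 [n, c0] [] 0 0)]
      (((outIdx x 0).filter fun i => zeroBut i x 0).map fun i => (2, 0, addNode x 0 [n, c0] [i] 0 0))

def extsX (c : ℕ) (d : List Node) : List SExt :=
  (1, Nat.add (Nat.mul c 32) 6, addOne 1 d) :: (1, Nat.add (Nat.mul c 32) 7, addOne 2 d) :: recvs 1 c d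

def extsA (c : ℕ) (d : List Node) : List SExt :=
  extsX c d ++ (extsX c d).flatMap fun x => fS x.2.2 closeY

/-- check of one extension with certificate -/
def chkExt (tL tA : List (List ℕ)) (x : SExt) (m : ℕ) : Bool :=
  fS x.2.2 fun s =>
  bi (Nat.beq x.1 2) (chkF s m)
    (bi (Nat.beq m 0) (fN x.2.1 fun c => an (lookC c (bi (Nat.beq x.1 0) tL tA)) (shEq (decode c) s))
      (chkE (an (Nat.beq x.1 0) (allZero s)) s m))

def nth (l : List ℕ) (i : ℕ) : ℕ := l.getD i 0

/-- capability vector `[z, S, Us, Uu, NS]` (offset 64, 0 = unavailable) -/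
def capV (cv : List ℕ) (a st : ℕ) : ℕ :=
  bi (Nat.beq a 1) (nth cv 1)
    (bi (Nat.beq a 0) (bi (Nat.beq st 0) 64 (bi (Nat.beq st 1) (nth cv 4) 0))
      (bi (Nat.beq st 1) (nth cv 2) (bi (Nat.beq st 2) (nth cv 3) 0)))
def capM (e : List ℕ) (a st : ℕ) : ℕ :=
  bi (Nat.beq a 1) (nth e 2)
    (bi (Nat.beq a 0) (bi (Nat.beq st 0) 0 (nth e 5)) (bi (Nat.beq st 1) (nth e 3) (nth e 4)))

def chkCap (d : List Node) (cv e : List ℕ) (a st : ℕ) : Bool :=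
  fN (capV cv a st) fun v => oo (Nat.beq v 0)
    (fN (capM e a st) fun m => an (Nat.beq (dig m (Nat.pred (len d))) a) (chk d m st v))

/-- check of an L entry: `[code, group, mS, mUs, mUu, mNS, certs...]` -/
def chkL (T tL tA : List (List ℕ)) (e : List ℕ) : Bool :=
  fS (decode (enC e)) fun d => fL (T.getD (enG e) []) fun cv =>
    an (oo (Nat.beq (enC cv) 1) (bi (allZero d) false true)) (an (Nat.ble (Nat.succ (enG e)) 36)
    (an (chkCap d cv e 0 0) (an (chkCap d cv e 0 1) (an (chkCap d cv e 0 2)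
    (an (chkCap d cv e 1 0) (an (chkCap d cv e 1 1) (an (chkCap d cv e 1 2)
    (an (chkCap d cv e 2 0) (an (chkCap d cv e 2 1) (an (chkCap d cv e 2 2)
    (all2 (chkExt tL tA) (extsL (enC e) d) (e.drop 6))))))))))))

/-- check of an arc entry `[code, certs...]` -/
def chkA (tA : List (List ℕ)) (e : List ℕ) : Bool :=
  fS (decode (enC e)) fun d => all2 (chkExt [] tA) (extsA (enC e) d) (e.drop 1)

/-- number of states equal to `s` among `a`, `b` -/
def num2 (s a b : ℕ) : ℕ := Nat.add (bi (Nat.beq a s) 1 0) (bi (Nat.beq b s) 1 0)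

/-- combination of two children below a new vertex of degree three -/
def comb1 (x y : List ℕ) (st a b : ℕ) : Bool :=
  fN (capV x a st) fun g1 => fN (capV y b st) fun g2 =>
  an (Nat.ble 1 g1) (an (Nat.ble 1 g2) (an (Nat.ble 1 (Nat.add st (Nat.add a b)))
  (fN (num2 1 a b) fun nS => fN (num2 2 a b) fun nU =>
    bi (Nat.beq st 0)
      (Nat.ble (Nat.add 128 (Wn (Nat.sub (Nat.sub 3 nS) nU) (Nat.ble 1 nS) (Nat.ble 1 nU))) (Nat.add (Nat.add g1 g2) 8))
      (bi (Nat.beq st 1)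
        (Nat.ble (Nat.add 150 (bi (an (Nat.beq (enC x) 1) (Nat.beq (enC y) 1)) 1 0)) (Nat.add (Nat.add g1 g2) 8))
        (an (an (Nat.ble 1 nS) (Nat.ble 1 nU)) (Nat.ble 130 (Nat.add (Nat.add g1 g2) 8)))))))

def any3 (p : ℕ → Bool) : Bool := oo (p 0) (oo (p 1) (p 2))

def comb (x y : List ℕ) : Bool := any3 fun st => any3 fun a => any3 fun b => comb1 x y st a b
/-! ### Data -/

def capT : List (List ℕ) := [
 [0,57,0,0,67],[0,52,0,67,62],[0,53,73,0,0],[0,0,77,0,0],[0,58,63,67,0],[0,52,77,0,0],[0,58,0,0,67],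
 [0,58,63,68,0],[1,51,0,71,0],[0,52,77,62,0],[0,52,64,69,0],[0,0,78,63,0],[0,53,78,63,0],[0,54,73,64,0],
 [0,57,0,67,67],[0,58,73,0,0],[0,59,0,69,62],[0,60,0,67,62],[0,0,79,63,0],[0,54,78,63,0],[0,58,0,64,67],
 [1,0,81,0,0],[0,0,80,0,0],[0,53,73,66,0],[0,54,79,62,0],[0,57,0,68,67],[0,58,69,64,0],[0,59,0,70,62],
 [0,52,80,0,0],[0,53,65,70,0],[0,55,75,0,0],[0,55,65,69,0],[1,56,76,0,0],[0,57,69,65,0],[1,61,0,0,0],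
 [0,61,0,0,0]]

def lv1 : List (List ℕ) := [
 [2,0,1,0,0,0,0,0,0,0],[3,1,1,0,2,0,0,8,0,0],[1,6,1,0,0,0,0,0,0,0],[4,8,1,0,2,0,0,8,0,0,8,7,8],
 [5,32,1,2,0,0,0,0,5,0,5,7,7]]

def lv2 : List (List ℕ) := [
 [39,1,3,0,6,0,0,25,0,0,25],[71,1,3,0,6,0,0,25,0,0,17],[104,2,3,8,0,0,0,0,0,0,23],[136,3,0,8,0,0,17,0,17,0],
 [72,6,3,0,0,0,0,25,0,0,17],[102,9,3,8,7,0,17,25,17,0,17],[70,14,3,0,7,0,0,25,0,0,17],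
 [40,20,3,0,7,0,0,25,0,0,23],[134,21,0,8,0,0,17,25,17,17,25,17,25],[38,25,3,0,7,0,0,25,0,0,17],
 [167,34,5,0,0,0,5,25,5,5,25,23,25],[166,34,5,0,0,0,5,25,5,5,25,23,25]]

def lv3 : List (List ℕ) := [
 [1256,2,9,24,0,0,0,0,0,0,53],[2280,2,9,24,0,0,0,0,0,0,53],[3335,4,17,25,18,0,0,79,0,0,71,53],
 [2121,6,9,0,0,0,0,75,0,0,47,51],[1254,9,9,24,21,0,51,75,51,0,53],[2278,9,9,24,21,0,51,75,51,0,53],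
 [3177,11,0,20,19,0,53,77,53,0,53,53],[2248,15,9,25,0,0,0,75,0,0,0],[1224,15,9,25,0,0,0,75,0,0,0],
 [1065,20,9,0,19,0,0,75,0,0,65,69],[1097,20,9,0,19,0,0,75,0,0,65,51],[2312,26,9,25,21,0,0,75,0,0,0,69],
 [1288,26,9,25,21,0,0,75,0,0,0,69],[2246,30,9,25,0,0,52,75,52,0,0],[1222,30,9,25,0,0,52,75,52,0,0],
 [2310,33,9,25,21,0,0,75,0,0,0,51],[1286,33,9,25,21,0,0,75,0,0,0,51],[4359,35,17,0,0,0,17,79,17,17,53],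
 [3334,35,17,0,0,0,17,75,17,17,71,53],[3336,35,17,0,0,0,17,0,17,17,71,53]]

def lv4 : List (List ℕ) := [
 [40199,4,51,75,54,0,0,237,0,0,0,159],[72967,4,51,75,54,0,0,237,0,0,0,159],
 [135433,5,52,56,0,0,137,0,137,0,161],[106759,10,27,75,71,0,0,233,0,0,0,237,233],
 [99561,11,0,56,55,0,155,227,155,0,155,161],[100585,11,0,56,55,0,155,227,155,0,155,161],
 [106728,13,52,72,71,0,0,233,0,0,0,161],[106726,23,52,72,71,0,153,233,153,0,0,161],
 [67880,26,27,73,63,0,0,225,0,0,158,160],[34088,26,27,73,63,0,0,225,0,0,158,160],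
 [35112,26,27,73,63,0,0,225,0,0,0,160],[67849,26,27,75,58,0,0,238,0,0,158,238,207],
 [39184,26,44,59,55,0,0,225,0,0,152,160],[101641,26,51,56,63,0,0,227,0,0,215,213,161],
 [73992,26,52,75,63,0,0,225,0,0,0,214,214],[73936,28,27,77,0,0,158,158,158,158,134],
 [41232,30,27,59,0,0,0,225,158,0,191,0,207],[41168,30,52,75,0,0,158,238,158,0,158,214],
 [74000,30,44,59,0,0,158,230,158,0,206,158],[73926,30,52,75,0,0,156,225,156,52,0,214],
 [39120,30,52,75,0,0,158,238,158,52,152],[71952,30,44,59,0,0,158,230,158,44,158],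
 [41158,30,52,75,0,0,156,225,156,52,0,214],[135369,32,52,77,0,0,0,0,158,0,238,214,238],
 [71888,32,44,77,0,0,158,158,158,158,238,214,238],[67878,33,27,73,63,0,0,225,0,0,158,160],
 [34086,33,27,73,63,0,0,225,0,0,158,160],[35110,33,27,73,63,0,0,225,0,0,158,160],
 [35081,33,27,75,58,0,0,238,0,0,238,238,207],[66825,33,27,75,58,0,0,238,0,0,158,238,207],
 [73990,33,52,75,63,0,0,225,0,0,0,214,160],[41222,33,52,75,63,0,0,225,0,0,0,214,160],
 [71942,33,52,75,63,0,52,225,52,52,0,160],[39174,33,52,75,63,0,52,225,52,52,0,160],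
 [41224,35,52,0,0,0,52,225,52,52,0,214,160],[40198,35,51,0,0,0,51,225,51,51,51,160],
 [72966,35,51,0,0,0,51,225,51,51,89,160],[102665,35,51,0,0,0,51,0,51,51,215,161],
 [101577,35,51,0,0,0,51,227,51,51,215,213],[40200,35,51,0,0,0,51,0,51,51,51,214],
 [72968,35,51,0,0,0,51,0,51,51,89,214],[71944,35,52,0,0,0,52,225,52,52,0,160],
 [73928,35,52,0,0,0,52,225,52,52,0,214],[68873,35,51,0,0,0,51,217,51,51,215,213,159],
 [36105,35,51,0,0,0,51,217,51,51,215,213,159],[39176,35,52,0,0,0,52,225,52,52,0,160],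
 [41160,35,52,0,0,0,52,225,52,52,0,214]]

def lv5 : List (List ℕ) := [
 [3285287,7,137,217,213,0,0,699,0,0,623,484],[1286407,10,81,225,213,0,0,700,0,0,700,711,700],
 [2334983,10,81,225,213,0,0,700,0,0,476,711,700],[1279209,11,0,168,165,0,465,681,465,0,476,484],
 [1280233,11,0,168,165,0,465,681,465,0,476,484],[2328809,11,0,168,165,0,465,681,465,0,476,484],
 [4295977,12,142,221,191,0,476,677,476,0,476,482],[1286376,13,156,216,213,0,0,699,0,0,467,484],
 [2334952,13,156,216,213,0,0,699,0,0,476,484],[3416304,18,0,221,163,0,476,677,476,0,476,482],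
 [1286374,23,156,216,213,0,459,700,459,0,476,484],[2334950,23,156,216,213,0,459,700,459,0,476,484],
 [3416294,24,156,233,189,0,476,675,476,0,476,476,484],[2165033,26,81,219,166,0,0,712,0,0,470,474,480],
 [2367696,26,81,167,194,0,0,700,0,0,680,712],[3185929,26,153,164,189,0,0,677,0,0,644,431,482],
 [3218697,26,153,164,189,0,0,677,0,0,644,458,482],[1281289,26,153,168,189,0,0,681,0,0,413,639,484],
 [2329865,26,153,168,189,0,0,681,0,0,476,639,484],[1286384,26,89,219,163,0,0,699,0,0,476,484],
 [3415312,26,153,173,187,0,0,677,0,0,458,482],[2172168,26,154,225,189,0,0,675,0,0,0,0,642],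
 [2171176,26,156,220,189,0,0,675,0,0,470,0,642],[1122600,26,156,220,189,0,0,675,0,0,470,0,643],
 [2367750,29,156,225,214,0,0,700,0,0,476,0,642,700],[1253648,29,98,225,214,0,0,700,0,0,476,0,482],
 [1317136,29,156,167,214,0,0,700,0,0,476,0,482],[1319110,29,156,225,214,0,468,700,468,156,476,0,642],
 [3416296,30,156,233,0,0,0,0,476,0,644,467,477],[1122598,30,156,220,0,0,0,675,481,0,470,0,642],
 [2138406,30,156,220,0,0,0,675,481,0,470,0,642],[1319441,30,116,169,0,0,0,692,474,0,476,484],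
 [2172102,30,154,225,0,0,468,675,468,156,156,154],[2334960,30,89,221,0,0,482,703,482,89,404],
 [3415248,30,153,227,0,0,476,677,476,153,404],[1090758,30,154,225,0,0,468,675,468,156,156,154],
 [1123526,30,154,225,0,0,468,675,468,156,156,154],[2367686,30,156,225,0,0,468,700,468,156,476,0,642],
 [1123600,30,104,173,0,0,158,675,470,158,644,0,644],[1253584,31,156,225,214,0,0,700,0,0,476,642],
 [2365712,31,98,167,214,0,0,700,0,0,584,482],[3252518,31,137,225,213,0,137,699,137,137,644,638,484],
 [1253894,31,140,217,206,0,158,692,158,158,476,484],[1317072,31,156,225,214,0,156,700,156,156,476,0],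
 [2302224,31,98,167,214,0,98,700,98,98,0,482],[1319184,33,81,167,214,0,0,700,0,0,476,680,642,482],
 [2302160,33,81,167,214,0,0,700,0,0,0],[2365648,33,81,225,214,0,0,700,0,0,0],
 [1116457,33,81,219,166,0,0,712,0,0,712,474,480],[2131241,33,81,219,166,0,0,715,0,0,473,715,715],
 [2132265,33,81,219,166,0,0,712,0,0,470,706,480],[2361609,33,81,178,174,0,0,714,0,0,682,714,714,682],
 [2172166,33,154,225,189,0,0,675,0,0,0,0,480],[2171174,33,156,220,189,0,0,675,0,0,470,0,642],
 [1090822,33,154,225,189,0,0,675,0,0,0,0,481],[1123590,33,154,225,189,0,0,675,0,0,0,0,480],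
 [2171145,33,156,225,172,0,0,712,0,0,644,0,642,642],[1319120,33,156,225,226,0,0,700,0,0,476,0,642],
 [2367760,33,98,167,194,0,0,700,0,0,680,0,482],[2367752,33,156,225,214,0,156,700,156,156,476,0,642,700],
 [2138377,33,156,225,172,0,156,712,156,156,644,0,642,480],
 [3252520,33,137,225,213,0,137,699,137,137,644,638,644],[1120521,33,156,225,172,0,156,712,156,156,644,0,480],
 [1248521,33,153,169,196,0,153,682,153,153,682,639,484],[1253896,33,140,217,206,0,158,692,158,158,476,484],
 [2367688,33,156,225,214,0,156,700,156,156,476,0,642],[1319112,33,156,225,214,0,156,700,156,156,476,574,643],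
 [1319430,33,140,217,189,0,158,692,158,158,476,0,484],[1087753,33,156,225,172,0,156,712,156,156,644,652,481],
 [4331815,34,158,0,0,0,158,700,158,158,724,644,724],[4331814,34,158,0,0,0,158,700,158,158,700,644,700],
 [1090824,35,154,0,0,0,156,675,156,156,156,154,643],[1123592,35,154,0,0,0,154,675,154,154,0,154,643],
 [2138408,35,156,0,0,0,156,675,156,156,470,0,643],[4333863,35,137,0,0,0,137,716,137,137,404],
 [3415302,35,153,0,0,0,153,700,153,153,644,646,484],[1282313,35,153,0,0,0,153,0,153,153,413,484],
 [2330889,35,153,0,0,0,153,0,153,153,404,484],[3185865,35,153,0,0,0,153,677,153,153,644,153],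
 [3218633,35,153,0,0,0,153,677,153,153,644,458],[1281225,35,153,0,0,0,153,681,153,153,476,639],
 [2329801,35,153,0,0,0,153,681,153,153,404,639],[3415304,35,153,0,0,0,153,0,153,153,644,646,646],
 [2172104,35,154,0,0,0,156,675,156,156,156,154],[2137353,35,153,0,0,0,153,649,153,153,644,153,642],
 [2170121,35,153,0,0,0,153,649,153,153,644,267,642],[3247401,35,141,0,0,0,159,0,159,159,647,645,645],
 [1088777,35,153,0,0,0,153,649,153,153,644,153,642],[1121545,35,153,0,0,0,153,649,153,153,644,267,642],
 [2362633,35,153,0,0,0,153,651,153,153,644,646,639,484],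
 [1314057,35,153,0,0,0,153,682,153,153,644,646,640,484],[2169097,35,156,0,0,0,156,712,156,156,644,0,480],
 [2297097,35,153,0,0,0,153,682,153,153,404,639,484],[1090760,35,154,0,0,0,157,675,157,157,156,154],
 [1123528,35,154,0,0,0,156,675,156,156,156,154],[2136329,35,156,0,0,0,156,712,156,156,644,0,480]]

def lv6 : List (List ℕ) := [
 [41034023,7,411,651,639,0,0,2097,0,0,0,1452],[74588455,7,411,651,639,0,0,2097,0,0,0,1452],
 [137403689,12,412,653,569,0,1412,2027,1412,0,1412,1454],
 [137436457,12,412,653,569,0,1412,2027,1412,0,1412,1454],[105129192,13,460,699,623,0,0,2081,0,0,0,1456],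
 [103916839,16,462,0,627,0,0,2176,0,0,1934,1934,1940],
 [109321479,17,476,0,486,0,0,2133,0,0,1934,1934,1961,1448],
 [104079593,22,0,699,0,0,1430,2158,1430,1430,1430,1430,1430,1454],
 [105129190,23,460,699,623,0,1428,2102,1428,0,0,1456],
 [41165030,24,468,699,567,0,1428,2025,1429,0,1430,1428,1452],
 [74719462,24,468,699,567,0,1428,2025,1428,0,1430,1428,1452],
 [40934665,26,459,492,567,0,0,2031,0,0,1223,1294,1447],[40967433,26,459,492,567,0,0,2031,0,0,1223,1374,1446],
 [74489097,26,459,492,567,0,0,2031,0,0,1412,1293,1446],[74521865,26,459,492,567,0,0,2031,0,0,1412,1374,1446],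
 [69281064,26,462,652,567,0,0,2025,0,0,1406,1447,1453],[35726632,26,462,652,567,0,0,2025,0,0,1406,1447,1453],
 [109158633,26,476,648,489,0,0,2097,0,0,1934,1448,1727,1456],
 [40116742,28,468,700,0,0,1429,2100,1429,1429,1421,1429,1926],
 [42148358,28,410,700,0,0,1429,2100,1429,1429,1406,1429,1453],
 [40116754,28,268,700,0,0,1429,2100,1427,1429,0,0],[42148369,28,294,700,0,0,1429,2100,1429,1429,0,0],
 [42211857,28,468,718,0,0,1447,2100,1429,1447,0,0],
 [75768017,28,468,682,0,0,1429,2100,1429,1429,1421,1429,1926],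
 [75768338,28,410,698,0,0,1427,2170,1427,1427,0,0],
 [69476657,28,294,664,0,0,1447,2100,1447,1447,1421,2040,1447],
 [75768006,28,468,700,0,0,1429,2100,1429,1429,1421,1429,1429,1926],
 [42211537,28,468,682,0,0,1429,2100,1429,1429,2032,1375],
 [35856689,28,294,664,0,0,1447,2100,1447,1447,2110,1447],
 [69509382,29,468,675,640,0,0,2101,0,0,1427,1429,1926,2101],
 [69477638,29,319,675,642,0,0,2101,0,0,2101,1933,1939,1453],
 [69476646,29,468,658,642,0,0,2100,1441,0,1406,1429,0,1453],[42221777,29,460,682,626,0,0,2102,1421,0,0,0],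
 [35955217,29,268,664,590,0,0,2102,1421,0,0,0],[75766033,29,468,520,642,0,0,2100,1429,0,2032,1375,1447],
 [68362545,29,294,658,642,0,0,2100,1447,0,1406,1429,1453],
 [35923206,29,319,675,642,0,481,2101,481,481,2101,1429,1939,1453],
 [42211846,29,468,712,642,0,468,2100,1429,468,1931,1933,0],
 [75768326,29,410,680,584,0,410,2042,1429,410,0,1913,1931],
 [34906310,29,468,675,640,0,1404,2101,1404,468,1427,1429,1926],
 [35954886,29,468,675,640,0,1404,2101,1404,468,1427,1429,1926],
 [42222118,29,412,682,602,0,474,2078,1421,474,474,466],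
 [68428998,29,463,675,642,0,1404,2101,1404,481,2101,1933,1939],
 [41165032,30,468,699,0,0,0,0,1428,0,1430,1402,1431],[74719464,30,468,699,0,0,0,0,1428,0,1430,1401,1431],
 [75768081,30,243,520,0,0,1429,2077,1429,0,1421,1375,2077,1429],
 [68428081,30,243,658,0,0,1447,2173,1447,0,1421,1429,2173,1447],
 [35726630,30,462,652,0,0,0,2025,1441,0,1406,1447,1453],[42146321,30,294,700,0,0,1429,2100,1429,0,0],
 [73671186,30,268,698,0,0,1427,2042,1427,0,0],[104078601,30,459,539,0,0,0,2102,1430,0,1940,2102,1376,1454],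
 [68199718,30,462,652,0,0,0,2025,1441,0,1406,1447,1453],
 [68232486,30,462,652,0,0,0,2025,1435,0,1406,1447,1453],
 [75571494,30,421,660,0,0,0,2025,1443,0,1931,1933,1915,1933],
 [42213894,30,410,700,0,0,1429,2100,1429,0,1421,1429,1429,1453],
 [40116744,30,468,700,0,0,1429,2100,1429,468,1205,1429,1853],
 [42148360,30,410,700,0,0,1429,2100,1429,410,1859,1429,1211],
 [73669126,30,410,700,0,0,1429,2069,1429,473,1429],[75700742,30,468,700,0,0,1429,2101,1429,473,1429],
 [104078537,30,459,699,0,0,1430,2102,1430,459,1430,1430,1376],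
 [69509318,30,468,675,0,0,1404,2101,1404,468,1427,1429,1926],
 [69477574,30,463,675,0,0,1404,2101,1404,481,2101,1429,1939],
 [40114694,30,468,700,0,0,1429,2100,1429,468,1205,1429],
 [75702790,30,410,700,0,0,1429,2042,1429,410,1429,1211],
 [75765969,30,468,682,0,0,1429,2100,1429,468,1205,1375],
 [69411121,30,294,664,0,0,1447,2100,1447,294,1187,1447],[40114696,30,468,700,0,0,468,2100,1429,468,1205,0],
 [75702792,30,410,700,0,0,410,2042,1429,410,0,1211],
 [75768008,30,468,700,0,0,1429,2100,1429,468,1205,1429,1429,1929],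
 [35923142,30,463,675,0,0,1404,2101,1404,481,2101,1429,1939],
 [109289735,31,476,700,639,0,0,2104,0,0,2104,1430,2158,2104],
 [101949734,31,407,675,639,0,407,2100,407,407,1928,1430,1450],
 [102998310,31,407,675,639,0,407,2100,407,407,1928,1430,1450],
 [41001254,31,411,675,639,0,411,2097,411,411,1412,1914,1452],
 [74555686,31,411,675,639,0,411,2097,411,411,1412,1914,1452],
 [41164294,31,462,649,575,0,482,2078,482,482,1430,1456],
 [109289990,31,416,673,639,0,476,2104,476,476,1430,1456],
 [73669138,32,403,698,0,0,1427,0,1427,0,2173,1931,2173],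
 [75700753,32,377,700,0,0,1429,0,1429,0,2173,1931,2173],
 [75565353,33,243,502,498,0,0,2136,0,0,2032,2136,1429,1447],
 [69281062,33,462,652,567,0,0,2025,0,0,1406,1447,1453],
 [35954960,33,266,497,640,0,0,2101,0,0,1373,1429,1859,1913],
 [68429073,33,460,501,562,0,0,2101,0,0,1367,1933,1939,1447],
 [69281033,33,462,675,514,0,0,2134,0,0,1931,0,0,1926],
 [69280041,33,468,660,514,0,0,2173,0,0,1445,2173,2173,1926],
 [35954896,33,266,675,676,0,0,2100,0,0,1427,1429,1926],[69477649,33,294,501,562,0,0,2100,0,0,1367,2040,1447],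
 [69509384,33,468,675,640,0,468,2101,468,468,1427,1429,1926,2101],
 [69477640,33,319,675,642,0,481,2101,481,481,2101,1933,1939,1453],
 [69476648,33,468,658,642,0,468,2100,468,468,1859,1429,0,1453],
 [68199689,33,462,675,514,0,468,2134,468,468,1931,468,462,1929],
 [68232457,33,462,675,514,0,462,2134,462,462,1931,0,462,1929],
 [69476617,33,468,675,642,0,468,2101,468,468,1373,1429,0,1926,2101],
 [34906320,33,266,675,642,0,266,2101,266,266,1373,1429,1211],
 [34906321,33,268,675,640,0,268,2101,268,268,1427,1375,1213],
 [35923217,33,460,501,562,0,460,2101,460,460,1367,1213,1447],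
 [35923208,33,319,675,642,0,481,2101,481,481,2101,1933,1939,1453],
 [101949736,33,407,675,639,0,407,2100,407,407,1928,1430,1928],
 [102998312,33,407,675,639,0,407,2097,407,407,1928,1430,1928],
 [41001256,33,411,675,639,0,411,2097,411,411,1412,1915,1933],
 [74555688,33,411,675,639,0,411,2097,411,411,1412,1914,1932],
 [75766278,33,410,680,567,0,473,2025,473,473,1933,1913],
 [70524169,33,459,699,538,0,459,2158,459,459,1430,1932,1938,1938],
 [75569417,33,468,520,516,0,468,2136,468,468,1931,1933,1375,1447],
 [70361385,33,411,675,676,0,411,2097,411,411,1934,1932,1914,1932],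
 [39886089,33,459,493,574,0,459,2032,459,459,2032,1375,1447],
 [39918857,33,459,493,574,0,459,2032,459,459,2032,1375,1447],
 [69509392,33,266,497,578,0,266,2098,266,266,0,1859,1913],
 [69509393,33,268,501,582,0,268,2100,268,268,0,1861,1915],
 [68429009,33,460,675,678,0,460,2100,460,460,0,1933,1939],
 [41164296,33,462,649,575,0,482,2033,482,482,1430,1456],
 [109289992,33,416,673,639,0,476,2097,476,476,1430,1456],
 [42211848,33,468,712,642,0,473,2100,473,473,1205,1933,1913],
 [75768328,33,410,680,584,0,473,2042,473,473,1933,1913,1211],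
 [69509320,33,468,675,640,0,468,2100,468,468,1427,1429,1926],
 [69477576,33,463,675,642,0,481,2100,481,481,468,1933,1939],
 [34906312,33,468,675,640,0,468,2101,468,468,1427,1429,1929],
 [35954888,33,468,675,640,0,468,2101,468,468,1427,1429,1927],
 [75536649,33,468,520,516,0,468,2136,468,468,1205,1933,1375,1447],
 [68362761,33,420,651,490,0,474,2076,474,474,1934,1429,1453],
 [68199720,35,462,0,0,0,468,2025,468,468,1406,1447,1453],
 [68232488,35,462,0,0,0,462,2025,462,462,1406,1447,1453],
 [75571496,35,421,0,0,0,475,2025,475,475,1931,1933,1915,1933],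
 [42213896,35,410,0,0,0,468,2100,468,468,1931,1933,1913,1931],
 [41164038,35,459,0,0,0,459,2100,459,459,1430,1938,1452],
 [74718470,35,459,0,0,0,459,2100,459,459,1430,1938,1452],[104997161,35,411,0,0,0,411,2102,411,411,1934,1454],
 [40934601,35,459,0,0,0,459,2031,459,459,1412,459],[40967369,35,459,0,0,0,459,2031,459,459,1412,1374],
 [74489033,35,459,0,0,0,459,2031,459,459,1196,459],[74521801,35,459,0,0,0,459,2031,459,459,1196,1374],
 [41164040,35,459,0,0,0,459,0,459,459,1430,1938,1938],[74718472,35,459,0,0,0,459,0,459,459,1430,1938,1938],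
 [73669128,35,410,0,0,0,473,2025,473,473,1913],[75700744,35,468,0,0,0,473,2025,473,473,1933],
 [142713065,35,476,0,0,0,476,2097,476,476,1376,1862,1214],
 [103849257,35,411,0,0,0,465,0,465,465,1934,1932,1454],[103882025,35,411,0,0,0,465,0,465,465,1934,1932,1454],
 [40996137,35,423,0,0,0,477,0,477,477,1430,1935,1935],[74550569,35,423,0,0,0,477,0,477,477,1214,1935,1935],
 [75537673,35,459,0,0,0,459,1947,459,459,1931,1933,1294,1447],
 [75570441,35,459,0,0,0,459,1947,459,459,1922,1932,1294,1926],
 [109119785,35,251,0,0,0,251,2025,251,251,1709,1412,1422,1440],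
 [41983241,35,459,0,0,0,459,2032,459,459,1922,1933,1294,1447],
 [42016009,35,459,0,0,0,459,2032,459,459,1922,1933,1375,1447],
 [109085993,35,251,0,0,0,251,2136,251,251,1736,1421,1422,1440],
 [109087017,35,251,0,0,0,251,2118,251,251,1718,1421,1808,1447],
 [73440521,35,459,0,0,0,459,2032,459,459,1196,1294,1447],
 [73473289,35,459,0,0,0,459,2032,459,459,1196,1375,1447],
 [107061481,35,476,0,0,0,476,2104,476,476,1862,1862,1214],[69509328,35,266,0,0,0,266,2098,266,266,1429,1211],
 [69509329,35,268,0,0,0,268,2100,268,268,1427,1213],[69477585,35,460,0,0,0,460,2100,460,460,1367,1213],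
 [109321478,35,476,0,0,0,476,2100,476,476,1934,1430,1938,1448],
 [75766280,35,410,0,0,0,473,2025,473,473,1933,1913],[35954897,35,268,0,0,0,268,2100,268,268,0,1213],
 [35923153,35,460,0,0,0,460,2100,460,460,0,1213]]

def lv7 : List (List ℕ) := [
 [4335901993,12,1234,1955,1703,0,4232,6077,4232,0,4238,4358],
 [4335934761,12,1234,1955,1703,0,4232,6077,4232,0,4238,4361],
 [4369489193,12,1234,1955,1703,0,4232,6077,4232,0,4265,4361],
 [1313088744,13,1380,2097,1869,0,0,6243,0,0,4292,4368],[2386830568,13,1380,2097,1869,0,0,6243,0,0,4292,4368],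
 [3323176231,16,1380,0,1869,0,0,6306,0,0,5786,5786,5804],
 [3324224807,16,1380,0,1869,0,0,6306,0,0,5786,5786,5804],
 [1311876391,16,1386,0,1881,0,0,6528,0,0,0,5802,5820],[2385618215,16,1386,0,1881,0,0,6528,0,0,0,5802,5820],
 [1317281031,17,1428,0,1458,0,0,6399,0,0,5884,5803,5884,4345],
 [2391022855,17,1428,0,1458,0,0,6399,0,0,0,5802,5883,4344],
 [4404289033,19,1393,1949,1703,0,4220,6077,4220,0,4292,4370],
 [3262390505,22,0,2097,0,0,4289,6475,4289,4286,4289,4292,4289,6475],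
 [3295944937,22,0,2097,0,0,4286,6472,4289,4286,4286,4292,4286,4358],
 [1312039145,22,0,2097,0,0,4291,6474,4291,4290,4292,4291,4291,4363],
 [2385780969,22,0,2097,0,0,4290,6474,4291,4290,4292,4290,4290,4362],
 [1313088742,23,1380,2097,1869,0,4284,6306,4284,0,4292,4369],
 [2386830566,23,1380,2097,1869,0,4284,6306,4284,0,4292,4369],
 [3498287336,23,1404,1944,1934,0,0,6308,0,0,5180,4346,6308,4364],
 [3325338854,23,1404,2085,1920,0,4290,6308,4290,0,0,6314,6308],
 [3364134160,26,1377,1511,1675,0,0,6077,0,0,4292,4346],[1313088752,26,737,1947,1459,0,0,6243,0,0,4292,4370],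
 [3490947305,26,1412,1944,1461,0,0,6291,0,0,5786,4328,5804,4363],
 [3491995881,26,1412,1944,1461,0,0,6291,0,0,5786,4328,5804,4356],
 [1317118185,26,1428,1944,1467,0,0,6291,0,0,4328,4345,5182,5803],
 [2390860009,26,1428,1944,1467,0,0,6291,0,0,4328,4344,5181,4368],
 [2224300230,28,1404,2098,0,0,4287,6300,4288,4287,4289,4291,4287,5778],
 [2223284422,28,1404,2100,0,0,4287,6313,4288,4287,4289,6313,4287,5778],
 [2223252690,28,1378,2046,0,0,4287,6300,4287,4287,0,5821,4287],
 [2216993073,28,798,1978,0,0,4327,6294,4327,4327,5579,0,5577],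
 [2216993074,28,804,1990,0,0,4339,6300,4339,4339,5585,0,5583],
 [1351096870,28,1411,2084,0,0,4289,6305,4289,4289,4283,4289],
 [2424513062,28,1249,2100,0,0,4287,6300,4287,4287,0,4291,5803],
 [1150566950,28,1393,2048,0,0,4289,6209,4289,4289,4289,4289],
 [2187601446,28,1387,2100,0,0,4287,6300,4287,4287,0,5821,4369],
 [2223252678,28,1387,2100,0,0,4287,6301,4287,4287,6301,5821,4287,4287],
 [1283736144,28,1421,2048,0,0,4289,6451,4289,4289,4127],
 [1283736147,28,804,2096,0,0,4283,6235,4283,4283,4121],[1348747824,28,746,2102,0,0,4289,6209,4289,4289,4127],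
 [1348747827,28,1429,2094,0,0,4283,6451,4283,4283,4121],
 [1350779440,28,920,2102,0,0,4289,6305,4289,4289,4049],
 [1350779442,28,1375,2154,0,0,4343,6547,4343,4343,4103],
 [1351096880,28,1205,2084,0,0,4289,6305,4289,4289,4289],
 [1351096882,28,1213,2100,0,0,4289,6313,4289,4289,4283],
 [2424586833,28,1349,2122,0,0,4363,6521,4363,4363,4129],
 [2424586835,28,946,2096,0,0,4283,6305,4283,4283,4049],
 [1150566960,28,1187,2048,0,0,4289,6209,4289,4289,4289],
 [1150566963,28,1213,2100,0,0,4289,6235,4289,4289,4289],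
 [1350779090,28,1378,2100,0,0,4287,6287,4287,4287,0,4265],
 [2424586449,28,1404,2042,0,0,4229,6305,4229,4229,4291,0],
 [2224300561,28,780,2042,0,0,4229,6233,4229,4229,0,4363],
 [2224300592,28,776,2042,0,0,4229,6235,4229,4229,0,4361],
 [2189728304,28,794,2138,0,0,4325,6313,4325,4325,4265,0],
 [3498287334,29,1404,1944,1934,0,4131,6308,4206,0,0,4346,6308,4364],
 [2216994054,29,949,2025,1920,0,0,6303,0,0,6301,4281,4287,6303],
 [2216993062,29,1404,1972,1920,0,0,6303,4321,0,4214,4281,4287,4357],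
 [2216961318,29,957,1972,1926,0,0,6303,4360,0,4214,6303,5799,5817],
 [1150558726,29,1226,2098,1724,0,4287,6233,4287,0,4289,4291,4287,6233],
 [2189730342,29,1230,2020,1918,0,4287,6313,4287,0,4283,6313,4287,4369],
 [1143252230,29,949,2025,1920,0,1441,6304,1441,1441,6304,6304,6304,4360],
 [3493076262,29,1377,1947,1934,0,1377,6236,1377,1377,5816,4292,6308,4368],
 [1150556678,29,1404,2134,1724,0,1404,6233,4287,1404,4289,4291,0],
 [2223284774,29,1230,2020,1752,0,1230,6313,4287,1230,4283,0,4369],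
 [2182390982,29,1381,2025,1920,0,4212,6304,4212,1444,6304,6304,6304],
 [2183439558,29,1381,2025,1920,0,4212,6303,4212,1441,6301,4281,4287],
 [2418287814,29,1389,2025,1879,0,4212,6307,4212,1443,5819,6303,5803,5817],
 [1283670290,29,754,1614,1926,0,1429,6287,4287,1429,0,4343],
 [2422489361,29,780,1556,1868,0,1429,6305,4229,1429,0,4345],
 [1150556720,29,1404,2040,1726,0,1427,6235,4229,1427,4289,0],
 [1149540912,29,1230,2136,1918,0,1367,6313,4325,1367,4283,0],
 [3325338856,30,1404,2085,0,0,0,6308,4290,0,0,6314,6308],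
 [3497271526,30,1429,2097,0,0,4284,6308,4291,0,0,4292,4284,4364],
 [3497271528,30,1429,2097,0,0,0,6308,4284,0,5780,4292,4210,4364],
 [2223251762,30,729,1560,0,0,4287,6231,4287,0,4289,4345,4125,6231],
 [3262389513,30,1377,1613,0,0,0,6302,4286,0,5816,4292,4127,4358],
 [3295943945,30,1377,1613,0,0,0,6302,4286,0,5816,4292,4124,4358],
 [1312038153,30,1377,1617,0,0,0,6307,4290,0,4292,6307,4129,4363],
 [2385779977,30,1377,1617,0,0,0,6306,4290,0,4292,6306,4128,4362],
 [2418091302,30,1231,1956,0,0,0,6075,4323,0,5783,5785,4341,4359],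
 [2223252754,30,1378,1560,0,0,4287,6231,4287,0,4097,5821,4125,4287],
 [2183438641,30,798,1972,0,0,4327,6303,4327,0,5579,4119,4287,5577],
 [3364134096,30,1377,2027,0,0,4268,6077,4268,1377,4292],[2386830576,30,737,1949,0,0,4298,6319,4298,737,4370],
 [3262389449,30,1377,2097,0,0,4286,6302,4289,1377,4286,4292,4124],
 [3295943881,30,1377,2097,0,0,4286,6302,4286,1377,4286,4292,4124],
 [1312038089,30,1377,2097,0,0,4290,6306,4291,1377,4292,4290,4128],
 [2385779913,30,1377,2097,0,0,4290,6306,4290,1377,4292,4290,4128],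
 [2216993990,30,1381,2025,0,0,4212,6303,4212,1441,6301,4281,4287],
 [2352225545,30,1377,1618,0,0,1377,6307,4291,1377,6307,6307,4129,4363],
 [3330515238,30,1268,2100,0,0,1430,6312,4289,1430,5804,5804,4292,5804],
 [2224300232,30,1404,2098,0,0,4287,6300,4287,1404,4289,4291,4287,5787],
 [2223284424,30,1404,2100,0,0,4287,6313,4287,1404,4289,6313,4287,5787],
 [1143252166,30,1381,2025,0,0,4212,6303,4212,1441,6301,4281,4287],
 [4566819049,30,1412,2097,0,0,1412,0,4284,1412,4292,5804,4203,5786],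
 [3425968361,30,1412,2097,0,0,1412,6474,4291,1412,5786,5804,4210,6474],
 [1317249287,31,1428,2100,1917,0,0,6312,0,0,6292,4291,6474,6312],
 [2390991111,31,1428,2100,1917,0,0,6312,0,0,0,4290,6474,6312],
 [1309909286,31,1221,2025,1917,0,1221,6300,1221,1221,4220,4291,4350],
 [1310957862,31,1221,2025,1917,0,1221,6300,1221,1221,4220,4291,4350],
 [2383651110,31,1221,2025,1917,0,1221,6300,1221,1221,4220,4291,4350],
 [2384699686,31,1221,2025,1917,0,1221,6300,1221,1221,4220,4291,4350],
 [1348682288,32,1187,2102,0,0,4289,4289,4289,4289,6547,5821,6547],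
 [2357477971,32,1211,2096,0,0,4283,4283,4283,4283,6521,5827,6521],
 [2224097577,33,729,1504,1494,0,0,6408,0,0,4235,4237,4287,4341],
 [2216764713,33,1386,1956,1540,0,0,6511,0,0,5789,6511,4341,4359],
 [2216994056,33,949,2025,1920,0,1441,6303,1441,1441,6301,4281,4287,5818],
 [2216993064,33,1404,1972,1920,0,1404,6303,1404,1404,5573,4281,4287,4357],
 [2216961320,33,957,1972,1926,0,1443,6303,1443,1443,5573,6303,5800,5818],
 [1150558728,33,1226,2098,1724,0,1404,6233,1404,1404,4289,4291,5735,6233],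
 [2189730344,33,1230,2020,1918,0,1404,6313,1404,1404,4283,6313,5799,4369],
 [2216993033,33,1404,2025,1920,0,1404,6303,1404,1404,4115,4281,4287,5778,6303],
 [2216961289,33,957,2025,1926,0,1443,6303,1443,1443,5819,6303,5799,5817,4359],
 [1143252232,33,949,2025,1920,0,1441,6303,1441,1441,6301,4281,4287,5818],
 [2183406857,33,957,2025,1926,0,1443,6303,1443,1443,5819,6303,5799,5817,4359],
 [1309909288,33,1221,2025,1917,0,1221,6300,1221,1221,4220,4291,5785],
 [1310957864,33,1221,2025,1917,0,1221,6291,1221,1221,4220,4291,5785],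
 [2383651112,33,1221,2025,1917,0,1221,6300,1221,1221,4220,4291,5784],
 [2384699688,33,1221,2025,1917,0,1221,6291,1221,1221,4220,4291,5784],
 [3493076264,33,1377,1947,1934,0,1377,6236,1377,1377,5819,4292,5803,5821],
 [2188647689,33,1377,2097,1612,0,1377,6475,1377,1377,4289,6475,5814,5814],
 [2222202121,33,1377,2097,1612,0,1377,6472,1377,1377,4286,4290,5814,5814],
 [2357266729,33,754,1506,1494,0,754,6408,754,754,4229,4237,4287,4341],
 [2249433385,33,1221,2025,2026,0,1221,6300,1221,1221,5795,5784,4291,5784],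
 [2250481961,33,1221,2025,2026,0,1221,6291,1221,1221,5786,5784,4291,5784],
 [2188484905,33,1233,2025,2026,0,1233,6291,1233,1233,5801,6421,5745,5799],
 [2222039337,33,1233,2025,2026,0,1233,6291,1233,1233,5801,4236,5742,5796],
 [1150556680,33,1404,2134,1724,0,1415,6233,1415,1415,4289,4291,5735],
 [2223284776,33,1230,2020,1752,0,1419,6313,1419,1419,4283,5799,4369],
 [2216993992,33,1381,2025,1920,0,1441,6300,1441,1441,1404,4281,4287],
 [1283524905,33,754,1506,1494,0,754,6408,754,754,4229,4264,4287,4341],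
 [2223249929,33,1230,2040,2041,0,1419,6475,1419,1419,4289,5799,5739],
 [2188647945,33,1386,1947,1612,0,1446,6472,1446,1446,5822,4290,4369],
 [2256773641,33,1248,2019,1534,0,1428,6291,1428,1428,5804,4291,4368],
 [3330546889,33,1428,1460,1926,0,1428,6302,1428,1428,5804,5802,4292,5814],
 [3497102633,33,1294,1971,1988,0,1456,6470,1456,1456,5822,3644,5822,5822],
 [2357412423,34,1427,0,0,0,1427,6235,1427,1427,6547,5803,6547],
 [2422424103,34,1429,0,0,0,1429,6209,1429,1429,6547,5821,6547],
 [2418091304,35,1231,0,0,0,1411,6075,1411,1411,5792,5794,4341,4359],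
 [1312956713,35,1233,0,0,0,1233,6306,1233,1233,3653,4363],
 [2386698537,35,1233,0,0,0,1233,6306,1233,1233,4265,4363],
 [3364134150,35,1428,0,0,0,1428,6292,1428,1428,5804,4292,4344],
 [4564689129,35,1412,0,0,0,1412,6291,1412,1412,4112,5804,4356],
 [4565737705,35,1412,0,0,0,1412,6291,1412,1412,4112,5804,4356],
 [3262160169,35,1233,0,0,0,1395,0,1395,1395,5801,4238,4358],
 [3262192937,35,1233,0,0,0,1395,0,1395,1395,5801,4238,4358],
 [3295747369,35,1233,0,0,0,1395,0,1395,1395,5801,4238,4358],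
 [1311808809,35,1233,0,0,0,1395,0,1395,1395,4337,5796,4363],
 [1311841577,35,1233,0,0,0,1395,0,1395,1395,4238,5796,4363],
 [2385550633,35,1233,0,0,0,1395,0,1395,1395,4337,5796,4362],
 [2385583401,35,1233,0,0,0,1395,0,1395,1395,4337,5796,4363],
 [1317079337,35,753,0,0,0,753,6075,753,753,4220,4237,4266,4320],
 [2390821161,35,753,0,0,0,753,6075,753,753,4220,4236,4266,4320],
 [1317045545,35,753,0,0,0,753,6408,753,753,4220,4263,4266,4320],
 [1317046569,35,753,0,0,0,753,6354,753,753,4220,4263,5424,4341],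
 [2390787369,35,753,0,0,0,753,6408,753,753,4247,4263,4266,4320],
 [2390788393,35,753,0,0,0,753,6354,753,753,4247,4263,5424,4341],
 [3423838441,35,1412,0,0,0,1412,6298,1412,1412,5570,5804,4363],
 [3424887017,35,1412,0,0,0,1412,6298,1412,1412,5570,4291,4363],
 [1315021033,35,1428,0,0,0,1428,6312,1428,1428,1428,5586,5803],
 [2388762857,35,1428,0,0,0,1428,6312,1428,1428,4148,5586,5803],
 [3358696745,35,1392,0,0,0,1428,6314,1428,1428,5804,5802,5820],
 [1317281030,35,1428,0,0,0,1429,6300,1429,1429,2420,4291,5814,4345],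
 [2391022854,35,1428,0,0,0,1428,6300,1428,1428,4220,5803,5814,4345],
 [3364134152,35,1428,0,0,0,1428,0,1428,1428,5804,4292,4344],
 [3330547209,35,1392,0,0,0,1428,0,1428,1428,5804,4292,4370]]

def lv8 : List (List ℕ) := [
 [104389125415,16,4140,0,5607,0,0,18921,0,0,17354,17459,17411],
 [104390173991,16,4140,0,5607,0,0,18918,0,0,17354,17432,17411],
 [105463915815,16,4140,0,5607,0,0,18918,0,0,17354,17459,17411],
 [41977881895,16,4140,0,5607,0,0,18918,0,0,0,17358,17413],
 [41978930471,16,4140,0,5607,0,0,18918,0,0,0,17358,17413],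
 [76337620263,16,4140,0,5607,0,0,18918,0,0,0,17358,17412],
 [76338668839,16,4140,0,5607,0,0,18918,0,0,0,17358,17413],
 [41917096169,22,0,6291,0,0,12867,19425,12867,12858,12869,12877,12867,19425],
 [41950650601,22,0,6291,0,0,12859,19416,12867,12858,12869,12877,12859,13075],
 [76276834537,22,0,6291,0,0,12867,19425,12867,12858,12869,12877,12867,19425],
 [76310388969,22,0,6291,0,0,12858,19416,12867,12858,12869,12877,12858,13074],
 [42152993000,23,4212,5832,5802,0,0,18925,0,0,12869,13039,18925,13093],
 [76512731368,23,4212,5832,5802,0,0,18925,0,0,12869,13039,18925,13093],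
 [106341639398,23,4212,6243,5754,0,12858,18941,12867,0,0,18941,13117],
 [106375193830,23,4212,6243,5754,0,12858,18941,12858,0,0,18941,12877],
 [41980044518,23,4212,6255,5760,0,12870,18925,12870,0,12878,18943,18925],
 [76339782886,23,4212,6255,5760,0,12870,18925,12870,0,12851,18943,18925],
 [42145652969,26,4236,5832,4383,0,0,18873,0,0,12968,12985,17413,13089],
 [42146701545,26,4236,5832,4383,0,0,18873,0,0,12968,12985,17413,13068],
 [76505391337,26,4236,5832,4383,0,0,18873,0,0,12968,12984,17413,13089],
 [76506439913,26,4236,5832,4383,0,0,18873,0,0,12968,12984,17413,13068],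
 [106577510695,27,4134,0,5766,0,0,18924,0,0,17342,18942,18924],
 [146138209575,27,4284,0,5786,0,0,18908,0,0,12644,17406,17406,17649],
 [140769500457,28,4285,6476,0,0,13037,18902,12797,13037,12644,13037,12878,13109],
 [70943809734,28,4212,6294,0,0,12861,18940,12864,12861,12866,12868,12874,17334],
 [70943777990,28,4159,6294,0,0,12861,18901,12864,12861,18901,12868,12874,12861],
 [70942762182,28,4159,6300,0,0,12861,18940,12864,12861,18940,12868,17464,17482],
 [76511715568,28,4220,5990,0,0,12875,19414,12875,12875,10853,12875,13037],
 [111945194704,28,4148,6152,0,0,12869,18902,12869,12869,12869,12875,10925],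
 [36817813715,28,4132,6300,0,0,12861,18857,12794,12861,4287,4285],
 [71145112786,28,4207,6126,0,0,12687,18915,12874,12687,4287,4207],
 [71144086096,28,2378,6410,0,0,12971,18937,12794,12971,4097,4073],
 [70943778354,28,2340,6126,0,0,12687,18699,13090,12687,4287,4207],
 [70943778385,28,2328,6126,0,0,12687,18705,13084,12687,4281,4201],
 [42152992998,29,4212,5832,5802,0,12393,18925,12618,0,12869,13039,18925,13093],
 [76512731366,29,4212,5832,5802,0,12393,18925,12618,0,12869,13039,18925,13093],
 [107652292871,29,4268,6292,5802,0,0,18924,0,0,18928,12877,19414,18924],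
 [70936470822,29,2847,5914,5760,0,0,18909,13072,0,12638,18903,13090,13108],
 [41077449296,29,2204,4532,5128,0,0,18925,12794,0,0],[43224930896,29,2378,6300,5752,0,0,18925,12794,0,0],
 [77519659571,29,2262,4526,5154,0,0,18925,12788,0,0],[77586766387,29,2404,6242,5778,0,0,18925,12788,0,0],
 [36817815059,29,2262,5010,5778,0,0,18923,12796,0,0],[71177617971,29,2260,6098,5154,0,0,18925,12794,0,0],
 [71177618963,29,2262,6100,5150,0,0,18923,12796,0,0],[36785309202,29,2340,5070,5604,0,0,18863,12874,0,0],
 [70071305746,29,2340,6292,5168,0,0,18863,12874,0,0],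
 [111710313766,29,4131,5835,5786,0,4131,18701,4131,4131,17444,12869,12877,13107],
 [111743868198,29,4131,5835,5786,0,4131,18692,4131,4131,17444,12869,12877,13107],
 [42147781926,29,4131,5841,5802,0,4131,18709,4131,4131,12869,12877,18925,13104],
 [76507520294,29,4131,5841,5802,0,4131,18925,4131,4131,12869,12877,18925,13104],
 [77378921670,29,4143,6075,5605,0,12636,18916,12636,4323,17456,18903,17386,17404],
 [77584418000,29,2204,6233,5623,0,4212,18925,12794,4212,4212,2204],
 [70003246288,29,2378,6209,5761,0,4134,18943,12770,4134,2378,4134],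
 [106341639400,30,4212,6243,0,0,0,18941,12858,0,0,18941,13117],
 [106375193832,30,4212,6243,0,0,0,18908,12858,0,0,18932,13117],
 [41980044520,30,4212,6255,0,0,0,18925,12870,0,12878,18943,18925],
 [76339782888,30,4212,6255,0,0,0,18924,12870,0,12878,18942,18924],
 [42151977190,30,4287,6291,0,0,12852,18925,12873,0,12869,12877,12852,13093],
 [76511715558,30,4287,6291,0,0,12852,18924,12873,0,12869,12877,12852,13093],
 [42151977192,30,4287,6291,0,0,0,18924,12852,0,12869,12877,12630,13093],
 [76511715560,30,4287,6291,0,0,0,18924,12852,0,12869,12877,12630,13093],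
 [41917095177,30,4131,4839,0,0,0,18907,12858,0,12869,12877,12381,13075],
 [41950649609,30,4131,4839,0,0,0,18907,12858,0,12869,12877,12373,13075],
 [76276833545,30,4131,4839,0,0,0,18906,12858,0,12869,12877,12381,13074],
 [76310387977,30,4131,4839,0,0,0,18906,12858,0,12869,12877,12372,13074],
 [71171122470,30,3691,5868,0,0,0,18225,12969,0,17345,17349,13023,13077],
 [106443349257,30,4284,4787,0,0,0,18878,12806,0,17408,17412,12389,13034],
 [106410843408,30,2864,4517,0,0,0,18902,12869,0,17450,17462,13040],
 [41980044528,30,4218,6255,0,0,0,18924,13091,0,12878,18942,18924],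
 [111945194758,30,4131,6308,0,0,12869,18701,12869,4206,12869,12869,12877,10925,12869],
 [41917095113,30,4131,6291,0,0,12858,18906,12867,4131,12869,12877,12372],
 [41950649545,30,4131,6291,0,0,12858,18906,12859,4131,12869,12877,12372],
 [76276833481,30,4131,6291,0,0,12858,18906,12867,4131,12869,12877,12372],
 [76310387913,30,4131,6291,0,0,12858,18906,12858,4131,12869,12877,12372],
 [106410843344,30,4322,6296,0,0,12869,18902,12869,4322,12869,12875],
 [76339782896,30,4220,6494,0,0,13091,19528,13091,4220,13091,13109],
 [106443349193,30,4284,6243,0,0,12806,18878,12806,4284,17411,17413,12389],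
 [75203091721,30,4131,4840,0,0,4131,19425,12859,4131,18907,12877,12382,13075],
 [75236646153,30,4131,4840,0,0,4131,18907,12859,4131,18907,12877,12373,13075],
 [106410843398,30,4272,6294,0,0,4290,18943,12869,4290,17414,17485,17491,13111],
 [104396464422,30,3800,6300,0,0,4289,18936,12863,4289,17411,12797,12875,17411],
 [105470206246,30,3800,6300,0,0,4286,18936,12863,4286,17411,12797,12875,17411],
 [41985220902,30,3804,6300,0,0,4291,18936,12867,4291,12797,17413,12877,17413],
 [76344959270,30,3804,6300,0,0,4290,18936,12867,4290,12797,17413,12877,17413],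
 [70943809736,30,4212,6294,0,0,12861,18940,12861,4212,12866,12868,12874,17361],
 [146070053097,30,4220,6291,0,0,4220,0,12852,4220,12869,10853,12618,17342],
 [146103607529,30,4220,6291,0,0,4220,0,12852,4220,12869,10853,12609,17342],
 [76512731376,30,2420,5990,0,0,4220,18878,13037,4220,16739,12875,10907],
 [111912688848,30,4284,6302,0,0,4284,18902,12869,4284,10853,12875,17459],
 [109562831081,30,4220,6291,0,0,4220,19425,12859,4220,17342,10853,12625,19425],
 [109596385513,30,4220,6291,0,0,4220,19416,12859,4220,17342,10853,12616,19416],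
 [42080674025,30,4236,6291,0,0,4237,19422,12873,4237,12869,17413,12630,19422],
 [76440412393,30,4236,6291,0,0,4236,19422,12873,4236,12869,17413,12630,19422],
 [107652293126,31,3698,6049,5751,0,4268,18941,4268,4268,10853,10907],
 [42018840070,31,4134,5833,5111,0,4284,18917,4284,4284,10853,10931],
 [111774278889,33,4148,6291,6294,0,0,19416,0,0,17270,12860,15335,13111],
 [70936470824,33,2847,5914,5760,0,4323,18909,4323,4323,16715,18903,13090,13108],
 [70936470793,33,2847,6075,5760,0,4323,18909,4323,4323,17456,18903,12843,12861,17454],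
 [69862728969,33,2847,6075,5760,0,4323,18909,4323,4323,17456,18903,12843,12861,17454],
 [111710313768,33,4131,5835,5786,0,4131,18692,4131,4131,17447,12869,17467,13107],
 [111743868200,33,4131,5835,5786,0,4131,18692,4131,4131,17447,12869,12877,13107],
 [42147781928,33,4131,5841,5802,0,4131,18925,4131,4131,13085,12877,18925,17463],
 [76507520296,33,4131,5841,5802,0,4131,18925,4131,4131,12869,12877,18925,17463],
 [70029386025,33,3663,6075,6076,0,3663,18900,3663,3663,17381,19219,12873,17355],
 [70030434601,33,3663,6075,6076,0,3663,18873,3663,3663,17357,19219,12874,17355],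
 [71103127849,33,3663,6075,6076,0,3663,18900,3663,3663,17381,12660,12873,17352],
 [71104176425,33,3663,6075,6076,0,3663,18873,3663,3663,17357,12660,12873,17352],
 [72212553001,33,4131,5841,5802,0,4131,18925,4131,4131,12365,19435,12877,18925,17463],
 [107652293128,33,3698,6049,5751,0,4268,18873,4268,4268,10853,10907],
 [42018840072,33,4134,5833,5111,0,4284,18233,4284,4284,10853,10931],
 [111912688902,33,4284,6308,5803,0,4291,18917,4291,4291,17411,10853,12877,17459,13039],
 [72083610889,33,4284,6243,4786,0,4284,19366,4284,4284,17411,17413,12877,13032],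
 [104396496073,33,4284,4376,5778,0,4287,18902,4287,4287,17411,12365,12875,17442],
 [105470237897,33,4284,4376,5778,0,4284,18902,4284,4284,17411,12365,12875,17442],
 [41985252553,33,4284,4380,5778,0,4284,18907,4284,4284,10853,17406,12877,17442],
 [76344990921,33,4284,4380,5778,0,4284,18906,4284,4284,10853,17406,12877,17442],
 [111907216681,33,3724,5859,5876,0,4291,19565,4291,4291,17405,10853,17405,13093],
 [111907249449,33,3724,5859,5876,0,4210,19268,4210,4210,17390,13013,17413,13093],
 [106603716841,33,4232,4393,5770,0,4238,18923,4238,4238,16739,16739,12875,10907],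
 [106604765417,33,4232,4393,5770,0,4238,18896,4238,4238,16712,16712,12875,13091],
 [71171122472,35,3691,0,0,0,4233,18225,4233,4233,17372,17376,13023,13077],
 [111945194760,35,4131,0,0,0,4206,0,4206,4206,17411,17459,17467,10925,17243],
 [42018839814,35,4284,0,0,0,4284,18876,4284,4284,12806,12877,13032],
 [76378578182,35,4284,0,0,0,4284,18876,4284,4284,10853,12877,13032],
 [41916865833,35,3699,0,0,0,4185,0,4185,4185,12995,12715,13075],
 [41916898601,35,3699,0,0,0,4185,0,4185,4185,12707,12715,13075],
 [41950453033,35,3699,0,0,0,4185,0,4185,4185,12698,12715,13075],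
 [76276604201,35,3699,0,0,0,4185,0,4185,4185,12995,12714,13074],
 [76276636969,35,3699,0,0,0,4185,0,4185,4185,12995,12714,13075],
 [76310191401,35,3699,0,0,0,4185,0,4185,4185,12995,12715,13075],
 [146134017257,35,4148,0,0,0,4148,18729,4148,4148,12869,17387,10925],
 [111908364585,35,3724,0,0,0,3724,18918,3724,3724,17390,12797,10933],
 [42078544105,35,4236,0,0,0,4236,18894,4236,4236,4236,17413,13089],
 [42079592681,35,4236,0,0,0,4236,18894,4236,4236,4236,17413,13089],
 [76438282473,35,4236,0,0,0,4236,18894,4236,4236,12410,17413,13089],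
 [76439331049,35,4236,0,0,0,4236,18894,4236,4236,12410,17413,13089],
 [107476133161,35,4146,0,0,0,4236,18896,4236,4236,17387,17358,17412],
 [107477181737,35,4146,0,0,0,4236,18896,4236,4236,17387,17358,12869],
 [42013402409,35,4176,0,0,0,4284,18942,4284,4284,12662,17406,17460],
 [76373140777,35,4176,0,0,0,4284,18942,4284,4284,10853,17406,17460],
 [109626795241,35,4148,0,0,0,4148,19416,4148,4148,17387,17387,10925],
 [42018839816,35,4284,0,0,0,4284,0,4284,4284,10853,12877,13032],
 [76378578184,35,4284,0,0,0,4284,0,4284,4284,10853,12877,13032],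
 [41985252873,35,4176,0,0,0,4284,0,4284,4284,10853,12877,13111],
 [76344991241,35,4176,0,0,0,4284,0,4284,4284,10853,12877,13111]]

def lv9 : List (List ℕ) := [
 [1341339706663,16,12420,0,16821,0,0,56763,0,0,0,52377,52233],
 [1341340755239,16,12420,0,16821,0,0,56754,0,0,0,52297,52234],
 [1342414497063,16,12420,0,16821,0,0,56754,0,0,0,52377,52233],
 [2440851334439,16,12420,0,16821,0,0,56763,0,0,0,52377,52233],
 [2440852383015,16,12420,0,16821,0,0,56754,0,0,0,52296,52233],
 [2441926124839,16,12420,0,16821,0,0,56754,0,0,0,52377,52233],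
 [4676422706408,23,12636,18908,17406,0,38591,56779,38591,0,39041,46620,38393,38627],
 [3340452013286,23,12636,18729,17262,0,38574,56819,38601,0,0,38607,38631],
 [3340485567718,23,12636,18729,17262,0,38574,56819,38577,0,0,38607,38631],
 [3374845306086,23,12636,18729,17262,0,38574,56819,38574,0,0,38607,38631],
 [1343292220646,23,12636,18729,17262,0,38574,56824,38601,0,38609,56824,56824],
 [1343325775078,23,12636,18729,17262,0,38574,56823,38574,0,38609,56823,38631],
 [2442803848422,23,12636,18729,17262,0,38574,56823,38601,0,38609,56823,39351],
 [2442837402854,23,12636,18729,17262,0,38574,56823,38574,0,38609,56823,38631],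
 [1343528091943,27,12402,0,17298,0,0,56772,0,0,0,56826,56772],
 [2443039719719,27,12402,0,17298,0,0,56772,0,0,0,56826,56772],
 [4674241699111,27,12852,0,17342,0,0,56708,0,0,37916,52956,52227,52956],
 [4675315440935,27,12852,0,17342,0,0,56708,0,0,37916,0,52218,52947],
 [3582241022185,28,12711,18944,0,0,38627,38627,38627,38627,38627,38609,38627,38627,37169,38627],
 [4676422706406,28,12636,18908,0,0,38591,56779,38591,38591,39041,0,38393,38627],
 [3410480342246,28,12636,18888,0,0,38607,56753,38607,38607,0,39041,39119],
 [3444873371878,28,12853,18924,0,0,38607,56756,38607,38607,0,38635,38607,39281],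
 [4502443007273,28,12853,19418,0,0,39110,56702,39110,39101,37916,38393,38627,39317],
 [4503516749097,28,12853,19418,0,0,39101,56702,39110,39101,37916,38393,38627,39317],
 [4440031763753,28,12853,19424,0,0,39107,56702,38387,39107,38393,39107,38633,39323],
 [4474391502121,28,12853,19424,0,0,39107,56702,38387,39107,38393,39107,38633,39323],
 [1314478377478,28,11093,18250,0,0,38608,55880,38608,38608,38608],
 [1383197788678,28,12861,18874,0,0,38608,56588,38608,38608,38312],
 [2480629106278,28,11087,18276,0,0,38608,55886,38608,38608,38608],
 [2482776524390,28,12803,18900,0,0,38608,56608,38608,38608,38312],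
 [1178170081894,28,11571,18900,0,0,38606,55888,38606,38606,38606],
 [2277683775078,28,12659,18276,0,0,38608,56744,38608,38608,38608],
 [2277683806822,28,12661,18272,0,0,38606,56744,38606,38606,38606],
 [1177129894470,28,11631,18726,0,0,38546,55888,38546,38546,38546],
 [2242281783878,28,12853,18290,0,0,38546,56776,38546,38546,38546],
 [2269967066310,28,12475,18882,0,0,38583,56820,38592,38583,56812,38598,38604,38622],
 [3404945726665,28,12816,18882,0,0,38609,56831,38609,38609,38609,38609,38609,38627],
 [1344602874119,29,12804,18876,17406,0,0,56772,0,0,56620,38631,58242,56772],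
 [2444114501895,29,12804,18876,17406,0,0,56772,0,0,0,38631,58242,56772],
 [1348660895014,29,12393,17505,17358,0,12393,56103,12393,12393,38591,38608,38631,39321],
 [1348694449446,29,12393,17505,17358,0,12393,56077,12393,12393,38591,38608,38631,39321],
 [2448172522790,29,12393,17505,17358,0,12393,56103,12393,12393,38600,38608,38631,39321],
 [2448206077222,29,12393,17505,17358,0,12393,56725,12393,12393,38591,38607,38631,39321],
 [3576776924454,29,12852,19416,17270,0,12852,56753,39099,12852,52223,38609,52243,38635],
 [3405146989062,29,11078,17716,15986,0,12869,56851,38585,12869,52163,52163,32723],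
 [1343361424902,29,12816,19528,17340,0,13091,56105,38607,13091,32561,52241,52241],
 [3406187176230,29,11348,18876,17406,0,12806,56772,38561,12806,52235,52163,32561,52235],
 [2277475919046,29,12429,18225,16813,0,37908,56748,37908,12969,52364,52368,52158,52212],
 [3340452013288,30,12636,18729,0,0,0,56819,38574,0,0,38607,38631],
 [3340485567720,30,12636,18729,0,0,0,56723,38574,0,0,38607,52402],
 [3374845306088,30,12636,18729,0,0,0,56720,38574,0,0,38607,38631],
 [1343292220648,30,12636,18729,0,0,0,56823,38574,0,38609,56823,39351],
 [1343325775080,30,12636,18729,0,0,0,56725,38574,0,38609,56797,39351],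
 [2442803848424,30,12636,18729,0,0,0,56823,38574,0,38609,56823,39351],
 [2442837402856,30,12636,18729,0,0,0,56724,38574,0,38609,56796,39351],
 [3410480342248,30,12636,18888,0,0,38607,56753,38607,0,0,39041,39119],
 [3444873371880,30,12853,18924,0,0,38607,56756,38607,0,52004,38635,38607,39281],
 [3410480078089,30,12393,14552,0,0,38609,56105,38609,0,38609,38609,37097,38633,37151,38609],
 [3340553723145,30,12852,14357,0,0,0,56630,38414,0,52220,38393,38633,39098],
 [3374913461513,30,12852,14357,0,0,0,56630,38414,0,52220,38393,38633,39098],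
 [1343393930505,30,12852,14361,0,0,0,56635,38418,0,38609,52236,37168,39103],
 [2442905558281,30,12852,14361,0,0,0,56634,38418,0,38609,52236,38635,39103],
 [3402932460816,30,8588,13535,0,0,0,56702,38591,0,52334,38393,39113],
 [3404006202640,30,8588,13535,0,0,0,56702,38591,0,52334,38393,39113],
 [1343292220656,30,12642,18729,0,0,0,56823,39227,0,38609,56823,38633],
 [1343325775088,30,12642,18729,0,0,0,56724,39227,0,38609,56796,38633],
 [1348895776006,30,12393,18924,0,0,38607,56103,38607,12618,38609,38607,38631,32775,38607],
 [2448407403782,30,12393,18924,0,0,38607,56103,38607,12618,38609,38607,38631,32775,38607],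
 [3402932460752,30,12962,18878,0,0,38591,56702,38624,12962,38591,38393],
 [3404006202576,30,12962,18878,0,0,38591,56702,38591,12962,38591,38393],
 [2442803848432,30,12644,19454,0,0,39227,58570,39326,12644,39227,38633],
 [2442837402864,30,12644,19454,0,0,39227,58570,39227,12644,39227,38633],
 [3340553723081,30,12852,18729,0,0,38414,56630,38417,12852,52229,38393,38633],
 [3374913461449,30,12852,18729,0,0,38414,56630,38414,12852,52229,38393,38633],
 [1343393930441,30,12852,18729,0,0,38418,56634,38419,12852,38609,52239,38635],
 [2442905558217,30,12852,18729,0,0,38418,56634,38418,12852,38609,52239,38635],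
 [3402932460806,30,12804,18876,0,0,12867,56848,38591,12867,52235,56848,38633,39352],
 [3404006202630,30,12804,18876,0,0,12858,56815,38591,12858,52235,52233,38633,39111],
 [1343361424646,30,12816,18882,0,0,12870,56829,38607,12870,32561,52455,52473,39333],
 [2442873052422,30,12816,18882,0,0,12870,56829,38607,12870,32561,52455,52473,39333],
 [1341347045670,30,11400,18900,0,0,12867,56808,38589,12867,38375,38391,38626,52234],
 [1342420787494,30,11400,18900,0,0,12859,56808,38589,12859,38375,38392,38626,52234],
 [2440858673446,30,11400,18900,0,0,12867,56808,38589,12867,38384,38391,38626,52234],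
 [2441932415270,30,11400,18900,0,0,12858,56808,38589,12858,38375,38391,38626,52233],
 [4676249756905,30,12644,18765,0,0,13031,56772,38610,13031,37097,50219,50219,50273],
 [2408545819913,30,12852,14362,0,0,12852,56635,38419,12852,32543,52239,37168,39103],
 [3411382904041,30,12440,18892,0,0,12446,56210,38579,12446,52163,52163,52163,32777],
 [1346513412329,30,12660,18873,0,0,12661,58275,38577,12661,38573,32559,37875,58275],
 [1346546966761,30,12660,18873,0,0,12661,58248,38577,12661,38573,32560,37848,58248],
 [2446025040105,30,12660,18873,0,0,12660,58275,38577,12660,38600,32559,37875,58275],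
 [2446058594537,30,12660,18873,0,0,12660,58248,38577,12660,38573,32559,37848,58248],
 [3582241939753,30,11172,13193,0,0,11172,56771,32876,11172,52241,32867,56771,39275],
 [3508018652393,30,12644,18765,0,0,13031,56779,38617,13031,50219,50219,50219,50273],
 [3582246232327,31,12869,18900,17253,0,0,56825,0,0,52235,38609,56825,38627,52235,39113],
 [1314478377493,32,10898,18869,0,0,38552,0,38552,38552,58792,52474,58792],
 [1383197788689,32,10178,18925,0,0,38608,0,38608,38608,58792,52370,58792],
 [2480629106293,32,10906,18845,0,0,38528,0,38528,38528,58766,52474,58766],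
 [2482776524402,32,10204,18923,0,0,38606,0,38606,38606,58766,52402,58766],
 [1178170081904,32,10688,18863,0,0,38546,0,38546,38546,59008,52402,59008],
 [2277683775092,32,10204,18683,0,0,38366,0,38366,38366,58928,52474,58928],
 [2277683806836,32,10202,18683,0,0,38366,0,38366,38366,58930,52474,58930],
 [1177129894480,32,10610,18863,0,0,38546,0,38546,38546,59008,52456,59008],
 [2242281783889,32,10124,18701,0,0,38384,0,38384,38384,59008,52456,59008],
 [3576911077609,33,12644,17496,17406,0,0,56779,0,0,50219,37097,50219,39121,52235,32723],
 [3574725879017,33,12428,18873,18876,0,0,58242,0,0,51794,38564,38635,39319],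
 [3575799620841,33,12428,18873,18876,0,0,58242,0,0,51794,38564,38635,39319],
 [1348724860137,33,12444,18873,18882,0,0,58248,0,0,38573,38581,46006,39333],
 [2448236487913,33,12444,18873,18882,0,0,58248,0,0,38573,38581,46005,39333],
 [1348660895016,33,12393,17505,17358,0,12393,56725,12393,12393,39221,38607,52401,39321],
 [1348694449448,33,12393,17505,17358,0,12393,56725,12393,12393,39221,38607,38631,39321],
 [2448172522792,33,12393,17505,17358,0,12393,56725,12393,12393,38591,38607,52401,39321],
 [2448206077224,33,12393,17505,17358,0,12393,56725,12393,12393,38591,38607,38631,39321],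
 [4676422705385,33,12644,17496,17406,0,10853,56779,10853,10853,37097,50219,32561,52235,32723],
 [2310733569321,33,12393,17505,17358,0,12393,58267,12393,12393,38585,58261,38607,52401,39321],
 [2310767123753,33,12393,17505,17358,0,12393,56725,12393,12393,37043,58261,38607,38631,39321],
 [2241171037481,33,12393,17523,17406,0,12393,56775,12393,12393,37091,39255,38631,56775,52389],
 [2275530775849,33,12393,17523,17406,0,12393,56775,12393,12393,37091,39256,38631,56775,52389],
 [3439472132393,33,12408,18231,17301,0,12660,56777,12660,12660,52163,38393,38627],
 [1348863270150,33,12852,18924,17409,0,12873,56751,12873,12873,38609,32559,38631,52377,39117],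
 [2448374897926,33,12852,18924,17409,0,12873,56751,12873,12873,38609,32559,38631,52377,39117],
 [3576776924456,33,12852,19416,17270,0,12859,56753,12859,12859,52229,38609,52243,38635],
 [2241042095369,33,12852,18729,14356,0,12852,58099,12852,12852,52376,32559,38632,39096],
 [2275401833737,33,12852,18729,14356,0,12852,58096,12852,12852,52229,32559,38631,39096],
 [2306675548681,33,11094,18147,13774,0,12804,56619,12804,12804,52163,32559,32721],
 [2241042095625,33,12402,17499,14356,0,12852,58096,12852,12852,52235,32559,32793],
 [1341347077321,33,12852,13128,17334,0,12861,56707,12861,12861,32543,37095,38626,52326],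
 [1342420819145,33,12852,13128,17334,0,12852,56707,12852,12852,32543,37096,38626,52326],
 [2440858705097,33,12852,13128,17334,0,12861,56706,12861,12861,32552,37095,38626,52326],
 [2441932446921,33,12852,13128,17334,0,12852,56706,12852,12852,32543,37095,38625,52326],
 [3581066454313,33,12553,18279,18296,0,12877,56826,12877,12877,52235,32561,52235,52397],
 [3580969917737,33,11122,17577,17594,0,12823,58661,12823,12823,52193,52216,38149,39229],
 [3580969950505,33,11122,17577,17594,0,12607,57797,12607,12607,52193,52216,38149,39229],
 [3581003504937,33,11122,17577,17594,0,12580,57770,12580,12580,52166,38987,38149,39229],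
 [1348857797929,33,11172,17577,17628,0,12873,58695,12873,12873,52241,39040,52215,39279],
 [1348857830697,33,11172,17577,17628,0,12630,57805,12630,12630,52241,39040,52239,39279],
 [2448369425705,33,11172,17577,17628,0,12873,58695,12873,12873,39032,39040,52215,39279],
 [2448369458473,33,11172,17577,17628,0,12630,57804,12630,12630,52241,39039,52239,39279],
 [1348895776008,35,12393,0,0,0,12618,0,12618,12618,38609,52377,52401,32775,51729],
 [2448407403784,35,12393,0,0,0,12618,0,12618,12618,38609,52377,52401,32775,51729],
 [4674237506793,35,12428,0,0,0,12428,56187,12428,12428,38591,38635,32759],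
 [4675311248617,35,12428,0,0,0,12428,56187,12428,12428,38591,38635,32759],
 [1348858945833,35,11172,0,0,0,11172,56754,11172,11172,52241,38391,32799],
 [2448370573609,35,11172,0,0,0,11172,56754,11172,11172,52241,38391,32799],
 [3437283747113,35,12426,0,0,0,12696,56678,12696,12696,52154,52377,52233],
 [3437284795689,35,12426,0,0,0,12696,56678,12696,12696,52145,52377,52233],
 [3438358537513,35,12426,0,0,0,12696,56678,12696,12696,52145,52377,52233],
 [1344426714409,35,12438,0,0,0,12708,56688,12708,12708,37934,52074,52236],
 [1344427762985,35,12438,0,0,0,12708,56688,12708,12708,37934,52074,38607],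
 [2443938342185,35,12438,0,0,0,12708,56688,12708,12708,32399,52074,52236],
 [2443939390761,35,12438,0,0,0,12708,56688,12708,12708,32399,52074,38607],
 [3506006402281,35,12428,0,0,0,12428,58242,12428,12428,52145,38635,32759],
 [3507080144105,35,12428,0,0,0,12428,58242,12428,12428,52145,38635,32759],
 [1346577376489,35,12444,0,0,0,12444,58248,12444,12444,12444,52161,32775],
 [2446089004265,35,12444,0,0,0,12444,58248,12444,12444,38573,52161,32775]]

def lv10 : List (List ℕ) := [
 
 [149575734371560,23,37908,56708,52218,0,115757,170325,115757,0,117116,115829,117351,170325],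
 [149610094109928,23,37908,56708,52218,0,115757,170325,115757,0,117116,115829,117351,170325],
 [42922870613222,23,37908,56187,51786,0,115722,170458,115803,0,115820,115821,115893],
 [42922904167654,23,37908,56187,51786,0,115722,170457,115731,0,115820,115821,115893],
 [42957263906022,23,37908,56187,51786,0,115722,170457,115722,0,115820,115821,115893],
 [78107242702054,23,37908,56187,51786,0,115722,170457,115803,0,115820,115821,115893],
 [78107276256486,23,37908,56187,51786,0,115722,170457,115731,0,115820,115821,115893],
 [78141635994854,23,37908,56187,51786,0,115722,170457,115722,0,115820,115821,115893],
 [114631644553449,28,37983,56690,0,0,115820,174825,115820,115739,115820,115820,115828,115901,115820,174825],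
 [114631678107881,28,37983,56690,0,0,115820,115739,115820,115739,115820,115820,115828,115172,115820,115739],
 [149575734371558,28,37908,56708,0,0,115757,170332,115757,115757,117116,115829,115172,115874],
 [149610094109926,28,37908,56708,0,0,115757,170325,115757,115757,117116,115829,117351,170325],
 [42992898942182,28,37908,56664,0,0,115821,170260,115821,115821,115802,117124,117358],
 [78177271031014,28,37908,56664,0,0,115821,170259,115821,115821,115802,117123,117357],
 [43027291971814,28,38559,56772,0,0,115821,170269,115821,115821,115829,115906,115821,117844],
 [78211664060646,28,38559,56772,0,0,115821,170268,115821,115821,115829,115906,115821,117843],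
 [142078835432745,28,38557,58250,0,0,117326,170102,117326,117299,115154,115178,115880,117947],
 [142079909174569,28,38557,58250,0,0,117299,170102,117326,117299,115154,115178,115880,117947],
 [143178347060521,28,38557,58250,0,0,117326,170102,117326,117299,115154,115178,115880,117947],
 [143179420802345,28,38557,58250,0,0,117299,170102,117326,117299,115154,115178,115880,117947],
 [108956048727241,28,38412,56628,0,0,115874,170546,115874,115775,115874,115874,170546,115901],
 [108957122469065,28,38412,56628,0,0,115775,170447,115874,115775,157424,156705,156699,115901],
 [106896477691081,28,38448,56646,0,0,115826,174874,115826,115823,115826,115181,115826,115880],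
 [107995989318857,28,38448,56646,0,0,115823,170489,115826,115823,115823,115181,115823,115877],
 [42987364326601,28,38448,56646,0,0,115828,170494,115828,115827,115829,115828,115828,115882],
 [78171736415433,28,38448,56646,0,0,115827,170493,115828,115827,115829,115827,115827,115881],
 [78211664060656,28,37916,53870,0,0,115835,174718,115826,115835,115178,115835,156698],
 [149645526605010,28,37332,55368,0,0,115821,170118,115154,115821,115802,157378,115875],
 [114461154483494,29,37179,56772,52010,0,115821,168317,115821,37854,157133,115829,156706,117849,168317,
 118012],[114391228128550,29,38556,58242,51794,0,38556,170252,117291,38556,156659,115820,117364,115900],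
 [114425587866918,29,38556,58242,51794,0,38556,170243,117291,38556,156659,115811,117364,115900],
 [43159195524390,29,38556,58248,51810,0,38556,170260,117297,38556,117332,115828,156730,115906],
 [78343567613222,29,38556,58248,51810,0,38556,170259,117297,38556,117332,115827,156729,115905],
 [108893838746118,29,33218,53140,47954,0,38624,170572,115751,38624,156482,115178,98162],
 [108928198484486,29,33218,53140,47954,0,38591,170539,115751,38591,156473,115178,118084],
 [42985351060998,29,38412,58570,52008,0,39326,168362,115773,39326,97658,156704,115900],
 [42986424802822,29,38412,58570,52008,0,39227,168263,115773,39227,115874,156699,115900],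
 [106897719140646,29,34040,56628,52218,0,38417,170316,115679,38417,156704,115802,97682,156704],
 [107997230768422,29,34040,56628,52218,0,38414,170316,115679,38414,156701,115802,115178,156701],
 [42988605776166,29,34044,56628,52218,0,38419,170316,115683,38419,115802,156490,97684,156706],
 [78172977864998,29,34044,56628,52218,0,38418,170316,115683,38418,115802,156489,115180,156705],
 [42922870613224,30,37908,56187,0,0,0,170457,115722,0,115820,115821,115893],
 [42922904167656,30,37908,56187,0,0,0,170169,115722,0,115820,115821,157206],
 [42957263906024,30,37908,56187,0,0,0,170161,115722,0,115820,115821,115893],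
 [78107242702056,30,37908,56187,0,0,0,170457,115722,0,115820,115821,115893],
 [78107276256488,30,37908,56187,0,0,0,170169,115722,0,115820,115821,157206],
 [78141635994856,30,37908,56187,0,0,0,170160,115722,0,115820,115821,115893],
 [42992898942184,30,37908,56664,0,0,115821,170259,115821,0,115829,117123,117357],
 [78177271031016,30,37908,56664,0,0,115821,170259,115821,0,115802,117123,117357],
 [114631879434470,30,38583,56619,0,0,115743,170333,115857,0,156683,115883,115828,115172,115743,117845],
 [114631879434472,30,38583,56619,0,0,0,170333,115668,0,156683,115883,170333,115901,113670,117845],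
 [43027291971816,30,38559,56772,0,0,115821,170268,115821,0,115829,115906,115821,117843],
 [78211664060648,30,38559,56772,0,0,115821,170268,115821,0,115829,115906,115821,117843],
 [106902012042505,30,37179,43652,0,0,115823,168311,115823,0,115823,115829,111287,115895,111452,115823],
 [108001523670281,30,37179,43652,0,0,115823,168311,115823,0,115823,115829,111287,115895,111452,115823],
 [42992898678025,30,37179,43656,0,0,115827,168315,115827,0,115829,115827,111291,115899,111454,115827],
 [78177270766857,30,37179,43656,0,0,115827,168315,115827,0,115829,115827,111291,115899,111454,115827],
 [42922972323081,30,38556,43071,0,0,0,169891,115242,0,115811,115179,115900,117295],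
 [42957332061449,30,38556,43071,0,0,0,169891,115242,0,115811,115180,115900,117295],
 [78107344411913,30,38556,43071,0,0,0,169890,115242,0,115820,115179,115900,117295],
 [78141704150281,30,38556,43071,0,0,0,169890,115242,0,115811,115179,115900,117295],
 [106894464425232,30,25760,40601,0,0,0,170102,115769,0,115127,115175,117338],
 [106895538167056,30,25760,40601,0,0,0,170102,115769,0,115127,115178,117338],
 [107995049794832,30,25760,40601,0,0,0,170102,115769,0,115127,115175,117338],
 [42922870613232,30,37914,56187,0,0,0,170457,117671,0,115820,115821,115893],
 [42922904167664,30,37914,56187,0,0,0,170169,117671,0,115820,115821,115898],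
 [42957263906032,30,37914,56187,0,0,0,170160,117671,0,115820,115821,115893],
 [109135370951952,30,25760,40760,0,0,99845,170102,115757,0,115829,115907,117332],
 [42992898942192,30,37914,56664,0,0,115821,170259,115821,0,115802,117851,118085],
 [109135370951888,30,38882,56624,0,0,115757,170102,115154,38882,115829,115907],
 [106894464425168,30,38882,56630,0,0,115769,170102,115868,38882,115154,115178],
 [106895538166992,30,38882,56630,0,0,115769,170102,115772,38882,115127,115178],
 [107995049794768,30,38882,56630,0,0,115769,170102,115769,38882,115154,115178],
 [78177271031024,30,37916,58334,0,0,117635,175696,115826,37916,117851,118085],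
 [78107242702064,30,37916,58352,0,0,117671,175696,117968,37916,115826,115898],
 [78107276256496,30,37916,58352,0,0,117671,175696,117680,37916,115745,115898],
 [78141635994864,30,37916,58352,0,0,117671,175696,117671,37916,115826,115898],
 [42922972323017,30,38556,56187,0,0,115242,169890,115251,38556,115820,115180,115900],
 [42957332061385,30,38556,56187,0,0,115242,169890,115243,38556,115811,115180,115900],
 [78107344411849,30,38556,56187,0,0,115242,169890,115251,38556,115820,115179,115900],
 [78141704150217,30,38556,56187,0,0,115242,169890,115242,38556,115820,115180,115900],
 [106894464425222,30,38412,56628,0,0,38601,170542,115769,38601,156704,157426,157378,117336],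
 [106895538167046,30,38412,56628,0,0,38577,170446,115769,38577,156704,157426,115898,117336],
 [107995049794822,30,38412,56628,0,0,38574,170443,115769,38574,156704,157426,157378,117333],
 [42985351060742,30,38412,56628,0,0,38601,170544,115773,38601,115874,170544,115900,118056],
 [42986424802566,30,38412,56628,0,0,38574,170445,115773,38574,115874,156699,115900,117333],
 [78169723149574,30,38412,56628,0,0,38601,170544,115773,38601,97658,170544,115900,118056],
 [78170796891398,30,38412,56628,0,0,38574,170445,115773,38574,115874,156699,115900,117333],
 [149639923016937,30,37916,56187,0,0,39248,170469,115722,39248,111428,150794,157130,150659],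
 [149639956571369,30,37916,56187,0,0,38951,170172,115722,38951,117980,150497,150497,150659],
 [149575561422057,30,37916,56295,0,0,39077,170325,115830,39077,111284,115909,150650,150812],
 [149609921160425,30,37916,56295,0,0,39077,170316,115830,39077,111275,115909,150641,150803],
 [77007832784137,30,38556,43072,0,0,38556,174297,115243,38556,97613,115180,115900,117295],
 [77042192522505,30,38556,43072,0,0,38556,169891,115243,38556,97613,115180,115900,117295],
 [110235947900112,30,38556,56702,0,0,38556,170102,115154,38556,115829,115883,157208],
 [149610094109938,30,21780,53910,0,0,37980,169902,115802,37980,117341,157216,115883],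
 [109162201883881,30,37280,56638,0,0,37286,168611,115691,37286,156464,156464,115907,111506],
 [109163275625705,30,37280,56638,0,0,37286,168584,115691,37286,156437,156437,115907,98279],
 [106902914868457,30,37316,56674,0,0,37337,168637,115733,37337,156488,115747,156488,98330],
 [108002426496233,30,37316,56674,0,0,37334,168626,115733,37334,156485,115747,156485,118012],
 [145420117614825,30,37964,56619,0,0,37964,174850,115668,37964,115828,115898,113562,174850],
 [145420151169257,30,37964,56619,0,0,37964,174769,115668,37964,115828,115898,113481,174769],
 [112256527672553,30,37916,56187,0,0,39248,170476,115729,39248,150794,150794,157130,118060],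
 [112256561226985,30,37916,56187,0,0,38951,170179,115729,38951,157346,150497,150497,118060],
 [112192166077673,30,37916,56295,0,0,39077,170332,115837,39077,150650,115909,150650,150812],
 [112226525816041,30,37916,56295,0,0,39077,170323,115837,39077,150641,115909,150641,150803],
 [43090437252329,30,37932,56295,0,0,39094,170337,115851,39094,115847,150658,150658,150820],
 [78274809341161,30,37932,56295,0,0,39093,170337,115851,39093,115847,150657,157192,157354],
 [43164664832263,31,38607,56700,51759,0,0,170475,0,0,169909,115827,170475,115882,156705,117339],
 [78349036921095,31,38607,56700,51759,0,0,170475,0,0,115757,115827,170475,115882,156705,117339],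
 [114391362281705,33,37916,52488,52218,0,0,170325,0,0,150641,111275,156707,117351,170325,117844],
 [114425722020073,33,37916,52488,52218,0,0,170325,0,0,150641,111275,115828,117351,170325,117844],
 [43159329677545,33,37932,52488,52218,0,0,170337,0,0,116648,111291,150657,117363,156705,98169],
 [78343701766377,33,37932,52488,52218,0,0,170337,0,0,117107,111291,150657,117363,156705,98169],
 [43157144478953,33,37284,56619,56628,0,0,174726,0,0,115685,115693,115905,117957],
 [43158218220777,33,37284,56619,56628,0,0,174726,0,0,115685,115693,115906,117957],
 [78341516567785,33,37284,56619,56628,0,0,174726,0,0,115685,115693,115905,117957],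
 [78342590309609,33,37284,56619,56628,0,0,174726,0,0,115685,115693,115905,117957],
 [114461154483496,33,37179,56772,52010,0,37854,168317,37854,37854,157133,115829,156706,117849,168317,118011],
 [149575734370537,33,37916,52488,52218,0,32543,170325,32543,32543,111284,156707,150650,170325,98162],
 [149610094108905,33,37916,52488,52218,0,32543,170325,32543,32543,111284,115828,150650,170325,98162],
 [71717405072681,33,37179,52515,52074,0,37179,174799,37179,37179,115751,117663,115821,157203,117963],
 [71717438627113,33,37179,52515,52074,0,37179,170175,37179,37179,111125,117663,115821,115893,117963],
 [72816916700457,33,37179,52515,52074,0,37179,174799,37179,37179,115751,115773,115821,157203,117963],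
 [72816950254889,33,37179,52515,52074,0,37179,170175,37179,37179,111125,115773,115821,115893,117963],
 [43021890732329,33,37224,54693,51903,0,37980,170332,37980,37980,170332,115180,115882],
 [78206262821161,33,37224,54693,51903,0,37980,170331,37980,37980,97037,115179,115881],
 [114391228128552,33,38556,58242,51794,0,38563,170243,38563,38563,156683,115811,117363,115900],
 [114425587866920,33,38556,58242,51794,0,38563,170243,38563,38563,156683,115811,97684,115900],
 [43159195524392,33,38556,58248,51810,0,38577,170259,38577,38577,117305,115827,156730,115905],
 [78343567613224,33,38556,58248,51810,0,38577,170259,38577,38577,117332,115827,156730,115905],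
 [114594124375337,33,37339,54729,54746,0,39040,170064,39040,39040,157130,98090,156490,156725],
 [114594125423913,33,37339,54729,54746,0,38149,170064,38149,38149,157115,157138,156239,156725],
 [43163485054249,33,37659,54837,54888,0,38631,170478,38631,38631,156731,97684,156706,157192],
 [43163388517673,33,33366,52731,52782,0,38469,175983,38469,38469,156650,156648,114447,117687],
 [43163388550441,33,33366,52731,52782,0,37821,173391,37821,37821,156650,156648,114447,117687],
 [43163422104873,33,33366,52731,52782,0,37740,173311,37740,37740,156650,116962,114447,117687],
 [78347857143081,33,37659,54837,54888,0,38631,170478,38631,38631,156731,97683,156705,157191],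
 [78347760606505,33,33366,52731,52782,0,38469,175983,38469,38469,156650,156648,114447,117687],
 [78347760639273,33,33366,52731,52782,0,37821,173391,37821,37821,156650,156648,114447,117687],
 [78347794193705,33,33366,52731,52782,0,37740,173310,37740,37740,156650,116961,114447,117687],
 [42063308079783,34,38552,0,0,0,38552,168362,38552,38552,176890,156706,176890],
 [44262329238055,34,38608,0,0,0,38608,167642,38608,38608,176890,157210,176890],
 [79380131401383,34,38528,0,0,0,38528,168370,38528,38528,176864,156706,176864],
 [79448848780871,34,38606,0,0,0,38606,167668,38606,38606,176864,157190,176864],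
 [37701442620935,34,38546,0,0,0,38546,168152,38546,38546,177106,156704,177106],
 [72885880802951,34,38366,0,0,0,38366,167668,38366,38366,177026,157190,177026],
 [72885881818759,34,38366,0,0,0,38366,167666,38366,38366,177028,157192,177028],
 [37668156623367,34,38546,0,0,0,38546,168074,38546,38546,177106,156704,177106],
 [71753017084455,34,38384,0,0,0,38384,167588,38384,38384,177106,157210,177106],
 [43019702347049,35,37278,0,0,0,38088,170034,38088,38088,113750,157131,156699],
 [43019703395625,35,37278,0,0,0,38088,170034,38088,38088,113750,157131,156699],
 [43020777137449,35,37278,0,0,0,38088,170034,38088,38088,113750,157131,156699],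
 [78204074435881,35,37278,0,0,0,38088,170034,38088,38088,97145,157131,156699],
 [78204075484457,35,37278,0,0,0,38088,170034,38088,38088,97145,157131,156699],
 [78205149226281,35,37278,0,0,0,38088,170034,38088,38088,97145,157131,156699],
 [43088425002217,35,37284,0,0,0,37284,174726,37284,37284,37284,115906,98277],
 [43089498744041,35,37284,0,0,0,37284,174726,37284,37284,37284,115906,98277],
 [78272797091049,35,37284,0,0,0,37284,174726,37284,37284,115685,115905,98277],
 [78273870832873,35,37284,0,0,0,37284,174726,37284,37284,115685,115906,98277],
 [145420181578985,35,37316,0,0,0,37316,174769,37316,37316,115747,156467,118004]]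

def lv11 : List (List ℕ) := [
 
 [1381269039751401,28,113949,170070,0,0,347460,524475,347460,347217,347462,347460,347484,347704,347460,
 524475],
 [1381269073305833,28,113949,170070,0,0,347460,347217,347460,347217,347462,347460,347484,347704,347460,
 353050],
 [2507168980148457,28,113949,170070,0,0,347460,347217,347460,347217,347462,347460,347484,347704,347460,
 353050],[3484594184953033,28,115236,169884,0,0,347606,511628,347606,347309,470108,470112,347408,347696],
 [3484595258694857,28,115236,169884,0,0,347318,511340,347606,347309,470108,470112,347408,347696],
 [3485694770322633,28,115236,169884,0,0,347309,511331,347606,347309,470108,470112,347408,347696],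
 [3420685071588553,28,115236,169884,0,0,347618,511634,347618,347321,347618,345464,511634,347702],
 [3420686145330377,28,115236,169884,0,0,347324,524470,347618,347321,472268,345464,470097,347702],
 [3455869443677385,28,115236,169884,0,0,347618,511634,347618,347321,347618,345464,511634,347702],
 [3455870517419209,28,115236,169884,0,0,347321,511337,347618,347321,472268,345464,470097,347702],
 [1375593443925193,28,115236,169884,0,0,347622,511638,347622,347325,347408,347622,511638,347704],
 [1375594517667017,28,115236,169884,0,0,347326,511342,347622,347325,347408,470115,470097,347704],
 [1373533872889033,28,115344,169938,0,0,347478,524622,347478,347469,347480,345544,347478,347640],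
 [1374633384516809,28,115344,169938,0,0,347470,511468,347478,347469,347480,345544,347470,347632],
 [2501493350767817,28,115236,169884,0,0,347622,511638,347622,347325,347408,347622,511638,347704],
 [2501494424509641,28,115236,169884,0,0,347325,511341,347622,347325,347408,470115,470097,347704],
 [2499433779731657,28,115344,169938,0,0,347478,524622,347478,347469,347480,345544,347478,347640],
 [2500533291359433,28,115344,169938,0,0,347469,511467,347478,347469,347480,345544,347469,347631],
 [3660523593014566,29,111537,170316,156014,0,347463,504944,347463,113562,471395,347480,347488,353550,504944,
 354036],
 [3661623104642342,29,111537,170316,156014,0,347463,504944,347463,113562,471395,347480,347488,353550,504944,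
 354036],
 [1381098549681446,29,111537,170316,156030,0,347463,504952,347463,113562,347480,347488,511000,353547,504952,
 354036],
 [2506998456524070,29,111537,170316,156030,0,347463,504952,347463,113562,347480,347488,511000,353547,504952,
 354036],
 [1381028623326502,29,115668,174726,155382,0,115668,510756,351873,115668,351962,347460,352092,347700],
 [1381062983064870,29,115668,174726,155382,0,115668,510730,351873,115668,351962,347434,352092,347700],
 [2506928530169126,29,115668,174726,155382,0,115668,510756,351873,115668,353285,347460,352092,347700],
 [2506962889907494,29,115668,174726,155382,0,115668,510729,351873,115668,351962,347433,352092,347700],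
 [3420622861607430,29,99650,159418,143858,0,115868,511714,347249,115868,470168,470120,294482],
 [3420657221345798,29,99650,159418,143858,0,115772,511618,347249,115772,470168,470120,354250],
 [3455841593434630,29,99650,159418,143858,0,115769,511615,347249,115769,470168,470120,354250],
 [1373531859623430,29,115236,175696,156012,0,117968,505070,347307,117968,292958,472280,472136],
 [1373532933365254,29,115236,175696,156012,0,117680,504782,347307,117680,347606,472280,472136],
 [1374632444993030,29,115236,175696,156012,0,117671,504773,347307,117671,347606,472280,472136],
 [1373535114338598,29,102120,169884,156654,0,115251,510948,347037,115251,347390,347406,345535,470112],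
 [1374634625966374,29,102120,169884,156654,0,115243,510948,347037,115243,347390,347407,345535,470104],
 [2499435021181222,29,102120,169884,156654,0,115251,510948,347037,115251,347399,347406,345535,470112],
 [2500534532808998,29,102120,169884,156654,0,115242,510948,347037,115242,347390,347406,345534,470103],
 [1381269274632422,30,115749,169857,0,0,347229,511000,347571,0,347480,347650,511000,347704,347229,353536],
 [2507169181475046,30,115749,169857,0,0,347229,511000,347571,0,347480,347650,511000,347704,347229,353536],
 [1381269274632424,30,115749,169857,0,0,0,510999,347004,0,347480,347650,510999,347704,341010,353536],
 [2507169181475048,30,115749,169857,0,0,0,510999,347004,0,347480,347650,510999,347704,341010,353536],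
 [1373539407240457,30,111537,130956,0,0,347469,504933,347469,0,347480,347488,333861,347685,334356,347469],
 [1374638918868233,30,111537,130956,0,0,347469,504933,347469,0,347480,347488,333861,347685,334356,347469],
 [2499439314083081,30,111537,130956,0,0,347469,504933,347469,0,347480,347488,333861,347685,334356,347469],
 [2500538825710857,30,111537,130956,0,0,347469,504933,347469,0,347480,347488,333861,347685,334356,347469],
 [3527345247132937,30,115773,130952,0,0,347465,511502,347465,115773,470096,327806,470122,333857,511502,
 351998],
 [4789751026787561,30,113732,170172,0,0,347319,511011,347319,117332,333872,274832,445904,451970,347650],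
 [1373531859623174,30,115236,169884,0,0,115803,511626,347307,115803,347606,472278,472134,352008],
 [1373532933364998,30,115236,169884,0,0,115731,511338,347307,115731,347606,472278,347694,352008],
 [1374632444992774,30,115236,169884,0,0,115722,511329,347307,115722,347606,472278,472134,351999],
 [2499431766465798,30,115236,169884,0,0,115803,511626,347307,115803,292958,472278,472134,352008],
 [2499432840207622,30,115236,169884,0,0,115731,511338,347307,115731,347606,472278,347694,352008],
 [2500532351835398,30,115236,169884,0,0,115722,511329,347307,115722,347606,472278,472134,351999],
 [4788415056094441,30,113732,168561,0,0,117710,511371,347166,117710,347444,452330,452384,451952],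
 [4788415089648873,30,113732,168561,0,0,116846,510507,347166,116846,347444,451466,452384,451952],
 [4788449449387241,30,113732,168561,0,0,116819,510480,347166,116819,347444,451439,452384,451952],
 [4786417896301801,30,113732,168561,0,0,117728,511407,347166,117728,334268,347488,471374,451970],
 [4786417929856233,30,113732,168561,0,0,116837,510525,347166,116837,353924,347488,451484,451970],
 [4787517407929577,30,113732,168561,0,0,117728,511407,347166,117728,334268,347488,471374,451970],
 [4787517441484009,30,113732,168561,0,0,116837,510516,347166,116837,353924,347488,451475,451970],
 [4788485084423401,30,113732,169992,0,0,347463,510777,347463,117116,333638,445904,294506,295208],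
 [3420891224745193,30,111836,169912,0,0,111857,505829,347069,111857,469388,347083,347720,334514],
 [3420892298487017,30,111836,169912,0,0,111857,505759,347069,111857,469310,347083,347720,294836],
 [3456075596834025,30,111836,169912,0,0,111854,505829,347069,111854,469388,347083,347720,334514],
 [3456076670575849,30,111836,169912,0,0,111854,505748,347069,111854,469307,347083,347720,353884],
 [3527550193214761,30,112969,164724,0,0,115885,511485,341871,115885,470192,293056,470192,471650],
 [3527550096678185,30,100090,158406,0,0,115399,527933,342843,115399,469721,292570,343329,353049],
 [3527550096710953,30,100090,158406,0,0,113455,520157,342843,113455,469721,350890,343329,353292],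
 [3527550130265385,30,100090,158406,0,0,113212,519914,342843,113212,469478,350890,343329,353049],
 [3592146405074153,30,113732,168561,0,0,117710,511378,347173,117710,452330,452330,452384,451952],
 [3592146438628585,30,113732,168561,0,0,116846,510514,347173,116846,472004,451466,452384,451952],
 [3592180798366953,30,113732,168561,0,0,116819,510487,347173,116819,472004,451439,452384,451952],
 [3590149245281513,30,113732,168561,0,0,117728,511414,347173,117728,452366,347488,471374,451970],
 [3590149278835945,30,113732,168561,0,0,116837,510532,347173,116837,472022,347488,451484,451970],
 [3591248756909289,30,113732,168561,0,0,117728,511414,347173,117728,452366,347488,471374,451970],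
 [3591248790463721,30,113732,168561,0,0,116837,510523,347173,116837,472022,347488,451475,451970],
 [1378893922870505,30,113748,168561,0,0,117744,511428,347187,117744,347183,452382,471390,451978],
 [1378893956424937,30,113748,168561,0,0,116854,510537,347187,116854,347183,451492,451492,451978],
 [1378829561275625,30,113748,168885,0,0,117232,510996,347511,117232,347507,347728,451950,452436],
 [1378863921013993,30,113748,168885,0,0,117232,510969,347511,117232,347507,347728,451924,452410],
 [2504793829713129,30,113748,168561,0,0,117744,511428,347187,117744,347426,452382,471390,451978],
 [2504793863267561,30,113748,168561,0,0,116853,510537,347187,116853,347183,451491,471148,451978],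
 [2504729468118249,30,113748,168885,0,0,117231,510996,347511,117231,347507,347728,451950,452436],
 [2504763827856617,30,113748,168885,0,0,117231,510969,347511,117231,347507,347728,471526,472012],
 [4653445771732201,30,113780,168885,0,0,117263,510948,347490,117263,294434,451955,471578,472064],
 [1381028757479657,33,113748,157464,156654,0,0,510975,0,0,349928,333825,470121,352053,510975,353532],
 [1381063117218025,33,113748,157464,156654,0,0,510975,0,0,349928,333825,470122,352053,510975,353532],
 [2506928664322281,33,113748,157464,156654,0,0,510975,0,0,351305,333825,470121,352053,510975,353532],
 [2506963024060649,33,113748,157464,156654,0,0,510975,0,0,351305,333825,470122,352053,510975,353532],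
 [3660523593014568,33,111537,170316,156014,0,113562,504935,113562,113562,471395,347480,347481,353541,504935,
 354036],
 [3661623104642344,33,111537,170316,156014,0,113562,504935,113562,113562,471395,347480,347488,353541,504935,
 354036],
 [1381098549681448,33,111537,170316,156030,0,113562,504951,113562,113562,347471,347488,470118,353547,504951,
 354033],
 [2506998456524072,33,111537,170316,156030,0,113562,504951,113562,113562,347480,347488,470118,353547,504951,
 354033],
 [4653445944680681,33,113780,157464,156654,0,97661,511016,97661,97661,274832,451976,352094,470120,294512],
 [1381028623326504,33,115668,174726,155382,0,115689,510729,115689,115689,351881,347433,352089,347700],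
 [1381062983064872,33,115668,174726,155382,0,115689,510729,115689,115689,351881,347433,293052,347700],
 [2506928530169128,33,115668,174726,155382,0,115689,510729,115689,115689,351962,347433,352089,347700],
 [2506962889907496,33,115668,174726,155382,0,115689,510729,115689,115689,351962,347433,293052,347700],
 [3668220141903110,33,115668,170333,156681,0,115857,510776,115857,115857,470120,470168,470176,293048,469952,
 471410,352070],
 [3667012215882025,33,111697,164079,164096,0,115180,511000,115180,115180,469466,292328,293056,295162],
 [3667010027496745,33,111859,164079,164096,0,116962,510102,116962,116962,471248,294110,471410,470114],
 [3667010028545321,33,111859,164079,164096,0,114370,510102,114370,114370,471233,471256,471410,470114],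
 [3667011102287145,33,111859,164079,164096,0,114289,510102,114289,114289,471233,471256,471410,470114],
 [1381231519573289,33,112017,164187,164238,0,117120,510192,117120,117120,469472,294270,469470,470176],
 [1381231520621865,33,112017,164187,164238,0,114447,510192,114447,114447,469472,471414,468718,470176],
 [2507131426415913,33,112017,164187,164238,0,117120,510192,117120,117120,469472,294270,469470,470176],
 [2507131427464489,33,112017,164187,164238,0,114447,510192,114447,114447,469472,471414,468717,470176],
 [4653443759482089,35,111836,0,0,0,111836,524203,111836,111836,347083,347720,353876],
 [4653444833223913,35,111836,0,0,0,111836,524203,111836,111836,347083,347704,353876]]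

def lv12 : List (List ℕ) := [
 
 [109459922916515017,28,345708,509652,0,0,1042814,1534880,1042814,1041923,1410320,1036340,1042220,1043084],
 [109459923990256841,28,345708,509652,0,0,1041950,1534016,1042814,1041923,1410320,1036340,1042220,1043087],
 [109461023501884617,28,345708,509652,0,0,1041926,1573366,1042814,1041923,1410320,1036340,1042223,1043087],
 [110585822823357641,28,345708,509652,0,0,1042814,1534880,1042814,1041923,1410320,1036367,1042220,1043084],
 [110585823897099465,28,345708,509652,0,0,1041950,1534016,1042814,1041923,1410320,1036367,1042220,1043087],
 [110586923408727241,28,345708,509652,0,0,1041923,1533989,1042814,1041923,1410320,1036340,1042220,1043084],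
 [44016990831287497,28,345708,509652,0,0,1042818,1534884,1042818,1041927,1042172,1410336,1042224,1043088],
 [44016991905029321,28,345708,509652,0,0,1041954,1534020,1042818,1041927,1042172,1410336,1042224,1043089],
 [44018091416657097,28,345708,509652,0,0,1041928,1533994,1042818,1041927,1042172,1410336,1042225,1043089],
 [43953081717923017,28,345708,509652,0,0,1042854,1534902,1042854,1041963,1042865,1042873,1534902,1043107],
 [43953082791664841,28,345708,509652,0,0,1041972,1573410,1042854,1041963,1042865,1042873,1410291,1043107],
 [43988266090011849,28,345708,509652,0,0,1042854,1534902,1042854,1041963,1042865,1036393,1534902,1043107],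
 [43988267163753673,28,345708,509652,0,0,1041964,1534012,1042854,1041963,1042865,1036393,1410291,1043107],
 [80045787850251465,28,345708,509652,0,0,1042818,1534884,1042818,1041927,1042199,1410336,1042224,1043088],
 [80045788923993289,28,345708,509652,0,0,1041954,1534020,1042818,1041927,1042199,1410336,1042224,1043089],
 [80046888435621065,28,345708,509652,0,0,1041927,1533993,1042818,1041927,1042172,1410336,1042224,1043088],
 [79981878736886985,28,345708,509652,0,0,1042854,1534902,1042854,1041963,1042217,1042873,1534902,1043107],
 [79981879810628809,28,345708,509652,0,0,1041972,1573410,1042854,1041963,1042217,1042873,1410291,1043107],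
 [80017063108975817,28,345708,509652,0,0,1042854,1534902,1042854,1041963,1042217,1036393,1534902,1043107],
 [80017064182717641,28,345708,509652,0,0,1041963,1534011,1042854,1041963,1042865,1042873,1410291,1043107],
 [44192920239349030,29,334611,510948,468042,0,1042389,1514832,1042389,340686,1042424,1042441,1042464,1060650,
 1514832,1062108],
 [44194019750976806,29,334611,510948,468042,0,1042389,1514832,1042389,340686,1042424,1042441,1042464,1060650,
 1514832,1062108],
 [80221717258312998,29,334611,510948,468042,0,1042389,1514832,1042389,340686,1042433,1042441,1042464,1060650,
 1514832,1062108],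
 [80222816769940774,29,334611,510948,468042,0,1042389,1514832,1042389,340686,1042433,1042441,1042464,1060650,
 1514832,1062108],
 [112872814556781833,30,347271,392852,0,0,1042391,1534478,1042391,347271,1410236,1042442,1036394,1001567,
 1534478,1055942],
 [112873914068409609,30,347271,392852,0,0,1042391,1534478,1042391,347271,1410236,1042442,1036394,1001567,
 1534478,1055942],
 [44059741893467401,30,347319,392856,0,0,1042395,1534506,1042395,347319,1042460,1042468,1410366,1001571,
 1534506,1055994],
 [80088538912431369,30,347319,392856,0,0,1042395,1534506,1042395,347319,1042460,1042468,1410366,1001571,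
 1534506,1055994],
 [153271963064968425,30,341180,510372,0,0,1041813,1532925,1041813,351908,1060577,1054044,1042468,1414871,
 1532925],
 [153271997424706793,30,341180,510372,0,0,1041813,1532925,1041813,351908,1060577,1054044,1042468,1414871,
 1532925],
 [153165310201210089,30,341180,505683,0,0,353114,1534113,1041498,353114,1042316,1042380,1357136,1355840],
 [153165310234764521,30,341180,505683,0,0,350522,1531521,1041498,350522,1042316,1042380,1357136,1355849],
 [153165344594502889,30,341180,505683,0,0,350441,1531449,1041498,350441,1042316,1042380,1357145,1355849],
 [153200494573298921,30,341180,505683,0,0,353114,1534113,1041498,353114,1042316,1042387,1357136,1355840],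
 [153200494606853353,30,341180,505683,0,0,350522,1531521,1041498,350522,1042316,1042387,1357136,1355849],
 [153200528966591721,30,341180,505683,0,0,350441,1531440,1041498,350441,1042316,1042380,1357136,1355840],
 [153165380229539049,30,341180,509976,0,0,1042389,1532331,1042389,351332,1000898,1042468,883502,885608],
 [153200564601627881,30,341180,509976,0,0,1042389,1532331,1042389,351332,1000898,1042468,883502,885608],
 [112881606180709673,30,336043,492774,0,0,351352,1532814,1024215,351352,1414247,882817,1408402,1410530],
 [112881606181758249,30,336043,492774,0,0,343333,1530627,1024215,343333,1414019,874798,1406228,1410530],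
 [147608647068034281,30,335561,509762,0,0,335573,1572613,1041203,335573,1408175,1408181,1043116,1003538],
 [147608648141776105,30,335561,509762,0,0,335573,1572613,1041203,335573,1407932,1407938,1043116,884510],
 [43953287871079657,30,335508,509736,0,0,335571,1517487,1041207,335571,1041209,1041249,1043160,1003542],
 [43953288944821481,30,335508,509736,0,0,335571,1517277,1041207,335571,1041209,1041249,1043161,884508],
 [43988472243168489,30,335508,509736,0,0,335563,1517487,1041207,335563,1041209,1041250,1043160,1003542],
 [43988473316910313,30,335508,509736,0,0,335563,1517245,1041207,335563,1041209,1041250,1043161,1061652],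
 [80017269262132457,30,335508,509736,0,0,335562,1517487,1041207,335562,1041209,1041249,1043160,1003542],
 [80017270335874281,30,335508,509736,0,0,335562,1517244,1041207,335562,1041209,1041249,1043160,1061652],
 [114884713368560873,30,341180,505683,0,0,353114,1534120,1041505,353114,1356974,1042387,1357136,1355840],
 [114884713402115305,30,341180,505683,0,0,350522,1531528,1041505,350522,1415996,1042387,1357136,1355849],
 [114884747761853673,30,341180,505683,0,0,350441,1531456,1041505,350441,1415996,1042387,1357145,1355849],
 [114919897740649705,30,341180,505683,0,0,353114,1534120,1041505,353114,1356974,1042387,1357136,1355840],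
 [114919897774204137,30,341180,505683,0,0,350522,1531528,1041505,350522,1415996,1042387,1357136,1355849],
 [114919932133942505,30,341180,505683,0,0,350441,1531447,1041505,350441,1415996,1042387,1357136,1355840],
 [44124543051408617,30,341196,505683,0,0,353130,1534134,1041519,353130,1041515,1356990,1416175,1414879],
 [44124543084963049,30,341196,505683,0,0,350538,1531542,1041519,350538,1041515,1354398,1416175,1355857],
 [44124577444701417,30,341196,505683,0,0,350458,1531461,1041519,350458,1041515,1354318,1357153,1355857],
 [44122545891615977,30,341196,505683,0,0,353184,1534242,1041519,353184,1041515,1416121,1414122,1355910],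
 [44122545925170409,30,341196,505683,0,0,350512,1531596,1041519,350512,1041515,1416121,1354452,1355911],
 [44123645403243753,30,341196,505683,0,0,353184,1534242,1041519,353184,1041515,1042465,1414122,1355910],
 [44123645436798185,30,341196,505683,0,0,350512,1531569,1041519,350512,1041515,1042465,1354426,1355911],
 [80153340070372585,30,341196,505683,0,0,353130,1534134,1041519,353130,1042244,1356990,1416175,1414879],
 [80153340103927017,30,341196,505683,0,0,350538,1531542,1041519,350538,1041596,1354398,1416175,1355857],
 [80153374463665385,30,341196,505683,0,0,350457,1531461,1041519,350457,1041515,1354317,1416175,1414879],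
 [80151342910579945,30,341196,505683,0,0,353184,1534242,1041519,353184,1042244,1416121,1414122,1355910],
 [80151342944134377,30,341196,505683,0,0,350511,1531596,1041519,350511,1041515,1416121,1354452,1355911],
 [80152442422207721,30,341196,505683,0,0,353184,1534242,1041519,353184,1042244,1042465,1414122,1355910],
 [80152442455762153,30,341196,505683,0,0,350511,1531569,1041519,350511,1041515,1416121,1413394,1355910],
 [148910264626226409,30,341228,505683,0,0,353216,1534221,1041498,353216,884681,1357130,1414154,1355936],
 [148910264659780841,30,341228,505683,0,0,350543,1531548,1041498,350543,1042306,1354457,1413446,1355936],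
 [148910200264631529,30,341228,506655,0,0,351677,1532925,1042470,351677,883142,1043170,1355834,1357292],
 [148910234624369897,30,341228,506655,0,0,351677,1532844,1042470,351677,883142,1043170,1414580,1416038],
 [44192920239349032,33,334611,510948,468042,0,340686,1514805,340686,340686,1042397,1042440,1042443,1060623,
 1514805,1062108],
 [44194019750976808,33,334611,510948,468042,0,340686,1514805,340686,340686,1042397,1042440,1042464,1060623,
 1514805,1062108],
 [80221717258313000,33,334611,510948,468042,0,340686,1514805,340686,340686,1042424,1042440,1042443,1060623,
 1514805,1062108],
 [80222816769940776,33,334611,510948,468042,0,340686,1514805,340686,340686,1042424,1042440,1042464,1060623,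
 1514805,1062108],
 [148910200437580009,33,341228,472392,469962,0,292871,1532925,292871,292871,824336,1410368,1355834,1532925,
 1060601],
 [148910234797318377,33,341228,472392,469962,0,292871,1532925,292871,292871,824336,1042457,1355834,1532925,
 1060601],
 [44200616788237574,33,347004,510999,470043,0,347571,1532328,347571,347571,1042442,1410504,1410528,879144,
 1409856,1414230,1056210],
 [80229413807201542,33,347004,510999,470043,0,347571,1532328,347571,347571,1042442,1410504,1410528,879144,
 1409856,1414230,1056210],
 [44199408862216489,33,335091,492237,492288,0,345540,1533000,345540,345540,1408424,876984,879168,885486],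
 [44199406673831209,33,335577,492237,492288,0,350886,1530306,350886,350886,1407938,882330,1414230,1410342],
 [44199406674879785,33,335577,492237,492288,0,343110,1530306,343110,343110,1407938,1413768,1414230,1410343],
 [44199407748621609,33,335577,492237,492288,0,342867,1530306,342867,342867,1407938,1413768,1414231,1410343],
 [80228205881180457,33,335091,492237,492288,0,345540,1533000,345540,345540,1408424,876984,879168,885486],
 [80228203692795177,33,335577,492237,492288,0,350886,1530306,350886,350886,1408181,882330,1414230,1410342],
 [80228203693843753,33,335577,492237,492288,0,343110,1530306,343110,343110,1408181,1413768,1414230,1410343],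
 [80228204767585577,33,335577,492237,492288,0,342867,1530306,342867,342867,1407938,1413768,1414230,1410342]]

def lv13 : List (List ℕ) := [
 
 [1406496615599217865,28,1037124,1528956,0,0,3128442,4604640,3128442,3125769,3128453,3128461,3126660,3129252],
 [1406496616672959689,28,1037124,1528956,0,0,3125850,4602048,3128442,3125769,3128453,3128461,3126660,3129261],
 [1406497716184587465,28,1037124,1528956,0,0,3125778,4720098,3128442,3125769,3128453,3128461,3126669,3129261],
 [1407622515506060489,28,1037124,1528956,0,0,3128442,4604640,3128442,3125769,3128453,3109101,3126660,3129252],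
 [1407622516579802313,28,1037124,1528956,0,0,3125850,4602048,3128442,3125769,3128453,3109101,3126660,3129261],
 [1407623616091430089,28,1037124,1528956,0,0,3125770,4601968,3128442,3125769,3128453,3109021,3126661,3129253],
 [2559418120206064841,28,1037124,1528956,0,0,3128442,4604640,3128442,3125769,3126581,3128461,3126660,3129252],
 [2559418121279806665,28,1037124,1528956,0,0,3125850,4602048,3128442,3125769,3126581,3128461,3126660,3129261],
 [2559419220791434441,28,1037124,1528956,0,0,3125778,4720098,3128442,3125769,3126509,3128461,3126669,3129261],
 [2560544020112907465,28,1037124,1528956,0,0,3128442,4604640,3128442,3125769,3126581,3109101,3126660,3129252],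
 [2560544021186649289,28,1037124,1528956,0,0,3125850,4602048,3128442,3125769,3126581,3109101,3126660,3129261],
 [2560545120698277065,28,1037124,1528956,0,0,3125769,4601967,3128442,3125769,3128453,3128461,3126660,3129252],
 [1409909507239484681,30,1041813,1178556,0,0,3127173,4603434,3127173,1041813,3127256,3127327,3109182,3004701,
 4603434,3167826],
 [1409910606751112457,30,1041813,1178556,0,0,3127173,4603434,3127173,1041813,3127256,3127327,3109183,3004701,
 4603434,3167826],
 [2562831011846331657,30,1041813,1178556,0,0,3127173,4603434,3127173,1041813,3127319,3127327,3109182,3004701,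
 4603434,3167826],
 [2562832111357959433,30,1041813,1178556,0,0,3127173,4603434,3127173,1041813,3127319,3127327,3109183,3004701,
 4603434,3167826],
 [3612211395830195497,30,1006723,1476924,0,0,1052650,4597530,3071247,1052650,4241309,2646997,4242767,4231103],
 [3612211395831244073,30,1006723,1476924,0,0,1029322,4591698,3071247,1029322,4241081,2623669,4242767,4231031],
 [3612211396904985897,30,1006723,1476924,0,0,1028593,4590969,3071247,1028593,4241081,2622940,4242767,4231103],
 [1409918298863412521,30,1008129,1478322,0,0,1054056,4598442,3072645,1054056,3179087,2648451,4225206,4231807],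
 [1409918298864461097,30,1008129,1478322,0,0,1029999,4591881,3072645,1029999,3179087,2624394,4218685,4231591],
 [2562839803470259497,30,1008129,1478322,0,0,1054056,4598442,3072645,1054056,3004127,2648451,4225206,4231807],
 [2562839803471308073,30,1008129,1478322,0,0,1029999,4591881,3072645,1029999,3179087,2624394,4218684,4231807],
 [1411921406051263721,30,1023540,1517049,0,0,1059342,4602360,3124515,1059342,3124511,3127161,4248475,4244587],
 [1411921406084818153,30,1023540,1517049,0,0,1051566,4594584,3124515,1051566,3124511,3127161,4248475,4067547],
 [1411921440444556521,30,1023540,1517049,0,0,1051324,4594368,3124515,1051324,3124511,3127161,4071435,4067547],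
 [1411956590423352553,30,1023540,1517049,0,0,1059342,4602360,3124515,1059342,3124511,3127161,4248475,4244587],
 [1411956590456906985,30,1023540,1517049,0,0,1051566,4594584,3124515,1051566,3124511,3127161,4248475,4067547],
 [1411956624816645353,30,1023540,1517049,0,0,1051324,4594341,3124515,1051324,3124511,3127161,4071409,4067521],
 [2564842910658110697,30,1023540,1517049,0,0,1059342,4602360,3124515,1059342,3126698,3127161,4248475,4244587],
 [2564842910691665129,30,1023540,1517049,0,0,1051566,4594584,3124515,1051566,3124754,3127161,4248475,4067547],
 [2564842945051403497,30,1023540,1517049,0,0,1051323,4594368,3124515,1051323,3124511,3127161,4071435,4067547],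
 [2564878095030199529,30,1023540,1517049,0,0,1059342,4602360,3124515,1059342,3126698,3127161,4248475,4244587],
 [2564878095063753961,30,1023540,1517049,0,0,1051566,4594584,3124515,1051566,3124754,3127161,4248475,4067547],
 [2564878129423492329,30,1023540,1517049,0,0,1051323,4594341,3124515,1051323,3124511,3127161,4248475,4244587],
 [4765128405558797545,30,1023572,1517049,0,0,1059374,4602339,3124494,1059374,3127003,4070954,4248527,4244639],
 [4765128405592351977,30,1023572,1517049,0,0,1051598,4594563,3124494,1051598,3127003,4063178,4248527,4067573],
 [4765128439952090345,30,1023572,1517049,0,0,1051355,4594320,3124494,1051355,3126760,4062935,4248527,4244639],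
 [4765126408399004905,30,1023572,1517049,0,0,1059536,4602663,3124494,1059536,2653883,3127397,4242350,4067714],
 [4765126408432559337,30,1023572,1517049,0,0,1051517,4594725,3124494,1051517,3126760,3127397,4063340,4067735],
 [4765127507910632681,30,1023572,1517049,0,0,1059536,4602663,3124494,1059536,2653883,3127381,4242350,4067714],
 [4765127507944187113,30,1023572,1517049,0,0,1051517,4594644,3124494,1051517,3126760,3127397,4240184,4067714]]

def lv14 : List (List ℕ) := [
 
 [45117385561676686633,30,3020169,4430772,0,0,3157950,13792590,9213741,3157950,9534509,7940991,12728301,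
 12693309],
 [45117385561677735209,30,3020169,4430772,0,0,3087966,13775094,9213741,3087966,9534509,7871007,12728301,
 12693310],
 [45117385562751477033,30,3020169,4430772,0,0,3085779,13772907,9213741,3085779,9534509,7868820,12728302,
 12693310],
 [82010873709095789865,30,3020169,4430772,0,0,3157950,13792590,9213741,3157950,12673589,7940991,12728301,
 12693309],
 [82010873709096838441,30,3020169,4430772,0,0,3087966,13775094,9213741,3087966,12673589,7871007,12728301,
 12693310],
 [82010873710170580265,30,3020169,4430772,0,0,3085779,13772907,9213741,3085779,9534509,7868820,12728301,
 12693309],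
 [152484045006287709417,30,3070604,4551147,0,0,3178010,13807017,9373482,3178010,9380851,9381420,12745427,
 12733763],
 [152484045006321263849,30,3070604,4551147,0,0,3154682,13783689,9373482,3154682,9380851,9381420,12745427,
 12202625],
 [152484045040681002217,30,3070604,4551147,0,0,3153953,13783041,9373482,3153953,9380122,9381420,12214289,
 12202625],
 [152484080190659798249,30,3070604,4551147,0,0,3178010,13807017,9373482,3178010,9380851,9381488,12745427,
 12733763],
 [152484080190693352681,30,3070604,4551147,0,0,3154682,13783689,9373482,3154682,9380851,9381488,12745427,
 12202625],
 [152484080225053091049,30,3070604,4551147,0,0,3153953,13782960,9373482,3153953,9380122,9381420,12745427,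
 12733763]]

def ar1 : List (List ℕ) := [
 [11,0,0,25,25,25,25],[12,0,8,25,25,25,26]]

def ar2 : List (List ℕ) := [
 [42,0,25,25,79],[74,0,25,17,77,79,77,79],[106,0,0,0,77,79,77,79],[138,17,0,71,71,71,79],
 [170,5,25,77,77,77,79],[358,0,25,76,77,79,79],[359,0,24,53,77,79,79],[390,17,0,71,77,79,79]]

def ar3 : List (List ℕ) := [
 [1226,0,75,0,238],[1258,0,0,53,215],[1290,0,75,0,75],[2250,0,75,0,230,238,230,238],
 [2282,0,0,53,161,161,215,215],[2314,0,75,0,75,238,238],[3274,17,0,71,233,233,233,233],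
 [3338,0,0,71,53,233,233],[4362,17,0,53,233,233,233,233],[1350,0,75,0,238],[2374,0,75,0,232,239,238,238],
 [3398,17,0,71,232,239,238,233],[3399,0,79,71,161,241,161,241],[3408,17,77,214,233,239,241],
 [4423,17,79,161,233,161,241],[11462,0,75,229,230,238,239],[11494,51,75,134,230,238,239],
 [12487,17,79,206,233,241,241]]

def ar4 : List (List ℕ) := [
 [39114,52,225,0,700],[39178,0,225,0,160],[40138,51,0,51,700],[40202,0,0,0,159],[41162,0,225,0,214],
 [41226,0,225,0,214,160],[71882,52,225,0,700,700,700,700],[71946,0,225,0,160,700,700],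
 [72906,51,0,89,700,700,700,700],[72970,0,0,89,159,700,700],[73930,0,225,0,214,700,700],
 [73994,0,225,0,0,225],[106730,0,233,0,161,485,647],[34090,0,225,158,160],[35114,0,225,0,160],
 [67882,0,225,158,160,692,692],[101674,53,0,215,215,701,701],[39238,52,225,0,700],
 [39248,0,217,191,700,724,692,724],[40262,51,0,51,700],[40263,0,237,0,485],[41286,0,225,0,214],
 [41296,0,217,191,0,724,724],[72006,52,225,0,700,716,715,700],[72016,158,217,692,700,716,724],
 [73030,51,0,89,700,716,620,700],[73031,0,237,0,485,485,620,724],[74054,0,225,0,214,718,716],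
 [74064,158,217,0,692,724,716,724],[104775,0,233,0,700,719,692,724],[106822,0,233,191,0,718,716],
 [106823,0,233,0,237,485,724],[139591,0,233,0,485,719,692,724],[43206,52,225,0,718],
 [43216,0,225,191,700,724,724,724],[75974,52,225,0,700,718,715,718],[75984,158,225,619,700,724,724],
 [108743,0,233,0,700,725,724,724],[108774,153,233,0,700,718,646,718],[366790,156,225,700,700,700,716]]

def ar5 : List (List ℕ) := [
 [1253898,0,692,476,484,2102,2102],[1286378,0,699,467,484],[1317386,158,700,476,0,2102,2102],
 [1319114,0,700,476,0,642],[1319434,158,692,476,0,484],[2334954,0,699,476,484,2102,2102],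
 [2367690,0,700,476,0,642],[2367754,0,700,476,0,642,700],[2368010,158,692,0,484,2102,2102],
 [3415242,153,0,644,646,2104,2104],[3415306,0,0,641,269,477],[3416298,0,0,0,467,477],[1090762,0,675,0,0],
 [1090826,0,675,0,0,480],[1123530,0,675,0,0],[1123594,0,675,0,0,478],[2172106,0,675,0,0,2101,2101],
 [2172170,0,675,0,0,675],[1122602,0,675,470,0,478],[2138410,0,675,470,0,642],[2171178,0,675,470,0,0],
 [3185962,155,0,644,155],[3218730,155,0,644,484,2102,2102],[3252522,0,699,623,629,0],
 [4331818,158,700,2102,2102,2102,2158],[4333866,137,0,404,2102,2102,2102,2102],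
 [1251664,0,700,476,2101,2158,2158,2158],[1253702,0,700,476,642],[1253712,0,700,476,0,2158,2173],
 [1284423,0,700,700,2158],[1286470,0,700,476,0],[1286471,0,699,0,711],[1286480,89,699,476,89,2158,2078],
 [1317190,156,700,476,0],[1317200,0,700,476,0,2158,2173],[1319238,0,700,476,0,642],
 [1319248,0,700,476,584,642],[2300240,98,700,2077,2096,2158,2158],[2302278,0,700,476,642,2158,2147],
 [2302288,98,700,0,2096,2158,2147,2096],[2332999,0,700,476,1448,2158,2158,2158],
 [2335046,0,700,476,0,2158,1430],[2335047,0,699,476,711,2158,1448],[2365766,156,700,476,0,2158,2147],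
 [2365776,0,700,584,2101,2158,2147,2096],[2367814,0,700,476,0,642],[2367824,0,649,584,0,2156,2173],
 [2367825,0,700,476,0,2158,2173],[3415366,153,0,644,646,2158,2104],[3415376,0,673,431,1934,2158,1934,2104],
 [1090886,0,675,0,0],[1123654,0,675,0,0],[1123664,158,649,644,0,2102,2173],[2172230,0,675,0,0,2149,2147],
 [3253575,0,701,673,671,2158,2156],[1255632,0,700,476,2101,2158,2173,2158],
 [1255942,158,692,476,2101,2158,2093,2158],[1288391,0,700,700,2158],[1288422,459,700,700,2158],
 [1288432,0,699,467,1940,2182,1940,2182],[1321158,156,700,476,0],[1321168,0,700,476,0,2176,2173],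
 [1321478,158,700,476,0,2102,2155],[1321489,0,700,476,2101,2182,2173,2182],
 [2304208,0,700,2069,2101,2173,2158],[2336967,0,700,476,1448,2174,2173,2158],
 [2336998,459,700,476,1940,2158,1214,2158],[2337008,482,703,1940,2078,1940,2182],
 [2369734,156,700,476,0,2102,2155],[2369744,0,700,680,2101,2176,2173,2156],
 [2370065,134,692,2093,2102,2174,2182],[3352806,476,700,476,1940,2158,2069,2158],
 [3352816,476,677,1940,1940,2150,2182],[3418310,476,700,476,476,2102,1934],
 [3418321,476,700,476,1934,2174,1376,2158],[3418342,459,675,644,467,2102,1940],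
 [3418352,482,677,467,1940,2182,1940,2182],[4466918,476,675,476,1934,2150,1214,1214],
 [4466929,476,0,2069,2078,2150,2182],[1382608,0,700,476,2102,2176,2102,2176],
 [1382918,158,692,476,2102,2158,2102,2158],[2431184,0,700,2101,2101,2173,2176],
 [3479782,476,700,476,2102,2158,2102,2158],[3479792,476,677,1934,1934,2182,2182],
 [3480784,476,677,1934,2104,1934,2176]]

def ar6 : List (List ℕ) := [
 [40114698,0,2100,0,0,6305,6305],[40116746,1429,2100,1421,1429,1926],[41163978,459,0,1430,1938],
 [41164042,0,0,1430,807,1431],[41164298,0,2033,1430,1456,6314,6314],[41165034,0,0,1430,1402,1431],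
 [42148362,1429,2100,1406,1429,1453],[42211850,0,2100,1931,1933,0],[42213898,0,2100,1406,1428,1402,1926],
 [42222122,474,2078,800,808,6313,6313],[73669130,0,2025,0,6305,6443,6305,6443],
 [74718410,459,0,1430,1938,6314,6314],[74718474,0,0,1430,807,1431],[74719466,0,0,1430,1401,1431],
 [75700746,0,2025,0,6307,6475,6307,6475],[75702794,0,2042,0,0,6307,6307],[75766282,0,2025,0,0,6307,6307],
 [75768010,1429,2100,1421,1429,1429,1926],[75768330,0,2042,0,1913,1931],
 [109289994,0,2097,1430,1456,6308,6308],[109321418,476,0,1934,1430,1938],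
 [109321482,476,2100,1934,1430,1938,1448],[109321738,476,0,1430,1456,6314,6314],
 [34906314,0,2101,1427,1429,1926],[35954890,0,2101,1427,1429,1926],[69509322,0,2100,1427,1429,1926],
 [69509386,0,2101,1427,1429,1926,2101],[35923146,481,2101,2101,1429,1939],
 [35923210,0,2101,2101,1933,1939,1453],[68429002,481,2101,2101,1933,1939],[69477578,0,2100,0,1933,1939],
 [69477642,0,2101,2101,1933,1939,1453],[105129194,0,2081,0,1456,4372,5830],[35726634,0,2025,1406,1447,1453],
 [69476650,0,2100,1406,1429,0,1453],[68199722,0,2025,1406,1447,1453],[68232490,0,2025,1406,1447,1453],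
 [69281066,0,2025,1406,1447,1453],[101949738,0,2100,1865,1430,0],[102998314,0,2097,1865,1430,0],
 [137471274,476,0,1934,1940,6314,6314],[40934698,465,0,465,465],[40967466,465,0,465,1452],
 [41001258,0,2097,1412,1888,0],[74521898,465,0,1412,1452,5804,5828],[74555690,0,2097,1412,1887,0],
 [75571498,0,2025,1931,1933,1915,1933],[40124742,0,2102,800,808,6475,6467],[41164102,459,0,1430,1938],
 [42156369,296,2102,1286,6313,6476,6475,6290],[42211654,1429,2101,1931,1429,1429],
 [42211665,1429,2100,2032,1375],[42221905,296,2102,1286,1294,6475,6467],[74718534,459,0,1430,1938,5804,3644],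
 [75766086,468,2100,1931,1933,0],[75766097,0,2100,1232,0,6475,6289],[75768134,1429,2100,1421,1429,1429,1926],
 [75768145,1429,2100,1421,1429,1926],[75776337,296,2102,1294,6305,6476,6467,6290],
 [109287751,0,2104,1934,1430,6478,6476],[109289798,0,2104,1934,1430,1934],[109289799,0,2158,2158,1430,2158],
 [109321542,476,0,1934,1430,1938],[109321543,0,2133,1934,1934,1961],[109321552,476,2102,1430,1289,6476,3644],
 [34904390,468,2101,1427,1429],[34904400,266,2101,1373,2101],[34904401,268,2101,2101,1375],
 [34906438,0,2101,1427,1429,1926],[34906448,266,2100,1427,1428,1926],[34906449,268,2100,1424,1429,1926],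
 [35952966,468,2101,2101,1429],[35952976,0,2100,1424,1428,6475,6475],[35952977,268,2100,0,6475],
 [35955014,0,2101,1427,1429,1926],[35955024,0,2100,1427,1429,1926],[35955025,268,1947,0,1213],
 [69507398,468,2101,1427,1429,6475,6475],[69507408,266,2098,0,6287,6475,6475,6475],
 [69507409,268,2100,0,6289,6475,6475,6475],[69509446,0,2100,1427,1429,1926],
 [69509456,266,1945,0,266,6475,6443],[69509457,268,1947,0,268,6475,6443],[35923270,481,2101,2101,1429,1939],
 [35923281,460,2020,1286,1213],[68429126,481,2101,2101,1933,1939],[68429137,0,2100,1286,1933,1939],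
 [69477702,0,2100,0,1933,1939],[69477713,0,2020,1286,1752,6475,6443],[69477714,478,2100,0,1428,6475,5804],
 [101950791,0,2102,2017,2102],[102999367,0,2102,2017,1934,4372,6476],[104080710,0,2102,1928,1934,0],
 [104080722,484,2102,1862,1862,6236,6476],[138683719,0,2102,0,4372,6476,6467,6467],
 [40053254,1429,2100,1868,6304,6475,6451,6475],[40118470,1429,2100,2026,1429],
 [40118790,0,2100,1868,1402,6451,6443],[40118802,0,2100,0,6235,6547,6451,6547],
 [41101542,1428,2100,1430,5822],[41167046,1428,2100,1430,1428],[41167058,1428,2100,1430,5804],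
 [41167078,1377,2025,1430,1402],[41167088,476,2158,1430,1401,6532,3644],[42150097,1429,2100,2032,6475],
 [42150406,0,2100,1868,1428,6475,6475],[42150417,0,2100,0,6209,6547,6451,6547],
 [42215622,1429,2101,1931,1429,1429],[42215633,1429,2100,2032,1375],[42215942,0,2100,1931,1933,1402],
 [73672902,1429,2100,1205,1429,6451,6466],[73673234,0,2042,6278,6305,6521,6470],
 [74655974,1428,2100,1430,5819,6475,5822,5822],[74721478,1428,2100,1430,1428,5804,4265],
 [74721490,1428,2100,1430,6235,6521,6451,6475],[74721510,1377,2025,1430,1402,5822,3644],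
 [75704529,1429,2100,2032,6304,6521,6451,6475],[75704838,410,2042,0,6305,6475,6278,6475],
 [75770054,468,2100,1931,1933,0],[75770065,0,2100,2032,0,6529,6521],[75770374,410,2042,0,1402,6307,6443],
 [75770386,0,2170,0,6305,6547,6521,6547],[75770406,474,2100,474,0,6451,6307],
 [75770418,430,2100,0,6307,6547,6523,6547],[109291719,0,2104,1934,1430,6532,5804],
 [109292038,476,2104,1430,4292,4292,6281,6308],[34908358,468,2101,1427,1429],[34908368,266,2101,1373,2101],
 [34908369,268,2101,2101,1375],[35956934,468,2101,2101,1429],[35956944,0,2100,1424,1428,6523,6475],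
 [35956945,268,2100,0,6475],[35957265,0,2102,0,6235,6547,6209,6547],[69511366,468,2101,1427,1429,6475,6475],
 [69511376,266,2098,0,6233,6523,6520,6475],[69511377,268,2100,0,6235,6521,6520,6475],
 [104114406,1430,2102,1430,1430,5804,5804],[40180230,1429,2100,1406,6305,6475,6305,6475],
 [41228518,1428,2100,1430,5822],[41229830,482,2078,1430,4292,4292,5804,6314],[42277073,1429,2100,2032,6529],
 [42277382,0,2100,1406,1428,4292,6475],[42277393,0,2100,0,6305,6547,6547,6547],
 [42287313,0,2102,0,6313,6529,6305,6529],[42287654,466,2078,0,4292,4292,6307,6475],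
 [73734662,1429,2025,6305,6305,6443,6475],[74782950,1428,2100,1430,4292,4292,5804,5804],
 [75831505,1429,2100,2032,6305,6529,6305,6529],[75831814,410,2025,0,4292,4292,6307,6475],
 [142941735,476,2078,6308,6308,6524,6556],[44243462,1429,2100,1406,6307,6476,6475,6475],
 [77797894,1429,2025,6305,6307,6475,6475]]

def ar7 : List (List ℕ) := [
 [1317280970,1429,0,2420,4291,5814],[1317281034,1428,6300,2420,5803,5814,4345],
 [1348682282,1429,6300,0,18943,18943,18943,18943],[1350844618,1429,6305,5783,4265,4291,5815],
 [1351096874,4289,6305,4283,4289,18925,18925],[2357412426,1427,6235,18925,18925,18925,19427],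
 [2357477962,1427,6242,0,18925,18925,18925,18925],[2391022794,1428,0,4220,5803,5814],
 [2391022858,1428,6300,2420,5803,5814,4345],[2422424106,1429,6209,18943,18943,18943,19427],
 [2424513066,4287,6300,2663,4291,5803],[2424578602,1429,6300,4229,4291,4206,5803],
 [3497271530,0,6308,0,4292,4210,4364],[3498287338,0,6308,0,4346,6308,4364],
 [1150556682,0,6233,4289,4291,2669],[1150558730,0,6233,4289,4291,4204,6233],
 [1150566954,4289,6209,4289,4289,18943,18943],[2224300234,4287,6300,4289,4291,4287,5778],
 [2189730346,0,6313,4283,6313,4284,4369],[2223284426,4287,6313,4289,6313,4287,5778],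
 [2223284778,0,6313,4283,2671,4369],[3364134090,1428,0,5804,4292,18926,18926],
 [3364134154,0,0,5804,4292,4344],[1143252170,1441,6301,6301,4281,4287],
 [1143252234,0,6303,6301,4281,4287,6303],[2187601450,4287,6300,2645,5821,4369],
 [2189698602,1447,6300,4325,5821,4284,4369],[2223252682,4287,6301,6301,5821,4287,4287],
 [2182390986,1441,6303,6301,4281,4287],[2183439562,1435,6303,6295,4281,4287],[2216993994,0,6300,0,4281,4287],
 [2216994058,0,6303,6301,4281,4287,6303],[3325338858,0,6308,0,6314,6308],[1313088746,0,6243,4292,4368],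
 [2386830570,0,6243,4292,4368,17414,17492],[2418287818,1443,6307,5819,6303,5803,5817],
 [2216993066,0,6303,4214,4281,4287,4357],[2216961322,0,6303,4214,6303,5799,5817],
 [3330515242,1430,6312,5804,5804,4292,5804],[4396918058,1412,0,5786,5804],
 [4397966634,1412,0,5786,5804,18926,18926],[1309909290,0,6300,4220,4291,0],[1310957866,0,6291,4220,4291,0],
 [2383651114,0,6300,4220,4291,0],[2384699690,0,6291,4220,4291,0],[2418091306,0,6075,5783,5785,4341,4359],
 [3493076266,0,6236,5816,4292,6308,4368],[1283670342,1429,6305,0,4291,19426,19427],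
 [1283670352,4289,6305,4289,18917,19427,19427,19427],[1283670354,1429,6300,0,18925,19427,19426,18925],
 [1317247303,0,6312,0,4290],[1317249350,0,6312,6292,4291,5803],[1317249351,0,6474,0,4291,6474],
 [1317257542,0,6314,0,4292,19435,17414],[1317281094,1429,0,2420,4291,5814],
 [1317281095,0,6399,5884,5803,5884],[1350779206,4287,6305,6301,4265,4291],
 [1350779218,4287,6287,5261,4265,19429,19427],[1350844742,1429,6305,5783,4265,4291,5815],
 [2357412166,1429,6305,4291,18940,19427,19427,19427],[2357412178,1429,6287,18698,18925,19427,19565],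
 [2390989127,0,6312,0,4290,19435,13094],[2390991174,0,6312,4220,4291,5802],[2390991175,0,6474,0,4290,6474],
 [2391022918,1428,0,4220,5803,5814],[2391022919,0,6399,0,5802,5883],
 [2422423878,1429,6305,4265,18940,19429,19427,19427],[2422423889,1429,6305,18698,18925,19429,19597],
 [2422489414,1429,6305,4265,0,19427,19400],[2422489425,1429,6242,0,18925,19429,19400,18925],
 [2422489427,4283,6305,4265,18949,19429,19427,19427],[2424521030,0,6305,4265,4291,19427,19429],
 [2424521041,0,6305,4291,18940,19429,19429,19429],[2424521042,0,6287,4265,18940,19429,19427,19427],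
 [2424586566,4229,6305,4265,4291,5815],[2424586577,4229,6305,4291,5255,19429,19409],
 [3497279814,0,6308,4292,0,17414,19403],[3498285383,0,6308,0,6312,6308],
 [3498295623,0,6308,6314,6308,19436,19430],[1117002054,4287,6303,4289,4291,4287],
 [1150556486,4285,6301,4289,4291,4285],[2224298310,1404,6300,4289,4291,0],
 [2224300358,4287,6300,4289,4291,4287,5778],[1149542726,4287,6313,4289,6313,4287,5778],
 [2223282502,1404,6313,4289,6313,5799],[2223282512,794,6313,4265,5261,19435,19429],
 [2223284550,4287,6313,4289,6313,4287,5778],[3364134214,1428,0,5804,4292,19435,17414],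
 [3364134224,0,6049,4292,13120,13120,17414,17414],[1143252294,1441,6301,6301,4281,4287],
 [2223252806,4287,6301,6301,5821,4287,4287],[2223252818,4287,6300,3857,5821,4287],
 [2182391110,1441,6303,6301,4281,4287],[2183439686,1435,6303,6295,4281,4287],[2216994118,0,6300,0,4281,4287],
 [3262391622,0,6302,5780,4290,0],[3262391635,1453,6302,5585,4290],[3295946054,0,6302,5780,4290,0],
 [3295946067,1450,6302,5582,4290,13094,17414],[4399080775,0,6308,6314,6308,19436,19430],
 [1309910343,0,6307,6307,6307],[1310958919,0,6306,6298,5802],[1312040262,0,6307,4292,5803,0],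
 [1312040275,1452,6307,4292,5587],[2384700743,0,6306,5810,5802,13118,13094],[2385782086,0,6306,4292,5803,0],
 [2385782099,1452,6306,4292,5586,17414,13094],[2418287942,1443,6307,5819,6303,5803,5817],
 [1283991750,4289,6305,4283,4289,18917,18925],[1317251271,0,6312,0,4290],
 [2390993095,0,6312,0,4290,19597,18925],[2424514770,4287,6300,0,5803,19564,19355],
 [2424515110,1429,6300,0,4291,19426,18925],[2424515122,1375,6300,0,18925,19411,18871,19411],
 [3497208038,4284,6308,0,4292,19357,17468],[3497273542,4284,6308,5780,4292,4284],
 [3497273574,4131,6308,0,4292,4210],[3498289351,0,6308,0,6312,6308],[3498289382,4131,6308,0,4346,6308],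
 [1117006022,4287,6303,4289,4291,4287],[1150495238,0,6233,4289,4291,19426,19355],
 [1150495280,0,6235,4289,18916,19597,19597,19597],[1150560454,4285,6301,4289,4291,4285],
 [1150560774,0,6233,4289,4291,4207],[1150560816,1427,6235,4289,6127,19597,19411],
 [2224237073,1429,6233,18628,18925,19597,19597],[2224237104,1427,6235,18628,18923,19597,19597],
 [2224302278,1404,6300,4289,4291,0],[2224302609,1429,6098,0,18925,19597,19562,19409],
 [2224302640,1427,6100,0,18923,19597,19564,19411],[2189732390,4207,6313,4283,6313,5799],
 [2223286470,1404,6313,4289,6313,5799],[2223286480,794,6313,4265,0,19597,19564],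
 [2223286822,1230,6313,4283,0,18917,19426],[2223286864,1373,6313,4265,18869,19597,19597,19597],
 [3262425318,4286,6302,4286,4292],[3295979750,4286,6302,4286,4292,19435,17468],
 [3330582726,4268,6302,5804,5802,4292],[3330582738,1428,6302,5804,5802,19435,19589],
 [4437879014,4268,6075,4292,17467,19427,17467,19427],[4437879026,753,6386,18629,18925,19589,19589],
 [1283801286,4229,6305,4229,4291,18925,18925],[1283801670,1429,6235,4337,18925,19357,18925,19357],
 [1283801680,4289,6242,18925,18925,19573,19669],[1348812998,4287,6305,0,4265,18925,18943],
 [1348813350,1429,6300,0,18943,19331,18925,18943],[1348813360,4289,6164,18925,18943,19573,19669],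
 [1350910150,4287,6305,6301,4265,4291],[2357543494,4229,6235,18925,18925,18925,19427],
 [2422554833,4229,6305,18925,18925,18925,19597],[2424641746,4287,6300,0,5803,18925,18925],
 [2424642086,1429,6300,4229,4291,18925,18925],[2424642098,1375,6300,0,18925,19643,18925,19591],
 [2424651985,4229,6305,4291,18925,19429,18925,19429],[2424652358,1427,6305,4265,18925,19427,18925,19427],
 [2424652369,4363,6242,18925,18925,19643,19669],[2424653010,1429,6289,4265,18925,19429,19411,19429],
 [2424653392,4289,6262,18925,18925,19645,19669],[3497335014,4284,6308,0,4292,12878,17468],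
 [1150622214,0,6233,4289,4291,18917,18917],[1150622256,0,6235,4289,18923,19597,18923,19597],
 [1150632486,4289,6235,4289,18943,19357,18917,19357],[1150632496,4289,6484,18923,18943,19331,19669],
 [2224364049,4229,6233,18925,18925,18925,19597],[2224364080,4229,6235,18923,18923,18923,19597],
 [1352876230,4287,6305,5783,4265,19429,19427],[1352876582,1429,6300,0,18943,19427,18943,18943],
 [1352876592,4289,6164,18943,18943,19669,19669],[1353194022,4289,6313,4283,18925,19435,18917,19435],
 [1353194032,4289,6292,18917,18925,19427,19651],[1353204944,4265,6298,18941,18949,19429,19597],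
 [2426618065,1429,6305,18940,18925,19429,19597]]

def ar8 : List (List ℕ) := [
 [42151977194,0,18924,12869,12877,12630,13093],[42152993002,0,18925,12869,13039,18925,13093],
 [76511715562,0,18924,12869,12877,12630,13093],[76512731370,0,18925,12869,13039,18925,13093],
 [111912688842,4291,18925,17411,10853,12877,17459],[111912688906,4284,18925,17411,17413,17413,17467,13039],
 [111945194698,12869,0,12869,12869,12877,10925],[111945194762,0,0,17411,12860,12870,7280,12954],
 [36817879242,12659,18911,17345,17351,12875,17443],[70071370954,12853,18915,12863,17349,12877,17445],
 [107652293130,0,18873,12797,13096,56777,56777],[71144088138,4287,18937,12848,12687,12874,17409],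
 [70943809738,12861,18940,12866,12868,12874,17334],[106410843338,4290,0,17414,17485,17491],
 [106410843402,4290,18943,17414,17485,17491,13111],[42018839754,4284,0,12806,12877],
 [42018839818,0,0,12806,12877,13032],[42018840074,0,18233,12806,12877,56849,56849],
 [76378578122,4284,0,10853,12877,56849,56849],[76378578186,0,0,12806,12877,13032],
 [71144056394,4287,18900,12971,12687,17410,17464],[69870036522,4327,18699,12965,12867,13036,13108],
 [70943777994,12861,18901,18901,12868,12874,12861],[70942762186,12861,18940,18940,12868,17464,17482],
 [106341639402,0,18941,0,18941,13117],[106375193834,0,18908,0,18932,13117],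
 [41980044522,0,18925,12878,18943,18925],[76339782890,0,18924,12878,18942,18924],
 [77378921674,4323,18916,17456,18903,17386,17404],[70936470826,0,18909,12638,18903,13090,13108],
 [104396464426,4286,18936,17411,12662,12875,17411],[105470206250,4286,18936,17411,12797,12875,17411],
 [140937249066,4220,0,17387,17405,56849,56849],[138748863786,4232,0,17459,17411],
 [138749912362,4232,0,17459,17411],[139823654186,4232,0,17459,17411,56825,56825],
 [41985220906,4290,18936,12869,17413,12877,17413],[76344959274,4290,18936,12797,17413,12877,17413],
 [111710313770,0,18692,17444,12869,12870,13107],[111743868202,0,18692,17444,12869,12877,13107],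
 [42147781930,0,18925,13085,12877,18925,13104],[76507520298,0,18925,12869,12877,18925,13104],
 [71171122474,0,18225,17345,17349,13023,13077],[42152991047,0,18925,12869,18936,18925],
 [43157833040,2645,18925,56122,56609,58309,58309],[75439294803,2669,18923,56128,56617,58291,58291],
 [76512729415,0,18925,12869,18936,18925],[111912688966,4291,18925,17411,10853,12877,17459],
 [111912688976,4284,18902,10853,12875,17459],[111945194822,12869,0,12869,12869,12877,10925],
 [111945194832,12869,18302,12869,12875,10925],[36817813830,12861,18911,18901,10906,12874],
 [36817879366,12659,18911,17345,17351,12875,17443],[70071371078,12853,18915,12863,17349,12877,17445],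
 [71145112902,12853,18915,10844,12796,17445],[107652290887,0,18924,17390,12877,39284,58307],
 [107652292934,0,18924,17390,12797,17390],[107652292935,0,18924,19414,12877,19414],
 [36584071494,12861,18940,12866,12868,12874,17334],[70943807814,4212,18940,12866,12868,12874],
 [70943807824,2378,18937,12779,12791,56105,56105],[70943809862,12861,18940,12866,12868,12874,17334],
 [106410843462,4290,0,17414,17485,17491],[106410843472,0,18214,17450,17462,58315,58309],
 [42018839878,4284,0,12806,12877],[76378578246,4284,0,10853,12877,52235,52243],
 [70943778118,12861,18901,18901,12868,12874,12861],[70942762310,12861,18940,18940,12868,17464,17482],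
 [140701377863,0,18941,18941,18941],[140734932295,0,18941,18941,18941,39284,58307],
 [41917097286,0,18907,12869,12870,0],[41917097300,4359,18907,12869,12870],
 [41950651718,0,18907,12869,12870,0],[41950651732,4350,18907,12869,12870],
 [76276835654,0,18906,12869,12870,0],[76276835668,4359,18906,12869,12870],
 [76310390086,0,18906,12869,12870,0],[76310390100,4350,18906,12869,12870,58291,52241],
 [77378921798,4323,18916,17456,18903,17386,17404],[111778440518,12869,18943,12869,12869,17413,12869],
 [41077450960,2204,18925,0,56744,58792,58792,58792],[41077451344,0,18925,56588,56776,58792,58291],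
 [42151913702,12852,18925,12869,12877],[42151913712,0,18924,12869,12877,58801,52405],
 [42151979206,12852,18925,12869,12877,12852],[42151979238,12393,18925,12869,12877,12630],
 [42151979248,13037,19573,12869,10853,19573],[42152241350,12875,18925,12851,10853,52241,52241],
 [42152241360,12875,18928,10853,52241,58801,51677,56753],[42152995015,0,18925,12869,18936,18925],
 [42152995046,12393,18925,12869,13039,18925],[76511652070,12852,18925,12869,12877,52379,52405],
 [76511652080,12875,19414,10853,52403,58801,52405,56753],[76511717574,12852,18925,12869,12877,12852],
 [76511717606,12393,18924,12869,12877,12630],[76511717616,13037,18302,10853,12632,56753,52403],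
 [76512733383,0,18925,12869,18936,18925],[76512733414,12393,18925,12869,13039,18925],
 [76512733424,4220,18878,16739,16757,56753,56771],[77519661267,2262,18925,0,56776,58766,58766,58766],
 [77519661619,0,18925,56608,56776,58766,58291],[77584672966,12866,18925,18905,18937,58306,58306],
 [77584673318,3877,18925,0,56744,58306,58064,58306],[77584673350,3857,18925,0,56776,58306,58064,58306],
 [111912954054,12869,18917,10853,12869,52235,52243],[111912954067,12869,18902,10853,52235,58769,51677,56779],
 [111945132262,12869,18900,12869,12869,12877],[111945132272,12869,18902,12869,12875,58801,58795],
 [111945459942,12869,18902,12869,12875,58073,58067],[71177545939,12861,18900,11093,11095,58234,58234],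
 [107652294855,0,18924,17390,12877,58801,58793],[107652295174,4268,18941,10853,38635,58307,52405,58307],
 [70943811782,4212,18940,12866,12868,12874],[70943811792,2378,18937,12779,12791,58792,58792],
 [104396531910,12800,18902,17411,12851,12875],[104396531923,4287,18902,17411,12851],
 [105470273734,12800,18902,17411,12851,12875],[105470273747,4284,18902,17411,12851,56777,52217],
 [140770584806,12869,18902,12869,12875,58073,58067],[41917130982,12858,18906,12869,12877],
 [41950685414,12858,18906,12869,12877],[41985288390,12804,18907,10853,17406,12877],
 [41985288403,4284,18907,10853,17406],[76310423782,12858,18906,12869,12877,52379,52403],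
 [76345026758,12804,18907,10853,17406,12877],[76345026771,4284,18906,10853,17406,58777,39095],
 [42152040678,12852,18925,12869,12877],[42152040688,0,18924,12869,12877,58963,56777],
 [76511779046,12852,18925,12869,12877,56777,56777],[76511779056,12875,19414,10853,56753,58963,56753,56753],
 [77584472656,12659,18925,18230,56776,58930,58720,58792],[77584483536,2204,18925,0,56776,58792,56776,58792],
 [77584483920,3941,18871,56776,56591,58237,58777],[111910657232,12869,18902,10853,56779,58723,56779,56833],
 [111912754384,4148,18902,10907,12875,56833,56779],[111945259238,12869,18900,12869,12869,12877],
 [111945259248,12869,18902,12869,12875,58963,52405],[111945260240,12869,18902,12869,12875,56825,52243],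
 [36815847622,12861,18911,12659,12689,56776,52217],[36815848966,12661,18923,12689,56776,58282,52217,52217],
 [36817944774,12861,18911,18901,10906,12874],[71177672915,12861,18900,12659,12661,56776,56776],
 [71177683507,0,18925,56776,56824,58928,58775],[71177684499,0,18923,56776,56822,58930,58777],
 [71145167378,0,18695,12689,56776,58930,52217,52217],[71145178322,12687,18915,0,52217,52217,56776,58792],
 [43162015952,12803,18925,17351,56776,58291,58280,56771],[43162027216,4229,18925,56822,56771,58291,58309],
 [77588535888,12659,18925,17351,56776,58291,58280,56771],[77588547152,4229,18871,56830,56771,58291,58957],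
 [111914720464,12869,18902,10853,56833,58291,56833,56833],[36819910854,12861,18911,17345,17351,58282,58280],
 [36819912198,12661,18923,17351,56822,58289,58282,56771],[43292050640,4325,18925,56848,56831,58309,58309]]

def ar9 : List (List ℕ) := [
 [1314478377482,38608,55880,38608,170468,174686,170468,174686],
 [1348863270090,12873,56775,38609,32559,38631,52377],
 [1348863270154,12852,56775,52241,52239,52239,52401,39117],[1348895775946,38607,0,38609,38607,38631,32775],
 [1348895776010,0,0,38609,38580,38610,21841,38862],
 [1383197788682,38608,56588,38312,170468,174874,170468,174874],
 [2448374897866,12873,56775,38609,32559,38631,52377],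
 [2448374897930,12852,56775,38609,52239,52239,52401,39117],[2448407403722,38607,0,38609,38607,38631,32775],
 [2448407403786,0,0,38609,38580,38610,21841,38862],
 [2480629106282,38608,55886,38608,170500,174706,170500,174706],
 [2482776524394,38608,56608,38312,170500,174842,170500,174842],
 [1178170081898,38606,55888,38606,170500,174874,170500,174874],
 [2277683775082,38608,56744,38608,170500,174874,170500,174874],
 [2277683806826,38606,56744,38606,170500,174874,170500,174874],
 [1177129894474,38546,55888,38546,170554,174874,170554,174874],
 [2242281783882,38546,56776,38546,170554,174920,170554,174920],
 [3444873371882,38607,56756,0,38635,38607,39281],[3405146989066,12869,56851,52163,52163,32723],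
 [3402932460746,12867,0,52235,52233,38633],[3402932460810,12858,56815,52235,52233,38633,39111],
 [3404006202570,12858,0,52235,52233,38633],[3404006202634,12858,56815,52235,52233,38633,39111],
 [1343361424586,12870,0,32561,52455,52473],[1343361424650,12870,56829,38609,52455,52473,39333],
 [1343361424906,13091,56105,32561,52241,52241],[2442873052362,12870,0,32561,52455,52473],
 [2442873052426,12870,56829,32561,52455,52473,39333],[2269967066314,38583,56820,56812,38598,38604,38622],
 [3410480342250,38607,56753,0,39041,39119],[3340452013290,0,56819,0,38607,38631],
 [3340485567722,0,56723,0,38607,38631],[3374845306090,0,56720,0,38607,38631],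
 [1343292220650,0,56823,38609,56823,39351],[1343325775082,0,56725,38609,56797,39351],
 [2442803848426,0,56823,38609,56823,39351],[2442837402858,0,56724,38609,56796,39351],
 [4676422706410,38591,56779,39041,0,38393,38627],[2277475919050,12969,56748,52364,52368,52158,52212],
 [3406187176234,12806,56772,52235,52163,32561,52235],[1341347045674,12858,56808,38591,37986,38626,52233],
 [1342420787498,12858,56808,38591,38391,38626,52233],[2440858673450,12858,56808,38375,37986,38626,52233],
 [2441932415274,12858,56808,38375,38391,38626,52233],[3576776924458,0,56753,52223,38609,52243,38635],
 [1348660895018,0,56725,39221,38607,38610,39321],[1348694449450,0,56725,39221,38607,38631,39321],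
 [2448172522794,0,56725,38591,38607,38610,39321],[2448206077226,0,56725,38591,38607,38631,39321],
 [1348863270214,12873,56775,38609,32559,38631,52377],[1348895776070,38607,0,38609,38607,38631,32775],
 [2448374897990,12873,56775,38609,32559,38631,52377],[2448407403846,38607,0,38609,38607,38631,32775],
 [3582246230343,12869,56825,52235,38609,56825,38627],
 [3582246232390,12869,56825,52235,38609,56825,38627,52235],
 [3582246232391,0,58067,52235,38609,58067,38627,52235],[3444873380166,0,56753,38635,0,156733,115829],
 [3405146986823,0,56851,52235,52235,52241],[1344602872135,0,56772,0,38631],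
 [1344602874182,0,56772,56620,38392,52171],[1344602874183,0,56772,0,38631,58242],
 [1344602882374,0,56777,0,38393,115907,156731],[2444114499911,0,56772,0,38631,117853,156731],
 [2444114501958,0,56772,37916,38391,52170],[2444114501959,0,56772,0,38631,58242],
 [3402932460870,12867,0,52235,52233,38633],[3402932460880,0,54661,52334,38393],
 [3404006202694,12858,0,52235,52233,38633],[3404006202704,0,54628,52334,38393,156707,156731],
 [1343361424710,12870,0,32561,52455,52473],[2442873052486,12870,0,32561,52455,52473],
 [2269967066438,38583,56820,56812,38598,38604,38622],[4509991970119,0,56753,56849,56753,174947,174929],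
 [4439963641159,0,56819,56723,56819],[4439997195591,0,56819,56723,56819],
 [4474356933959,0,56819,56723,56819,174875,174923],[3574730040646,38591,56815,52229,38591,38393,38627],
 [3575803782470,38591,56815,52229,38591,38393,38627],[1348729021766,38607,56829,38393,38607,52239,38635],
 [2448240649542,38607,56829,38393,38607,52239,38635],[2277475919174,12969,56748,52364,52368,52158,52212],
 [1348895713510,38608,56700,38609,38608,38631],[2448407341286,38607,56700,38609,38607,38631],
 [3582246234311,12869,56825,52235,38609,56825,38627],[3444873308390,38607,56777,0,38635,115829,157219],
 [3444873373894,38607,56777,52004,38635,38607],[3444873373926,37179,56756,0,38635,37878],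
 [3405146990791,0,56851,52235,52235,52241],[3405146991110,12869,56851,52163,52163,170333,170339],
 [1344602876103,0,56772,0,38631],[2444114503879,0,56772,0,38631,117365,156731],
 [4502444091622,38591,56702,38591,38633],[4503517833446,38591,56702,38591,38633,156707,157219],
 [1341347113158,38400,56707,32543,38554,38626],[1341347113172,12861,56707,32543,38553],
 [1342420854982,38400,56707,32543,38554,38626],[1342420854996,12852,56707,32543,38554],
 [2440858740934,38400,56707,32552,38554,38626],[2440858740948,12861,56706,32552,38553],
 [2441932482758,38400,56707,32543,38554,38626],[2441932482772,12852,56706,32543,38553,156707,156488],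
 [1314478430738,38606,57600,170330,170330,176890,176890],
 [1314478443014,38608,56345,170330,170468,174686,174874],
 [1348861238790,12875,56105,38609,39121,170339,170339],[1348895840486,38608,56700,38609,38608,38631],
 [2448407468262,38607,56700,38609,38607,38631],[2480629160561,38608,57594,170330,170330,176864,176864],
 [2480629171814,38608,56365,170332,170500,174706,174874],
 [2482709546194,38606,56365,170332,170500,176162,176404],
 [2482709547217,38608,56345,170330,170468,176162,176404],[3444873435366,38607,56777,0,38635,115909,157139],
 [1348865302022,12875,56105,38609,39121,170501,170501],
 [2482703473170,38606,55907,170260,170330,174874,176890],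
 [2277685872230,38608,56695,170500,170500,174874,174922],
 [2277685903974,38606,56695,170500,170500,174874,174920],
 [2276645356102,37973,56776,38608,170500,174874,174874,174874],
 [2276645706320,38600,56695,170258,170338,174874,176890]]

def ar10 : List (List ℕ) := [
 [114631879434474,0,170333,0,115883,170333,115901,113670,117845],
 [110235947900170,38607,170317,156707,115829,115881,157195,117339],
 [43027291971818,115821,170268,115829,115906,115821,117843],
 [78211664060650,115821,170268,115829,115906,115821,117843],
 [108893838746122,38591,170539,156473,156707,118084],[108928198484490,38591,170539,156473,115178,118084],
 [109135370951946,38607,170431,156707,115829,115907,117339],[106894464425162,38601,0,156704,157426,157378],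
 [106894464425226,38574,170443,156704,115775,115895,117333],[106895538166986,38577,0,156704,157426,115898],
 [106895538167050,38574,170443,156704,115775,157378,117333],[107995049794762,38574,0,156704,157426,157378],
 [107995049794826,38574,170443,156704,157426,157378,117333],[42985351060682,38601,0,115874,156699,115900],
 [42985351060746,38574,170445,115775,156699,115899,117333],
 [42985351061002,39227,168263,115874,156699,157379],[42986424802506,38574,0,115874,156699,115900],
 [42986424802570,38574,170445,115775,156699,115900,117333],
 [42986424802826,39227,168263,115874,156699,115900],[78169723149514,38601,0,97658,156699,115900],
 [78169723149578,38574,170445,115874,156699,115899,117333],[78170796891338,38574,0,115874,156699,115900],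
 [78170796891402,38574,170445,115874,156699,115900,117333],
 [149645526605066,38591,0,115829,156707,115740,156689,117323],
 [42992898942186,115821,170259,115829,117123,117357],[42922870613226,0,170457,115820,115821,115893],
 [42922904167658,0,170169,115820,115821,115893],[42957263906026,0,170161,115820,115821,115893],
 [78177271031018,115821,170259,115802,117123,117357],[78107242702058,0,170457,115820,115821,115893],
 [78107276256490,0,170169,115820,115821,115893],[78141635994858,0,170160,115820,115821,115893],
 [149575734371562,115757,170325,117116,115829,117351,170325],
 [149610094109930,115757,170325,117116,115829,117351,170325],
 [109135362498858,38609,170424,156707,156707,115829,156719,115883,156707],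
 [106897719140650,38414,170316,156701,113750,115178,156701],
 [107997230768426,38414,170316,156701,115802,115178,156701],
 [42988605776170,38418,170316,115685,156489,115180,156705],
 [78172977865002,38418,170316,115802,156489,115180,156705],
 [114461154483498,0,168317,156980,115829,170333,117849,168317,118011],
 [114391228128554,0,170243,156659,115811,117363,115900],
 [114425587866922,0,170243,156659,115811,117364,115900],
 [43159195524394,0,170259,117305,115827,156729,115905],[78343567613226,0,170259,117332,115827,156729,115905],
 [43164664830279,38607,170475,169909,156706,170475,115882],
 [43164664832326,38607,170475,115757,115828,170475,115882,156706],
 [43164664832327,0,174201,158893,115827,174201,115882,156705],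
 [78349036919111,38607,170475,169909,156706,170475,115882],
 [78349036921158,38607,170475,115154,115828,170475,115882,156706],
 [78349036921159,0,174201,115757,115827,174201,115882,156705],
 [110235947900240,99845,170102,115829,115883,157208],[108893838743879,0,170572,156722,170572,156707],
 [108928198482247,0,170331,156689,156689,156707],[42987565586759,0,170553,170431,156706,156724],
 [78171937675591,0,170553,0,156705,156723],[109135370952016,99845,163915,115829,115907,470123,470201],
 [106894464425286,38601,0,156704,157426,157378],[106894464425296,0,163981,115127,115175],
 [106895538167110,38577,0,156704,157426,115898],[106895538167120,0,163885,115127,115178],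
 [107995049794886,38574,0,156704,157426,157378],[107995049794896,0,163882,115127,115175,470123,470195],
 [42985351060806,38601,0,115874,156699,115900],[42986424802630,38574,0,115874,156699,115900],
 [78169723149638,38601,0,97658,156699,115900],[78170796891462,38574,0,115874,156699,115900],
 [149645526605138,115821,164718,115802,157378,115875],
 [114456861582662,115685,170323,157208,170319,157216,115181],
 [43157148640582,115773,170445,115127,115773,115179,115882],
 [43158222382406,115773,170445,115127,115773,115180,115882],
 [78341520729414,115773,170445,115154,115773,115179,115882],
 [78342594471238,115773,170445,115154,115773,115180,115882],
 [43164664834247,38607,170475,169909,156706,170475,115882],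
 [78349036923079,38607,170475,169909,156706,170475,115882],
 [114631879436518,112013,170333,156683,115883,170333,115901,113687],
 [110235948165318,115805,170330,115586,115883,470123,470177],
 [110235948165333,115805,170102,115829,511016,528998,528998,528998],
 [108964703578342,115827,170333,0,170339,170333],[43027291908326,115821,170331,115829,115906],
 [43027291908336,0,170268,115829,115907,470123,471659],[43027291973830,115821,170332,115829,115906,115821],
 [43027291973862,111537,170269,115829,115906,113634],[43027291973872,117293,176380,115829,115907,176380],
 [43027292235974,115821,170548,115829,115906,470123,470201],
 [43027292235984,115835,170344,115907,510992,529240,529216,529216],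
 [78211663997158,115821,170331,115829,115906,470123,471659],
 [78211663997168,115835,174718,115907,354049,354049,471659,471659],
 [78211664062662,115821,170331,115829,115906,115821],[78211664062694,111537,170268,115829,117124,113634],
 [78211664062704,117293,164678,115907,113639,471659,354049],[108893838747847,0,170572,156722,170572,156707],
 [108893838748166,38624,170572,156482,156707],[108928198486215,0,170331,156689,156689,156707],
 [108928198486534,38591,170539,156473,156707,347651,470123],[42987565590727,0,170553,170431,156706,156724],
 [78171937679559,0,170553,0,156705,156723],[144319743043814,115757,170102,115829,115907,470123,470201],
 [142078836517094,115769,170102,115802,115898],[142079910258918,115769,170102,115775,115898],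
 [143179421886694,115769,170102,115802,115898,470123,470195],
 [110235945868496,115805,170102,115829,347651,347651,470123,470123],
 [110235947965648,37316,170102,115829,115883,470123,470177],[108964703705318,115827,170333,0,170339,170333],
 [43027292035302,115821,170331,115829,115906],[43027292035312,0,170268,115829,115907,470123,471659],
 [78211664124134,115821,170331,115829,115906,470123,471659],
 [78211664124144,115835,174718,115907,347729,347729,470201,470201],
 [110235949931728,115805,170102,115829,352105,352105,470123,470123]]

def ar11 : List (List ℕ) := [
 [1381269274632426,0,510999,347480,347650,510999,347704,341010,353536],
 [2507169181475050,0,510999,347480,347650,510999,347704,341010,353536],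
 [3668220141903050,115857,510975,470120,470168,470176,293048,469952,471410],
 [3668220141903114,115668,510975,470120,469979,470169,470151,470151,471609,352053],
 [1376873343098122,115821,510951,470129,347488,347643,471585,352017],
 [2502773249940746,115821,510951,292976,347488,347643,471585,352017],
 [3492331870462474,115757,511603,345464,345542,294488],[3420622861607434,115769,511615,470168,470120,354250],
 [3420657221345802,115769,511615,470168,470120,354250],[3455841593434634,115769,511615,470168,470120,354250],
 [1375772766149898,115821,511293,347273,347488,347722,352017],
 [1375772766150154,115821,504737,292976,347488,347722],[1373531859623114,115803,0,347606,472278,472134],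
 [1373531859623178,115722,511329,347309,347325,347685,351999],
 [1373531859623434,117671,504773,347606,472280,472136],[1373532933364938,115731,0,347606,472278,347694],
 [1373532933365002,115722,511329,347309,347325,472134,351999],
 [1373532933365258,117671,504773,347606,472280,472136],[1374632444992714,115722,0,347606,472278,472134],
 [1374632444992778,115722,511329,347309,472278,472134,351999],
 [1374632444993034,117671,504773,347606,472280,472136],
 [2501672672992522,115821,511293,292976,347488,347722,352017],
 [2499431766465738,115803,0,292958,472278,472134],
 [2499431766465802,115722,511329,347606,347325,347685,351999],
 [2499432840207562,115731,0,347606,472278,347694],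
 [2499432840207626,115722,511329,347606,347325,472134,351999],
 [2500532351835338,115722,0,347606,472278,472134],
 [2500532351835402,115722,511329,347606,472278,472134,351999],
 [4786423499889930,115757,0,347480,347481,347220,470051,351953],
 [4787523011517706,115757,0,347480,292976,347220,470051,351953],
 [3420864385360170,115823,511272,470120,347273,347486,470153,347648,470120],
 [3456048757449002,115823,511272,470120,345464,347486,470153,347648,470120],
 [1375772757696810,115827,511272,347255,470122,347488,470157,347650,470122],
 [1373535114338602,115242,510948,347039,341250,345534,470103],
 [1374634625966378,115242,510948,347039,347406,345534,470103],
 [2501672664539434,115827,511272,345464,470122,347488,470157,347650,470122],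
 [2499435021181226,115242,510948,347390,341250,345534,470103],
 [2500534532809002,115242,510948,347390,347406,345534,470103],
 [3660523593014570,0,504935,470936,347480,347481,353541,504935,354036],
 [3661623104642346,0,504935,470936,347480,347488,353541,504935,354036],
 [1381098549681450,0,504951,347471,347488,510999,353547,504951,354033],
 [1381028623326506,0,510729,351881,347433,352089,347700],
 [1381062983064874,0,510729,351881,347433,352092,347700],
 [2506998456524074,0,504951,347480,347488,510999,353547,504951,354033],
 [2506928530169130,0,510729,351962,347433,352089,347700],
 [2506962889907498,0,510729,351962,347433,352092,347700],
 [3668220141903174,115857,510975,470120,470168,470176,293048,469952,471410],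
 [3668220141903184,115685,510977,470168,347483,293048,347648,471410],
 [3420622861605191,0,510996,470162,470168,470120],[3420657221343559,0,510996,470066,470168,470120],
 [3455841593432391,0,510993,470063,470168,470120],[1375531233941831,0,511716,511279,511716,470122],
 [1375565593680199,0,510993,511279,470068,470122],[2501431140784455,0,511716,0,511716,470122],
 [2501465500522823,0,510993,0,470067,470122],[4788656851362119,0,524794,345464,470115,347481,524794,524794],
 [1373531859623238,115803,0,347606,472278,472134],[1373532933365062,115731,0,347606,472278,347694],
 [1374632444992838,115722,0,347606,472278,472134],[2499431766465862,115803,0,292958,472278,472134],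
 [2499432840207686,115731,0,347606,472278,347694],[2500532351835462,115722,0,347606,472278,472134],
 [3662756943471942,347255,511425,470120,470122,470122,347489,511425,347651],
 [3660519300113734,347039,510955,471614,510951,347408,345536],
 [3661618811741510,347039,510955,471614,510951,344816,345536],
 [1381094256780614,347055,510969,347408,510957,471648,345544],
 [2506994163623238,347055,510969,345464,510957,471648,345544],
 [1381269274634470,336039,511000,347480,347650,511000,347704,341061],
 [2507169181477094,336039,511000,347480,347650,511000,347704,341061],
 [3484602839804134,347478,510992,0,511016,347488],[3485702351431910,347469,511016,0,511016,347488],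
 [1375602098776294,347481,511000,347462,511018,511000],[2501502005618918,347481,511000,347462,511018,511000],
 [2501502005618928,347702,524725,347702,347720,1587748,1587730],
 [3420622861609159,0,510996,470162,470168,470120],[3420622861609478,115868,511714,470168,470120],
 [3420657221347527,0,510996,470066,470168,470120],[3420657221347846,115772,511618,470168,470120],
 [3455841593436359,0,510993,470063,470168,470120],
 [3455841593436678,115769,511615,470168,470120,1533050,1533002],
 [1375531233945799,0,511716,511279,511716,470122],[1375565593684167,0,510993,511279,470068,470122],
 [2501431140788423,0,511716,0,511716,470122],[2501465500526791,0,510993,0,470067,470122],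
 [3486870514506960,347480,510977,347480,347486,1533059,1533059],
 [1376873341066758,115821,510992,292976,293054,1042955,1533074],
 [3484602839931110,347478,510992,0,511016,347488],[3485702351558886,347469,511016,0,511016,347488],
 [1375602098903270,347481,511000,347462,511018,511000],[2501502005745894,347481,511000,347462,511018,511000],
 [2501502005745904,347702,524725,347702,347720,1533005,1533005],
 [3486870518570192,347480,510977,347480,347486,1534517,1534517],
 [1376873345129990,115821,510992,292976,293054,1534532,1573874]]

def ar12 : List (List ℕ) := [
 [44200616788237514,347571,1532925,1042442,1410504,1410528,879144,1409856,1414230],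
 [44200616788237578,347004,1532925,531674,1409937,1410507,1410453,1410453,1414827,1056159],
 [80229413807201482,347571,1532925,1042442,1410504,1410528,879144,1409856,1414230],
 [80229413807201546,347004,1532925,1042442,1409937,1410507,1410453,1410453,1414827,1056159],
 [43953261031694634,347469,1533816,1041749,1041819,1042458,1410459,1042945,1410360],
 [43988445403783466,347469,1533816,1041749,1036392,1042458,1410459,1042945,1410360],
 [79982058050658602,347469,1533816,1036376,1041819,1042458,1410459,1042945,1410360],
 [80017242422747434,347469,1533816,1036376,1036392,1042458,1410459,1042945,1410360],
 [44192920239349034,0,1514805,1042397,1042440,1042443,1060623,1514805,1062108],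
 [44194019750976810,0,1514805,1042397,1042440,1042464,1060623,1514805,1062108],
 [80221717258313002,0,1514805,1042424,1042440,1042443,1060623,1514805,1062108],
 [80222816769940778,0,1514805,1042424,1042440,1042464,1060623,1514805,1062108],
 [44200616788237638,347571,1532925,1042442,1410504,1410528,879144,1409856,1414230],
 [80229413807201606,347571,1532925,1042442,1410504,1410528,879144,1409856,1414230],
 [43953019507939655,0,1532988,1533823,1410504,1410360],[43953053867678023,0,1532988,1533823,1410504,1410361],
 [43988238239766855,0,1532979,1533823,1410505,1410361],[79981816526903623,0,1532988,0,1410504,1410360],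
 [79981850886641991,0,1532988,0,1410504,1410361],[80017035258730823,0,1532979,0,1410504,1410360],
 [153165551996477767,0,1574374,1036376,1430037,1042443,1574374,1574374],
 [153200736368566599,0,1574374,1036376,1041813,1042443,1574374,1574374],
 [117136754976466246,1041749,1534275,1410356,1410352,1036394,1042460,1534275,1042946],
 [117171939348555078,1041749,1534275,1410356,1410352,1036394,1042460,1534275,1042946],
 [44195153589806406,1041765,1534275,1036394,1410366,1410366,1042468,1534275,1042954],
 [44192915946448198,1041117,1532865,1042172,1532853,1042224,1036609],
 [44194015458075974,1041117,1532865,1042172,1532853,1042225,1036609],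
 [80223950608770374,1041765,1534275,1036394,1410366,1410366,1042468,1534275,1042954],
 [80221712965412166,1041117,1532865,1042199,1532853,1042224,1036609],
 [80222812477039942,1041117,1532865,1042199,1532853,1042225,1036609],
 [109459931571366118,1042434,1532972,0,1042440,1042464],
 [109461031082993894,1042410,1533044,0,1042440,1042465],
 [110586930989836518,1042407,1533044,0,1042440,1042464],
 [44016999486138598,1042434,1533049,1042442,1533049,1533049],
 [44018098997766374,1042407,1533049,1042442,1533049,1042945],
 [80045796505102566,1042434,1533049,1042433,1533049,1533049],
 [80045796505102576,1043159,1574161,1043060,1042466],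
 [80046896016730342,1042407,1533048,1042442,1533048,1042464],
 [80046896016730352,1043060,1574161,1043060,1042466,4244882,4244954],
 [153237019243587814,1042424,1533004,1042874,1410147,1042226,1042460,1042424],
 [43953019507943623,0,1532988,1533823,1410504,1410360],[43953053867681991,0,1532988,1533823,1410504,1410361],
 [43988238239770823,0,1532979,1533823,1410505,1410361],[79981816526907591,0,1532988,0,1410504,1410360],
 [79981850886645959,0,1532988,0,1410504,1410361],[80017035258734791,0,1532979,0,1410504,1410360],
 [111507290873732304,1042457,1532927,1042424,1036394],
 [111542475245821136,1042424,1532927,1042424,1036394,4599232,4599232],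
 [109459931571493094,1042434,1532972,0,1042440,1042464],
 [109461031083120870,1042410,1533044,0,1042440,1042465],
 [110586930989963494,1042407,1533044,0,1042440,1042464],
 [44016999486265574,1042434,1533049,1042442,1533049,1533049],
 [44018098997893350,1042407,1533049,1042442,1533049,1042945],
 [80045796505229542,1042434,1533049,1042433,1533049,1533049],
 [80045796505229552,1043159,1574161,1043060,1042466],
 [80046896016857318,1042407,1533048,1042442,1533048,1042464],
 [80046896016857328,1043060,1574161,1043060,1042466,4598936,4598936],
 [111507290877795536,1042457,1532927,1042424,1036394],
 [111542475249884368,1042424,1532927,1042424,1036394,4603606,4603606]]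

def ar13 : List (List ℕ) := [
 [1414173447659169094,3125247,4602825,3109130,4231056,3109182,3127381,4602825,3128839],
 [1414208632031257926,3125247,4602825,3109130,4231056,3109183,3127381,4602825,3128839],
 [2567094952266016070,3125247,4602825,3109157,4231056,3109182,3127381,4602825,3128839],
 [2567130136638104902,3125247,4602825,3109157,4231056,3109183,3127381,4602825,3128839],
 [1406496624254068966,3127302,4599133,3127319,3127320,3127392],
 [1406497723765696742,3127230,4599133,3127319,3127320,3127395],
 [1407623623672539366,3127221,4599133,3127319,3127320,3127392],
 [2559418128860915942,3127302,4599133,3127319,3127320,3127392],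
 [2559418128860915952,3129467,4722469,3127325,3127397],
 [2559419228372543718,3127230,4599132,3127319,3127320,3127395],
 [2559419228372543728,3129179,4722469,3127325,3127397],
 [2560545128279386342,3127221,4599132,3127319,3127320,3127392],
 [2560545128279386352,3129170,4722469,3127325,3127397,12734654,12734870],
 [4901297663887288550,3127256,4599000,3128615,3127328,3168223,4599000,3127256],
 [4902423563794131174,3127256,4599000,3128615,3127328,3168223,4599000,3127256],
 [3502717810283715792,3127367,4598777,3109157,3109181],[3502752994655804624,3127271,4598777,3109157,3109181],
 [3538781791674768592,3127268,4598777,3109157,3109181,12693266,12693338],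
 [1406496624254195942,3127302,4599133,3127319,3127320,3127392],
 [1406497723765823718,3127230,4599133,3127319,3127320,3127395],
 [1407623623672666342,3127221,4599133,3127319,3127320,3127392],
 [2559418128861042918,3127302,4599133,3127319,3127320,3127392],
 [2559418128861042928,3129467,4722469,3127325,3127397],
 [2559419228372670694,3127230,4599132,3127319,3127320,3127395],
 [2559419228372670704,3129179,4722469,3127325,3127397],
 [2560545128279513318,3127221,4599132,3127319,3127320,3127392],
 [2560545128279513328,3129170,4722469,3127325,3127397,12734654,12734870],
 [3502717810287779024,3127367,4598777,3109157,3109181],[3502752994659867856,3127271,4598777,3109157,3109181],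
 [3538781791678831824,3127268,4598777,3109157,3109181,12693266,12693338]]

def tabL (n : ℕ) : List (List ℕ) :=
  [[], lv1, lv2, lv3, lv4, lv5, lv6, lv7, lv8, lv9, lv10, lv11, lv12, lv13, lv14].getD n []
def tabA (n : ℕ) : List (List ℕ) :=
  [[], ar1, ar2, ar3, ar4, ar5, ar6, ar7, ar8, ar9, ar10, ar11, ar12, ar13].getD n []
def allOk (p : List ℕ → Bool) (l : List (List ℕ)) : Bool :=
  @List.rec (List ℕ) (fun _ => Bool) true (fun e _ ih => an (p e) ih) l

def lvs (n : ℕ) : List (List ℕ) :=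
  @Nat.rec (fun _ => List (List ℕ)) (tabL 0) (fun n ih => tabL (Nat.succ n) ++ ih) n

def filtG (g : ℕ) (l : List (List ℕ)) : List (List ℕ) :=
  @List.rec (List ℕ) (fun _ => List (List ℕ)) [] (fun e _ ih => bi (Nat.beq (enG e) g) (e :: ih) ih) l

def chkPair1 (c1 c2 : ℕ) (d1 d2 : List Node) : Bool :=
  fN (Nat.add (Nat.mul (Nat.add (Nat.mul c1 (Nat.pow 32 (len d2))) c2) 32) 9) fun c =>
    an (lookC c (tabL (Nat.succ (Nat.add (len d1) (len d2))))) (shEq (decode c) (twoS d1 d2))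

def chkPair (e1 e2 : List ℕ) : Bool :=
  fS (decode (enC e1)) fun d1 => fS (decode (enC e2)) fun d2 =>
    oo (chkPair1 (enC e1) (enC e2) d1 d2) (chkPair1 (enC e2) (enC e1) d2 d1)

def chkGrp (g1 g2 : ℕ) : Bool :=
  oo (comb (capT.getD g1 []) (capT.getD g2 []))
    (allOk (fun e1 => allOk (fun e2 => chkPair e1 e2) (filtG g2 (lvs 14))) (filtG g1 (lvs 14)))

def allLt (p : ℕ → Bool) (n : ℕ) : Bool :=
  @Nat.rec (fun _ => Bool) true (fun n ih => an (p n) ih) n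
def chkGrps : Bool := allLt (fun g1 => allLt (fun g2 => chkGrp g1 g2) (Nat.succ g1)) 36
set_option maxRecDepth 100000
theorem okL1 : allOk (chkL capT (tabL 2) (tabA 2)) (tabL 1) = true := by decide +kernel
theorem okL2 : allOk (chkL capT (tabL 3) (tabA 3)) (tabL 2) = true := by decide +kernel
theorem okL3 : allOk (chkL capT (tabL 4) (tabA 4)) (tabL 3) = true := by decide +kernel
theorem okL4 : allOk (chkL capT (tabL 5) (tabA 5)) (tabL 4) = true := by decide +kernel
theorem okL5 : allOk (chkL capT (tabL 6) (tabA 6)) (tabL 5) = true := by decide +kernel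
theorem okL6 : allOk (chkL capT (tabL 7) (tabA 7)) (tabL 6) = true := by decide +kernel
theorem okL7 : allOk (chkL capT (tabL 8) (tabA 8)) (tabL 7) = true := by decide +kernel
theorem okL8 : allOk (chkL capT (tabL 9) (tabA 9)) (tabL 8) = true := by decide +kernel
theorem okL9 : allOk (chkL capT (tabL 10) (tabA 10)) (tabL 9) = true := by decide +kernel
theorem okL10 : allOk (chkL capT (tabL 11) (tabA 11)) (tabL 10) = true := by decide +kernel
theorem okL11 : allOk (chkL capT (tabL 12) (tabA 12)) (tabL 11) = true := by decide +kernel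
theorem okL12 : allOk (chkL capT (tabL 13) (tabA 13)) (tabL 12) = true := by decide +kernel
theorem okL13 : allOk (chkL capT (tabL 14) (tabA 14)) (tabL 13) = true := by decide +kernel
theorem okL14 : allOk (chkL capT (tabL 15) (tabA 15)) (tabL 14) = true := by decide +kernel
theorem okA1 : allOk (chkA (tabA 2)) (tabA 1) = true := by decide +kernel
theorem okA2 : allOk (chkA (tabA 3)) (tabA 2) = true := by decide +kernel
theorem okA3 : allOk (chkA (tabA 4)) (tabA 3) = true := by decide +kernel
theorem okA4 : allOk (chkA (tabA 5)) (tabA 4) = true := by decide +kernel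
theorem okA5 : allOk (chkA (tabA 6)) (tabA 5) = true := by decide +kernel
theorem okA6 : allOk (chkA (tabA 7)) (tabA 6) = true := by decide +kernel
theorem okA7 : allOk (chkA (tabA 8)) (tabA 7) = true := by decide +kernel
theorem okA8 : allOk (chkA (tabA 9)) (tabA 8) = true := by decide +kernel
theorem okA9 : allOk (chkA (tabA 10)) (tabA 9) = true := by decide +kernel
theorem okA10 : allOk (chkA (tabA 11)) (tabA 10) = true := by decide +kernel
theorem okA11 : allOk (chkA (tabA 12)) (tabA 11) = true := by decide +kernel
theorem okA12 : allOk (chkA (tabA 13)) (tabA 12) = true := by decide +kernel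
theorem okA13 : allOk (chkA (tabA 14)) (tabA 13) = true := by decide +kernel
theorem okG : chkGrps = true := by decide +kernel
/-! ### Specifications of the checking functions -/

@[simp] theorem bi_true {α : Type} (x y : α) : bi true x y = x := rfl
@[simp] theorem bi_false {α : Type} (x y : α) : bi false x y = y := rfl
@[simp] theorem an_eq (a b : Bool) : an a b = (a && b) := by cases a <;> rfl
@[simp] theorem oo_eq (a b : Bool) : oo a b = (a || b) := by cases a <;> rfl
theorem bi_eq {α : Type} (b : Bool) (x y : α) : bi b x y = if b = true then x else y := by
  cases b <;> rfl
@[simp] theorem len_eq {α : Type} (l : List α) : len l = l.length := by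
  induction l with
  | nil => rfl
  | cons a l ih => exact congrArg Nat.succ ih
@[simp] theorem fN_eq {β : Type} (n : ℕ) (k : ℕ → β) : fN n k = k n := by cases n <;> rfl
@[simp] theorem fL_eq {β : Type} (l : List ℕ) (k : List ℕ → β) : fL l k = k l := by
  induction l generalizing k with
  | nil => rfl
  | cons a l ih =>
    have : fL (a :: l) k = fN a fun a' => fL l fun l' => k (a' :: l') := rfl
    rw [this, fN_eq, ih]
@[simp] theorem fS_eq {β : Type} (l : List Node) (k : List Node → β) : fS l k = k l := by
  induction l generalizing k with
  | nil => rfl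
  | cons x l ih =>
    have : fS (x :: l) k = fN x.1 fun a => fN x.2.1 fun b => fN x.2.2.1 fun c => fL x.2.2.2 fun d =>
      fS l fun l' => k ((a, b, c, d) :: l') := rfl
    rw [this]; simp only [fN_eq, fL_eq, ih]
@[simp] theorem natbeq (a b : ℕ) : (Nat.beq a b = true) ↔ a = b := Nat.beq_eq ▸ Iff.rfl
@[simp] theorem natble (a b : ℕ) : (Nat.ble a b = true) ↔ a ≤ b := by rw [Nat.ble_eq]

theorem memB_iff (i : ℕ) (l : List ℕ) : memB i l = true ↔ i ∈ l := by
  induction l with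
  | nil => simp [memB]
  | cons a l ih =>
    have : memB i (a :: l) = oo (Nat.beq i a) (memB i l) := rfl
    rw [this]; simp [ih]

/-- node access -/
def nd (d : List Node) (i : ℕ) : Node := d.getD i (0, 0, 0, [])
@[simp] theorem nd_cons_zero (x : Node) (l : List Node) : nd (x :: l) 0 = x := rfl
@[simp] theorem nd_cons_succ (x : Node) (l : List Node) (i : ℕ) : nd (x :: l) (i + 1) = nd l i := rfl

theorem updNodes_length (n : ℕ) (nbB nbO : List ℕ) (l : List Node) (i : ℕ) :
    (updNodes n nbB nbO l i).length = l.length := by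
  induction l generalizing i with
  | nil => rfl
  | cons x l ih => exact congrArg Nat.succ (ih (i + 1))

theorem updNodes_nd (n : ℕ) (nbB nbO : List ℕ) (l : List Node) (i j : ℕ) (hj : j < l.length) :
    nd (updNodes n nbB nbO l i) j =
      if (i + j) ∈ nbB then ((nd l j).1, (nd l j).2.1, (nd l j).2.2.1 - 1, n :: (nd l j).2.2.2)
      else if (i + j) ∈ nbO then ((nd l j).1, (nd l j).2.1 - 1, (nd l j).2.2.1, n :: (nd l j).2.2.2)
      else nd l j := by
  induction l generalizing i j with
  | nil => simp at hj
  | cons x l ih =>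
    have e : updNodes n nbB nbO (x :: l) i =
      (bi (memB i nbB) (x.1, x.2.1, Nat.pred x.2.2.1, n :: x.2.2.2)
        (bi (memB i nbO) (x.1, Nat.pred x.2.1, x.2.2.1, n :: x.2.2.2) x)) :: updNodes n nbB nbO l (i + 1) := rfl
    rw [e]
    cases j with
    | zero => simp only [nd_cons_zero, add_zero, bi_eq, memB_iff]; rfl
    | succ j =>
      simp only [nd_cons_succ]
      rw [ih (i + 1) j (by simpa using hj)]
      rw [show i + 1 + j = i + (j + 1) by ring]

theorem addNode_length (d : List Node) (ty : ℕ) (nbB nbO : List ℕ) (out bad : ℕ) :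
    (addNode d ty nbB nbO out bad).length = d.length + 1 := by
  simp [addNode, updNodes_length]

theorem addNode_nd_lt (d : List Node) (ty : ℕ) (nbB nbO : List ℕ) (out bad : ℕ) (j : ℕ)
    (hj : j < d.length) :
    nd (addNode d ty nbB nbO out bad) j =
      if j ∈ nbB then ((nd d j).1, (nd d j).2.1, (nd d j).2.2.1 - 1, d.length :: (nd d j).2.2.2)
      else if j ∈ nbO then ((nd d j).1, (nd d j).2.1 - 1, (nd d j).2.2.1, d.length :: (nd d j).2.2.2)
      else nd d j := by
  have := updNodes_nd d.length nbB nbO d 0 j hj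
  rw [zero_add] at this
  rw [← this]
  unfold nd addNode
  rw [len_eq, List.getD_append _ _ _ _ (by rw [updNodes_length]; exact hj)]

theorem addNode_nd_last (d : List Node) (ty : ℕ) (nbB nbO : List ℕ) (out bad : ℕ) :
    nd (addNode d ty nbB nbO out bad) d.length = (ty, out, bad, nbB ++ nbO) := by
  unfold nd addNode
  rw [List.getD_append_right _ _ _ _ (by rw [updNodes_length])]
  simp [updNodes_length]

theorem mergeS_length (a b : List Node) : (mergeS a b).length = a.length + b.length := by
  simp [mergeS]

theorem mergeS_nd_lt (a b : List Node) (j : ℕ) (hj : j < a.length) : nd (mergeS a b) j = nd a j := by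
  unfold nd mergeS
  rw [List.getD_append _ _ _ _ hj]

theorem mergeS_nd_ge (a b : List Node) (j : ℕ) (hj : j < b.length) :
    nd (mergeS a b) (a.length + j) = shiftNode a.length (nd b j) := by
  unfold nd mergeS
  rw [List.getD_append_right _ _ _ _ (by omega)]
  simp [List.getD_eq_getElem?_getD, hj]

/-- number of neighbours of node `i` in state `s` -/
def nsD (d : List Node) (m md i s : ℕ) : ℕ := cnt m s (nd d i).2.2.2 + exS d.length i md s

def okD (d : List Node) (m md i : ℕ) : Prop :=
  ndOk (nd d i).1 (dig m i) (nsD d m md i 1) (nsD d m md i 2) = true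
def pD (d : List Node) (m i : ℕ) : ℕ := ndP (nd d i).1 (nd d i).2.1 (dig m i)
def mD (d : List Node) (m md i : ℕ) : ℕ :=
  ndM (nd d i).1 (nd d i).2.1 (bdv md (nd d i).2.2.1) (dig m i) (nsD d m md i 1) (nsD d m md i 2)

theorem valA_spec (n m md lo : ℕ) (l : List Node) (i P M : ℕ)
    (h : valA n m md lo l i P M = true) :
    (∀ j < l.length, ndOk (nd l j).1 (dig m (i + j)) (cnt m 1 (nd l j).2.2.2 + exS n (i + j) md 1)
      (cnt m 2 (nd l j).2.2.2 + exS n (i + j) md 2) = true) ∧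
    M + (∑ j ∈ Finset.range l.length, ndM (nd l j).1 (nd l j).2.1 (bdv md (nd l j).2.2.1) (dig m (i + j))
      (cnt m 1 (nd l j).2.2.2 + exS n (i + j) md 1) (cnt m 2 (nd l j).2.2.2 + exS n (i + j) md 2)) + lo
      ≤ P + (∑ j ∈ Finset.range l.length, ndP (nd l j).1 (nd l j).2.1 (dig m (i + j))) + 64 := by
  induction l generalizing i P M with
  | nil =>
    have : Nat.ble (M + lo) (P + 64) = true := h
    simpa using this
  | cons x l ih =>
    have e : valA n m md lo (x :: l) i P M =
      fN (dig m i) fun s => fN (Nat.add (cnt m 1 x.2.2.2) (exS n i md 1)) fun ns =>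
      fN (Nat.add (cnt m 2 x.2.2.2) (exS n i md 2)) fun nu =>
      an (ndOk x.1 s ns nu) (fN (Nat.add P (ndP x.1 x.2.1 s)) fun P' =>
        fN (Nat.add M (ndM x.1 x.2.1 (bdv md x.2.2.1) s ns nu)) fun M' => valA n m md lo l (Nat.succ i) P' M') := rfl
    rw [e] at h
    simp only [fN_eq, an_eq, Bool.and_eq_true] at h
    obtain ⟨h1, h2⟩ := h
    obtain ⟨h3, h4⟩ := ih _ _ _ h2
    constructor
    · intro j hj
      cases j with
      | zero => exact h1
      | succ j =>
        have := h3 j (by simpa using hj)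
        rw [show i.succ + j = i + (j + 1) by omega] at this
        exact this
    · simp only [List.length_cons, Finset.sum_range_succ', nd_cons_zero, nd_cons_succ, add_zero]
      have e2 : ∀ j, i.succ + j = i + (j + 1) := fun j => by omega
      simp only [e2] at h4
      simp only [Nat.add_eq] at h4
      omega

theorem bitv_eq (R i : ℕ) : bitv R i = true ↔ R / 2 ^ i % 2 = 1 := by
  simp only [bitv, natbeq]; rfl

theorem bitv_add (R i j : ℕ) (h : bitv R i = false) (h2 : bitv (R + 2 ^ i) j = true) :
    j = i ∨ bitv R j = true := by
  rw [bitv_eq] at h2 ⊢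
  have h' : ¬ (R / 2 ^ i % 2 = 1) := by rw [← bitv_eq, h]; simp
  by_cases hji : j = i
  · exact Or.inl hji
  right
  rcases lt_or_gt_of_ne hji with hlt | hgt
  · obtain ⟨k, rfl⟩ : ∃ k, i = j + (k + 1) := ⟨i - j - 1, by omega⟩
    rw [pow_add, Nat.add_mul_div_left _ _ (by positivity), pow_succ] at h2
    omega
  · obtain ⟨k, rfl⟩ : ∃ k, j = i + 1 + k := ⟨j - i - 1, by omega⟩
    have h3 : (R + 2 ^ i) / 2 ^ (i + 1) = R / 2 ^ (i + 1) := by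
      rw [pow_succ, ← Nat.div_div_eq_div_mul, ← Nat.div_div_eq_div_mul]
      rw [Nat.add_div_right _ (by positivity)]
      omega
    rw [pow_add, ← Nat.div_div_eq_div_mul, h3, Nat.div_div_eq_div_mul, ← pow_add] at h2
    exact h2

theorem anyR_spec (R : ℕ) (l : List ℕ) (h : anyR R l = true) : ∃ j ∈ l, bitv R j = true := by
  induction l with
  | nil => exact absurd h (by simp [anyR])
  | cons a l ih =>
    have e : anyR R (a :: l) = oo (bitv R a) (anyR R l) := rfl
    rw [e, oo_eq, Bool.or_eq_true] at h
    rcases h with h | h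
    · exact ⟨a, by simp, h⟩
    · obtain ⟨j, hj, hb⟩ := ih h
      exact ⟨j, by simp [hj], hb⟩

section reach
variable (n m md : ℕ) (Q : ℕ → Prop)

theorem up1_inv (i : ℕ) (x : Node) (R : ℕ) (hR : ∀ j, bitv R j = true → Q j)
    (hx1 : dig m i = 0 → isBase n i md x.2.1 x.2.2.1 = true → Q i)
    (hx2 : dig m i = 0 → ∀ j ∈ x.2.2.2, Q j → Q i) :
    ∀ j, bitv (up1 n m md i x R) j = true → Q j := by
  intro j hj
  unfold up1 at hj
  rw [bi_eq] at hj
  split_ifs at hj with hc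
  · simp only [an_eq, Bool.and_eq_true, natbeq] at hc
    obtain ⟨h0, hc⟩ := hc
    rw [bi_eq] at hc
    split_ifs at hc with hb
    simp only [oo_eq, Bool.or_eq_true] at hc
    rcases bitv_add R i j (by simpa using hb) hj with rfl | h
    · rcases hc with hc | hc
      · exact hx1 h0 hc
      · obtain ⟨k, hk, hkb⟩ := anyR_spec _ _ hc
        exact hx2 h0 k hk (hR k hkb)
    · exact hR j h
  · exact hR j hj

theorem passU_inv (l : List Node) (i R : ℕ) (hR : ∀ j, bitv R j = true → Q j)
    (hx1 : ∀ j < l.length, dig m (i + j) = 0 → isBase n (i + j) md (nd l j).2.1 (nd l j).2.2.1 = true → Q (i + j))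
    (hx2 : ∀ j < l.length, dig m (i + j) = 0 → ∀ k ∈ (nd l j).2.2.2, Q k → Q (i + j)) :
    ∀ j, bitv (passU n m md l i R) j = true → Q j := by
  induction l generalizing i R with
  | nil => exact hR
  | cons x l ih =>
    have e : passU n m md (x :: l) i R = fN (up1 n m md i x R) fun R' => passU n m md l (Nat.succ i) R' := rfl
    rw [e, fN_eq]
    have e2 : ∀ j, i.succ + j = i + (j + 1) := fun j => by omega
    apply ih
    · exact up1_inv n m md Q i x R hR (hx1 0 (by simp)) (hx2 0 (by simp))
    · intro j hj; rw [e2]; exact hx1 (j + 1) (by simpa using hj)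
    · intro j hj; rw [e2]; exact hx2 (j + 1) (by simpa using hj)

theorem passD_inv (l : List Node) (i R : ℕ) (hR : ∀ j, bitv R j = true → Q j)
    (hx1 : ∀ j < l.length, dig m (i + j) = 0 → isBase n (i + j) md (nd l j).2.1 (nd l j).2.2.1 = true → Q (i + j))
    (hx2 : ∀ j < l.length, dig m (i + j) = 0 → ∀ k ∈ (nd l j).2.2.2, Q k → Q (i + j)) :
    ∀ j, bitv (passD n m md l i R) j = true → Q j := by
  induction l generalizing i with
  | nil => exact hR
  | cons x l ih =>
    have e : passD n m md (x :: l) i R = fN (passD n m md l (Nat.succ i) R) fun R' => up1 n m md i x R' := rfl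
    rw [e, fN_eq]
    have e2 : ∀ j, i.succ + j = i + (j + 1) := fun j => by omega
    apply up1_inv n m md Q i x _ _ (hx1 0 (by simp)) (hx2 0 (by simp))
    apply ih
    · intro j hj; rw [e2]; exact hx1 (j + 1) (by simpa using hj)
    · intro j hj; rw [e2]; exact hx2 (j + 1) (by simpa using hj)

theorem allR_spec (R k : ℕ) (h : allR m R k = true) : ∀ i < k, dig m i = 0 → bitv R i = true := by
  induction k with
  | zero => intro i hi; omega
  | succ k ih =>
    have e : allR m R (k + 1) = an (oo (Nat.ble 1 (dig m k)) (bitv R k)) (allR m R k) := rfl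
    rw [e] at h
    simp only [an_eq, oo_eq, Bool.and_eq_true, Bool.or_eq_true, natble] at h
    intro i hi h0
    rcases Nat.lt_succ_iff_lt_or_eq.mp hi with hi | rfl
    · exact ih h.2 i hi h0
    · rcases h.1 with h | h
      · omega
      · exact h

theorem fullB_spec (k : ℕ) (h : fullB m k = true) : ∀ i < k, dig m i ≠ 0 := by
  induction k with
  | zero => intro i hi; omega
  | succ k ih =>
    have e : fullB m (k + 1) = an (Nat.ble 1 (dig m k)) (fullB m k) := rfl
    rw [e] at h
    simp only [an_eq, Bool.and_eq_true, natble] at h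
    intro i hi
    rcases Nat.lt_succ_iff_lt_or_eq.mp hi with hi | rfl
    · exact ih h.2 i hi
    · omega

theorem reachOk_spec (d : List Node) (h : reachOk d n m md = true) (hn : n = d.length)
    (hx1 : ∀ j < n, dig m j = 0 → isBase n j md (nd d j).2.1 (nd d j).2.2.1 = true → Q j)
    (hx2 : ∀ j < n, dig m j = 0 → ∀ k ∈ (nd d j).2.2.2, Q k → Q j) :
    ∀ j < n, dig m j = 0 → Q j := by
  subst hn
  have hU := fun R hR => passU_inv d.length m md Q d 0 R hR (by simpa using hx1) (by simpa using hx2)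
  have hD := fun R hR => passD_inv d.length m md Q d 0 R hR (by simpa using hx1) (by simpa using hx2)
  have h0 : ∀ j, bitv 0 j = true → Q j := by intro j hj; rw [bitv_eq] at hj; simp at hj
  unfold reachOk at h
  simp only [fN_eq, oo_eq, Bool.or_eq_true] at h
  intro j hj hj0
  rcases h with h | h | h | h
  · exact absurd hj0 (fullB_spec m _ h j hj)
  · exact hD _ h0 j (allR_spec m _ _ h j hj hj0)
  · exact hU _ (hD _ h0) j (allR_spec m _ _ h j hj hj0)
  · exact hU _ (hD _ (hU _ (hD _ h0))) j (allR_spec m _ _ h j hj hj0)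
end reach

/-- what a successful check means -/
structure ChkOK (d : List Node) (m md lo : ℕ) : Prop where
  ok : ∀ i < d.length, okD d m md i
  val : (∑ i ∈ Finset.range d.length, mD d m md i) + lo ≤ (∑ i ∈ Finset.range d.length, pD d m i) + 64
  reach : ∀ Q : ℕ → Prop,
    (∀ j < d.length, dig m j = 0 → isBase d.length j md (nd d j).2.1 (nd d j).2.2.1 = true → Q j) →
    (∀ j < d.length, dig m j = 0 → ∀ k ∈ (nd d j).2.2.2, Q k → Q j) →
    ∀ j < d.length, dig m j = 0 → Q j

theorem chk_spec (d : List Node) (m md lo : ℕ) (h : chk d m md lo = true) : ChkOK d m md lo := by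
  unfold chk at h
  simp only [fN_eq, an_eq, Bool.and_eq_true, len_eq] at h
  obtain ⟨h1, h2⟩ := h
  obtain ⟨h3, h4⟩ := valA_spec _ _ _ _ _ _ _ _ h1
  simp only [zero_add] at h3 h4
  exact ⟨h3, h4, fun Q a b => reachOk_spec _ m md Q d h2 rfl a b⟩

theorem allZero_iff (d : List Node) : allZero d = true ↔ ∀ i < d.length, (nd d i).2.1 = 0 := by
  induction d with
  | nil => simp [allZero]
  | cons x l ih =>
    have e : allZero (x :: l) = an (Nat.beq x.2.1 0) (allZero l) := rfl
    rw [e, an_eq, Bool.and_eq_true, ih, natbeq]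
    constructor
    · rintro ⟨h1, h2⟩ i hi
      cases i with
      | zero => exact h1
      | succ i => exact h2 i (by simpa using hi)
    · intro h
      exact ⟨h 0 (by simp), fun i hi => h (i + 1) (by simpa using hi)⟩

theorem outIdx_mem (d : List Node) (i j : ℕ) (hj : j < d.length) (h : 0 < (nd d j).2.1) :
    i + j ∈ outIdx d i := by
  induction d generalizing i j with
  | nil => simp at hj
  | cons x l ih =>
    have e : outIdx (x :: l) i = bi (Nat.ble 1 x.2.1) (i :: outIdx l (i + 1)) (outIdx l (i + 1)) := rfl
    rw [e, bi_eq]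
    cases j with
    | zero =>
      rw [if_pos (by rw [natble]; exact h)]; simp
    | succ j =>
      have := ih (i + 1) j (by simpa using hj) h
      rw [show i + 1 + j = i + (j + 1) by ring] at this
      split_ifs <;> simp [this]

theorem badIdx_mem (d : List Node) (i j : ℕ) (hj : j < d.length) (h : 0 < (nd d j).2.2.1) :
    i + j ∈ badIdx d i := by
  induction d generalizing i j with
  | nil => simp at hj
  | cons x l ih =>
    have e : badIdx (x :: l) i = bi (Nat.ble 1 x.2.2.1) (i :: badIdx l (i + 1)) (badIdx l (i + 1)) := rfl
    rw [e, bi_eq]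
    cases j with
    | zero =>
      rw [if_pos (by rw [natble]; exact h)]; simp
    | succ j =>
      have := ih (i + 1) j (by simpa using hj) h
      rw [show i + 1 + j = i + (j + 1) by ring] at this
      split_ifs <;> simp [this]

theorem remB_mem (n : ℕ) (l : List ℕ) (a : ℕ) (h : a ∈ l) (hn : a ≠ n) : a ∈ remB n l := by
  induction l with
  | nil => simp at h
  | cons b l ih =>
    have e : remB n (b :: l) = bi (Nat.beq b n) (remB n l) (b :: remB n l) := rfl
    rw [e, bi_eq]
    rcases List.mem_cons.mp h with rfl | h
    · rw [if_neg (by rw [natbeq]; exact hn)]; simp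
    · have := ih h
      split_ifs <;> simp [this]

theorem zeroBut_of (i : ℕ) (d : List Node) (j : ℕ)
    (h : ∀ k < d.length, (nd d k).2.1 = 0 ∨ (i = j + k ∧ (nd d k).2.1 = 1)) : zeroBut i d j = true := by
  induction d generalizing j with
  | nil => rfl
  | cons x l ih =>
    have e : zeroBut i (x :: l) j = an (oo (Nat.beq x.2.1 0) (an (Nat.beq i j) (Nat.beq x.2.1 1))) (zeroBut i l (j + 1)) := rfl
    rw [e]
    simp only [an_eq, oo_eq, Bool.and_eq_true, Bool.or_eq_true, natbeq]
    refine ⟨by simpa using h 0 (by simp), ih _ fun k hk => ?_⟩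
    have := h (k + 1) (by simpa using hk)
    rw [show j + 1 + k = j + (k + 1) by ring]
    exact this

theorem natsEq_spec (l l' : List ℕ) (h : natsEq l l' = true) : l = l' := by
  induction l generalizing l' with
  | nil => cases l' with
    | nil => rfl
    | cons b t => exact absurd h (by simp [natsEq])
  | cons a l ih => cases l' with
    | nil => exact absurd h (by simp [natsEq])
    | cons b t =>
      have e : natsEq (a :: l) (b :: t) = an (Nat.beq a b) (natsEq l t) := rfl
      rw [e] at h
      simp only [an_eq, Bool.and_eq_true, natbeq] at h
      rw [h.1, ih _ h.2]

theorem nodeEq_spec (x y : Node) (h : nodeEq x y = true) : x = y := by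
  unfold nodeEq at h
  simp only [an_eq, Bool.and_eq_true, natbeq] at h
  exact Prod.ext h.1 (Prod.ext h.2.1 (Prod.ext h.2.2.1 (natsEq_spec _ _ h.2.2.2)))

theorem shEq_spec (l l' : List Node) (h : shEq l l' = true) : l = l' := by
  induction l generalizing l' with
  | nil => cases l' with
    | nil => rfl
    | cons b t => exact absurd h (by simp [shEq])
  | cons a l ih => cases l' with
    | nil => exact absurd h (by simp [shEq])
    | cons b t =>
      have e : shEq (a :: l) (b :: t) = an (nodeEq a b) (shEq l t) := rfl
      rw [e] at h
      simp only [an_eq, Bool.and_eq_true] at h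
      rw [nodeEq_spec _ _ h.1, ih _ h.2]

theorem lookC_spec (c : ℕ) (l : List (List ℕ)) (h : lookC c l = true) : ∃ e ∈ l, enC e = c := by
  induction l with
  | nil => exact absurd h (by simp [lookC])
  | cons a l ih =>
    have e : lookC c (a :: l) = oo (Nat.beq (enC a) c) (lookC c l) := rfl
    rw [e] at h
    simp only [oo_eq, Bool.or_eq_true, natbeq] at h
    rcases h with h | h
    · exact ⟨a, by simp, h⟩
    · obtain ⟨e, he, hc⟩ := ih h
      exact ⟨e, by simp [he], hc⟩

theorem all2_spec {α : Type} (p : α → ℕ → Bool) (l : List α) (l' : List ℕ) (h : all2 p l l' = true) :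
    ∀ a ∈ l, ∃ b, p a b = true := by
  induction l generalizing l' with
  | nil => simp
  | cons a l ih => cases l' with
    | nil => exact absurd h (by simp [all2])
    | cons b t =>
      have e : all2 p (a :: l) (b :: t) = an (p a b) (all2 p l t) := rfl
      rw [e] at h
      simp only [an_eq, Bool.and_eq_true] at h
      intro x hx
      rcases List.mem_cons.mp hx with rfl | hx
      · exact ⟨b, h.1⟩
      · exact ih _ h.2 x hx

theorem allOk_spec (p : List ℕ → Bool) (l : List (List ℕ)) (h : allOk p l = true) : ∀ e ∈ l, p e = true := by
  induction l with
  | nil => simp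
  | cons a l ih =>
    have e : allOk p (a :: l) = an (p a) (allOk p l) := rfl
    rw [e] at h
    simp only [an_eq, Bool.and_eq_true] at h
    intro x hx
    rcases List.mem_cons.mp hx with rfl | hx
    · exact h.1
    · exact ih h.2 x hx

theorem filtG_mem (g : ℕ) (l : List (List ℕ)) (e : List ℕ) (he : e ∈ l) (hg : enG e = g) : e ∈ filtG g l := by
  induction l with
  | nil => simp at he
  | cons a l ih =>
    have eq : filtG g (a :: l) = bi (Nat.beq (enG a) g) (a :: filtG g l) (filtG g l) := rfl
    rw [eq, bi_eq]
    rcases List.mem_cons.mp he with rfl | he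
    · rw [if_pos (by rw [natbeq]; exact hg)]; simp
    · have := ih he
      split_ifs <;> simp [this]

theorem allLt_spec (p : ℕ → Bool) (n : ℕ) (h : allLt p n = true) : ∀ i < n, p i = true := by
  induction n with
  | zero => intro i hi; omega
  | succ k ih =>
    have e : allLt p (k + 1) = an (p k) (allLt p k) := rfl
    rw [e] at h
    simp only [an_eq, Bool.and_eq_true] at h
    intro i hi
    rcases Nat.lt_succ_iff_lt_or_eq.mp hi with hi | rfl
    · exact ih h.2 i hi
    · exact h.1

/-! ### Consequences of the verified tables -/

def InL (s : List Node) : Prop := ∃ n e, e ∈ tabL n ∧ decode (enC e) = s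
def InA (s : List Node) : Prop := ∃ n e, e ∈ tabA n ∧ decode (enC e) = s

theorem chkL_of_mem (n : ℕ) (e : List ℕ) (he : e ∈ tabL n) : chkL capT (tabL (n+1)) (tabA (n+1)) e = true := by
  rcases n with _|_|_|_|_|_|_|_|_|_|_|_|_|_|_|n
  · exact absurd he (by simp [tabL])
  · exact allOk_spec _ _ okL1 e he
  · exact allOk_spec _ _ okL2 e he
  · exact allOk_spec _ _ okL3 e he
  · exact allOk_spec _ _ okL4 e he
  · exact allOk_spec _ _ okL5 e he
  · exact allOk_spec _ _ okL6 e he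
  · exact allOk_spec _ _ okL7 e he
  · exact allOk_spec _ _ okL8 e he
  · exact allOk_spec _ _ okL9 e he
  · exact allOk_spec _ _ okL10 e he
  · exact allOk_spec _ _ okL11 e he
  · exact allOk_spec _ _ okL12 e he
  · exact allOk_spec _ _ okL13 e he
  · exact allOk_spec _ _ okL14 e he
  · exact absurd he (by simp [tabL])

theorem chkA_of_mem (n : ℕ) (e : List ℕ) (he : e ∈ tabA n) : chkA (tabA (n+1)) e = true := by
  rcases n with _|_|_|_|_|_|_|_|_|_|_|_|_|_|n
  · exact absurd he (by simp [tabA])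
  · exact allOk_spec _ _ okA1 e he
  · exact allOk_spec _ _ okA2 e he
  · exact allOk_spec _ _ okA3 e he
  · exact allOk_spec _ _ okA4 e he
  · exact allOk_spec _ _ okA5 e he
  · exact allOk_spec _ _ okA6 e he
  · exact allOk_spec _ _ okA7 e he
  · exact allOk_spec _ _ okA8 e he
  · exact allOk_spec _ _ okA9 e he
  · exact allOk_spec _ _ okA10 e he
  · exact allOk_spec _ _ okA11 e he
  · exact allOk_spec _ _ okA12 e he
  · exact allOk_spec _ _ okA13 e he
  · exact absurd he (by simp [tabA])

/-- external reducibility -/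
def Red (z : Prop) (s : List Node) : Prop :=
  ∃ m, (∃ i < s.length, dig m i ≠ 0) ∧ ChkOK s m 3 64 ∧ (z → dig m (s.length - 1) = 1 → ChkOK s m 3 65)
def RedL (s : List Node) : Prop := Red (allZero s = true) s
def RedA (s : List Node) : Prop := Red False s
def Fin' (s : List Node) : Prop := ∃ m, (∀ i < s.length, dig m i ≠ 0) ∧ ChkOK s m 3 54

theorem dig_lt (m i : ℕ) : dig m i < 3 := Nat.mod_lt _ (by norm_num)

theorem dig_ne (n m : ℕ) (h1 : 1 ≤ m) (h2 : m < 3 ^ n) : ∃ i < n, dig m i ≠ 0 := by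
  induction n generalizing m with
  | zero => simp at h2; omega
  | succ n ih =>
    by_cases h : m % 3 = 0
    · obtain ⟨i, hi, hd⟩ := ih (m / 3) (by omega) (by rw [pow_succ] at h2; omega)
      refine ⟨i + 1, by omega, ?_⟩
      have : dig m (i + 1) = dig (m / 3) i := by
        show m / 3 ^ (i + 1) % 3 = m / 3 / 3 ^ i % 3
        rw [Nat.div_div_eq_div_mul, pow_succ']
      rw [this]; exact hd
    · refine ⟨0, by omega, ?_⟩
      show m / 3 ^ 0 % 3 ≠ 0
      simpa using h

theorem ChkOK.mono {d : List Node} {m md lo lo' : ℕ} (h : ChkOK d m md lo) (hl : lo' ≤ lo) :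
    ChkOK d m md lo' := ⟨h.ok, by have := h.val; omega, h.reach⟩

theorem chkE_spec (z : Bool) (d : List Node) (m : ℕ) (h : chkE z d m = true) : Red (z = true) d := by
  unfold chkE at h
  simp only [fN_eq, an_eq, Bool.and_eq_true, len_eq, natble] at h
  obtain ⟨h1, h2, h3⟩ := h
  refine ⟨m, dig_ne _ m h1 h2, ?_, ?_⟩
  · refine (chk_spec _ _ _ _ h3).mono ?_
    rw [bi_eq]; split_ifs <;> omega
  · intro hz hd
    have := chk_spec _ _ _ _ h3
    rw [bi_eq, if_pos] at this
    · exact this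
    · simp only [Bool.and_eq_true, natbeq]; exact ⟨hd, hz⟩

theorem chkF_spec (d : List Node) (m : ℕ) (h : chkF d m = true) : Fin' d := by
  unfold chkF at h
  simp only [an_eq, Bool.and_eq_true, len_eq] at h
  exact ⟨m, fullB_spec _ _ h.1, chk_spec _ _ _ _ h.2⟩

theorem chkExt_spec2 (tL tA c s m) (h : chkExt tL tA (2, c, s) m = true) : Fin' s := by
  unfold chkExt at h
  rw [fS_eq] at h
  exact chkF_spec s m h

theorem chkExt_spec0 (n : ℕ) (tA c s m) (h : chkExt (tabL n) tA (0, c, s) m = true) : InL s ∨ RedL s := by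
  unfold chkExt at h
  rw [fS_eq] at h
  have h : bi (Nat.beq m 0) (fN c fun c => an (lookC c (tabL n)) (shEq (decode c) s))
      (chkE (allZero s) s m) = true := h
  rw [bi_eq] at h
  split_ifs at h with hm
  · left
    simp only [fN_eq, an_eq, Bool.and_eq_true] at h
    obtain ⟨e, he, hc⟩ := lookC_spec _ _ h.1
    exact ⟨n, e, he, by rw [hc]; exact shEq_spec _ _ h.2⟩
  · right
    exact chkE_spec _ _ _ h

theorem chkExt_spec1 (n : ℕ) (tL c s m) (h : chkExt tL (tabA n) (1, c, s) m = true) : InA s ∨ RedA s := by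
  unfold chkExt at h
  rw [fS_eq] at h
  have h : bi (Nat.beq m 0) (fN c fun c => an (lookC c (tabA n)) (shEq (decode c) s))
      (chkE false s m) = true := h
  rw [bi_eq] at h
  split_ifs at h with hm
  · left
    simp only [fN_eq, an_eq, Bool.and_eq_true] at h
    obtain ⟨e, he, hc⟩ := lookC_spec _ _ h.1
    exact ⟨n, e, he, by rw [hc]; exact shEq_spec _ _ h.2⟩
  · right
    obtain ⟨m, a, b, c⟩ := chkE_spec _ _ _ h
    exact ⟨m, a, b, fun h => h.elim⟩

/-- capabilities -/
structure CapOK (d : List Node) (cv : List ℕ) : Prop where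
  z : allZero d = true → enC cv = 1
  cap : ∀ a < 3, ∀ st < 3, capV cv a st ≠ 0 → ∃ m, dig m (d.length - 1) = a ∧ ChkOK d m st (capV cv a st)

theorem chkCap_spec (d cv e a st) (h : chkCap d cv e a st = true) (h0 : capV cv a st ≠ 0) :
    ∃ m, dig m (d.length - 1) = a ∧ ChkOK d m st (capV cv a st) := by
  unfold chkCap at h
  simp only [fN_eq, an_eq, oo_eq, Bool.and_eq_true, Bool.or_eq_true, natbeq, len_eq] at h
  rcases h with h | h
  · exact absurd h h0
  · exact ⟨_, h.1, chk_spec _ _ _ _ h.2⟩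

theorem chkL_spec (n : ℕ) (e : List ℕ) (h : chkL capT (tabL n) (tabA n) e = true) :
    CapOK (decode (enC e)) (capT.getD (enG e) []) ∧ enG e < 36 ∧
    ∀ x ∈ extsL (enC e) (decode (enC e)), ∃ m, chkExt (tabL n) (tabA n) x m = true := by
  unfold chkL at h
  simp only [fS_eq, fL_eq, an_eq, oo_eq, Bool.and_eq_true, Bool.or_eq_true, natbeq, natble] at h
  obtain ⟨hz, hg, h00, h01, h02, h10, h11, h12, h20, h21, h22, hx⟩ := h
  refine ⟨⟨?_, ?_⟩, hg, all2_spec _ _ _ hx⟩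
  · intro ha
    rcases hz with hz | hz
    · exact hz
    · rw [ha] at hz; exact absurd hz (by simp)
  · intro a ha st hst
    interval_cases a <;> interval_cases st <;> apply chkCap_spec <;> assumption

section
variable {d : List Node}

theorem InL.ext (h : InL d) : ∃ n c, ∀ x ∈ extsL c d, ∃ m, chkExt (tabL n) (tabA n) x m = true := by
  obtain ⟨n, e, he, rfl⟩ := h
  exact ⟨n+1, _, (chkL_spec _ _ (chkL_of_mem n e he)).2.2⟩

theorem InL.one (h : InL d) {t : ℕ} (ht : t = 1 ∨ t = 2) : InL (addOne t d) ∨ RedL (addOne t d) := by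
  obtain ⟨n, c, h⟩ := h.ext
  rcases ht with rfl | rfl
  · obtain ⟨m, hm⟩ := h (0, Nat.add (Nat.mul c 32) 6, addOne 1 d) (by simp [extsL])
    exact chkExt_spec0 _ _ _ _ _ hm
  · obtain ⟨m, hm⟩ := h (0, Nat.add (Nat.mul c 32) 7, addOne 2 d) (by simp [extsL])
    exact chkExt_spec0 _ _ _ _ _ hm

theorem InL.out (h : InL d) : InL (addOut d) ∨ RedL (addOut d) := by
  obtain ⟨n, c, h⟩ := h.ext
  obtain ⟨m, hm⟩ := h (0, Nat.add (Nat.mul c 32) 8, addOut d) (by simp [extsL])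
  exact chkExt_spec0 _ _ _ _ _ hm

theorem InL.arc (h : InL d) : InA (addArc d) ∨ RedA (addArc d) := by
  obtain ⟨n, c, h⟩ := h.ext
  obtain ⟨m, hm⟩ := h (1, Nat.add (Nat.mul c 32) 10, addArc d) (by simp [extsL])
  exact chkExt_spec1 _ _ _ _ _ hm

theorem recvs_mem (tag c : ℕ) (d : List Node) (i : ℕ) (hi : i < d.length) (hn : i ≠ d.length - 1)
    (ho : 0 < (nd d i).2.1) : (tag, Nat.add (Nat.mul c 32) (Nat.add 16 i), addRecv i d) ∈ recvs tag c d := by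
  unfold recvs
  apply List.mem_map.mpr
  refine ⟨i, remB_mem _ _ _ ?_ (by rw [len_eq]; exact hn), rfl⟩
  simpa using outIdx_mem d 0 i hi ho

theorem InL.recv (h : InL d) (i : ℕ) (hi : i < d.length) (hn : i ≠ d.length - 1)
    (ho : 0 < (nd d i).2.1) : InL (addRecv i d) ∨ RedL (addRecv i d) := by
  obtain ⟨n, c, h⟩ := h.ext
  obtain ⟨m, hm⟩ := h (0, Nat.add (Nat.mul c 32) (Nat.add 16 i), addRecv i d) (by
    have := recvs_mem 0 c d i hi hn ho
    unfold extsL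
    simp only [List.mem_cons, List.mem_append]
    tauto)
  exact chkExt_spec0 _ _ _ _ _ hm

theorem InL.fin (h : InL d) (hz : allZero d = true) {t : ℕ} (ht : t = 3 ∨ t = 4 ∨ t = 5) : Fin' (addEnd t d) := by
  obtain ⟨n, c, h⟩ := h.ext
  obtain ⟨m, hm⟩ := h (2, 0, addEnd t d) (by
    unfold extsL
    rw [hz]
    rcases ht with rfl | rfl | rfl <;> simp)
  exact chkExt_spec2 _ _ _ _ _ hm

/-- one step extensions of an arc shape -/
inductive AStep (d : List Node) : List Node → Prop
  | one (t : ℕ) (ht : t = 1 ∨ t = 2) : AStep d (addOne t d)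
  | recv (i : ℕ) (hi : i < d.length) (hn : i ≠ d.length - 1) (ho : 0 < (nd d i).2.1) : AStep d (addRecv i d)

theorem InA.ext (h : InA d) : ∃ n c, ∀ x ∈ extsA c d, ∃ m, chkExt [] (tabA n) x m = true := by
  obtain ⟨n, e, he, rfl⟩ := h
  have := chkA_of_mem n e he
  unfold chkA at this
  rw [fS_eq] at this
  exact ⟨n+1, _, all2_spec _ _ _ this⟩

theorem AStep.mem {s : List Node} (h : AStep d s) (c : ℕ) : ∃ c', (1, c', s) ∈ extsX c d := by
  unfold extsX
  cases h with
  | one t ht =>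
    rcases ht with rfl | rfl
    · exact ⟨Nat.add (Nat.mul c 32) 6, by simp⟩
    · exact ⟨Nat.add (Nat.mul c 32) 7, by simp⟩
  | recv i hi hn ho =>
    refine ⟨Nat.add (Nat.mul c 32) (Nat.add 16 i), ?_⟩
    have := recvs_mem 1 c d i hi hn ho
    simp only [List.mem_cons]
    exact Or.inr (Or.inr this)

theorem InA.step (h : InA d) {s : List Node} (hs : AStep d s) : InA s ∨ RedA s := by
  obtain ⟨n, c, h⟩ := h.ext
  obtain ⟨c', hc⟩ := hs.mem c
  obtain ⟨m, hm⟩ := h _ (by unfold extsA; exact List.mem_append_left _ hc)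
  exact chkExt_spec1 _ _ _ _ _ hm

theorem InA.fin (h : InA d) {x s : List Node} (hs : AStep d x) (c0 : ℕ) (hc0 : c0 < x.length)
    (hn : c0 ≠ x.length - 1) (hb : 0 < (nd x c0).2.2.1)
    (hh : (allZero x = true ∧ (s = addNode x 1 [x.length - 1, c0] [] 0 0 ∨ s = addNode x 2 [x.length - 1, c0] [] 0 0)) ∨
      (∃ i < x.length, (nd x i).2.1 = 1 ∧ (∀ k < x.length, k ≠ i → (nd x k).2.1 = 0) ∧
        s = addNode x 0 [x.length - 1, c0] [i] 0 0)) : Fin' s := by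
  obtain ⟨n, c, h⟩ := h.ext
  obtain ⟨c', hc⟩ := hs.mem c
  have hmem : (2, 0, s) ∈ closeY x := by
    unfold closeY
    rw [fN_eq, len_eq]
    apply List.mem_flatMap.mpr
    refine ⟨c0, remB_mem _ _ _ (by simpa using badIdx_mem x 0 c0 hc0 hb) hn, ?_⟩
    rcases hh with ⟨hz, hh⟩ | ⟨i, hi, h1, h2, hh⟩
    · rw [hz, bi_true]
      rcases hh with rfl | rfl <;> simp
    · have : allZero x = false := by
        by_contra hc
        have := (allZero_iff x).mp (by simpa using hc) i hi
        omega
      rw [this, bi_false]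
      apply List.mem_map.mpr
      refine ⟨i, List.mem_filter.mpr ⟨by simpa using outIdx_mem x 0 i hi (by omega), ?_⟩, by rw [hh]; rfl⟩
      apply zeroBut_of
      intro k hk
      by_cases hki : k = i
      · right; subst hki; exact ⟨by simp, h1⟩
      · left; exact h2 k hk hki
  obtain ⟨m, hm⟩ := h (2, 0, s) (by
    unfold extsA
    apply List.mem_append_right
    apply List.mem_flatMap.mpr
    exact ⟨_, hc, by rw [fS_eq]; exact hmem⟩)
  exact chkExt_spec2 _ _ _ _ _ hm
end

/-- two children can be handled below a vertex of degree three -/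
def TwoOK (d1 d2 : List Node) : Prop := ∃ st a b m1 m2 g1 g2, st < 3 ∧ a < 3 ∧ b < 3 ∧
  dig m1 (d1.length - 1) = a ∧ dig m2 (d2.length - 1) = b ∧ ChkOK d1 m1 st g1 ∧ ChkOK d2 m2 st g2 ∧
  0 < st + a + b ∧
  (st = 0 → 128 + Wn (3 - num2 1 a b - num2 2 a b) (Nat.ble 1 (num2 1 a b)) (Nat.ble 1 (num2 2 a b)) ≤ g1 + g2 + 8) ∧
  (st = 1 → 150 ≤ g1 + g2 + 8 ∧ (allZero d1 = true → allZero d2 = true → 151 ≤ g1 + g2 + 8)) ∧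
  (st = 2 → 1 ≤ num2 1 a b ∧ 1 ≤ num2 2 a b ∧ 130 ≤ g1 + g2 + 8)

theorem any3_spec (p : ℕ → Bool) (h : any3 p = true) : ∃ i < 3, p i = true := by
  unfold any3 at h
  simp only [oo_eq, Bool.or_eq_true] at h
  rcases h with h | h | h
  · exact ⟨0, by norm_num, h⟩
  · exact ⟨1, by norm_num, h⟩
  · exact ⟨2, by norm_num, h⟩

theorem comb_spec {d1 d2 x y} (h1 : CapOK d1 x) (h2 : CapOK d2 y) (h : comb x y = true) : TwoOK d1 d2 := by
  obtain ⟨st, hst, h⟩ := any3_spec _ h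
  obtain ⟨a, ha, h⟩ := any3_spec _ h
  obtain ⟨b, hb, h⟩ := any3_spec _ h
  unfold comb1 at h
  simp only [fN_eq, an_eq, Bool.and_eq_true, natble] at h
  obtain ⟨hg1, hg2, hpos, h⟩ := h
  obtain ⟨m1, hm1, hc1⟩ := h1.cap a ha st hst (by omega)
  obtain ⟨m2, hm2, hc2⟩ := h2.cap b hb st hst (by omega)
  refine ⟨st, a, b, m1, m2, _, _, hst, ha, hb, hm1, hm2, hc1, hc2, by rw [add_assoc]; exact hpos, ?_, ?_, ?_⟩
  · intro h0
    rw [bi_eq, if_pos (by rw [natbeq]; exact h0), natble] at h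
    exact h
  · intro h0
    rw [bi_eq, if_neg (by rw [natbeq]; omega), bi_eq, if_pos (by rw [natbeq]; exact h0), natble] at h
    simp only [Nat.add_eq] at h
    refine ⟨by omega, fun z1 z2 => ?_⟩
    rw [h1.z z1, h2.z z2] at h
    exact h
  · intro h0
    rw [bi_eq, if_neg (by rw [natbeq]; omega), bi_eq, if_neg (by rw [natbeq]; omega)] at h
    simp only [Bool.and_eq_true, natble] at h
    exact ⟨h.1.1, h.1.2, h.2⟩

theorem lvs_mem (N n : ℕ) (e : List ℕ) (he : e ∈ tabL n) (hn : n ≤ N) : e ∈ lvs N := by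
  induction N with
  | zero =>
    obtain rfl : n = 0 := by omega
    exact he
  | succ N ih =>
    have eq : lvs (N + 1) = tabL (N + 1) ++ lvs N := rfl
    rw [eq]
    rcases Nat.lt_or_ge N n with h | h
    · obtain rfl : n = N + 1 := by omega
      exact List.mem_append_left _ he
    · exact List.mem_append_right _ (ih h)

theorem tabL_lt (n : ℕ) (e : List ℕ) (he : e ∈ tabL n) : n ≤ 14 := by
  by_contra h
  obtain ⟨k, rfl⟩ : ∃ k, n = k + 15 := ⟨n - 15, by omega⟩
  exact absurd he (by simp [tabL])

theorem chkPair1_spec (c1 c2 d1 d2) (h : chkPair1 c1 c2 d1 d2 = true) : InL (twoS d1 d2) := by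
  unfold chkPair1 at h
  simp only [fN_eq, an_eq, Bool.and_eq_true] at h
  obtain ⟨e, he, hc⟩ := lookC_spec _ _ h.1
  exact ⟨_, e, he, by rw [hc]; exact shEq_spec _ _ h.2⟩

theorem InL.two_aux {n1 n2 : ℕ} {e1 e2 : List ℕ} (h1 : e1 ∈ tabL n1) (h2 : e2 ∈ tabL n2)
    (hg : enG e2 ≤ enG e1) :
    InL (twoS (decode (enC e1)) (decode (enC e2))) ∨ InL (twoS (decode (enC e2)) (decode (enC e1))) ∨
    TwoOK (decode (enC e1)) (decode (enC e2)) := by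
  obtain ⟨c1, g1, -⟩ := chkL_spec _ _ (chkL_of_mem n1 e1 h1)
  obtain ⟨c2, g2, -⟩ := chkL_spec _ _ (chkL_of_mem n2 e2 h2)
  have hk := allLt_spec _ _ (allLt_spec _ _ okG (enG e1) g1) (enG e2) (Nat.lt_succ_of_le hg)
  unfold chkGrp at hk
  simp only [oo_eq, Bool.or_eq_true] at hk
  rcases hk with hk | hk
  · exact Or.inr (Or.inr (comb_spec c1 c2 hk))
  · have m1 := filtG_mem (enG e1) _ e1 (lvs_mem 14 n1 e1 h1 (tabL_lt _ _ h1)) rfl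
    have m2 := filtG_mem (enG e2) _ e2 (lvs_mem 14 n2 e2 h2 (tabL_lt _ _ h2)) rfl
    have := allOk_spec _ _ (allOk_spec _ _ hk e1 m1) e2 m2
    unfold chkPair at this
    simp only [fS_eq, oo_eq, Bool.or_eq_true] at this
    rcases this with h | h
    · exact Or.inl (chkPair1_spec _ _ _ _ h)
    · exact Or.inr (Or.inl (chkPair1_spec _ _ _ _ h))

theorem InL.two {d1 d2 : List Node} (h1 : InL d1) (h2 : InL d2) :
    InL (twoS d1 d2) ∨ InL (twoS d2 d1) ∨ TwoOK d1 d2 ∨ TwoOK d2 d1 := by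
  obtain ⟨n1, e1, h1, rfl⟩ := h1
  obtain ⟨n2, e2, h2, rfl⟩ := h2
  rcases le_total (enG e2) (enG e1) with h | h
  · have := InL.two_aux h1 h2 h; tauto
  · have := InL.two_aux h2 h1 h; tauto

theorem InL.leaf {t : ℕ} (ht : t < 5) : InL [(t, tR t - 1, 1, [])] := by
  have : lookC (t + 1) (tabL 1) = true := by
    interval_cases t <;> decide +kernel
  obtain ⟨e, he, hc⟩ := lookC_spec _ _ this
  refine ⟨1, e, he, ?_⟩
  rw [hc]
  interval_cases t <;> decide +kernel

theorem RedL.leaf5 : RedL [(5, 0, 1, [])] := by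
  apply chkE_spec _ _ 2
  decide +kernel

theorem InA.base {t : ℕ} (ht : t = 1 ∨ t = 2) : InA [(t, 0, 2, [])] := by
  have : lookC (t + 10) (tabA 1) = true := by
    rcases ht with rfl | rfl <;> decide +kernel
  obtain ⟨e, he, hc⟩ := lookC_spec _ _ this
  refine ⟨1, e, he, ?_⟩
  rw [hc]
  rcases ht with rfl | rfl <;> decide +kernel

/-! ### Graph side: weights, reductions -/

section graph
set_option linter.unusedSectionVars false
variable {V : Type*} [DecidableEq V] (G : SimpleGraph V) [DecidableRel G.Adj]

def dg (A : Finset V) (x : V) : ℕ := (A.filter fun y => G.Adj x y).card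
/-- number of neighbours in state `s` -/
def cs (A : Finset V) (σ : V → ℕ) (s : ℕ) (x : V) : ℕ := (A.filter fun y => G.Adj x y ∧ σ y = s).card

def Sol (A : Finset V) (fs fu : V → Bool) (S : Finset V) : Prop :=
  S ⊆ A ∧ ∀ x ∈ A, x ∉ S → (fs x = true ∨ ∃ y ∈ S, G.Adj x y) ∧ (fu x = true ∨ ∃ y ∈ A, y ∉ S ∧ G.Adj x y)

def Bd (A : Finset V) (fs fu : V → Bool) : Prop :=
  ∃ S, Sol G A fs fu S ∧ 20 * S.card ≤ ∑ x ∈ A, Wn (dg G A x) (fs x) (fu x) + 10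

def Conn (A : Finset V) : Prop :=
  A.Nonempty ∧ ∀ D ⊆ A, D.Nonempty → (∀ x ∈ D, ∀ y ∈ A, G.Adj x y → y ∈ D) → D = A

structure Good (A : Finset V) (fs fu : V → Bool) : Prop where
  conn : Conn G A
  deg : ∀ x ∈ A, dg G A x ≤ 3
  one : ∀ x ∈ A, dg G A x = 1 → fs x = true ∨ fu x = true

def fs' (A : Finset V) (fs : V → Bool) (σ : V → ℕ) (s : ℕ) (x : V) : Bool := fs x || Nat.ble 1 (cs G A σ s x)

def ctr (A : Finset V) (fs fu : V → Bool) (σ : V → ℕ) (x : V) : ℤ :=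
  (Wn (dg G A x) (fs x) (fu x) : ℤ) -
    (if σ x = 0 then (Wn (dg G A x - cs G A σ 1 x - cs G A σ 2 x) (fs' G A fs σ 1 x) (fs' G A fu σ 2 x) : ℤ)
     else if σ x = 1 then 20 else 0)

variable {G} {A : Finset V} {fs fu : V → Bool} {σ : V → ℕ}

theorem dg_split (hσ : ∀ x ∈ A, σ x < 3) (x : V) :
    dg G (A.filter fun y => σ y = 0) x + cs G A σ 1 x + cs G A σ 2 x = dg G A x := by
  unfold dg cs
  rw [Finset.filter_filter]
  rw [← Finset.card_union_of_disjoint, ← Finset.card_union_of_disjoint]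
  · congr 1
    ext y
    simp only [Finset.mem_union, Finset.mem_filter]
    constructor
    · tauto
    · rintro ⟨h1, h2⟩
      have : σ y = 0 ∨ σ y = 1 ∨ σ y = 2 := by have := hσ y h1; omega
      tauto
  · rw [Finset.disjoint_left]
    intro y; simp only [Finset.mem_union, Finset.mem_filter]; omega
  · rw [Finset.disjoint_left]
    intro y; simp only [Finset.mem_filter]; omega

theorem cs_pos {s : ℕ} {x : V} (h : 0 < cs G A σ s x) : ∃ y ∈ A, G.Adj x y ∧ σ y = s := by
  obtain ⟨y, hy⟩ := Finset.card_pos.mp h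
  exact ⟨y, by simpa using hy⟩

theorem fs'_true {s : ℕ} {x : V} : fs' G A fs σ s x = true ↔ fs x = true ∨ 0 < cs G A σ s x := by
  unfold fs'
  rw [Bool.or_eq_true, natble]; rfl

theorem reduce (hσ : ∀ x ∈ A, σ x < 3)
    (hok : ∀ x ∈ A, σ x = 2 → fs' G A fs σ 1 x = true ∧ fs' G A fu σ 2 x = true)
    (S : Finset V) (κ : ℕ) (hS : Sol G (A.filter fun y => σ y = 0) (fs' G A fs σ 1) (fs' G A fu σ 2) S)
    (hc : 20 * S.card ≤ ∑ x ∈ A.filter (fun y => σ y = 0),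
      Wn (dg G (A.filter fun y => σ y = 0) x) (fs' G A fs σ 1 x) (fs' G A fu σ 2 x) + κ)
    (hv : (κ : ℤ) ≤ ∑ x ∈ A, ctr G A fs fu σ x + 10) : Bd G A fs fu := by
  have hS0 : ∀ x ∈ S, x ∈ A ∧ σ x = 0 := fun x hx => by simpa using hS.1 hx
  refine ⟨S ∪ A.filter (fun y => σ y = 1), ⟨?_, ?_⟩, ?_⟩
  · intro x hx
    rcases Finset.mem_union.mp hx with h | h
    · exact (hS0 x h).1
    · exact (Finset.mem_filter.mp h).1
  · intro x hx hxS
    simp only [Finset.mem_union, Finset.mem_filter, not_or, not_and] at hxS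
    have hx3 := hσ x hx
    have key : fs' G A fs σ 1 x = true → (fs x = true ∨ ∃ y ∈ S ∪ A.filter (fun y => σ y = 1), G.Adj x y) := by
      intro h
      rcases fs'_true.mp h with h | h
      · exact Or.inl h
      · obtain ⟨y, hy, ha, hs⟩ := cs_pos h
        exact Or.inr ⟨y, by simp [hy, hs], ha⟩
    have key2 : fs' G A fu σ 2 x = true → (fu x = true ∨ ∃ y ∈ A, y ∉ S ∪ A.filter (fun y => σ y = 1) ∧ G.Adj x y) := by
      intro h
      rcases fs'_true.mp h with h | h
      · exact Or.inl h
      · obtain ⟨y, hy, ha, hs⟩ := cs_pos h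
        refine Or.inr ⟨y, hy, ?_, ha⟩
        simp only [Finset.mem_union, Finset.mem_filter, not_or, not_and]
        refine ⟨fun h => ?_, fun _ => by omega⟩
        have := (hS0 y h).2; omega
    have hc : σ x = 0 ∨ σ x = 2 := by have := hxS.2 hx; omega
    rcases hc with h0 | h2
    · obtain ⟨h3, h4⟩ := hS.2 x (by simp [hx, h0]) hxS.1
      constructor
      · rcases h3 with h3 | ⟨y, hy, ha⟩
        · exact key h3
        · exact Or.inr ⟨y, by simp [hy], ha⟩
      · rcases h4 with h4 | ⟨y, hy, hyS, ha⟩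
        · exact key2 h4
        · rw [Finset.mem_filter] at hy
          refine Or.inr ⟨y, hy.1, ?_, ha⟩
          simp only [Finset.mem_union, Finset.mem_filter, not_or, not_and]
          exact ⟨hyS, fun _ => by omega⟩
    · exact ⟨key (hok x hx h2).1, key2 (hok x hx h2).2⟩
  · have hcard : (S ∪ A.filter (fun y => σ y = 1)).card ≤ S.card + (A.filter (fun y => σ y = 1)).card :=
      Finset.card_union_le _ _
    have h1 : ∑ x ∈ A, ctr G A fs fu σ x = (∑ x ∈ A, (Wn (dg G A x) (fs x) (fu x) : ℤ)) -
        ((∑ x ∈ A.filter (fun y => σ y = 0),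
          (Wn (dg G (A.filter fun y => σ y = 0) x) (fs' G A fs σ 1 x) (fs' G A fu σ 2 x) : ℤ)) +
          20 * (A.filter (fun y => σ y = 1)).card) := by
      unfold ctr
      rw [Finset.sum_sub_distrib]
      congr 1
      rw [Finset.sum_ite]
      congr 1
      · apply Finset.sum_congr rfl
        intro x _
        have := dg_split hσ (G := G) x
        rw [show dg G A x - cs G A σ 1 x - cs G A σ 2 x = dg G (A.filter fun y => σ y = 0) x by omega]
      · rw [Finset.sum_ite, Finset.sum_const, Finset.sum_const_zero, add_zero, Finset.filter_filter]
        rw [show (A.filter fun a => ¬σ a = 0 ∧ σ a = 1) = A.filter fun a => σ a = 1 by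
          apply Finset.filter_congr; intro x _; constructor
          · exact fun h => h.2
          · exact fun h => ⟨by omega, h⟩]
        simp [mul_comm]
    rw [h1] at hv
    simp only [← Nat.cast_sum] at hv
    omega

theorem reduce_empty (hσ : ∀ x ∈ A, σ x < 3) (h0 : ∀ x ∈ A, σ x ≠ 0)
    (hok : ∀ x ∈ A, σ x = 2 → fs' G A fs σ 1 x = true ∧ fs' G A fu σ 2 x = true)
    (hv : -10 ≤ ∑ x ∈ A, ctr G A fs fu σ x) : Bd G A fs fu := by
  have : (A.filter fun y => σ y = 0) = ∅ := by
    rw [Finset.filter_eq_empty_iff]; exact fun {x} hx => h0 x hx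
  refine reduce hσ hok ∅ 0 ?_ ?_ (by push_cast; linarith)
  · rw [this]; exact ⟨by simp, by simp⟩
  · simp

theorem reduce_single (hσ : ∀ x ∈ A, σ x < 3) (p : V) (h0 : (A.filter fun y => σ y = 0) = {p})
    (hok : ∀ x ∈ A, σ x = 2 → fs' G A fs σ 1 x = true ∧ fs' G A fu σ 2 x = true)
    (hv : -10 ≤ ∑ x ∈ A, ctr G A fs fu σ x) : Bd G A fs fu := by
  have hd : dg G {p} p = 0 := by
    unfold dg; rw [Finset.card_eq_zero, Finset.filter_eq_empty_iff]
    intro y hy; rw [Finset.mem_singleton.mp hy]; exact G.loopless.irrefl p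
  by_cases hp : fs' G A fs σ 1 p = true ∧ fs' G A fu σ 2 p = true
  · refine reduce hσ hok ∅ 0 ?_ (by simp) (by push_cast; linarith)
    rw [h0]
    refine ⟨by simp, ?_⟩
    intro x hx _
    rw [Finset.mem_singleton.mp hx]
    exact ⟨Or.inl hp.1, Or.inl hp.2⟩
  · refine reduce hσ hok {p} 0 ?_ ?_ (by push_cast; linarith)
    · rw [h0]
      exact ⟨by simp, fun x hx hn => absurd hx hn⟩
    · rw [h0, Finset.sum_singleton, hd]
      have : Wn 0 (fs' G A fs σ 1 p) (fs' G A fu σ 2 p) = 20 := by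
        revert hp
        generalize fs' G A fs σ 1 p = a
        generalize fs' G A fu σ 2 p = b
        revert a b; decide
      simp [this]

/-- inductive hypothesis -/
def IHyp (G : SimpleGraph V) [DecidableRel G.Adj] (N : ℕ) : Prop :=
  ∀ (A : Finset V) (fs fu : V → Bool), A.card < N → Good G A fs fu → Bd G A fs fu

theorem reduce_IH (hG : Good G A fs fu) (hI : IHyp G A.card) (hσ : ∀ x ∈ A, σ x < 3)
    (hne : ∃ x ∈ A, σ x ≠ 0) (hconn : Conn G (A.filter fun y => σ y = 0))
    (hok : ∀ x ∈ A, σ x = 2 → fs' G A fs σ 1 x = true ∧ fs' G A fu σ 2 x = true)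
    (hv : 0 ≤ ∑ x ∈ A, ctr G A fs fu σ x) : Bd G A fs fu := by
  obtain ⟨S, hS, hc⟩ := hI (A.filter fun y => σ y = 0) (fs' G A fs σ 1) (fs' G A fu σ 2) (by
    apply Finset.card_lt_card
    rw [Finset.filter_ssubset]
    exact hne) ⟨hconn, (by
      intro x hx
      have := dg_split hσ (G := G) x
      have := hG.deg x (Finset.mem_filter.mp hx).1
      omega), (by
      intro x hx h1
      have hs := dg_split hσ (G := G) x
      rw [fs'_true, fs'_true]
      by_cases hz : 0 < cs G A σ 1 x ∨ 0 < cs G A σ 2 x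
      · tauto
      · have := hG.one x (Finset.mem_filter.mp hx).1 (by omega)
        tauto)⟩
  exact reduce hσ hok S 10 hS hc (by push_cast; linarith)

variable (G) in
/-- outgoing normal (`b = false`) or bad edges -/
def outE (C : Finset V) (bd : V → V → Bool) (b : Bool) (x : V) : ℕ :=
  (C.filter fun w => G.Adj x w ∧ bd x w = b).card

variable (G) in
/-- local contribution of a vertex including the effect on the outside -/
def lc (A B : Finset V) (fs fu : V → Bool) (bd : V → V → Bool) (σ : V → ℕ) (x : V) : ℤ :=
  ctr G A fs fu σ x +
    (if σ x = 1 then 3 * (outE G (A \ B) bd false x : ℤ) - 2 * outE G (A \ B) bd true x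
     else if σ x = 2 then - 2 * (outE G (A \ B) bd false x : ℤ) - 2 * outE G (A \ B) bd true x else 0)

theorem Wn_table_aux : ∀ (d : Fin 4) (a1 a2 b1 b2 : Fin 2) (f g : Bool),
    (a1.1 + a2.1 ≤ 1 ∧ b1.1 + b2.1 ≤ 1 ∧ (a1.1 + a2.1 = 1 → d.1 = 3) ∧
    (a1.1 + b1.1 + (a2.1 + b2.1) + 1 ≤ d.1 ∨ a1.1 + b1.1 + (a2.1 + b2.1) = 0)) →
    Wn (d.1 - (a1.1 + b1.1) - (a2.1 + b2.1)) (f || Nat.ble 1 (a1.1 + b1.1)) (g || Nat.ble 1 (a2.1 + b2.1)) + 3 * a1.1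
      ≤ Wn d.1 f g + 2 * a2.1 + 2 * b1.1 + 2 * b2.1 := by decide +kernel

theorem Wn_table (d : ℕ) (hd : d < 4) (a1 : ℕ) (h1 : a1 < 2) (a2 : ℕ) (h2 : a2 < 2) (b1 : ℕ) (h3 : b1 < 2)
    (b2 : ℕ) (h4 : b2 < 2) (f g : Bool)
    (h : a1 + a2 ≤ 1 ∧ b1 + b2 ≤ 1 ∧ (a1 + a2 = 1 → d = 3) ∧
      (a1 + b1 + (a2 + b2) + 1 ≤ d ∨ a1 + b1 + (a2 + b2) = 0)) :
    Wn (d - (a1 + b1) - (a2 + b2)) (f || Nat.ble 1 (a1 + b1)) (g || Nat.ble 1 (a2 + b2)) + 3 * a1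
      ≤ Wn d f g + 2 * a2 + 2 * b1 + 2 * b2 :=
  Wn_table_aux ⟨d, hd⟩ ⟨a1, h1⟩ ⟨a2, h2⟩ ⟨b1, h3⟩ ⟨b2, h4⟩ f g h

/-- frame conditions -/
structure Frame (G : SimpleGraph V) [DecidableRel G.Adj] (A B : Finset V) (bd : V → V → Bool) : Prop where
  sub : B ⊆ A
  nor : ∀ w ∈ A \ B, ∀ x ∈ B, G.Adj x w → bd x w = false → dg G A w = 3 ∧
    ∀ x' ∈ B, G.Adj x' w → bd x' w = false → x' = x
  bad : ∀ w ∈ A \ B, ∀ x ∈ B, ∀ x' ∈ B, G.Adj x w → G.Adj x' w → bd x w = true → bd x' w = true → x = x'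

theorem frame_sum (hG : Good G A fs fu) {B : Finset V} {bd : V → V → Bool} (hF : Frame G A B bd)
    (h0 : ∀ w ∈ A \ B, σ w = 0)
    (hd : ∀ w ∈ A \ B, cs G A σ 1 w + cs G A σ 2 w + 1 ≤ dg G A w ∨ cs G A σ 1 w + cs G A σ 2 w = 0) :
    ∑ x ∈ B, lc G A B fs fu bd σ x ≤ ∑ x ∈ A, ctr G A fs fu σ x := by
  let num : ℕ → Bool → V → ℕ := fun s b w => (B.filter fun x => G.Adj x w ∧ bd x w = b ∧ σ x = s).card
  have hcs : ∀ s, s ≠ 0 → ∀ w, cs G A σ s w = num s false w + num s true w := by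
    intro s hs w
    show _ = (B.filter _).card + (B.filter _).card
    rw [← Finset.card_union_of_disjoint]
    · unfold cs
      congr 1
      ext y
      simp only [Finset.mem_union, Finset.mem_filter]
      constructor
      · rintro ⟨hy, ha, hsy⟩
        have hyB : y ∈ B := by
          by_contra hn
          exact hs (by rw [← hsy, h0 y (Finset.mem_sdiff.mpr ⟨hy, hn⟩)])
        cases hb : bd y w <;> simp [hyB, ha.symm, hsy]
      · rintro (⟨hy, ha, _, hsy⟩ | ⟨hy, ha, _, hsy⟩) <;> exact ⟨hF.sub hy, ha.symm, hsy⟩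
    · rw [Finset.disjoint_left]
      intro y; simp only [Finset.mem_filter]
      rintro ⟨_, _, h, _⟩ ⟨_, _, h', _⟩
      rw [h] at h'; cases h'
  have hw : ∀ w ∈ A \ B, (3 * (num 1 false w : ℤ) - 2 * num 2 false w - 2 * num 1 true w - 2 * num 2 true w)
      ≤ ctr G A fs fu σ w := by
    intro w hw
    have hwA := (Finset.mem_sdiff.mp hw).1
    have add : ∀ b, num 1 b w + num 2 b w ≤ (B.filter fun x => G.Adj x w ∧ bd x w = b).card := by
      intro b
      show (B.filter _).card + (B.filter _).card ≤ _
      rw [← Finset.card_union_of_disjoint]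
      · apply Finset.card_le_card
        intro y; simp only [Finset.mem_union, Finset.mem_filter]; tauto
      · rw [Finset.disjoint_left]
        intro y; simp only [Finset.mem_filter]; omega
    have ha : (B.filter fun x => G.Adj x w ∧ bd x w = false).card ≤ 1 := by
      rw [Finset.card_le_one]
      intro x hx y hy
      rw [Finset.mem_filter] at hx hy
      exact ((hF.nor w hw y hy.1 hy.2.1 hy.2.2).2 x hx.1 hx.2.1 hx.2.2)
    have hb : (B.filter fun x => G.Adj x w ∧ bd x w = true).card ≤ 1 := by
      rw [Finset.card_le_one]
      intro x hx y hy
      rw [Finset.mem_filter] at hx hy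
      exact hF.bad w hw x hx.1 y hy.1 hx.2.1 hy.2.1 hx.2.2 hy.2.2
    have h3 : num 1 false w + num 2 false w = 1 → dg G A w = 3 := by
      intro h
      have := add false
      obtain ⟨x, hx⟩ := Finset.card_pos.mp (show 0 < (B.filter fun x => G.Adj x w ∧ bd x w = false).card by omega)
      rw [Finset.mem_filter] at hx
      exact (hF.nor w hw x hx.1 hx.2.1 hx.2.2).1
    have a1 := add false
    have a2 := add true
    have := hd w hw
    rw [hcs 1 (by norm_num), hcs 2 (by norm_num)] at this
    have key := Wn_table (dg G A w) (by have := hG.deg w hwA; omega) (num 1 false w) (by omega) (num 2 false w)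
      (by omega) (num 1 true w) (by omega) (num 2 true w) (by omega) (fs w) (fu w) ⟨by omega, by omega, h3, this⟩
    unfold ctr fs'
    rw [if_pos (h0 w hw), hcs 1 (by norm_num), hcs 2 (by norm_num)]
    zify at key
    linarith
  rw [← Finset.sum_sdiff hF.sub]
  unfold lc
  rw [Finset.sum_add_distrib]
  have hsw : ∑ w ∈ A \ B, (3 * (num 1 false w : ℤ) - 2 * num 2 false w - 2 * num 1 true w - 2 * num 2 true w) =
      ∑ x ∈ B, (if σ x = 1 then 3 * (outE G (A \ B) bd false x : ℤ) - 2 * outE G (A \ B) bd true x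
     else if σ x = 2 then - 2 * (outE G (A \ B) bd false x : ℤ) - 2 * outE G (A \ B) bd true x else 0) := by
    have dc : ∀ s b, (∑ w ∈ A \ B, (num s b w : ℤ)) = ∑ x ∈ B, if σ x = s then (outE G (A \ B) bd b x : ℤ) else 0 := by
      intro s b
      have e1 : ∀ w, (num s b w : ℤ) = ∑ x ∈ B, if G.Adj x w ∧ bd x w = b ∧ σ x = s then (1 : ℤ) else 0 := by
        intro w; rw [Finset.sum_boole]
      simp only [e1]
      rw [Finset.sum_comm]
      apply Finset.sum_congr rfl
      intro x _
      split_ifs with h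
      · unfold outE; rw [← Finset.sum_boole]
        simp [h]
      · simp [h]
    rw [Finset.sum_sub_distrib, Finset.sum_sub_distrib, Finset.sum_sub_distrib]
    simp only [← Finset.mul_sum]
    rw [dc, dc, dc, dc]
    simp only [Finset.mul_sum]
    rw [← Finset.sum_sub_distrib, ← Finset.sum_sub_distrib, ← Finset.sum_sub_distrib]
    apply Finset.sum_congr rfl
    intro x _
    by_cases h1 : σ x = 1
    · simp [h1]
    · by_cases h2 : σ x = 2
      · simp [h2]
      · simp [h1, h2]
  have := Finset.sum_le_sum hw
  rw [hsw] at this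
  linarith

theorem Conn.nbr (h : Conn G A) (h2 : 2 ≤ A.card) {x : V} (hx : x ∈ A) : ∃ y ∈ A, G.Adj x y := by
  by_contra hn
  push Not at hn
  have := h.2 {x} (by simpa using hx) (by simp) (by
    intro y hy z hz ha
    rw [Finset.mem_singleton.mp hy] at ha
    exact absurd ha (hn z hz))
  rw [← this] at h2; simp at h2

theorem cs_zero_of {s : ℕ} (hs : s ≠ 0) {w : V} (h : ∀ y ∈ A, G.Adj w y → σ y = 0) : cs G A σ s w = 0 := by
  unfold cs
  rw [Finset.card_eq_zero, Finset.filter_eq_empty_iff]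
  rintro y hy ⟨ha, hh⟩
  exact hs (by rw [← hh, h y hy ha])

theorem Wn_single : ∀ f g : Bool, (f = true ∨ g = true) → Wn 0 (f || true) g ≤ Wn 1 f g + 13 ∧
    Wn 0 f (g || true) ≤ Wn 1 f g + 12 := by decide

/-- The main frame lemma. -/
theorem frame (hG : Good G A fs fu) (hI : IHyp G A.card) {B : Finset V} {bd : V → V → Bool}
    (hF : Frame G A B bd) (hC : Conn G (A \ B))
    (h0 : ∀ w ∈ A \ B, σ w = 0) (hσ : ∀ x ∈ B, σ x < 3) (hne : ∃ x ∈ B, σ x ≠ 0)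
    (hok : ∀ x ∈ B, σ x = 2 → fs' G A fs σ 1 x = true ∧ fs' G A fu σ 2 x = true)
    (hreach : ∀ E : Finset V, A \ B ⊆ E → (∀ x ∈ E, ∀ y ∈ A, σ y = 0 → G.Adj x y → y ∈ E) →
      ∀ x ∈ B, σ x = 0 → x ∈ E)
    (hv : 0 ≤ ∑ x ∈ B, lc G A B fs fu bd σ x)
    (hC2 : 2 ≤ (A \ B).card ∨ ∃ p v, A \ B = {p} ∧ v ∈ B ∧ dg G A p = 1 ∧ G.Adj v p ∧ bd v p = true ∧
      (σ v = 1 → 1 ≤ ∑ x ∈ B, lc G A B fs fu bd σ x)) : Bd G A fs fu := by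
  have hσA : ∀ x ∈ A, σ x < 3 := by
    intro x hx
    by_cases hB : x ∈ B
    · exact hσ x hB
    · rw [h0 x (Finset.mem_sdiff.mpr ⟨hx, hB⟩)]; norm_num
  have hokA : ∀ x ∈ A, σ x = 2 → fs' G A fs σ 1 x = true ∧ fs' G A fu σ 2 x = true := by
    intro x hx h2
    by_cases hB : x ∈ B
    · exact hok x hB h2
    · rw [h0 x (Finset.mem_sdiff.mpr ⟨hx, hB⟩)] at h2; omega
  have hCA : ∀ w ∈ A \ B, w ∈ A.filter fun y => σ y = 0 := by
    intro w hw
    exact Finset.mem_filter.mpr ⟨(Finset.mem_sdiff.mp hw).1, h0 w hw⟩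
  have hconn : Conn G (A.filter fun y => σ y = 0) := by
    refine ⟨⟨_, hCA _ hC.1.choose_spec⟩, ?_⟩
    intro D hDA hDne hDc
    have hDc' : ∀ x ∈ D, ∀ y ∈ A, σ y = 0 → G.Adj x y → y ∈ D := fun x hx y hy hs ha =>
      hDc x hx y (Finset.mem_filter.mpr ⟨hy, hs⟩) ha
    by_cases hDC : (D ∩ (A \ B)).Nonempty
    · have hsub : A \ B ⊆ D := by
        have := hC.2 (D ∩ (A \ B)) Finset.inter_subset_right hDC (by
          intro x hx y hy ha
          rw [Finset.mem_inter] at hx ⊢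
          exact ⟨hDc' x hx.1 y (Finset.mem_sdiff.mp hy).1 (h0 y hy) ha, hy⟩)
        rw [← this]; exact Finset.inter_subset_left
      apply Finset.Subset.antisymm hDA
      intro x hx
      rw [Finset.mem_filter] at hx
      by_cases hB : x ∈ B
      · exact hreach D hsub hDc' x hB hx.2
      · exact hsub (Finset.mem_sdiff.mpr ⟨hx.1, hB⟩)
    · exfalso
      obtain ⟨x, hx⟩ := hDne
      have hxA := Finset.mem_filter.mp (hDA hx)
      have hnC : ∀ y ∈ D, y ∉ A \ B := fun y hy hc => hDC ⟨y, Finset.mem_inter.mpr ⟨hy, hc⟩⟩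
      have hxB : x ∈ B := by
        by_contra hn; exact hnC x hx (Finset.mem_sdiff.mpr ⟨hxA.1, hn⟩)
      have := hreach (A.filter (fun y => σ y = 0) \ D) (by
        intro w hw
        exact Finset.mem_sdiff.mpr ⟨hCA w hw, fun h => hnC w h hw⟩) (by
        intro z hz y hy hs ha
        rw [Finset.mem_sdiff] at hz ⊢
        refine ⟨Finset.mem_filter.mpr ⟨hy, hs⟩, fun h => hz.2 ?_⟩
        exact hDc y h z hz.1 ha.symm) x hxB hxA.2
      exact (Finset.mem_sdiff.mp this).2 hx
  have hne' : ∃ x ∈ A, σ x ≠ 0 := by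
    obtain ⟨x, hx, h⟩ := hne; exact ⟨x, hF.sub hx, h⟩
  rcases hC2 with hC2 | ⟨p, v, hp, hvB, hdp, hvp, hbd, hv1⟩
  · apply reduce_IH hG hI hσA hne' hconn hokA
    refine le_trans hv (frame_sum hG hF h0 ?_)
    intro w hw
    left
    have hs := dg_split hσA (G := G) w
    obtain ⟨y, hy, ha⟩ := hC.nbr hC2 hw
    have : 0 < dg G (A.filter fun y => σ y = 0) w := Finset.card_pos.mpr ⟨y, by
      simp only [Finset.mem_filter]
      exact ⟨⟨(Finset.mem_sdiff.mp hy).1, h0 y hy⟩, ha⟩⟩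
    omega
  · have hpA : p ∈ A := by
      have : p ∈ A \ B := by rw [hp]; simp
      exact (Finset.mem_sdiff.mp this).1
    have hp0 : σ p = 0 := h0 p (by rw [hp]; simp)
    have honly : ∀ y ∈ A, G.Adj p y → y = v := by
      intro y hy ha
      have := Finset.card_le_one.mp (le_of_eq hdp)
      exact this y (by simp [hy, ha]) v (by simp [hF.sub hvB, hvp.symm])
    by_cases hv0 : σ v = 0
    · apply reduce_IH hG hI hσA hne' hconn hokA
      refine le_trans hv (frame_sum hG hF h0 ?_)
      intro w hw
      right
      rw [hp, Finset.mem_singleton] at hw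
      subst hw
      have : ∀ y ∈ A, G.Adj w y → σ y = 0 := fun y hy ha => by rw [honly y hy ha, hv0]
      rw [cs_zero_of (by norm_num) this, cs_zero_of (by norm_num) this]
    · have hA0 : (A.filter fun y => σ y = 0) = {p} := by
        apply Finset.Subset.antisymm
        · intro x hx
          rw [Finset.mem_filter] at hx
          by_cases hB : x ∈ B
          · apply hreach {p} (by rw [hp]) _ x hB hx.2
            intro x hx y hy hs ha
            rw [Finset.mem_singleton.mp hx] at ha
            have := honly y hy ha
            subst this
            exact absurd hs hv0
          · rw [← hp]; exact Finset.mem_sdiff.mpr ⟨hx.1, hB⟩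
        · intro x hx
          rw [Finset.mem_singleton.mp hx]
          simp [hpA, hp0]
      apply reduce_single hσA p hA0 hokA
      have hAs : ∑ x ∈ A, ctr G A fs fu σ x = ctr G A fs fu σ p + ∑ x ∈ B, ctr G A fs fu σ x := by
        rw [← Finset.sum_sdiff hF.sub, hp, Finset.sum_singleton]
      have hlc : ∑ x ∈ B, lc G A B fs fu bd σ x = ∑ x ∈ B, ctr G A fs fu σ x - 2 := by
        unfold lc
        rw [Finset.sum_add_distrib, sub_eq_add_neg]
        congr 1
        rw [← Finset.add_sum_erase B _ hvB]
        have hout : ∀ x ∈ B.erase v, ∀ b, outE G (A \ B) bd b x = 0 := by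
          intro x hx b
          unfold outE
          rw [hp, Finset.card_eq_zero, Finset.filter_eq_empty_iff]
          rintro y hy ⟨ha, _⟩
          rw [Finset.mem_singleton.mp hy] at ha
          rw [Finset.mem_erase] at hx
          exact hx.1 (honly x (hF.sub hx.2) ha.symm)
        have hz : ∑ x ∈ B.erase v, (if σ x = 1 then 3 * (outE G (A \ B) bd false x : ℤ) - 2 * outE G (A \ B) bd true x
            else if σ x = 2 then - 2 * (outE G (A \ B) bd false x : ℤ) - 2 * outE G (A \ B) bd true x else 0) = 0 := by
          apply Finset.sum_eq_zero
          intro x hx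
          rw [hout x hx, hout x hx]; simp
        rw [hz]
        have e1 : outE G (A \ B) bd false v = 0 := by
          unfold outE; rw [hp, Finset.card_eq_zero, Finset.filter_eq_empty_iff]
          rintro y hy ⟨_, h⟩
          rw [Finset.mem_singleton.mp hy, hbd] at h; cases h
        have e2 : outE G (A \ B) bd true v = 1 := by
          unfold outE; rw [hp, Finset.card_eq_one]
          refine ⟨p, ?_⟩
          ext y; simp only [Finset.mem_filter, Finset.mem_singleton]
          constructor
          · exact fun h => h.1
          · rintro rfl; exact ⟨rfl, hvp, hbd⟩
        rw [e1, e2]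
        have := hσ v hvB
        by_cases h1 : σ v = 1
        · simp [h1]
        · have h2 : σ v = 2 := by omega
          simp [h2]
      rw [hAs]
      rw [hlc] at hv hv1
      have hcp : ∀ s, cs G A σ s p = if σ v = s then 1 else 0 := by
        intro s
        unfold cs
        split_ifs with h
        · rw [Finset.card_eq_one]
          refine ⟨v, ?_⟩
          ext y; simp only [Finset.mem_filter, Finset.mem_singleton]
          constructor
          · exact fun hh => honly y hh.1 hh.2.1
          · rintro rfl; exact ⟨hF.sub hvB, hvp.symm, h⟩
        · rw [Finset.card_eq_zero, Finset.filter_eq_empty_iff]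
          rintro y hy ⟨ha, hh⟩
          rw [honly y hy ha] at hh; exact h hh
      have hWn := Wn_single (fs p) (fu p) (hG.one p hpA hdp)
      unfold ctr at *
      unfold fs' at *
      rw [if_pos hp0, hdp, hcp, hcp]
      have := hσ v hvB
      by_cases h1 : σ v = 1
      · have h3 := hWn.1
        have h4 := hv1 h1
        simp only [h1, if_true, if_neg (show ¬ (1 : ℕ) = 2 by norm_num)]
        simp only [show (1 - 1 - 0 : ℕ) = 0 from rfl, show Nat.ble 1 1 = true from rfl, show Nat.ble 1 0 = false from rfl,
          Bool.or_false]
        zify at h3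
        linarith
      · have h2 : σ v = 2 := by omega
        have h3 := hWn.2
        simp only [h2, if_true, if_neg (show ¬ (2 : ℕ) = 1 by norm_num)]
        simp only [show (1 - 0 - 1 : ℕ) = 0 from rfl, show Nat.ble 1 1 = true from rfl, show Nat.ble 1 0 = false from rfl,
          Bool.or_false]
        zify at h3
        linarith
end graph

/-! ### Realizations of shapes -/
section real
set_option linter.unusedSectionVars false
variable {V : Type*} [DecidableEq V] {G : SimpleGraph V} [DecidableRel G.Adj]
variable {A : Finset V} {fs fu : V → Bool} {σ : V → ℕ}

def tyOK (G : SimpleGraph V) [DecidableRel G.Adj] (A : Finset V) (fs fu : V → Bool) (t : ℕ) (x : V) : Prop :=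
  Wn (dg G A x) (fs x) (fu x) = tW t ∧ dg G A x = tR t ∧ (tS t = true → fs x = true) ∧ (tU t = true → fu x = true)

structure Real (G : SimpleGraph V) [DecidableRel G.Adj] (A : Finset V) (fs fu : V → Bool)
    (bd : V → V → Bool) (d : List Node) (f : ℕ → V) (B : Finset V) : Prop where
  inj : ∀ i < d.length, ∀ j < d.length, f i = f j → i = j
  img : ∀ x, x ∈ B ↔ ∃ i < d.length, f i = x
  sub : B ⊆ A
  adj : ∀ i < d.length, ∀ j < d.length, G.Adj (f i) (f j) ↔ j ∈ (nd d i).2.2.2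
  nodup : ∀ i < d.length, (nd d i).2.2.2.Nodup
  lt : ∀ i < d.length, ∀ j ∈ (nd d i).2.2.2, j < d.length
  ty : ∀ i < d.length, tyOK G A fs fu (nd d i).1 (f i)
  out : ∀ i < d.length, outE G (A \ B) bd false (f i) = (nd d i).2.1
  bad : ∀ i < d.length, outE G (A \ B) bd true (f i) = (nd d i).2.2.1

theorem Wn_anti (d : ℕ) (f g f' g' : Bool) (hf : f = true → f' = true) (hg : g = true → g' = true) :
    Wn d f' g' ≤ Wn d f g := by
  rcases d with _ | _ | _ | d
  · revert f g f' g'; decide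
  · revert f g f' g'; decide
  · revert f g f' g'; decide
  · have : ∀ a b, Wn (d + 3) a b = 8 := fun a b => rfl
    rw [this, this]

theorem node_val {B : Finset V} {bd : V → V → Bool} {t : ℕ} {x : V} (ht : tyOK G A fs fu t x) (hs : σ x < 3) :
    (ndP t (outE G (A \ B) bd false x) (σ x) : ℤ) -
      ndM t (outE G (A \ B) bd false x) (outE G (A \ B) bd true x) (σ x) (cs G A σ 1 x) (cs G A σ 2 x)
      ≤ lc G A B fs fu bd σ x := by
  obtain ⟨h1, h2, h3, h4⟩ := ht
  unfold lc ctr fs'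
  rw [h1]
  have hc : σ x = 0 ∨ σ x = 1 ∨ σ x = 2 := by omega
  rcases hc with h | h | h
  · simp only [h, if_true, ndP, ndM]
    have := Wn_anti (dg G A x - cs G A σ 1 x - cs G A σ 2 x) (tS t || Nat.ble 1 (cs G A σ 1 x))
      (tU t || Nat.ble 1 (cs G A σ 2 x)) (fs x || Nat.ble 1 (cs G A σ 1 x)) (fu x || Nat.ble 1 (cs G A σ 2 x))
      (by simp only [Bool.or_eq_true]; tauto) (by simp only [Bool.or_eq_true]; tauto)
    rw [h2] at this ⊢
    have e : Nat.beq 0 1 = false := rfl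
    have e2 : Nat.beq 0 0 = true := rfl
    rw [e, e2, bi_false, bi_true, oo_eq, oo_eq]
    have e3 : Nat.sub (Nat.sub (tR t) (cs G A σ 1 x)) (cs G A σ 2 x) = tR t - cs G A σ 1 x - cs G A σ 2 x := rfl
    rw [e3]
    have h' : ((Wn (tR t - cs G A σ 1 x - cs G A σ 2 x) (fs x || Nat.ble 1 (cs G A σ 1 x))
      (fu x || Nat.ble 1 (cs G A σ 2 x)) : ℕ) : ℤ) ≤ ((Wn (tR t - cs G A σ 1 x - cs G A σ 2 x)
      (tS t || Nat.ble 1 (cs G A σ 1 x)) (tU t || Nat.ble 1 (cs G A σ 2 x)) : ℕ) : ℤ) := by exact_mod_cast this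
    simp only [if_neg (show ¬ (0 : ℕ) = 1 by norm_num), if_neg (show ¬ (0 : ℕ) = 2 by norm_num)]
    linarith
  · simp only [h, ndP, ndM]
    have e : Nat.beq 1 1 = true := rfl
    have e2 : Nat.beq 1 0 = false := rfl
    rw [e, e2, bi_false, bi_true, bi_true]
    simp only [Nat.add_eq, Nat.mul_eq]
    push_cast
    simp
    linarith
  · simp only [h, ndP, ndM]
    have e : Nat.beq 2 1 = false := rfl
    have e2 : Nat.beq 2 0 = false := rfl
    rw [e, e2, bi_false, bi_false, bi_false]
    simp only [Nat.add_eq, Nat.mul_eq]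
    push_cast
    simp
    linarith

theorem node_ok {t : ℕ} {x : V} (ht : tyOK G A fs fu t x) (h2 : σ x = 2)
    (ho : ndOk t (σ x) (cs G A σ 1 x) (cs G A σ 2 x) = true) :
    fs' G A fs σ 1 x = true ∧ fs' G A fu σ 2 x = true := by
  obtain ⟨_, _, h3, h4⟩ := ht
  unfold ndOk at ho
  rw [h2] at ho
  have e : Nat.beq 2 2 = true := rfl
  rw [e, bi_true] at ho
  simp only [an_eq, oo_eq, Bool.and_eq_true, Bool.or_eq_true, natble] at ho
  rw [fs'_true, fs'_true]
  have := ho.1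
  have := ho.2
  constructor <;> [skip; skip] <;> tauto

theorem cnt_eq (m s : ℕ) (l : List ℕ) : cnt m s l = (l.filter fun j => dig m j = s).length := by
  induction l with
  | nil => rfl
  | cons a l ih =>
    have e : cnt m s (a :: l) = bi (Nat.beq (dig m a) s) (Nat.succ (cnt m s l)) (cnt m s l) := rfl
    rw [e, bi_eq, ih, List.filter_cons]
    simp only [natbeq]
    by_cases h : dig m a = s <;> simp [h]

variable {bd : V → V → Bool} {d : List Node} {f : ℕ → V} {B : Finset V}

theorem Real.mem (h : Real G A fs fu bd d f B) {i : ℕ} (hi : i < d.length) : f i ∈ B := (h.img _).mpr ⟨i, hi, rfl⟩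

theorem Real.image (h : Real G A fs fu bd d f B) : B = (Finset.range d.length).image f := by
  ext x
  rw [h.img]; simp

theorem Real.sum (h : Real G A fs fu bd d f B) (g : V → ℤ) : ∑ x ∈ B, g x = ∑ i ∈ Finset.range d.length, g (f i) := by
  rw [h.image, Finset.sum_image]
  intro i hi j hj
  exact h.inj i (by simpa using hi) j (by simpa using hj)

theorem Real.count (h : Real G A fs fu bd d f B) {m : ℕ} (hm : ∀ j < d.length, σ (f j) = dig m j)
    {i : ℕ} (hi : i < d.length) (s : ℕ) :
    cs G A σ s (f i) = cnt m s (nd d i).2.2.2 + ((A \ B).filter fun y => G.Adj (f i) y ∧ σ y = s).card := by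
  have e : cnt m s (nd d i).2.2.2 = (B.filter fun y => G.Adj (f i) y ∧ σ y = s).card := by
    rw [cnt_eq, ← List.toFinset_card_of_nodup ((h.nodup i hi).filter _)]
    symm
    have : (B.filter fun y => G.Adj (f i) y ∧ σ y = s) =
        (List.toFinset ((nd d i).2.2.2.filter fun j => dig m j = s)).image f := by
      ext y
      simp only [Finset.mem_filter, Finset.mem_image, List.mem_toFinset, List.mem_filter, decide_eq_true_eq]
      constructor
      · rintro ⟨hy, ha, hs⟩
        obtain ⟨j, hj, rfl⟩ := (h.img y).mp hy
        exact ⟨j, ⟨(h.adj i hi j hj).mp ha, by rw [← hm j hj]; exact hs⟩, rfl⟩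
      · rintro ⟨j, ⟨hj, hs⟩, rfl⟩
        have hjl := h.lt i hi j hj
        exact ⟨h.mem hjl, (h.adj i hi j hjl).mpr hj, by rw [hm j hjl]; exact hs⟩
    rw [this, Finset.card_image_of_injOn]
    intro j hj k hk
    simp only [Finset.mem_coe, List.mem_toFinset, List.mem_filter] at hj hk
    exact h.inj j (h.lt i hi j hj.1) k (h.lt i hi k hk.1)
  rw [e]
  unfold cs
  rw [← Finset.card_union_of_disjoint, ← Finset.filter_union, Finset.union_sdiff_of_subset h.sub]
  exact Finset.disjoint_filter_filter Finset.disjoint_sdiff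

theorem Real.vals (h : Real G A fs fu bd d f B) {B' : Finset V} {bd' : V → V → Bool} {m md lo : ℕ}
    (hm : ∀ j < d.length, σ (f j) = dig m j) (hk : ChkOK d m md lo)
    (ho : ∀ i < d.length, outE G (A \ B') bd' false (f i) = (nd d i).2.1)
    (hb : ∀ i < d.length, outE G (A \ B') bd' true (f i) = bdv md (nd d i).2.2.1)
    (he : ∀ i < d.length, ∀ s, s = 1 ∨ s = 2 →
      ((A \ B).filter fun y => G.Adj (f i) y ∧ σ y = s).card = exS d.length i md s) :
    (lo : ℤ) - 64 ≤ ∑ x ∈ B, lc G A B' fs fu bd' σ x ∧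
    ∀ x ∈ B, σ x = 2 → fs' G A fs σ 1 x = true ∧ fs' G A fu σ 2 x = true := by
  have hns : ∀ i < d.length, ∀ s, s = 1 ∨ s = 2 → cs G A σ s (f i) = nsD d m md i s := by
    intro i hi s hs
    rw [h.count hm hi, he i hi s hs]; rfl
  constructor
  · rw [h.sum]
    have h1 : ∑ i ∈ Finset.range d.length, ((pD d m i : ℤ) - mD d m md i) ≤
        ∑ i ∈ Finset.range d.length, lc G A B' fs fu bd' σ (f i) := by
      apply Finset.sum_le_sum
      intro i hi
      rw [Finset.mem_range] at hi
      have := node_val (B := B') (bd := bd') (σ := σ) (h.ty i hi) (by rw [hm i hi]; exact dig_lt _ _)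
      rw [ho i hi, hb i hi, hns i hi 1 (Or.inl rfl), hns i hi 2 (Or.inr rfl), hm i hi] at this
      exact this
    rw [Finset.sum_sub_distrib] at h1
    simp only [← Nat.cast_sum] at h1
    have := hk.val
    omega
  · intro x hx h2
    obtain ⟨i, hi, rfl⟩ := (h.img x).mp hx
    apply node_ok (h.ty i hi) h2
    rw [hns i hi 1 (Or.inl rfl), hns i hi 2 (Or.inr rfl), hm i hi]
    exact hk.ok i hi

theorem Real.reach (h : Real G A fs fu bd d f B) {m md lo : ℕ}
    (hm : ∀ j < d.length, σ (f j) = dig m j) (hk : ChkOK d m md lo) (E : Finset V)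
    (hE : ∀ x ∈ E, ∀ y ∈ A, σ y = 0 → G.Adj x y → y ∈ E)
    (hb : ∀ j < d.length, dig m j = 0 → isBase d.length j md (nd d j).2.1 (nd d j).2.2.1 = true → f j ∈ E) :
    ∀ x ∈ B, σ x = 0 → x ∈ E := by
  intro x hx h0
  obtain ⟨i, hi, rfl⟩ := (h.img x).mp hx
  refine hk.reach (fun j => f j ∈ E) hb ?_ i hi (by rw [← hm i hi]; exact h0)
  intro j hj hj0 k hkk hkE
  have hkl := h.lt j hj k hkk
  exact hE (f k) hkE (f j) (h.sub (h.mem hj)) (by rw [hm j hj]; exact hj0) ((h.adj j hj k hkl).mpr hkk).symm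

theorem Real.exists_state (h : Real G A fs fu bd d f B) (m : ℕ) :
    ∃ σ : V → ℕ, (∀ j < d.length, σ (f j) = dig m j) ∧ ∀ x ∉ B, σ x = 0 := by
  classical
  refine ⟨fun x => if hx : ∃ j < d.length, f j = x then dig m hx.choose else 0, ?_, ?_⟩
  · intro j hj
    have hx : ∃ k < d.length, f k = f j := ⟨j, hj, rfl⟩
    simp only
    rw [dif_pos hx]
    rw [h.inj _ hx.choose_spec.1 j hj hx.choose_spec.2]
  · intro x hx
    simp only
    rw [dif_neg]
    rwa [h.img] at hx

theorem exS_three (n i s : ℕ) (hs : s = 1 ∨ s = 2) : exS n i 3 s = 0 := by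
  unfold exS
  rcases hs with rfl | rfl <;> rfl

theorem Real.filter_zero (hz : ∀ x ∉ B, σ x = 0) {s : ℕ} (hs : s = 1 ∨ s = 2) (x : V) :
    ((A \ B).filter fun y => G.Adj x y ∧ σ y = s).card = 0 := by
  rw [Finset.card_eq_zero, Finset.filter_eq_empty_iff]
  rintro y hy ⟨_, hh⟩
  have := hz y (Finset.mem_sdiff.mp hy).2
  omega

theorem Real.red (h : Real G A fs fu bd d f B) (hG : Good G A fs fu) (hI : IHyp G A.card)
    (hF : Frame G A B bd) (hC : Conn G (A \ B)) {z : Prop} (hr : Red z d)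
    (hC2 : 2 ≤ (A \ B).card ∨ ∃ p, A \ B = {p} ∧ 0 < d.length ∧ dg G A p = 1 ∧ G.Adj (f (d.length - 1)) p ∧
      bd (f (d.length - 1)) p = true ∧ z) : Bd G A fs fu := by
  obtain ⟨m, ⟨i, hi, hne⟩, hk, hk1⟩ := hr
  obtain ⟨σ, hm, hz⟩ := h.exists_state m
  have vals := fun lo hk => h.vals (B' := B) (bd' := bd) (md := 3) (lo := lo) hm hk h.out h.bad
    (fun i _ s hs => by rw [exS_three _ _ _ hs, Real.filter_zero hz hs])
  obtain ⟨v1, v2⟩ := vals 64 hk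
  refine frame (σ := σ) hG hI hF hC (fun w hw => hz w (Finset.mem_sdiff.mp hw).2) ?_ ⟨f i, h.mem hi, by rw [hm i hi]; exact hne⟩
    v2 ?_ (by simpa using v1) ?_
  · intro x hx
    obtain ⟨i, hi, rfl⟩ := (h.img x).mp hx
    rw [hm i hi]; exact dig_lt _ _
  · intro E hCE hE
    refine h.reach hm hk E hE ?_
    intro j hj hj0 hbase
    have : ∃ w ∈ A \ B, G.Adj (f j) w := by
      unfold isBase at hbase
      simp only [oo_eq, an_eq, Bool.or_eq_true, Bool.and_eq_true, natble, natbeq] at hbase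
      rcases hbase with hb | hb | hb
      · rw [← h.out j hj] at hb
        obtain ⟨w, hw⟩ := Finset.card_pos.mp hb
        rw [Finset.mem_filter] at hw
        exact ⟨w, hw.1, hw.2.1⟩
      · have hb : 0 < (nd d j).2.2.1 := hb
        rw [← h.bad j hj] at hb
        obtain ⟨w, hw⟩ := Finset.card_pos.mp hb
        rw [Finset.mem_filter] at hw
        exact ⟨w, hw.1, hw.2.1⟩
      · omega
    obtain ⟨w, hw, ha⟩ := this
    exact hE w (hCE hw) (f j) (h.sub (h.mem hj)) (by rw [hm j hj]; exact hj0) ha.symm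
  · rcases hC2 with hC2 | ⟨p, hp, hn, hd, ha, hb, hzz⟩
    · exact Or.inl hC2
    · refine Or.inr ⟨p, f (d.length - 1), hp, h.mem (by omega), hd, ha, hb, ?_⟩
      intro h1
      rw [hm _ (by omega)] at h1
      have := (vals 65 (hk1 hzz h1)).1
      simpa using this

theorem Real.fin (h : Real G A fs fu bd d f A) (hr : Fin' d) : Bd G A fs fu := by
  obtain ⟨m, hne, hk⟩ := hr
  obtain ⟨σ, hm, hz⟩ := h.exists_state m
  obtain ⟨v1, v2⟩ := h.vals (B' := A) (bd' := bd) (md := 3) hm hk h.out h.bad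
    (fun i _ s hs => by rw [exS_three _ _ _ hs, Real.filter_zero hz hs])
  refine reduce_empty (σ := σ) ?_ ?_ v2 ?_
  · intro x hx
    obtain ⟨i, hi, rfl⟩ := (h.img x).mp hx
    rw [hm i hi]; exact dig_lt _ _
  · intro x hx
    obtain ⟨i, hi, rfl⟩ := (h.img x).mp hx
    rw [hm i hi]; exact hne i hi
  · have : ∀ x, lc G A A fs fu bd σ x = ctr G A fs fu σ x := by
      intro x
      unfold lc outE
      simp
    simp only [this] at v1
    norm_num at v1
    exact v1
end real

section ops
set_option linter.unusedSectionVars false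
variable {V : Type*} [DecidableEq V] {G : SimpleGraph V} [DecidableRel G.Adj]
variable {A : Finset V} {fs fu : V → Bool} {σ : V → ℕ}
variable {bd bd' : V → V → Bool} {d : List Node} {f : ℕ → V} {B : Finset V}

theorem outE_congr {C : Finset V} {b : Bool} {x : V} (h : ∀ w ∈ C, G.Adj x w → bd' x w = bd x w) :
    outE G C bd' b x = outE G C bd b x := by
  unfold outE
  congr 1
  apply Finset.filter_congr
  intro w hw
  constructor
  · rintro ⟨ha, hb⟩; exact ⟨ha, by rw [← h w hw ha]; exact hb⟩
  · rintro ⟨ha, hb⟩; exact ⟨ha, by rw [h w hw ha]; exact hb⟩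

theorem Real.single {v : V} (hv : v ∈ A) {t out bad : ℕ} (ht : tyOK G A fs fu t v)
    (ho : outE G (A \ {v}) bd false v = out) (hb : outE G (A \ {v}) bd true v = bad) :
    Real G A fs fu bd [(t, out, bad, [])] (fun _ => v) {v} := by
  constructor
  · intro i hi j hj _
    simp only [List.length_singleton] at hi hj; omega
  · intro x; simp only [Finset.mem_singleton, List.length_singleton]
    constructor
    · rintro rfl; exact ⟨0, by norm_num, rfl⟩
    · rintro ⟨_, _, rfl⟩; rfl
  · simpa using hv
  · intro i hi j hj
    obtain rfl : i = 0 := by simp at hi; exact hi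
    simp
  · intro i hi
    obtain rfl : i = 0 := by simp at hi; exact hi
    simp
  · intro i hi
    obtain rfl : i = 0 := by simp at hi; exact hi
    simp
  · intro i hi
    obtain rfl : i = 0 := by simp at hi; exact hi
    exact ht
  · intro i hi
    obtain rfl : i = 0 := by simp at hi; exact hi
    exact ho
  · intro i hi
    obtain rfl : i = 0 := by simp at hi; exact hi
    exact hb

theorem Real.addNode (h : Real G A fs fu bd d f B) {v : V} (hvA : v ∈ A) (hvB : v ∉ B)
    {t out bad : ℕ} {nbB nbO : List ℕ} (hnd : (nbB ++ nbO).Nodup) (hlt : ∀ i ∈ nbB ++ nbO, i < d.length)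
    (hB : ∀ i < d.length, (G.Adj (f i) v ∧ bd (f i) v = true) ↔ i ∈ nbB)
    (hO : ∀ i < d.length, (G.Adj (f i) v ∧ bd (f i) v = false) ↔ i ∈ nbO)
    (hbd : ∀ x ∈ B, ∀ w ∈ A \ insert v B, G.Adj x w → bd' x w = bd x w)
    (ht : tyOK G A fs fu t v)
    (ho : outE G (A \ insert v B) bd' false v = out) (hb : outE G (A \ insert v B) bd' true v = bad) :
    Real G A fs fu bd' (RDom.addNode d t nbB nbO out bad) (Function.update f d.length v) (insert v B) := by
  have hlen := addNode_length d t nbB nbO out bad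
  have fn : Function.update f d.length v d.length = v := by simp
  have fl : ∀ i < d.length, Function.update f d.length v i = f i := by
    intro i hi; rw [Function.update_of_ne (by omega)]
  have hcase : ∀ i < d.length + 1, i < d.length ∨ i = d.length := by intro i hi; omega
  have hfv : ∀ i < d.length, f i ≠ v := fun i hi hc => hvB (hc ▸ h.mem hi)
  have hadjv : ∀ i < d.length, G.Adj (f i) v ↔ i ∈ nbB ++ nbO := by
    intro i hi
    rw [List.mem_append, ← hB i hi, ← hO i hi]
    cases bd (f i) v <;> simp
  have ndlt := fun i hi => addNode_nd_lt d t nbB nbO out bad i hi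
  have ndn := addNode_nd_last d t nbB nbO out bad
  have nblt : ∀ i < d.length, (nd (RDom.addNode d t nbB nbO out bad) i).2.2.2 =
      if i ∈ nbB ++ nbO then d.length :: (nd d i).2.2.2 else (nd d i).2.2.2 := by
    intro i hi
    rw [ndlt i hi]
    by_cases h1 : i ∈ nbB
    · simp [h1]
    · by_cases h2 : i ∈ nbO <;> simp [h1, h2]
  have hAB : A \ B = insert v (A \ insert v B) := by
    ext w; simp only [Finset.mem_sdiff, Finset.mem_insert]
    constructor
    · intro ⟨h1, h2⟩
      by_cases hw : w = v
      · exact Or.inl hw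
      · exact Or.inr ⟨h1, by tauto⟩
    · rintro (rfl | ⟨h1, h2⟩)
      · exact ⟨hvA, hvB⟩
      · exact ⟨h1, by tauto⟩
  have hvn : v ∉ A \ insert v B := by simp
  have hout : ∀ i < d.length, ∀ b, outE G (A \ B) bd b (f i) =
      outE G (A \ insert v B) bd' b (f i) + if G.Adj (f i) v ∧ bd (f i) v = b then 1 else 0 := by
    intro i hi b
    rw [outE_congr (bd := bd) (bd' := bd') (fun w hw ha => hbd _ (h.mem hi) w hw ha)]
    unfold outE
    rw [hAB, Finset.filter_insert]
    split_ifs with hc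
    · rw [Finset.card_insert_of_notMem (by simp)]
    · rfl
  constructor
  · intro i hi j hj hij
    rw [hlen] at hi hj
    rcases hcase i hi with hi | rfl <;> rcases hcase j hj with hj | rfl
    · rw [fl i hi, fl j hj] at hij; exact h.inj i hi j hj hij
    · rw [fl i hi, fn] at hij; exact absurd hij (hfv i hi)
    · rw [fl j hj, fn] at hij; exact absurd hij.symm (hfv j hj)
    · rfl
  · intro x
    rw [hlen, Finset.mem_insert, h.img]
    constructor
    · rintro (rfl | ⟨i, hi, rfl⟩)
      · exact ⟨d.length, by omega, fn⟩
      · exact ⟨i, by omega, fl i hi⟩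
    · rintro ⟨i, hi, rfl⟩
      rcases hcase i hi with hi | rfl
      · exact Or.inr ⟨i, hi, (fl i hi).symm⟩
      · exact Or.inl fn
  · intro x hx
    rcases Finset.mem_insert.mp hx with rfl | hx
    · exact hvA
    · exact h.sub hx
  · intro i hi j hj
    rw [hlen] at hi hj
    rcases hcase i hi with hi | rfl
    · rw [nblt i hi, fl i hi]
      rcases hcase j hj with hj | rfl
      · rw [fl j hj, h.adj i hi j hj]
        split_ifs
        · simp only [List.mem_cons]
          constructor
          · exact Or.inr
          · rintro (h | h)
            · omega
            · exact h
        · rfl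
      · rw [fn, hadjv i hi]
        split_ifs with hc
        · simp [hc]
        · constructor
          · intro h; exact absurd h hc
          · intro hh
            have := h.lt i hi _ hh; omega
    · rw [ndn, fn]
      rcases hcase j hj with hj | rfl
      · rw [fl j hj, G.adj_comm, hadjv j hj]
      · rw [fn]
        constructor
        · intro h; exact absurd h (G.loopless.irrefl v)
        · intro hh; have := hlt _ hh; omega
  · intro i hi
    rw [hlen] at hi
    rcases hcase i hi with hi | rfl
    · rw [nblt i hi]
      split_ifs
      · rw [List.nodup_cons]
        exact ⟨fun hh => by have := h.lt i hi _ hh; omega, h.nodup i hi⟩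
      · exact h.nodup i hi
    · rw [ndn]; exact hnd
  · intro i hi j hj
    rw [hlen] at hi ⊢
    rcases hcase i hi with hi | rfl
    · rw [nblt i hi] at hj
      split_ifs at hj
      · rcases List.mem_cons.mp hj with rfl | hj
        · omega
        · have := h.lt i hi j hj; omega
      · have := h.lt i hi j hj; omega
    · rw [ndn] at hj; have := hlt j hj; omega
  · intro i hi
    rw [hlen] at hi
    rcases hcase i hi with hi | rfl
    · rw [fl i hi, ndlt i hi]
      have := h.ty i hi
      split_ifs <;> exact this
    · rw [fn, ndn]; exact ht
  · intro i hi
    rw [hlen] at hi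
    rcases hcase i hi with hi | rfl
    · rw [fl i hi, ndlt i hi]
      have h1 := hout i hi false
      rw [h.out i hi] at h1
      have h2 := hO i hi
      have h3 := hB i hi
      by_cases hcB : i ∈ nbB
      · rw [if_pos hcB]
        have : ¬ (G.Adj (f i) v ∧ bd (f i) v = false) := by
          intro hh; have := (h3.mpr hcB).2; rw [hh.2] at this; cases this
        rw [if_neg this] at h1
        simp only; omega
      · rw [if_neg hcB]
        by_cases hcO : i ∈ nbO
        · rw [if_pos hcO]
          rw [if_pos (h2.mpr hcO)] at h1
          simp only; omega
        · rw [if_neg hcO]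
          rw [if_neg (fun hh => hcO (h2.mp hh))] at h1
          omega
    · rw [fn, ndn]; exact ho
  · intro i hi
    rw [hlen] at hi
    rcases hcase i hi with hi | rfl
    · rw [fl i hi, ndlt i hi]
      have h1 := hout i hi true
      rw [h.bad i hi] at h1
      have h2 := hO i hi
      have h3 := hB i hi
      by_cases hcB : i ∈ nbB
      · rw [if_pos hcB]
        rw [if_pos (h3.mpr hcB)] at h1
        simp only; omega
      · rw [if_neg hcB]
        rw [if_neg (fun hh => hcB (h3.mp hh))] at h1
        split_ifs <;> (try simp only) <;> omega
    · rw [fn, ndn]; exact hb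

theorem Real.merge {bd1 bd2 : V → V → Bool} {d1 d2 : List Node} {f1 f2 : ℕ → V} {B1 B2 : Finset V}
    (h1 : Real G A fs fu bd1 d1 f1 B1) (h2 : Real G A fs fu bd2 d2 f2 B2) (hdis : Disjoint B1 B2)
    (hna : ∀ x ∈ B1, ∀ y ∈ B2, ¬ G.Adj x y)
    (hb1 : ∀ x ∈ B1, ∀ w ∈ A \ B1, G.Adj x w → bd x w = bd1 x w)
    (hb2 : ∀ x ∈ B2, ∀ w ∈ A \ B2, G.Adj x w → bd x w = bd2 x w) :
    Real G A fs fu bd (mergeS d1 d2) (fun i => if i < d1.length then f1 i else f2 (i - d1.length)) (B1 ∪ B2) := by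
  have hlen := mergeS_length d1 d2
  set f : ℕ → V := fun i => if i < d1.length then f1 i else f2 (i - d1.length) with hf
  have fl : ∀ i < d1.length, f i = f1 i := by intro i hi; simp [hf, hi]
  have fg : ∀ i, f (d1.length + i) = f2 i := by intro i; simp [hf]
  have hcase : ∀ i < d1.length + d2.length, i < d1.length ∨ ∃ j < d2.length, i = d1.length + j := by
    intro i hi
    by_cases h : i < d1.length
    · exact Or.inl h
    · exact Or.inr ⟨i - d1.length, by omega, by omega⟩
  have hne : ∀ i < d1.length, ∀ j < d2.length, f1 i ≠ f2 j := by
    intro i hi j hj hc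
    exact Finset.disjoint_left.mp hdis (h1.mem hi) (hc ▸ h2.mem hj)
  have shm : ∀ (x : Node) j, d1.length + j ∈ (shiftNode d1.length x).2.2.2 ↔ j ∈ x.2.2.2 := by
    intro x j
    simp only [shiftNode, List.mem_map]
    constructor
    · rintro ⟨a, ha, he⟩
      have he : d1.length + a = d1.length + j := he
      obtain rfl : a = j := by omega
      exact ha
    · intro h; exact ⟨j, h, rfl⟩
  have shl : ∀ (x : Node) i, i ∈ (shiftNode d1.length x).2.2.2 → ∃ j ∈ x.2.2.2, i = d1.length + j := by
    intro x i
    simp only [shiftNode, List.mem_map]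
    rintro ⟨a, ha, he⟩
    exact ⟨a, ha, he.symm⟩
  have o1 : ∀ i < d1.length, ∀ b, outE G (A \ (B1 ∪ B2)) bd b (f1 i) = outE G (A \ B1) bd1 b (f1 i) := by
    intro i hi b
    rw [← outE_congr (bd := bd1) (bd' := bd) (fun w hw ha => hb1 _ (h1.mem hi) w hw ha)]
    unfold outE
    congr 1
    ext w
    simp only [Finset.mem_filter, Finset.mem_sdiff, Finset.mem_union]
    constructor
    · tauto
    · rintro ⟨⟨h3, h4⟩, h5, h6⟩
      have : w ∉ B2 := fun hw => hna _ (h1.mem hi) w hw h5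
      tauto
  have o2 : ∀ i < d2.length, ∀ b, outE G (A \ (B1 ∪ B2)) bd b (f2 i) = outE G (A \ B2) bd2 b (f2 i) := by
    intro i hi b
    rw [← outE_congr (bd := bd2) (bd' := bd) (fun w hw ha => hb2 _ (h2.mem hi) w hw ha)]
    unfold outE
    congr 1
    ext w
    simp only [Finset.mem_filter, Finset.mem_sdiff, Finset.mem_union]
    constructor
    · tauto
    · rintro ⟨⟨h3, h4⟩, h5, h6⟩
      have : w ∉ B1 := fun hw => hna w hw _ (h2.mem hi) h5.symm
      tauto
  constructor
  · intro i hi j hj hij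
    rw [hlen] at hi hj
    replace hi := hcase i hi; replace hj := hcase j hj
    rcases hi with hi | ⟨i, hi, rfl⟩ <;> rcases hj with hj | ⟨j, hj, rfl⟩
    · rw [fl i hi, fl j hj] at hij; exact h1.inj i hi j hj hij
    · rw [fl i hi, fg] at hij; exact absurd hij (hne i hi j hj)
    · rw [fl j hj, fg] at hij; exact absurd hij.symm (hne j hj i hi)
    · rw [fg, fg] at hij; rw [h2.inj i hi j hj hij]
  · intro x
    rw [hlen, Finset.mem_union, h1.img, h2.img]
    constructor
    · rintro (⟨i, hi, rfl⟩ | ⟨i, hi, rfl⟩)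
      · exact ⟨i, by omega, fl i hi⟩
      · exact ⟨d1.length + i, by omega, fg i⟩
    · rintro ⟨i, hi, rfl⟩
      replace hi := hcase i hi
      rcases hi with hi | ⟨i, hi, rfl⟩
      · exact Or.inl ⟨i, hi, (fl i hi).symm⟩
      · exact Or.inr ⟨i, hi, (fg i).symm⟩
  · exact Finset.union_subset h1.sub h2.sub
  · intro i hi j hj
    rw [hlen] at hi hj
    replace hi := hcase i hi; replace hj := hcase j hj
    rcases hi with hi | ⟨i, hi, rfl⟩ <;> rcases hj with hj | ⟨j, hj, rfl⟩
    · rw [mergeS_nd_lt _ _ _ hi, fl i hi, fl j hj]; exact h1.adj i hi j hj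
    · rw [mergeS_nd_lt _ _ _ hi, fl i hi, fg]
      constructor
      · intro h; exact absurd h (hna _ (h1.mem hi) _ (h2.mem hj))
      · intro h; have := h1.lt i hi _ h; omega
    · rw [mergeS_nd_ge _ _ _ hi, fl j hj, fg]
      constructor
      · intro h; exact absurd h.symm (hna _ (h1.mem hj) _ (h2.mem hi))
      · intro h; obtain ⟨k, _, hk⟩ := shl _ _ h; omega
    · rw [mergeS_nd_ge _ _ _ hi, fg, fg, shm]; exact h2.adj i hi j hj
  · intro i hi
    rw [hlen] at hi
    replace hi := hcase i hi
    rcases hi with hi | ⟨i, hi, rfl⟩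
    · rw [mergeS_nd_lt _ _ _ hi]; exact h1.nodup i hi
    · rw [mergeS_nd_ge _ _ _ hi]
      simp only [shiftNode]
      apply List.Nodup.map _ (h2.nodup i hi)
      intro a b hab
      have hab : d1.length + a = d1.length + b := hab
      omega
  · intro i hi j hj
    rw [hlen] at hi ⊢
    replace hi := hcase i hi
    rcases hi with hi | ⟨i, hi, rfl⟩
    · rw [mergeS_nd_lt _ _ _ hi] at hj; have := h1.lt i hi j hj; omega
    · rw [mergeS_nd_ge _ _ _ hi] at hj
      obtain ⟨k, hk, rfl⟩ := shl _ _ hj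
      have := h2.lt i hi k hk; omega
  · intro i hi
    rw [hlen] at hi
    replace hi := hcase i hi
    rcases hi with hi | ⟨i, hi, rfl⟩
    · rw [mergeS_nd_lt _ _ _ hi, fl i hi]; exact h1.ty i hi
    · rw [mergeS_nd_ge _ _ _ hi, fg]; exact h2.ty i hi
  · intro i hi
    rw [hlen] at hi
    replace hi := hcase i hi
    rcases hi with hi | ⟨i, hi, rfl⟩
    · rw [mergeS_nd_lt _ _ _ hi, fl i hi, o1 i hi]; exact h1.out i hi
    · rw [mergeS_nd_ge _ _ _ hi, fg, o2 i hi]; exact h2.out i hi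
  · intro i hi
    rw [hlen] at hi
    replace hi := hcase i hi
    rcases hi with hi | ⟨i, hi, rfl⟩
    · rw [mergeS_nd_lt _ _ _ hi, fl i hi, o1 i hi]; exact h1.bad i hi
    · rw [mergeS_nd_ge _ _ _ hi, fg, o2 i hi]; exact h2.bad i hi
end ops

/-! ### Two branches below a vertex -/
section two
set_option linter.unusedSectionVars false
variable {V : Type*} [DecidableEq V] {G : SimpleGraph V} [DecidableRel G.Adj]
variable {A : Finset V} {fs fu : V → Bool} {σ : V → ℕ}
variable {d : List Node} {f : ℕ → V} {B B1 B2 : Finset V} {v p : V}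

/-- the only bad edge goes from `v` to `p` -/
def bdp (v p : V) : V → V → Bool := fun x w => decide (x = v ∧ w = p)

theorem bdp_true {v p x w : V} : bdp v p x w = true ↔ x = v ∧ w = p := by simp [bdp]
theorem bdp_false {v p x w : V} : bdp v p x w = false ↔ ¬ (x = v ∧ w = p) := by
  unfold bdp; rw [decide_eq_false_iff_not]

theorem tyOK_three {x : V} (h : dg G A x = 3) : tyOK G A fs fu 0 x := by
  refine ⟨?_, h, ?_, ?_⟩
  · rw [h]
    have : ∀ a b : Bool, Wn 3 a b = tW 0 := by decide
    exact this _ _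
  · intro h; exact absurd h (by decide)
  · intro h; exact absurd h (by decide)

theorem tyOK_two {x : V} (h : dg G A x = 2) : ∃ t, (t = 1 ∨ t = 2) ∧ tyOK G A fs fu t x := by
  unfold tyOK
  rw [h]
  generalize fs x = a
  generalize fu x = b
  cases a
  · refine ⟨1, by norm_num, ?_⟩
    revert b; decide
  · refine ⟨2, by norm_num, ?_⟩
    revert b; decide

theorem tyOK_one {x : V} (h : dg G A x = 1) (h1 : fs x = true ∨ fu x = true) :
    ∃ t, (t = 3 ∨ t = 4 ∨ t = 5) ∧ tyOK G A fs fu t x := by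
  unfold tyOK
  rw [h]
  revert h1
  generalize fs x = a
  generalize fu x = b
  intro h1
  cases a <;> cases b
  · simp at h1
  · exact ⟨4, by decide⟩
  · exact ⟨3, by decide⟩
  · exact ⟨5, by decide⟩

theorem bdv_lt {md b : ℕ} (h : md < 3) : bdv md b = 0 := by
  unfold bdv; rw [bi_eq, if_neg]; rw [natbeq]; omega

theorem Real.child_out (h : Real G A fs fu (bdp (f (d.length - 1)) v) d f B1)
    (hvB1 : v ∉ B1) (hvB : v ∈ B) (hB : B1 ⊆ B)
    (hadj : ∀ x ∈ B1, ∀ w ∈ A \ B1, G.Adj x w → w = v ∨ w ∈ A \ B)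
    (hv1 : ∀ x ∈ B1, G.Adj x v ↔ x = f (d.length - 1)) {i : ℕ} (hi : i < d.length) :
    outE G (A \ B) (bdp v p) false (f i) = (nd d i).2.1 ∧ outE G (A \ B) (bdp v p) true (f i) = 0 := by
  have hne : f i ≠ v := fun hc => hvB1 (hc ▸ h.mem hi)
  constructor
  · rw [← h.out i hi]
    unfold outE
    congr 1
    ext w
    simp only [Finset.mem_filter, bdp_false]
    constructor
    · rintro ⟨hw, ha, _⟩
      rw [Finset.mem_sdiff] at hw
      exact ⟨Finset.mem_sdiff.mpr ⟨hw.1, fun hc => hw.2 (hB hc)⟩, ha, fun hc => hw.2 (hc.2 ▸ hvB)⟩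
    · rintro ⟨hw, ha, hn⟩
      rcases hadj _ (h.mem hi) w hw ha with rfl | hw'
      · exact absurd ⟨(hv1 _ (h.mem hi)).mp ha, rfl⟩ hn
      · exact ⟨hw', ha, fun hc => hne hc.1⟩
  · unfold outE
    rw [Finset.card_eq_zero, Finset.filter_eq_empty_iff]
    rintro w _ ⟨_, hb⟩
    exact hne (bdp_true.mp hb).1

theorem Real.child (h : Real G A fs fu (bdp (f (d.length - 1)) v) d f B1) (hn : 0 < d.length)
    (hvA : v ∈ A) (hvB1 : v ∉ B1) (hvB : v ∈ B) (hB : B1 ⊆ B)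
    (hadj : ∀ x ∈ B1, ∀ w ∈ A \ B1, G.Adj x w → w = v ∨ w ∈ A \ B)
    (hv1 : ∀ x ∈ B1, G.Adj x v ↔ x = f (d.length - 1))
    {m st lo : ℕ} (hst : st < 3) (hm : ∀ j < d.length, σ (f j) = dig m j) (hσv : σ v = st)
    (h0 : ∀ w ∈ A \ B, σ w = 0) (hk : ChkOK d m st lo) :
    ((lo : ℤ) - 64 ≤ ∑ x ∈ B1, lc G A B fs fu (bdp v p) σ x) ∧
    (∀ x ∈ B1, σ x = 2 → fs' G A fs σ 1 x = true ∧ fs' G A fu σ 2 x = true) ∧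
    ∀ E : Finset V, A \ B ⊆ E → (∀ x ∈ E, ∀ y ∈ A, σ y = 0 → G.Adj x y → y ∈ E) → (st = 0 → v ∈ E) →
      ∀ x ∈ B1, σ x = 0 → x ∈ E := by
  have ho := fun i hi => h.child_out (p := p) hvB1 hvB hB hadj hv1 (i := i) hi
  obtain ⟨v1, v2⟩ := h.vals (B' := B) (bd' := bdp v p) (σ := σ) hm hk (fun i hi => (ho i hi).1)
    (fun i hi => by rw [(ho i hi).2, bdv_lt hst]) (by
      intro i hi s hs
      unfold exS
      rw [bi_eq, bi_eq]
      simp only [natbeq]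
      by_cases hc : st = s ∧ i.succ = d.length
      · rw [if_pos hc.1, if_pos hc.2, Finset.card_eq_one]
        refine ⟨v, ?_⟩
        ext y
        simp only [Finset.mem_filter, Finset.mem_singleton]
        constructor
        · rintro ⟨hy, ha, hs'⟩
          rcases hadj _ (h.mem hi) y hy ha with rfl | hw'
          · rfl
          · have := h0 y hw'; omega
        · rintro rfl
          refine ⟨Finset.mem_sdiff.mpr ⟨hvA, hvB1⟩, (hv1 _ (h.mem hi)).mpr ?_, by omega⟩
          congr 1; omega
      · have : (if st = s then (if i.succ = d.length then 1 else 0) else 0) = 0 := by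
          split_ifs <;> tauto
        rw [this, Finset.card_eq_zero, Finset.filter_eq_empty_iff]
        rintro y hy ⟨ha, hs'⟩
        rcases hadj _ (h.mem hi) y hy ha with rfl | hw'
        · refine hc ⟨by omega, ?_⟩
          have := h.inj i hi _ (by omega) ((hv1 _ (h.mem hi)).mp ha)
          omega
        · have := h0 y hw'; omega)
  refine ⟨v1, v2, ?_⟩
  intro E hCE hE hvE
  refine h.reach hm hk E hE ?_
  intro j hj hj0 hbase
  have hj1 : σ (f j) = 0 := by rw [hm j hj]; exact hj0
  unfold isBase at hbase
  rw [bdv_lt hst] at hbase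
  simp only [oo_eq, an_eq, Bool.or_eq_true, Bool.and_eq_true, natble, natbeq] at hbase
  rcases hbase with hb | hb | hb
  · rw [← (ho j hj).1] at hb
    obtain ⟨w, hw⟩ := Finset.card_pos.mp hb
    rw [Finset.mem_filter] at hw
    exact hE w (hCE hw.1) (f j) (h.sub (h.mem hj)) hj1 hw.2.1.symm
  · omega
  · refine hE v (hvE hb.1) (f j) (h.sub (h.mem hj)) hj1 ((hv1 _ (h.mem hj)).mpr ?_).symm
    congr 1; omega

set_option maxHeartbeats 1000000 in
theorem two_bd (hG : Good G A fs fu) (hI : IHyp G A.card) {d1 d2 : List Node} {f1 f2 : ℕ → V} {v1 v2 : V}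
    (h1 : Real G A fs fu (bdp v1 v) d1 f1 B1) (h2 : Real G A fs fu (bdp v2 v) d2 f2 B2)
    (hn1 : 0 < d1.length) (hn2 : 0 < d2.length) (e1 : f1 (d1.length - 1) = v1) (e2 : f2 (d2.length - 1) = v2)
    (hvA : v ∈ A) (hv1 : v ∉ B1) (hv2 : v ∉ B2) (hdis : Disjoint B1 B2)
    (hna : ∀ x ∈ B1, ∀ y ∈ B2, ¬ G.Adj x y) (hpA : p ∈ A) (hpB : p ∉ insert v (B1 ∪ B2))
    (hvn : ∀ y ∈ A, G.Adj v y ↔ y = v1 ∨ y = v2 ∨ y = p)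
    (hF : Frame G A (insert v (B1 ∪ B2)) (bdp v p)) (hC : Conn G (A \ insert v (B1 ∪ B2)))
    (hC2 : 2 ≤ (A \ insert v (B1 ∪ B2)).card ∨ (A \ insert v (B1 ∪ B2) = {p} ∧ dg G A p = 1))
    (hok : TwoOK d1 d2) : Bd G A fs fu := by
  set B := insert v (B1 ∪ B2) with hBdef
  obtain ⟨st, a, b, m1, m2, g1, g2, hst, ha, hb, hm1, hm2, hk1, hk2, hpos, c0, c1, c2⟩ := hok
  obtain ⟨σ1, hσ1, hz1⟩ := h1.exists_state m1
  obtain ⟨σ2, hσ2, hz2⟩ := h2.exists_state m2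
  have hvB : v ∈ B := Finset.mem_insert_self _ _
  have hB1 : B1 ⊆ B := fun x hx => Finset.mem_insert_of_mem (Finset.mem_union_left _ hx)
  have hB2 : B2 ⊆ B := fun x hx => Finset.mem_insert_of_mem (Finset.mem_union_right _ hx)
  have hBm : ∀ x, x ∈ B ↔ x = v ∨ x ∈ B1 ∨ x ∈ B2 := by intro x; simp [hBdef]
  have hv1B : v1 ∈ B1 := e1 ▸ h1.mem (by omega)
  have hv2B : v2 ∈ B2 := e2 ▸ h2.mem (by omega)
  obtain ⟨σ, hσ⟩ : ∃ σ : V → ℕ, σ = fun x => if x = v then st else if x ∈ B1 then σ1 x else σ2 x := ⟨_, rfl⟩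
  have sv : σ v = st := by rw [hσ]; simp
  have s1 : ∀ j < d1.length, σ (f1 j) = dig m1 j := by
    intro j hj
    have hmem := h1.mem hj
    have hne : f1 j ≠ v := fun hc => hv1 (hc ▸ hmem)
    rw [hσ]; simp only
    rw [if_neg hne, if_pos hmem, hσ1 j hj]
  have s2 : ∀ j < d2.length, σ (f2 j) = dig m2 j := by
    intro j hj
    have hmem := h2.mem hj
    have hne : f2 j ≠ v := fun hc => hv2 (hc ▸ hmem)
    have hn1 : f2 j ∉ B1 := fun hc => Finset.disjoint_left.mp hdis hc hmem
    rw [hσ]; simp only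
    rw [if_neg hne, if_neg hn1, hσ2 j hj]
  have h0 : ∀ w ∈ A \ B, σ w = 0 := by
    intro w hw
    rw [Finset.mem_sdiff, hBm, not_or, not_or] at hw
    rw [hσ]; simp only
    rw [if_neg hw.2.1, if_neg hw.2.2.1, hz2 w hw.2.2.2]
  have sa : σ v1 = a := by rw [← e1, s1 _ (by omega), hm1]
  have sb : σ v2 = b := by rw [← e2, s2 _ (by omega), hm2]
  have ad1 : ∀ x ∈ B1, ∀ w ∈ A \ B1, G.Adj x w → w = v ∨ w ∈ A \ B := by
    intro x hx w hw hxw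
    rw [Finset.mem_sdiff] at hw ⊢
    rw [hBm, not_or, not_or]
    have h3 : w ∉ B2 := fun hc => hna x hx w hc hxw
    by_cases h4 : w = v
    · exact Or.inl h4
    · exact Or.inr ⟨hw.1, h4, hw.2, h3⟩
  have ad2 : ∀ x ∈ B2, ∀ w ∈ A \ B2, G.Adj x w → w = v ∨ w ∈ A \ B := by
    intro x hx w hw hxw
    rw [Finset.mem_sdiff] at hw ⊢
    rw [hBm, not_or, not_or]
    have h3 : w ∉ B1 := fun hc => hna w hc x hx hxw.symm
    by_cases h4 : w = v
    · exact Or.inl h4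
    · exact Or.inr ⟨hw.1, h4, h3, hw.2⟩
  have hpB' : p ≠ v ∧ p ∉ B1 ∧ p ∉ B2 := by rwa [hBm, not_or, not_or] at hpB
  have n1 : ∀ x ∈ B1, G.Adj x v ↔ x = f1 (d1.length - 1) := by
    intro x hx
    rw [G.adj_comm, hvn x (h1.sub hx), e1]
    constructor
    · rintro (h | h | h)
      · exact h
      · exact absurd hv2B (fun hc => Finset.disjoint_left.mp hdis hx (h ▸ hc))
      · exact absurd hx (h ▸ hpB'.2.1)
    · exact Or.inl
  have n2 : ∀ x ∈ B2, G.Adj x v ↔ x = f2 (d2.length - 1) := by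
    intro x hx
    rw [G.adj_comm, hvn x (h2.sub hx), e2]
    constructor
    · rintro (h | h | h)
      · exact absurd hv1B (fun hc => Finset.disjoint_left.mp hdis hc (h ▸ hx))
      · exact h
      · exact absurd hx (h ▸ hpB'.2.2)
    · exact fun h => Or.inr (Or.inl h)
  rw [← e1] at h1
  rw [← e2] at h2
  obtain ⟨V1, O1, R1⟩ := h1.child (p := p) hn1 hvA hv1 hvB hB1 ad1 n1 hst s1 sv h0 hk1
  obtain ⟨V2, O2, R2⟩ := h2.child (p := p) hn2 hvA hv2 hvB hB2 ad2 n2 hst s2 sv h0 hk2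
  have hvp : G.Adj v p := (hvn p hpA).mpr (Or.inr (Or.inr rfl))
  have hv12 : v1 ≠ v2 := fun h => Finset.disjoint_left.mp hdis hv1B (h ▸ hv2B)
  have hv1p : v1 ≠ p := fun h => hpB'.2.1 (h ▸ hv1B)
  have hv2p : v2 ≠ p := fun h => hpB'.2.2 (h ▸ hv2B)
  have hvN : (A.filter fun y => G.Adj v y) = {v1, v2, p} := by
    ext y
    simp only [Finset.mem_filter, Finset.mem_insert, Finset.mem_singleton]
    constructor
    · rintro ⟨hy, h⟩; exact (hvn y hy).mp h
    · intro h
      have hy : y ∈ A := by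
        rcases h with rfl | rfl | rfl
        · exact h1.sub hv1B
        · exact h2.sub hv2B
        · exact hpA
      exact ⟨hy, (hvn y hy).mpr h⟩
  have hdv : dg G A v = 3 := by
    unfold dg
    rw [hvN, Finset.card_insert_of_notMem, Finset.card_insert_of_notMem, Finset.card_singleton]
    · simpa using hv2p
    · simp [hv12, hv1p]
  have tv : tyOK G A fs fu 0 v := tyOK_three hdv
  have hpC : p ∈ A \ B := Finset.mem_sdiff.mpr ⟨hpA, hpB⟩
  have hcs : ∀ s, s = 1 ∨ s = 2 → cs G A σ s v = num2 s a b := by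
    intro s hs
    unfold cs num2
    rw [← Finset.filter_filter, hvN, Finset.filter_insert, Finset.filter_insert, Finset.filter_singleton, bi_eq, bi_eq]
    simp only [natbeq]
    rw [sa, sb, if_neg (show ¬ σ p = s by rw [h0 p hpC]; omega)]
    by_cases h : a = s <;> by_cases h' : b = s <;> simp [h, h', hv12]
  have ov : outE G (A \ B) (bdp v p) false v = 0 := by
    unfold outE
    rw [Finset.card_eq_zero, Finset.filter_eq_empty_iff]
    rintro w hw ⟨hvw, hb⟩
    rw [bdp_false] at hb
    rw [Finset.mem_sdiff] at hw
    rcases (hvn w hw.1).mp hvw with rfl | rfl | rfl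
    · exact hw.2 (hB1 hv1B)
    · exact hw.2 (hB2 hv2B)
    · exact hb ⟨rfl, rfl⟩
  have bv : outE G (A \ B) (bdp v p) true v = 1 := by
    unfold outE
    rw [Finset.card_eq_one]
    refine ⟨p, ?_⟩
    ext w
    simp only [Finset.mem_filter, Finset.mem_singleton, bdp_true]
    constructor
    · exact fun h => h.2.2.2
    · rintro rfl; exact ⟨hpC, hvp, trivial, rfl⟩
  have hnv := node_val (B := B) (bd := bdp v p) (σ := σ) tv (by rw [sv]; exact hst)
  rw [ov, bv, sv, hcs 1 (Or.inl rfl), hcs 2 (Or.inr rfl)] at hnv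
  have hsum : ∑ x ∈ B, lc G A B fs fu (bdp v p) σ x = lc G A B fs fu (bdp v p) σ v +
      (∑ x ∈ B1, lc G A B fs fu (bdp v p) σ x + ∑ x ∈ B2, lc G A B fs fu (bdp v p) σ x) := by
    conv_lhs => rw [hBdef]
    rw [Finset.sum_insert (by simp [hv1, hv2]), Finset.sum_union hdis]
  have tot : 0 ≤ ∑ x ∈ B, lc G A B fs fu (bdp v p) σ x ∧
      (st = 1 → allZero d1 = true → allZero d2 = true → 1 ≤ ∑ x ∈ B, lc G A B fs fu (bdp v p) σ x) := by
    rw [hsum]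
    have hcase : st = 0 ∨ st = 1 ∨ st = 2 := by omega
    rcases hcase with rfl | rfl | rfl
    · have := c0 rfl
      have e : ndP 0 0 0 = 8 := rfl
      have e' : ndM 0 0 1 0 (num2 1 a b) (num2 2 a b) =
        Wn (3 - num2 1 a b - num2 2 a b) (Nat.ble 1 (num2 1 a b)) (Nat.ble 1 (num2 2 a b)) := rfl
      rw [e, e'] at hnv
      refine ⟨by omega, by intro h; omega⟩
    · have := (c1 rfl).1
      have h3 := (c1 rfl).2
      have e : ndP 0 0 1 = 8 := rfl
      have e' : ndM 0 0 1 1 (num2 1 a b) (num2 2 a b) = 22 := rfl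
      rw [e, e'] at hnv
      refine ⟨by omega, fun _ z1 z2 => ?_⟩
      have := h3 z1 z2
      omega
    · have := (c2 rfl)
      have e : ndP 0 0 2 = 8 := rfl
      have e' : ndM 0 0 1 2 (num2 1 a b) (num2 2 a b) = 2 := rfl
      rw [e, e'] at hnv
      refine ⟨by omega, by intro h; omega⟩
  refine frame (σ := σ) hG hI hF hC h0 ?_ ?_ ?_ ?_ tot.1 ?_
  · intro x hx
    rcases (hBm x).mp hx with rfl | hx | hx
    · rw [sv]; exact hst
    · obtain ⟨i, hi, rfl⟩ := (h1.img x).mp hx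
      rw [s1 i hi]; exact dig_lt _ _
    · obtain ⟨i, hi, rfl⟩ := (h2.img x).mp hx
      rw [s2 i hi]; exact dig_lt _ _
  · have : st ≠ 0 ∨ a ≠ 0 ∨ b ≠ 0 := by omega
    rcases this with h | h | h
    · exact ⟨v, hvB, by rw [sv]; exact h⟩
    · exact ⟨v1, hB1 hv1B, by rw [sa]; exact h⟩
    · exact ⟨v2, hB2 hv2B, by rw [sb]; exact h⟩
  · intro x hx h
    rcases (hBm x).mp hx with rfl | hx | hx
    · rw [sv] at h
      obtain ⟨q1, q2, _⟩ := c2 h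
      rw [fs'_true, fs'_true, hcs 1 (Or.inl rfl), hcs 2 (Or.inr rfl)]
      exact ⟨Or.inr q1, Or.inr q2⟩
    · exact O1 x hx h
    · exact O2 x hx h
  · intro E hCE hE x hx h
    have hvE : st = 0 → v ∈ E := by
      intro h
      exact hE p (hCE hpC) v hvA (by rw [sv]; exact h) hvp.symm
    rcases (hBm x).mp hx with rfl | hx | hx
    · exact hvE (by rw [← sv]; exact h)
    · exact R1 E hCE hE hvE x hx h
    · exact R2 E hCE hE hvE x hx h
  · rcases hC2 with h | ⟨hp, hdp⟩
    · exact Or.inl h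
    · refine Or.inr ⟨p, v, hp, hvB, hdp, hvp, bdp_true.mpr ⟨rfl, rfl⟩, ?_⟩
      intro h
      rw [sv] at h
      have hpo : ∀ y ∈ A, G.Adj y p → y = v := by
        intro y hy hyp
        exact Finset.card_le_one.mp (le_of_eq hdp) y (by simp [hy, hyp.symm]) v (by simp [hvA, hvp.symm])
      refine tot.2 h ?_ ?_
      · rw [allZero_iff]
        intro i hi
        rw [← (h1.child_out (p := p) hv1 hvB hB1 ad1 n1 hi).1]
        unfold outE
        rw [Finset.card_eq_zero, Finset.filter_eq_empty_iff, hp]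
        rintro w hw ⟨hh, _⟩
        rw [Finset.mem_singleton.mp hw] at hh
        exact hv1 (hpo _ (h1.sub (h1.mem hi)) hh ▸ h1.mem hi)
      · rw [allZero_iff]
        intro i hi
        rw [← (h2.child_out (p := p) hv2 hvB hB2 ad2 n2 hi).1]
        unfold outE
        rw [Finset.card_eq_zero, Finset.filter_eq_empty_iff, hp]
        rintro w hw ⟨hh, _⟩
        rw [Finset.mem_singleton.mp hw] at hh
        exact hv2 (hpo _ (h2.sub (h2.mem hi)) hh ▸ h2.mem hi)
end two

/-! ### The structural claim -/
section struct
set_option linter.unusedSectionVars false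
variable {V : Type*} [DecidableEq V] {G : SimpleGraph V} [DecidableRel G.Adj]
variable {A : Finset V} {fs fu : V → Bool}
variable {d : List Node} {f : ℕ → V} {B D : Finset V} {v p : V}

theorem comp_exists (X : Finset V) {y : V} (hy : y ∈ X) :
    ∃ D ⊆ X, y ∈ D ∧ Conn G D ∧ ∀ a ∈ D, ∀ b ∈ X, G.Adj a b → b ∈ D := by
  obtain ⟨D, hD, hmin⟩ := Finset.exists_min_image
    (X.powerset.filter fun D => y ∈ D ∧ ∀ a ∈ D, ∀ b ∈ X, G.Adj a b → b ∈ D) Finset.card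
    ⟨X, by simp only [Finset.mem_filter, Finset.mem_powerset]; exact ⟨subset_rfl, hy, fun _ _ b hb _ => hb⟩⟩
  simp only [Finset.mem_filter, Finset.mem_powerset] at hD hmin
  obtain ⟨hDX, hyD, hcl⟩ := hD
  refine ⟨D, hDX, hyD, ⟨⟨y, hyD⟩, ?_⟩, hcl⟩
  intro E hED hne hE
  have hE' : ∀ a ∈ E, ∀ b ∈ X, G.Adj a b → b ∈ E := fun a ha b hb hab =>
    hE a ha b (hcl a (hED ha) b hb hab) hab
  by_cases hyE : y ∈ E
  · exact Finset.eq_of_subset_of_card_le hED (hmin E ⟨hED.trans hDX, hyE, hE'⟩)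
  · exfalso
    have := hmin (D \ E) ⟨Finset.sdiff_subset.trans hDX, Finset.mem_sdiff.mpr ⟨hyD, hyE⟩, by
      intro a ha b hb hab
      rw [Finset.mem_sdiff] at ha ⊢
      exact ⟨hcl a ha.1 b hb hab, fun hc => ha.2 (hE b hc a ha.1 hab.symm)⟩⟩
    have h2 := Finset.card_sdiff_add_card_eq_card hED
    have := hne.card_pos
    omega

theorem dg_mem {s : Finset V} (hs : ∀ y ∈ s, y ∈ A ∧ G.Adj v y) (hc : dg G A v ≤ s.card) :
    ∀ y ∈ A, G.Adj v y → y ∈ s := by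
  intro y hy hvy
  have := Finset.eq_of_subset_of_card_le (s := s) (t := A.filter fun y => G.Adj v y)
    (fun y hy => Finset.mem_filter.mpr (hs y hy)) hc
  rw [this]; exact Finset.mem_filter.mpr ⟨hy, hvy⟩

theorem dg_ge {s : Finset V} (hs : ∀ y ∈ s, y ∈ A ∧ G.Adj v y) : s.card ≤ dg G A v :=
  Finset.card_le_card (fun y hy => Finset.mem_filter.mpr (hs y hy))

theorem outE_card {C : Finset V} {bd : V → V → Bool} {b : Bool} {x : V} {S : Finset V}
    (h : ∀ w, (w ∈ C ∧ G.Adj x w ∧ bd x w = b) ↔ w ∈ S) : outE G C bd b x = S.card := by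
  unfold outE
  congr 1
  ext w
  rw [Finset.mem_filter, h]

structure Valid (G : SimpleGraph V) [DecidableRel G.Adj] (A B : Finset V) (v p : V) : Prop where
  hv : v ∈ B
  hp : p ∈ A \ B
  adj : G.Adj v p
  cB : Conn G B
  cC : Conn G (A \ B)
  fr : Frame G A B (bdp v p)
  two : 2 ≤ (A \ B).card ∨ (A \ B = {p} ∧ dg G A p = 1)

theorem Valid.child (h : Valid G A B v p) (hG : Good G A fs fu) (hD : D ⊆ B.erase v) (hDc : Conn G D)
    (hcl : ∀ a ∈ D, ∀ b ∈ B.erase v, G.Adj a b → b ∈ D) {x : V} (hx : x ∈ D) (hxv : G.Adj x v) :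
    Valid G A D x v := by
  have hBA := h.fr.sub
  have hDB : D ⊆ B := hD.trans (Finset.erase_subset _ _)
  have hvD : v ∉ D := fun hc => Finset.notMem_erase v B (hD hc)
  have hvA : v ∈ A := hBA h.hv
  have hpm := Finset.mem_sdiff.mp h.hp
  have hcl' : ∀ a ∈ D, ∀ b ∈ B, G.Adj a b → b ≠ v → b ∈ D := fun a ha b hb hab hne =>
    hcl a ha b (Finset.mem_erase.mpr ⟨hne, hb⟩) hab
  have hpD : p ∉ D := fun hc => hpm.2 (hDB hc)
  have hvp : v ≠ p := fun hc => hpm.2 (hc ▸ h.hv)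
  -- a set inside `B`, avoiding `v` and `D`, closed in `A \ D`, is empty
  have key : ∀ F ⊆ A \ D, F ⊆ B → v ∉ F → (∀ a ∈ F, ∀ b ∈ A \ D, G.Adj a b → b ∈ F) → ¬ F.Nonempty := by
    intro F hFA hFB hvF hFc hne
    have := h.cB.2 F hFB hne (by
      intro a ha b hb hab
      apply hFc a ha b _ hab
      refine Finset.mem_sdiff.mpr ⟨hBA hb, fun hc => ?_⟩
      have hav : a ≠ v := fun hh => hvF (hh ▸ ha)
      exact (Finset.mem_sdiff.mp (hFA ha)).2 (hcl' b hc a (hFB ha) hab.symm hav))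
    exact hvF (this ▸ h.hv)
  refine ⟨hx, Finset.mem_sdiff.mpr ⟨hvA, hvD⟩, hxv, hDc, ⟨⟨v, Finset.mem_sdiff.mpr ⟨hvA, hvD⟩⟩, ?_⟩, ⟨hDB.trans hBA, ?_, ?_⟩, ?_⟩
  · intro E hEA hne hEc
    have hCD : A \ B ⊆ A \ D := Finset.sdiff_subset_sdiff subset_rfl hDB
    by_cases hm : (E ∩ (A \ B)).Nonempty
    · have hsub : A \ B ⊆ E := by
        have := h.cC.2 (E ∩ (A \ B)) Finset.inter_subset_right hm (by
          intro a ha b hb hab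
          rw [Finset.mem_inter] at ha ⊢
          exact ⟨hEc a ha.1 b (hCD hb) hab, hb⟩)
        rw [← this]; exact Finset.inter_subset_left
      have hvE : v ∈ E := hEc p (hsub h.hp) v (Finset.mem_sdiff.mpr ⟨hvA, hvD⟩) h.adj.symm
      have := key ((A \ D) \ E) Finset.sdiff_subset (by
        intro a ha
        rw [Finset.mem_sdiff, Finset.mem_sdiff] at ha
        by_contra hc
        exact ha.2 (hsub (Finset.mem_sdiff.mpr ⟨ha.1.1, hc⟩))) (fun hc => (Finset.mem_sdiff.mp hc).2 hvE) (by
        intro a ha b hb hab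
        rw [Finset.mem_sdiff] at ha ⊢
        exact ⟨hb, fun hc => ha.2 (hEc b hc a ha.1 hab.symm)⟩)
      rw [Finset.not_nonempty_iff_eq_empty, Finset.sdiff_eq_empty_iff_subset] at this
      exact Finset.Subset.antisymm hEA this
    · exfalso
      have hEB : E ⊆ B := by
        intro a ha
        by_contra hc
        exact hm ⟨a, Finset.mem_inter.mpr ⟨ha, Finset.mem_sdiff.mpr ⟨(Finset.mem_sdiff.mp (hEA ha)).1, hc⟩⟩⟩
      refine key E hEA hEB (fun hc => ?_) hEc hne
      exact hm ⟨p, Finset.mem_inter.mpr ⟨hEc v hc p (hCD h.hp) h.adj, h.hp⟩⟩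
  · intro w hw y hy hyw hb
    rw [bdp_false] at hb
    by_cases hwv : w = v
    · subst hwv
      have hyx : y ≠ x := fun hc => hb ⟨hc, rfl⟩
      have hs : ∀ z ∈ ({y, x, p} : Finset V), z ∈ A ∧ G.Adj w z := by
        intro z hz
        simp only [Finset.mem_insert, Finset.mem_singleton] at hz
        rcases hz with rfl | rfl | rfl
        · exact ⟨hBA (hDB hy), hyw.symm⟩
        · exact ⟨hBA (hDB hx), hxv.symm⟩
        · exact ⟨hpm.1, h.adj⟩
      have hcard : ({y, x, p} : Finset V).card = 3 := by
        rw [Finset.card_insert_of_notMem, Finset.card_insert_of_notMem, Finset.card_singleton]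
        · intro hc; rw [Finset.mem_singleton] at hc; exact hpD (hc ▸ hx)
        · simp only [Finset.mem_insert, Finset.mem_singleton, not_or]
          exact ⟨hyx, fun hc => hpD (hc ▸ hy)⟩
      have h3 := hG.deg w hvA
      have h4 := dg_ge hs
      refine ⟨by omega, ?_⟩
      intro y' hy' hyw' hb'
      rw [bdp_false] at hb'
      have := dg_mem hs (by omega) y' (hBA (hDB hy')) hyw'.symm
      simp only [Finset.mem_insert, Finset.mem_singleton] at this
      rcases this with h | h | h
      · exact h
      · exact absurd ⟨h, rfl⟩ hb'
      · exact absurd hy' (h ▸ hpD)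
    · have hwB : w ∉ B := fun hc => (Finset.mem_sdiff.mp hw).2 (hcl' y hy w hc hyw hwv)
      have hwC : w ∈ A \ B := Finset.mem_sdiff.mpr ⟨(Finset.mem_sdiff.mp hw).1, hwB⟩
      have hyv : ∀ y' ∈ D, bdp v p y' w = false := by
        intro y' hy'
        rw [bdp_false]
        rintro ⟨hc, _⟩
        exact hvD (hc ▸ hy')
      obtain ⟨q1, q2⟩ := h.fr.nor w hwC y (hDB hy) hyw (hyv y hy)
      exact ⟨q1, fun y' hy' ha _ => q2 y' (hDB hy') ha (hyv y' hy')⟩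
  · intro w _ y _ y' _ _ _ hb hb'
    rw [bdp_true] at hb hb'
    rw [hb.1, hb'.1]
  · left
    have : ({v, p} : Finset V) ⊆ A \ D := by
      intro z hz
      simp only [Finset.mem_insert, Finset.mem_singleton] at hz
      rcases hz with rfl | rfl
      · exact Finset.mem_sdiff.mpr ⟨hvA, hvD⟩
      · exact Finset.mem_sdiff.mpr ⟨hpm.1, hpD⟩
    have h2 := Finset.card_le_card this
    rw [Finset.card_pair hvp] at h2
    exact h2

/-- realized by a table shape -/
def Rep (G : SimpleGraph V) [DecidableRel G.Adj] (A : Finset V) (fs fu : V → Bool) (B : Finset V) (v p : V)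
    (d : List Node) (f : ℕ → V) : Prop :=
  0 < d.length ∧ Real G A fs fu (bdp v p) d f B ∧ f (d.length - 1) = v

theorem Valid.allZero (h : Valid G A B v p) (hr : Rep G A fs fu B v p d f) (hC : A \ B = {p}) (hd : dg G A p = 1) :
    RDom.allZero d = true := by
  rw [allZero_iff]
  intro i hi
  rw [← hr.2.1.out i hi]
  unfold outE
  rw [Finset.card_eq_zero, Finset.filter_eq_empty_iff, hC]
  rintro w hw ⟨ha, hb⟩
  rw [Finset.mem_singleton] at hw
  subst hw
  rw [bdp_false] at hb
  refine hb ⟨?_, rfl⟩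
  have := dg_mem (A := A) (v := w) (s := {v}) (by
    intro y hy
    rw [Finset.mem_singleton.mp hy]
    exact ⟨h.fr.sub h.hv, h.adj.symm⟩) (by rw [hd]; simp) (f i) (hr.2.1.sub (hr.2.1.mem hi)) ha.symm
  exact Finset.mem_singleton.mp this

theorem Valid.red (h : Valid G A B v p) (hG : Good G A fs fu) (hI : IHyp G A.card) (hr : Rep G A fs fu B v p d f)
    (hd : RedL d) : Bd G A fs fu := by
  refine hr.2.1.red hG hI h.fr h.cC hd ?_
  rcases h.two with h2 | ⟨h2, h3⟩
  · exact Or.inl h2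
  · refine Or.inr ⟨p, h2, hr.1, h3, ?_, ?_, h.allZero hr h2 h3⟩
    · rw [hr.2.2]; exact h.adj
    · rw [hr.2.2]; exact bdp_true.mpr ⟨rfl, rfl⟩

theorem Valid.leaf (h : Valid G A {v} v p) (hG : Good G A fs fu) (hI : IHyp G A.card) :
    Bd G A fs fu ∨ ∃ d f, InL d ∧ Rep G A fs fu {v} v p d f := by
  have hvA : v ∈ A := h.fr.sub h.hv
  have hpA := Finset.mem_sdiff.mp h.hp
  have hbad : outE G (A \ {v}) (bdp v p) true v = 1 := by
    rw [outE_card (S := {p}), Finset.card_singleton]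
    intro w
    rw [bdp_true, Finset.mem_singleton]
    constructor
    · exact fun h => h.2.2.2
    · rintro rfl; exact ⟨h.hp, h.adj, rfl, rfl⟩
  have hout : outE G (A \ {v}) (bdp v p) false v = dg G A v - 1 := by
    rw [outE_card (S := (A.filter fun y => G.Adj v y).erase p), Finset.card_erase_of_mem]
    · rfl
    · exact Finset.mem_filter.mpr ⟨hpA.1, h.adj⟩
    · intro w
      rw [bdp_false, Finset.mem_erase, Finset.mem_filter, Finset.mem_sdiff, Finset.mem_singleton]
      constructor
      · rintro ⟨h1, h2, h3⟩; exact ⟨fun hc => h3 ⟨rfl, hc⟩, h1.1, h2⟩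
      · rintro ⟨h1, h2, h3⟩; exact ⟨⟨h2, fun hc => G.loopless.irrefl v (hc ▸ h3)⟩, h3, fun hc => h1 hc.2⟩
  have hd1 : 1 ≤ dg G A v := dg_ge (s := {p}) (by
    intro y hy; rw [Finset.mem_singleton.mp hy]; exact ⟨hpA.1, h.adj⟩)
  have hd3 := hG.deg v hvA
  have hty : ∃ t, t < 6 ∧ tyOK G A fs fu t v := by
    have : dg G A v = 1 ∨ dg G A v = 2 ∨ dg G A v = 3 := by omega
    rcases this with h | h | h
    · obtain ⟨t, ht, h⟩ := tyOK_one h (hG.one v hvA h)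
      exact ⟨t, by omega, h⟩
    · obtain ⟨t, ht, h⟩ := tyOK_two (fs := fs) (fu := fu) h
      exact ⟨t, by omega, h⟩
    · exact ⟨0, by omega, tyOK_three h⟩
  obtain ⟨t, ht, hty⟩ := hty
  rw [hty.2.1] at hout
  have hrep : Rep G A fs fu {v} v p [(t, tR t - 1, 1, [])] (fun _ => v) :=
    ⟨by simp, Real.single hvA hty hout hbad, rfl⟩
  by_cases h5 : t = 5
  · subst h5
    exact Or.inl (h.red hG hI hrep RedL.leaf5)
  · exact Or.inr ⟨_, _, InL.leaf (by omega), hrep⟩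

/-- attach `v` on top of one child -/
theorem Rep.attach {x : V} (h : Rep G A fs fu D x v d f) (hvA : v ∈ A) (hvD : v ∉ D) (hxv : G.Adj x v)
    {t out : ℕ} {nbO : List ℕ} (hnd : ([d.length - 1] ++ nbO).Nodup) (hlt : ∀ i ∈ nbO, i < d.length)
    (hO : ∀ i < d.length, (G.Adj (f i) v ∧ f i ≠ x) ↔ i ∈ nbO) (ht : tyOK G A fs fu t v)
    (ho : outE G (A \ insert v D) (bdp v p) false v = out)
    (hb : outE G (A \ insert v D) (bdp v p) true v = 1) :
    Rep G A fs fu (insert v D) v p (RDom.addNode d t [d.length - 1] nbO out 1) (Function.update f d.length v) := by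
  obtain ⟨hn, h, hx⟩ := h
  have hlen := addNode_length d t [d.length - 1] nbO out 1
  refine ⟨by omega, h.addNode hvA hvD hnd ?_ ?_ ?_ ?_ ht ho hb, ?_⟩
  · intro i hi
    rcases List.mem_append.mp hi with hi | hi
    · rw [List.mem_singleton] at hi; omega
    · exact hlt i hi
  · intro i hi
    rw [bdp_true, List.mem_singleton]
    constructor
    · rintro ⟨_, h1, _⟩
      exact h.inj i hi _ (by omega) (h1.trans hx.symm)
    · rintro rfl; rw [hx]; exact ⟨hxv, rfl, rfl⟩
  · intro i hi
    rw [bdp_false, ← hO i hi]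
    simp
  · intro y hy w hw _
    have h1 : bdp v p y w = false := bdp_false.mpr fun hc => hvD (hc.1 ▸ hy)
    have h2 : bdp x v y w = false := bdp_false.mpr fun hc => (Finset.mem_sdiff.mp hw).2 (by rw [hc.2]; simp)
    rw [h1, h2]
  · rw [hlen]; simp

theorem nodup_pair {i j : ℕ} (h : i ≠ j) : [i, j].Nodup := by simp [h]

theorem Rep.two {d1 d2 : List Node} {f1 f2 : ℕ → V} {D1 D2 : Finset V} {x1 x2 : V}
    (h1 : Rep G A fs fu D1 x1 v d1 f1) (h2 : Rep G A fs fu D2 x2 v d2 f2)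
    (hvA : v ∈ A) (hv1 : v ∉ D1) (hv2 : v ∉ D2) (hdis : Disjoint D1 D2)
    (hna : ∀ x ∈ D1, ∀ y ∈ D2, ¬ G.Adj x y) (hpA : p ∈ A) (hpB : p ∉ insert v (D1 ∪ D2))
    (hvn : ∀ y ∈ A, G.Adj v y ↔ y = x1 ∨ y = x2 ∨ y = p) (hd3 : dg G A v = 3) :
    ∃ f, Rep G A fs fu (insert v (D1 ∪ D2)) v p (twoS d1 d2) f := by
  obtain ⟨hn1, r1, e1⟩ := h1
  obtain ⟨hn2, r2, e2⟩ := h2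
  have hx1 : x1 ∈ D1 := e1 ▸ r1.mem (by omega)
  have hx2 : x2 ∈ D2 := e2 ▸ r2.mem (by omega)
  have hpv : p ∉ D1 ∪ D2 := fun hc => hpB (Finset.mem_insert_of_mem hc)
  let bdm : V → V → Bool := fun x w => decide ((x = x1 ∨ x = x2) ∧ w = v)
  have bm : ∀ x w, bdm x w = true ↔ ((x = x1 ∨ x = x2) ∧ w = v) := fun x w => by simp [bdm]
  have bool_eq : ∀ a b : Bool, (a = true ↔ b = true) → a = b := by decide
  have hm := Real.merge (bd := bdm) r1 r2 hdis hna (by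
    intro x hx w _ _
    apply bool_eq
    rw [bm, bdp_true]
    constructor
    · rintro ⟨h | h, hw⟩
      · exact ⟨h, hw⟩
      · exact absurd hx2 (fun hc => Finset.disjoint_left.mp hdis hx (h ▸ hc))
    · rintro ⟨h, hw⟩; exact ⟨Or.inl h, hw⟩) (by
    intro x hx w _ _
    apply bool_eq
    rw [bm, bdp_true]
    constructor
    · rintro ⟨h | h, hw⟩
      · exact absurd hx1 (fun hc => Finset.disjoint_left.mp hdis hc (h ▸ hx))
      · exact ⟨h, hw⟩
    · rintro ⟨h, hw⟩; exact ⟨Or.inr h, hw⟩)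
  have hlen := mergeS_length d1 d2
  obtain ⟨g, hg⟩ : ∃ g : ℕ → V, g = fun i => if i < d1.length then f1 i else f2 (i - d1.length) := ⟨_, rfl⟩
  rw [← hg] at hm
  have hvD : v ∉ D1 ∪ D2 := by rw [Finset.mem_union]; tauto
  have g1 : g (d1.length - 1) = x1 := by
    rw [hg]; simp only
    rw [if_pos (by omega), e1]
  have g2 : g (d1.length + d2.length - 1) = x2 := by
    rw [hg]; simp only
    rw [if_neg (by omega), ← e2]; congr 1; omega
  have hnb : ∀ i < (mergeS d1 d2).length, G.Adj (g i) v ↔ i = d1.length - 1 ∨ i = d1.length + d2.length - 1 := by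
    intro i hi
    rw [G.adj_comm, hvn _ (hm.sub (hm.mem hi))]
    constructor
    · rintro (h | h | h)
      · exact Or.inl (hm.inj i hi _ (by omega) (h.trans g1.symm))
      · exact Or.inr (hm.inj i hi _ (by omega) (h.trans g2.symm))
      · exact absurd (hm.mem hi) (h ▸ hpv)
    · rintro (rfl | rfl)
      · exact Or.inl g1
      · exact Or.inr (Or.inl g2)
  have hadd := hm.addNode (bd' := bdp v p) (t := 0) (out := 0) (bad := 1)
    (nbB := [d1.length - 1, d1.length + d2.length - 1]) (nbO := []) hvA hvD (nodup_pair (by omega))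
    (by
      intro i hi
      simp only [List.append_nil, List.mem_cons, List.not_mem_nil, or_false] at hi
      omega)
    (by
      intro i hi
      simp only [List.mem_cons, List.not_mem_nil, or_false]
      rw [hnb i hi, bm]
      constructor
      · exact fun h => h.1
      · rintro (rfl | rfl)
        · exact ⟨Or.inl rfl, Or.inl g1, rfl⟩
        · exact ⟨Or.inr rfl, Or.inr g2, rfl⟩)
    (by
      intro i hi
      simp only [List.not_mem_nil, iff_false]
      rintro ⟨ha, hb⟩
      have : bdm (g i) v = true := by
        rw [bm]
        rcases (hnb i hi).mp ha with rfl | rfl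
        · exact ⟨Or.inl g1, rfl⟩
        · exact ⟨Or.inr g2, rfl⟩
      rw [this] at hb; cases hb)
    (by
      intro x hx w hw _
      have q1 : bdp v p x w = false := bdp_false.mpr fun hc => hvD (hc.1 ▸ hx)
      have q2 : bdm x w = false := by
        rw [← Bool.not_eq_true, bm]
        exact fun hc => (Finset.mem_sdiff.mp hw).2 (by rw [hc.2]; simp)
      rw [q1, q2])
    (tyOK_three hd3)
    (by
      rw [outE_card (S := ∅), Finset.card_empty]
      intro w
      simp only [Finset.notMem_empty, iff_false]
      rintro ⟨hw, ha, hb⟩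
      rw [bdp_false] at hb
      rw [Finset.mem_sdiff] at hw
      rcases (hvn w hw.1).mp ha with rfl | rfl | rfl
      · exact hw.2 (by simp [hx1])
      · exact hw.2 (by simp [hx2])
      · exact hb ⟨rfl, rfl⟩)
    (by
      rw [outE_card (S := {p}), Finset.card_singleton]
      intro w
      rw [bdp_true, Finset.mem_singleton]
      constructor
      · exact fun h => h.2.2.2
      · rintro rfl
        exact ⟨Finset.mem_sdiff.mpr ⟨hpA, hpB⟩, (hvn w hpA).mpr (Or.inr (Or.inr rfl)), rfl, rfl⟩)
  have e : twoS d1 d2 = RDom.addNode (mergeS d1 d2) 0 [d1.length - 1, d1.length + d2.length - 1] [] 0 1 := by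
    unfold twoS
    rw [len_eq, len_eq]; rfl
  rw [e]
  refine ⟨_, ?_, hadd, ?_⟩
  · rw [addNode_length]; omega
  · rw [addNode_length]; simp
end struct

section claim
set_option linter.unusedSectionVars false
variable {V : Type*} [DecidableEq V] {G : SimpleGraph V} [DecidableRel G.Adj]
variable {A : Finset V} {fs fu : V → Bool}
variable {d : List Node} {f : ℕ → V} {B D : Finset V} {v p : V}

theorem addOne_eq (t : ℕ) (d : List Node) : addOne t d = RDom.addNode d t [d.length - 1] [] 0 1 := by
  unfold addOne; rw [len_eq]; rfl
theorem addOut_eq (d : List Node) : addOut d = RDom.addNode d 0 [d.length - 1] [] 1 1 := by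
  unfold addOut; rw [len_eq]; rfl
theorem addRecv_eq (i : ℕ) (d : List Node) : addRecv i d = RDom.addNode d 0 [d.length - 1] [i] 0 1 := by
  unfold addRecv; rw [len_eq]; rfl
theorem addArc_eq (d : List Node) : addArc d = RDom.addNode d 0 [d.length - 1] [] 0 2 := by
  unfold addArc; rw [len_eq]; rfl
theorem addEnd_eq (t : ℕ) (d : List Node) : addEnd t d = RDom.addNode d t [d.length - 1] [] 0 0 := by
  unfold addEnd; rw [len_eq]; rfl

theorem Valid.one_child (h : Valid G A B v p) (hG : Good G A fs fu) (hI : IHyp G A.card) {x : V}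
    (hBD : B = insert v D) (hvD : v ∉ D) (hx : x ∈ D) (hxv : G.Adj x v) (hin : InL d)
    (hr : Rep G A fs fu D x v d f) : Bd G A fs fu ∨ ∃ d f, InL d ∧ Rep G A fs fu B v p d f := by
  have hvA : v ∈ A := h.fr.sub h.hv
  have hpm := Finset.mem_sdiff.mp h.hp
  have hDA : D ⊆ A := hr.2.1.sub
  have hxp : x ≠ p := fun hc => hpm.2 (by rw [hBD, ← hc]; simp [hx])
  have hpD : p ∉ D := fun hc => hpm.2 (by rw [hBD]; simp [hc])
  have hn := hr.1
  have hbad : outE G (A \ insert v D) (bdp v p) true v = 1 := by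
    rw [← hBD, outE_card (S := {p}), Finset.card_singleton]
    intro w
    rw [bdp_true, Finset.mem_singleton]
    constructor
    · exact fun h => h.2.2.2
    · rintro rfl; exact ⟨h.hp, h.adj, rfl, rfl⟩
  have fin : ∀ s g, Rep G A fs fu B v p s g → (InL s ∨ RedL s) →
      Bd G A fs fu ∨ ∃ d f, InL d ∧ Rep G A fs fu B v p d f := by
    intro s g hs hh
    rcases hh with hh | hh
    · exact Or.inr ⟨s, g, hh, hs⟩
    · exact Or.inl (h.red hG hI hs hh)
  have hs2 : ∀ y ∈ ({x, p} : Finset V), y ∈ A ∧ G.Adj v y := by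
    intro y hy
    simp only [Finset.mem_insert, Finset.mem_singleton] at hy
    rcases hy with rfl | rfl
    · exact ⟨hDA hx, hxv.symm⟩
    · exact ⟨hpm.1, h.adj⟩
  have hc2 : ({x, p} : Finset V).card = 2 := Finset.card_pair hxp
  have hge := dg_ge hs2
  have hle := hG.deg v hvA
  by_cases hd2 : dg G A v = 2
  · have hnb := dg_mem hs2 (by omega)
    simp only [Finset.mem_insert, Finset.mem_singleton] at hnb
    obtain ⟨t, ht, hty⟩ := tyOK_two (fs := fs) (fu := fu) hd2
    have := hr.attach (p := p) (t := t) (out := 0) (nbO := []) hvA hvD hxv (by simp) (by simp) (by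
      intro i hi
      simp only [List.not_mem_nil, iff_false]
      rintro ⟨ha, hne⟩
      have hfi := hr.2.1.mem hi
      rcases hnb _ (hDA hfi) ha.symm with h | h
      · exact hne h
      · exact hpD (h ▸ hfi)) hty (by
      rw [outE_card (S := ∅), Finset.card_empty]
      intro w
      simp only [Finset.notMem_empty, iff_false]
      rintro ⟨hw, ha, hb⟩
      rw [bdp_false] at hb
      rw [Finset.mem_sdiff] at hw
      rcases hnb w hw.1 ha with rfl | rfl
      · exact hw.2 (by simp [hx])
      · exact hb ⟨rfl, rfl⟩) hbad
    rw [← hBD, ← addOne_eq] at this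
    exact fin _ _ this (hin.one ht)
  · have hd3 : dg G A v = 3 := by omega
    obtain ⟨y, hy⟩ : ∃ y, y ∈ (A.filter fun y => G.Adj v y) \ {x, p} := by
      rw [← Finset.Nonempty, ← Finset.card_pos]
      have := Finset.le_card_sdiff ({x, p} : Finset V) (A.filter fun y => G.Adj v y)
      unfold dg at hd3
      omega
    rw [Finset.mem_sdiff, Finset.mem_filter] at hy
    simp only [Finset.mem_insert, Finset.mem_singleton, not_or] at hy
    obtain ⟨⟨hyA, hvy⟩, hyx, hyp⟩ := hy
    have hs3 : ∀ z ∈ ({y, x, p} : Finset V), z ∈ A ∧ G.Adj v z := by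
      intro z hz
      rcases Finset.mem_insert.mp hz with rfl | hz
      · exact ⟨hyA, hvy⟩
      · exact hs2 z hz
    have hc3 : ({y, x, p} : Finset V).card = 3 := by
      rw [Finset.card_insert_of_notMem, hc2]
      simp [hyx, hyp]
    have hnb := dg_mem hs3 (by omega)
    simp only [Finset.mem_insert, Finset.mem_singleton] at hnb
    by_cases hyD : y ∈ D
    · obtain ⟨i, hi, hfi⟩ := (hr.2.1.img y).mp hyD
      have hin1 : i ≠ d.length - 1 := by
        rintro rfl; exact hyx (hfi.symm.trans hr.2.2)
      have hout : 0 < (nd d i).2.1 := by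
        rw [← hr.2.1.out i hi, hfi]
        apply Finset.card_pos.mpr
        refine ⟨v, Finset.mem_filter.mpr ⟨Finset.mem_sdiff.mpr ⟨hvA, hvD⟩, hvy.symm, ?_⟩⟩
        rw [bdp_false]; exact fun hc => hyx hc.1
      have := hr.attach (p := p) (t := 0) (out := 0) (nbO := [i]) hvA hvD hxv (nodup_pair (Ne.symm hin1)) (by
        intro j hj
        rw [List.mem_singleton] at hj; omega) (by
        intro j hj
        rw [List.mem_singleton]
        constructor
        · rintro ⟨ha, hne⟩
          have hfj := hr.2.1.mem hj
          rcases hnb _ (hDA hfj) ha.symm with h | h | h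
          · exact hr.2.1.inj j hj i hi (h.trans hfi.symm)
          · exact absurd h hne
          · exact absurd hfj (h ▸ hpD)
        · rintro rfl
          rw [hfi]; exact ⟨hvy.symm, hyx⟩) (tyOK_three hd3) (by
        rw [outE_card (S := ∅), Finset.card_empty]
        intro w
        simp only [Finset.notMem_empty, iff_false]
        rintro ⟨hw, ha, hb⟩
        rw [bdp_false] at hb
        rw [Finset.mem_sdiff] at hw
        rcases hnb w hw.1 ha with rfl | rfl | rfl
        · exact hw.2 (by simp [hyD])
        · exact hw.2 (by simp [hx])
        · exact hb ⟨rfl, rfl⟩) hbad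
      rw [← hBD, ← addRecv_eq] at this
      exact fin _ _ this (hin.recv i hi hin1 hout)
    · have hyv : y ≠ v := fun hc => G.loopless.irrefl v (hc ▸ hvy)
      have := hr.attach (p := p) (t := 0) (out := 1) (nbO := []) hvA hvD hxv (by simp) (by simp) (by
        intro j hj
        simp only [List.not_mem_nil, iff_false]
        rintro ⟨ha, hne⟩
        have hfj := hr.2.1.mem hj
        rcases hnb _ (hDA hfj) ha.symm with h | h | h
        · exact hyD (h ▸ hfj)
        · exact hne h
        · exact hpD (h ▸ hfj)) (tyOK_three hd3) (by
        rw [outE_card (S := {y}), Finset.card_singleton]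
        intro w
        rw [Finset.mem_singleton, bdp_false, Finset.mem_sdiff]
        constructor
        · rintro ⟨hw, ha, hb⟩
          rcases hnb w hw.1 ha with rfl | rfl | rfl
          · rfl
          · exact absurd (by simp [hx]) hw.2
          · exact absurd ⟨rfl, rfl⟩ hb
        · rintro rfl
          exact ⟨⟨hyA, by simp [hyD, hyv]⟩, hvy, fun hc => hyp hc.2⟩) hbad
      rw [← hBD, ← addOut_eq] at this
      exact fin _ _ this hin.out

theorem claim (hG : Good G A fs fu) (hI : IHyp G A.card) (n : ℕ) : ∀ (B : Finset V) (v p : V), B.card ≤ n →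
    Valid G A B v p → Bd G A fs fu ∨ ∃ d f, InL d ∧ Rep G A fs fu B v p d f := by
  induction n with
  | zero =>
    intro B v p hB h
    have := Finset.card_pos.mpr ⟨v, h.hv⟩
    omega
  | succ n ih =>
    intro B v p hB h
    by_cases hBv : B = {v}
    · subst hBv
      exact h.leaf hG hI
    have hvA : v ∈ A := h.fr.sub h.hv
    have hpm := Finset.mem_sdiff.mp h.hp
    have hB2 : 2 ≤ B.card := by
      by_contra hc
      apply hBv
      have := Finset.card_pos.mpr ⟨v, h.hv⟩
      obtain ⟨a, ha⟩ := Finset.card_eq_one.mp (show B.card = 1 by omega)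
      have := h.hv
      rw [ha, Finset.mem_singleton] at this
      rw [ha, this]
    obtain ⟨x, hxB, hvx⟩ := h.cB.nbr hB2 h.hv
    have hxv : x ≠ v := fun hc => G.loopless.irrefl v (hc ▸ hvx)
    have hxe : x ∈ B.erase v := Finset.mem_erase.mpr ⟨hxv, hxB⟩
    have hcardlt : ∀ D ⊆ B.erase v, D.card ≤ n := by
      intro D hD
      have h1 := Finset.card_le_card hD
      rw [Finset.card_erase_of_mem h.hv] at h1
      omega
    obtain ⟨D, hDs, hxD, hDc, hDcl⟩ := comp_exists (G := G) (B.erase v) hxe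
    have hV := h.child hG hDs hDc hDcl hxD hvx.symm
    have hvD : v ∉ D := fun hc => Finset.notMem_erase v B (hDs hc)
    rcases ih D x v (hcardlt D hDs) hV with hbd | ⟨d, f, hin, hr⟩
    · exact Or.inl hbd
    by_cases hR : B = insert v D
    · exact h.one_child hG hI hR hvD hxD hvx.symm hin hr
    obtain ⟨z, hzB, hzD⟩ : ∃ z ∈ B.erase v, z ∉ D := by
      by_contra hc
      push Not at hc
      apply hR
      rw [← Finset.insert_erase h.hv]
      congr 1
      exact Finset.Subset.antisymm hc hDs
    obtain ⟨D2, hDs2, hzD2, hDc2, hDcl2⟩ := comp_exists (G := G) (B.erase v) hzB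
    have hvD2 : v ∉ D2 := fun hc => Finset.notMem_erase v B (hDs2 hc)
    have hdis : Disjoint D D2 := by
      rw [Finset.disjoint_left]
      intro a ha ha2
      have := hDc2.2 (D ∩ D2) Finset.inter_subset_right ⟨a, Finset.mem_inter.mpr ⟨ha, ha2⟩⟩ (by
        intro a ha b hb hab
        rw [Finset.mem_inter] at ha ⊢
        exact ⟨hDcl a ha.1 b (hDs2 hb) hab, hb⟩)
      rw [← this] at hzD2
      exact hzD (Finset.mem_inter.mp hzD2).1
    have hna : ∀ a ∈ D, ∀ b ∈ D2, ¬ G.Adj a b := by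
      intro a ha b hb hab
      exact Finset.disjoint_left.mp hdis (hDcl a ha b (hDs2 hb) hab) hb
    have hDB : D ⊆ B := hDs.trans (Finset.erase_subset _ _)
    have hDB2 : D2 ⊆ B := hDs2.trans (Finset.erase_subset _ _)
    obtain ⟨x2, hx2, hx2v⟩ : ∃ x2 ∈ D2, G.Adj x2 v := by
      by_contra hc
      push Not at hc
      have := h.cB.2 D2 hDB2 ⟨z, hzD2⟩ (by
        intro a ha b hb hab
        by_cases hbv : b = v
        · exact absurd (hbv ▸ hab) (hc a ha)
        · exact hDcl2 a ha b (Finset.mem_erase.mpr ⟨hbv, hb⟩) hab)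
      exact hvD2 (this ▸ h.hv)
    have hV2 := h.child hG hDs2 hDc2 hDcl2 hx2 hx2v
    rcases ih D2 x2 v (hcardlt D2 hDs2) hV2 with hbd | ⟨d2, f2, hin2, hr2⟩
    · exact Or.inl hbd
    have hBA := h.fr.sub
    have hx12 : x ≠ x2 := fun hc => Finset.disjoint_left.mp hdis hxD (hc ▸ hx2)
    have hxp : x ≠ p := fun hc => hpm.2 (hc ▸ hxB)
    have hx2p : x2 ≠ p := fun hc => hpm.2 (hc ▸ hDB2 hx2)
    have hs3 : ∀ y ∈ ({x, x2, p} : Finset V), y ∈ A ∧ G.Adj v y := by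
      intro y hy
      simp only [Finset.mem_insert, Finset.mem_singleton] at hy
      rcases hy with rfl | rfl | rfl
      · exact ⟨hBA hxB, hvx⟩
      · exact ⟨hBA (hDB2 hx2), hx2v.symm⟩
      · exact ⟨hpm.1, h.adj⟩
    have hc3 : ({x, x2, p} : Finset V).card = 3 := by
      rw [Finset.card_insert_of_notMem, Finset.card_pair hx2p]
      simp [hx12, hxp]
    have hge := dg_ge hs3
    have hle := hG.deg v hvA
    have hd3 : dg G A v = 3 := by omega
    have hvn : ∀ y ∈ A, G.Adj v y ↔ y = x ∨ y = x2 ∨ y = p := by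
      intro y hy
      constructor
      · intro hh
        have := dg_mem hs3 (by omega) y hy hh
        simpa using this
      · intro hh; exact (hs3 y (by simpa using hh)).2
    have hBeq : B = insert v (D ∪ D2) := by
      by_contra hne
      have hsub : insert v (D ∪ D2) ⊆ B := by
        intro a ha
        rw [Finset.mem_insert, Finset.mem_union] at ha
        rcases ha with rfl | ha | ha
        · exact h.hv
        · exact hDB ha
        · exact hDB2 ha
      have hne2 : (B \ insert v (D ∪ D2)).Nonempty := by
        rw [Finset.sdiff_nonempty]
        exact fun hc => hne (Finset.Subset.antisymm hc hsub)
      have := h.cB.2 (B \ insert v (D ∪ D2)) Finset.sdiff_subset hne2 (by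
        intro a ha b hb hab
        rw [Finset.mem_sdiff, Finset.mem_insert, Finset.mem_union, not_or, not_or] at ha ⊢
        have hae : a ∈ B.erase v := Finset.mem_erase.mpr ⟨ha.2.1, ha.1⟩
        refine ⟨hb, ?_, fun hc => ha.2.2.1 (hDcl b hc a hae hab.symm), fun hc => ha.2.2.2 (hDcl2 b hc a hae hab.symm)⟩
        rintro rfl
        rcases (hvn a (hBA ha.1)).mp hab.symm with rfl | rfl | rfl
        · exact ha.2.2.1 hxD
        · exact ha.2.2.2 hx2
        · exact hpm.2 ha.1)
      have hv := h.hv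
      rw [← this] at hv
      simp at hv
    have hBeq' : B = insert v (D2 ∪ D) := by rw [Finset.union_comm]; exact hBeq
    have hna' : ∀ a ∈ D2, ∀ b ∈ D, ¬ G.Adj a b := fun a ha b hb hab => hna b hb a ha hab.symm
    have hvn' : ∀ y ∈ A, G.Adj v y ↔ y = x2 ∨ y = x ∨ y = p := by
      intro y hy; rw [hvn y hy]; tauto
    rcases hin.two hin2 with hh | hh | hh | hh
    · obtain ⟨g, hg⟩ := hr.two hr2 hvA hvD hvD2 hdis hna hpm.1 (hBeq ▸ hpm.2) hvn hd3
      rw [← hBeq] at hg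
      exact Or.inr ⟨_, g, hh, hg⟩
    · obtain ⟨g, hg⟩ := hr2.two hr hvA hvD2 hvD hdis.symm hna' hpm.1 (hBeq' ▸ hpm.2) hvn' hd3
      rw [← hBeq'] at hg
      exact Or.inr ⟨_, g, hh, hg⟩
    · left
      exact two_bd hG hI hr.2.1 hr2.2.1 hr.1 hr2.1 hr.2.2 hr2.2.2 hvA hvD hvD2 hdis hna hpm.1 (hBeq ▸ hpm.2) hvn
        (hBeq ▸ h.fr) (hBeq ▸ h.cC) (hBeq ▸ h.two) hh
    · left
      exact two_bd hG hI hr2.2.1 hr.2.1 hr2.1 hr.1 hr2.2.2 hr.2.2 hvA hvD2 hvD hdis.symm hna' hpm.1 (hBeq' ▸ hpm.2) hvn'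
        (hBeq' ▸ h.fr) (hBeq' ▸ h.cC) (hBeq' ▸ h.two) hh

theorem Conn.singleton (p : V) : Conn G {p} :=
  ⟨⟨p, by simp⟩, fun D hD hne _ => by
    rcases Finset.subset_singleton_iff.mp hD with h | h
    · exact absurd h hne.ne_empty
    · exact h⟩

theorem leaf_phase (hG : Good G A fs fu) (hI : IHyp G A.card) (hp : p ∈ A) (hd : dg G A p = 1) : Bd G A fs fu := by
  obtain ⟨v, hv⟩ := Finset.card_eq_one.mp hd
  have hpn : ∀ y ∈ A, G.Adj p y ↔ y = v := by
    intro y hy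
    have : y ∈ (A.filter fun y => G.Adj p y) ↔ y = v := by rw [hv, Finset.mem_singleton]
    rw [← this, Finset.mem_filter]; tauto
  have hvm : v ∈ A ∧ G.Adj p v := by
    have : v ∈ (A.filter fun y => G.Adj p y) := by rw [hv]; simp
    simpa using this
  have hvp : v ≠ p := fun hc => G.loopless.irrefl p (hc ▸ hvm.2)
  have hC : A \ A.erase p = {p} := by
    ext y
    simp only [Finset.mem_sdiff, Finset.mem_erase, Finset.mem_singleton]
    constructor
    · tauto
    · rintro rfl; tauto
  have hpe : p ∉ A.erase p := Finset.notMem_erase _ _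
  have hV : Valid G A (A.erase p) v p := by
    refine ⟨Finset.mem_erase.mpr ⟨hvp, hvm.1⟩, by rw [hC]; simp, hvm.2.symm, ⟨⟨v, Finset.mem_erase.mpr ⟨hvp, hvm.1⟩⟩, ?_⟩,
      by rw [hC]; exact Conn.singleton p, ⟨Finset.erase_subset _ _, ?_, ?_⟩, Or.inr ⟨hC, hd⟩⟩
    · intro E hE hne hcl
      by_cases hvE : v ∈ E
      · have := hG.conn.2 (insert p E) (Finset.insert_subset hp (hE.trans (Finset.erase_subset _ _))) (Finset.insert_nonempty _ _) (by
          intro a ha b hb hab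
          rw [Finset.mem_insert] at ha ⊢
          by_cases hbp : b = p
          · exact Or.inl hbp
          right
          rcases ha with rfl | ha
          · rw [(hpn b hb).mp hab]; exact hvE
          · exact hcl a ha b (Finset.mem_erase.mpr ⟨hbp, hb⟩) hab)
        rw [← this, Finset.erase_insert (fun hc => hpe (hE hc))]
      · exfalso
        have := hG.conn.2 E (hE.trans (Finset.erase_subset _ _)) hne (by
          intro a ha b hb hab
          apply hcl a ha b (Finset.mem_erase.mpr ⟨?_, hb⟩) hab
          rintro rfl
          exact hvE ((hpn a (Finset.mem_of_mem_erase (hE ha))).mp hab.symm ▸ ha))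
        exact hpe (hE (this ▸ hp))
    · intro w hw x hx hxw hb
      rw [hC, Finset.mem_singleton] at hw
      subst hw
      rw [bdp_false] at hb
      exact absurd ⟨(hpn x (Finset.mem_of_mem_erase hx)).mp hxw.symm, rfl⟩ hb
    · intro w _ y _ y' _ _ _ hb hb'
      rw [bdp_true] at hb hb'
      rw [hb.1, hb'.1]
  rcases claim hG hI _ _ v p le_rfl hV with h | ⟨d, f, hin, hr⟩
  · exact h
  obtain ⟨t, ht, hty⟩ := tyOK_one hd (hG.one p hp hd)
  have hz := hV.allZero hr hC hd
  have hf := hin.fin hz ht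
  have hr2 := hr.2.1
  have hn := hr.1
  have := hr2.addNode (bd' := bdp v p) (t := t) (out := 0) (bad := 0) (nbB := [d.length - 1]) (nbO := []) hp hpe
    (by simp) (by intro i hi; simp at hi; omega) (by
      intro i hi
      rw [bdp_true, List.mem_singleton]
      constructor
      · rintro ⟨_, h1, _⟩
        exact hr2.inj i hi _ (by omega) (h1.trans hr.2.2.symm)
      · rintro rfl; rw [hr.2.2]; exact ⟨hvm.2.symm, rfl, rfl⟩) (by
      intro i hi
      simp only [List.not_mem_nil, iff_false, bdp_false]
      rintro ⟨ha, hb⟩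
      exact hb ⟨(hpn _ (hr2.sub (hr2.mem hi))).mp ha.symm, trivial⟩) (fun _ _ _ _ _ => rfl) hty (by
      rw [Finset.insert_erase hp]; unfold outE; simp) (by
      rw [Finset.insert_erase hp]; unfold outE; simp)
  rw [Finset.insert_erase hp, ← addEnd_eq] at this
  exact this.fin hf
end claim

section arc
set_option linter.unusedSectionVars false
variable {V : Type*} [DecidableEq V] {G : SimpleGraph V} [DecidableRel G.Adj]
variable {A : Finset V} {fs fu : V → Bool}
variable {d : List Node} {f : ℕ → V} {B K T : Finset V} {v p q c : V}

theorem dg_sdiff (hK : K ⊆ A) (w : V) : dg G A w = dg G K w + dg G (A \ K) w := by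
  unfold dg
  rw [← Finset.card_union_of_disjoint, ← Finset.filter_union, Finset.union_sdiff_of_subset hK]
  exact Finset.disjoint_filter_filter Finset.disjoint_sdiff

theorem Knbr (hG : Good G A fs fu) (hK : K ⊆ A) (h2 : ∀ w ∈ K, dg G K w = 2) {w : V} (hw : w ∈ K) :
    (dg G A w = 2 ∧ ∀ y ∈ A, y ∉ K → ¬ G.Adj w y) ∨
    (dg G A w = 3 ∧ ∃ b ∈ A, b ∉ K ∧ G.Adj w b ∧ ∀ y ∈ A, y ∉ K → G.Adj w y → y = b) := by
  have h1 := dg_sdiff (G := G) hK w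
  have h3 := h2 w hw
  have h4 := hG.deg w (hK hw)
  have : dg G (A \ K) w = 0 ∨ dg G (A \ K) w = 1 := by omega
  rcases this with h | h
  · left
    refine ⟨by omega, fun y hy hyK ha => ?_⟩
    have := Finset.card_eq_zero.mp h
    have hm : y ∈ (A \ K).filter fun y => G.Adj w y := by simp [hy, hyK, ha]
    rw [this] at hm; simp at hm
  · right
    refine ⟨by omega, ?_⟩
    obtain ⟨b, hb⟩ := Finset.card_eq_one.mp h
    have hm : ∀ y, y ∈ ((A \ K).filter fun y => G.Adj w y) ↔ y = b := by intro y; rw [hb]; simp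
    simp only [Finset.mem_filter, Finset.mem_sdiff] at hm
    have hb2 := (hm b).mpr rfl
    exact ⟨b, hb2.1.1, hb2.1.2, hb2.2, fun y h1 h2 h3 => (hm y).mp ⟨⟨h1, h2⟩, h3⟩⟩

structure Arc (G : SimpleGraph V) [DecidableRel G.Adj] (A : Finset V) (fs fu : V → Bool) (K T : Finset V)
    (v c p q : V) (d : List Node) (f : ℕ → V) : Prop where
  real : Real G A fs fu (fun x _ => decide (x ∈ K)) d f T
  pos : 0 < d.length
  top : f (d.length - 1) = v
  hv : v ∈ K ∧ v ∈ T
  hc : c ∈ K ∧ c ∈ T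
  hp : p ∈ A \ T
  hq : q ∈ A \ T
  ne : p ≠ q
  qK : A \ T ⊆ K
  edge : ∀ x ∈ K, x ∈ T → ∀ w ∈ A \ T, G.Adj x w ↔ (x = v ∧ w = p) ∨ (x = c ∧ w = q)
  conn : Conn G (A \ T)

theorem arc_frame (hG : Good G A fs fu) (hK : K ⊆ A) (h2 : ∀ w ∈ K, dg G K w = 2) (hT : T ⊆ A) (qK : A \ T ⊆ K)
    (ne : p ≠ q) (edge : ∀ x ∈ K, x ∈ T → ∀ w ∈ A \ T, G.Adj x w ↔ (x = v ∧ w = p) ∨ (x = c ∧ w = q)) :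
    Frame G A T (fun x _ => decide (x ∈ K)) := by
  refine ⟨hT, ?_, ?_⟩
  · intro w hw x hx hxw hb
    rw [decide_eq_false_iff_not] at hb
    rcases Knbr hG hK h2 (qK hw) with h | ⟨h, b, _, _, _, hu⟩
    · exact absurd hxw.symm (h.2 x (hT hx) hb)
    · refine ⟨h, fun x' hx' ha hb' => ?_⟩
      rw [decide_eq_false_iff_not] at hb'
      rw [hu x (hT hx) hb hxw.symm, hu x' (hT hx') hb' ha.symm]
  · intro w hw x hx x' hx' ha ha' hb hb'
    rw [decide_eq_true_eq] at hb hb'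
    rcases (edge x hb hx w hw).mp ha with ⟨h, e⟩ | ⟨h, e⟩ <;>
    rcases (edge x' hb' hx' w hw).mp ha' with ⟨h', e'⟩ | ⟨h', e'⟩
    · rw [h, h']
    · exact absurd (e.symm.trans e') ne
    · exact absurd (e'.symm.trans e) ne
    · rw [h, h']

/-- the other neighbour on the cycle -/
theorem Arc.other (h : Arc G A fs fu K T v c p q d f) (hK : K ⊆ A) (h2 : ∀ w ∈ K, dg G K w = 2) :
    ∃ r ∈ A \ T, r ≠ p ∧ ∀ y ∈ K, G.Adj p y ↔ y = v ∨ y = r := by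
  obtain ⟨a, b, hab, he⟩ := Finset.card_eq_two.mp (h2 p (h.qK h.hp))
  have hm : ∀ y ∈ K, G.Adj p y ↔ y = a ∨ y = b := by
    intro y hy
    have : y ∈ (K.filter fun y => G.Adj p y) ↔ y = a ∨ y = b := by rw [he]; simp
    rw [← this, Finset.mem_filter]; tauto
  have hmm : ∀ y, y = a ∨ y = b → y ∈ K ∧ G.Adj p y := by
    intro y hy
    have : y ∈ (K.filter fun y => G.Adj p y) := by rw [he]; simpa using hy
    simpa using this
  have hvp : G.Adj v p := (h.edge v h.hv.1 h.hv.2 p h.hp).mpr (Or.inl ⟨rfl, rfl⟩)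
  have key : ∀ r, r ∈ K → G.Adj p r → r ≠ v → r ∈ A \ T := by
    intro r hr ha hrv
    by_contra hc
    have hK' : r ∈ T := by
      by_contra hrT
      exact hc (Finset.mem_sdiff.mpr ⟨hK hr, hrT⟩)
    rcases (h.edge r hr hK' p h.hp).mp ha.symm with e | e
    · exact hrv e.1
    · exact h.ne e.2
  have hpne : ∀ r, G.Adj p r → r ≠ p := fun r hr hc => G.loopless.irrefl p (hc ▸ hr)
  rcases (hm v h.hv.1).mp hvp.symm with e | e
  · subst e
    exact ⟨b, key b (hmm b (Or.inr rfl)).1 (hmm b (Or.inr rfl)).2 hab.symm, hpne _ (hmm b (Or.inr rfl)).2, hm⟩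
  · subst e
    refine ⟨a, key a (hmm a (Or.inl rfl)).1 (hmm a (Or.inl rfl)).2 hab, hpne _ (hmm a (Or.inl rfl)).2, ?_⟩
    intro y hy; rw [hm y hy]; tauto

theorem Arc.ext (h : Arc G A fs fu K T v c p q d f) (hG : Good G A fs fu) (hK : K ⊆ A) (h2 : ∀ w ∈ K, dg G K w = 2)
    {r : V} (hr : r ∈ A \ T) (hrp : r ≠ p) (hn : ∀ y ∈ K, G.Adj p y ↔ y = v ∨ y = r) :
    ∃ s, AStep d s ∧ s.length = d.length + 1 ∧
      Real G A fs fu (fun x _ => decide (x ∈ K)) s (Function.update f d.length p) (insert p T) := by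
  have hpA := (Finset.mem_sdiff.mp h.hp)
  have hpK := h.qK h.hp
  have hrA := (Finset.mem_sdiff.mp hr)
  have hR := h.real
  have hpos := h.pos
  have hout : outE G (A \ insert p T) (fun x _ => decide (x ∈ K)) false p = 0 := by
    unfold outE; simp [hpK]
  have hbad : outE G (A \ insert p T) (fun x _ => decide (x ∈ K)) true p = 1 := by
    rw [outE_card (S := {r}), Finset.card_singleton]
    intro w
    rw [Finset.mem_singleton, decide_eq_true_eq, Finset.mem_sdiff, Finset.mem_insert, not_or]
    constructor
    · rintro ⟨⟨h1, h3, h4⟩, h5, _⟩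
      rcases (hn w (h.qK (Finset.mem_sdiff.mpr ⟨h1, h4⟩))).mp h5 with e | e
      · exact absurd (e ▸ h.hv.2) h4
      · exact e
    · rintro rfl
      exact ⟨⟨hrA.1, hrp, hrA.2⟩, (hn w (h.qK hr)).mpr (Or.inr rfl), hpK⟩
  have hB : ∀ i < d.length, (G.Adj (f i) p ∧ decide (f i ∈ K) = true) ↔ i ∈ [d.length - 1] := by
    intro i hi
    rw [List.mem_singleton, decide_eq_true_eq]
    constructor
    · rintro ⟨ha, hk⟩
      rcases (h.edge _ hk (hR.mem hi) p h.hp).mp ha with e | e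
      · exact hR.inj i hi _ (by omega) (e.1.trans h.top.symm)
      · exact absurd e.2 h.ne
    · rintro rfl
      rw [h.top]
      exact ⟨(h.edge v h.hv.1 h.hv.2 p h.hp).mpr (Or.inl ⟨rfl, rfl⟩), h.hv.1⟩
  rcases Knbr hG hK h2 hpK with ⟨hd, hno⟩ | ⟨hd, b, hbA, hbK, hpb, hu⟩
  · obtain ⟨t, ht, hty⟩ := tyOK_two (fs := fs) (fu := fu) hd
    refine ⟨_, AStep.one t ht, ?_, ?_⟩
    · rw [addOne_eq, addNode_length]
    · rw [addOne_eq]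
      refine hR.addNode hpA.1 hpA.2 (by simp) (by intro i hi; simp at hi; omega) hB ?_ (fun _ _ _ _ _ => rfl) hty hout hbad
      intro i hi
      rw [decide_eq_false_iff_not]
      constructor
      · rintro ⟨ha, hk⟩
        exact absurd ha.symm (hno _ (hR.sub (hR.mem hi)) hk)
      · intro hh; simp at hh
  · have hbT : b ∈ T := by
      by_contra hc
      exact hbK (h.qK (Finset.mem_sdiff.mpr ⟨hbA, hc⟩))
    obtain ⟨i, hi, rfl⟩ := (hR.img b).mp hbT
    have hit : i ≠ d.length - 1 := by
      rintro rfl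
      exact hbK (h.top ▸ h.hv.1)
    have ho : 0 < (nd d i).2.1 := by
      rw [← hR.out i hi]
      exact Finset.card_pos.mpr ⟨p, by rw [Finset.mem_filter, decide_eq_false_iff_not]; exact ⟨h.hp, hpb.symm, hbK⟩⟩
    refine ⟨_, AStep.recv i hi hit ho, ?_, ?_⟩
    · rw [addRecv_eq, addNode_length]
    · rw [addRecv_eq]
      refine hR.addNode hpA.1 hpA.2 (nodup_pair hit.symm) ?_ hB ?_ (fun _ _ _ _ _ => rfl) (tyOK_three hd) hout hbad
      · intro j hj
        simp at hj
        omega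
      · intro j hj
        rw [decide_eq_false_iff_not, List.mem_singleton]
        constructor
        · rintro ⟨ha, hk⟩
          exact hR.inj j hj i hi (hu _ (hR.sub (hR.mem hj)) hk ha.symm)
        · rintro rfl
          exact ⟨hpb.symm, hbK⟩

/-- closing the cycle -/
theorem Arc.close (h : Arc G A fs fu K T v c p q d f) (hA : InA d) (hG : Good G A fs fu) (hK : K ⊆ A)
    (h2 : ∀ w ∈ K, dg G K w = 2) (hn : ∀ y ∈ K, G.Adj p y ↔ y = v ∨ y = q) (hQ : A \ insert p T = {q}) :
    Bd G A fs fu := by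
  obtain ⟨x, hx, hl, hR⟩ := h.ext hG hK h2 h.hq h.ne.symm hn
  set g := Function.update f d.length p with hg
  have hgt : g (x.length - 1) = p := by rw [hl, hg]; simp
  have hpA := (Finset.mem_sdiff.mp h.hp)
  have hqA := (Finset.mem_sdiff.mp h.hq)
  have hqT : q ∉ insert p T := by rw [Finset.mem_insert]; exact fun hc => hc.elim h.ne.symm hqA.2
  have hqK := h.qK h.hq
  have hpq := (hn q hqK).mpr (Or.inr rfl)
  have hcq : G.Adj c q := (h.edge c h.hc.1 h.hc.2 q h.hq).mpr (Or.inr ⟨rfl, rfl⟩)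
  obtain ⟨i0, hi0, hgi0⟩ := (hR.img c).mp (Finset.mem_insert_of_mem h.hc.2)
  have hcp : c ≠ p := fun hc => hpA.2 (hc ▸ h.hc.2)
  have hit : i0 ≠ x.length - 1 := by
    rintro rfl
    exact hcp (hgi0.symm.trans hgt)
  have hins : insert q (insert p T) = A := by
    have h1 : insert p T ⊆ A := hR.sub
    rw [← Finset.sdiff_union_of_subset h1, hQ]; rfl
  have hb : 0 < (nd x i0).2.2.1 := by
    rw [← hR.bad i0 hi0, hgi0]
    exact Finset.card_pos.mpr ⟨q, by rw [Finset.mem_filter, hQ, decide_eq_true_eq]; exact ⟨by simp, hcq, h.hc.1⟩⟩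
  have hB : ∀ i < x.length, (G.Adj (g i) q ∧ decide (g i ∈ K) = true) ↔ i ∈ [x.length - 1, i0] := by
    intro i hi
    simp only [List.mem_cons, List.not_mem_nil, or_false]
    rw [decide_eq_true_eq]
    constructor
    · rintro ⟨ha, hk⟩
      rcases Finset.mem_insert.mp (hR.mem hi) with e | e
      · left; exact hR.inj i hi _ (by omega) (e.trans hgt.symm)
      · rcases (h.edge _ hk e q h.hq).mp ha with e | e
        · exact absurd e.2.symm h.ne
        · right; exact hR.inj i hi _ hi0 (e.1.trans hgi0.symm)
    · rintro (rfl | rfl)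
      · rw [hgt]; exact ⟨hpq, h.qK h.hp⟩
      · rw [hgi0]; exact ⟨hcq, h.hc.1⟩
  have hz : ∀ b, outE G (A \ insert q (insert p T)) (fun x _ => decide (x ∈ K)) b q = 0 := by
    intro b; rw [hins]; unfold outE; simp
  rcases Knbr hG hK h2 hqK with ⟨hd, hno⟩ | ⟨hd, b, hbA, hbK, hpb, hu⟩
  · obtain ⟨t, ht, hty⟩ := tyOK_two (fs := fs) (fu := fu) hd
    have := hR.addNode (bd' := fun x _ => decide (x ∈ K)) (nbO := []) hqA.1 hqT (by simpa using hit.symm) (by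
      intro i hi; simp at hi; omega) hB (by
      intro i hi
      rw [decide_eq_false_iff_not]
      constructor
      · rintro ⟨ha, hk⟩
        exact absurd ha.symm (hno _ (hR.sub (hR.mem hi)) hk)
      · intro hh; simp at hh) (fun _ _ _ _ _ => rfl) hty (hz false) (hz true)
    rw [hins] at this
    refine this.fin (hA.fin hx i0 hi0 hit hb (Or.inl ⟨?_, ?_⟩))
    · rw [allZero_iff]
      intro i hi
      rw [← hR.out i hi, hQ]
      refine Finset.card_eq_zero.mpr (Finset.filter_eq_empty_iff.mpr ?_)
      intro w hw
      rw [Finset.mem_singleton] at hw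
      subst hw
      rw [decide_eq_false_iff_not]
      rintro ⟨ha, hk⟩
      exact absurd ha.symm (hno _ (hR.sub (hR.mem hi)) hk)
    · rcases ht with rfl | rfl
      · exact Or.inl rfl
      · exact Or.inr rfl
  · have hbT : b ∈ insert p T := by
      by_contra hc
      have : b ∈ A \ insert p T := Finset.mem_sdiff.mpr ⟨hbA, hc⟩
      rw [hQ, Finset.mem_singleton] at this
      exact hbK (this ▸ hqK)
    obtain ⟨i, hi, rfl⟩ := (hR.img b).mp hbT
    have hi1 : i ≠ x.length - 1 := by
      rintro rfl
      exact hbK (hgt ▸ h.qK h.hp)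
    have hi2 : i ≠ i0 := by
      rintro rfl
      exact hbK (hgi0 ▸ h.hc.1)
    have := hR.addNode (bd' := fun x _ => decide (x ∈ K)) (nbO := [i]) hqA.1 hqT (by
      simp; exact ⟨⟨hit.symm, hi1.symm⟩, hi2.symm⟩) (by
      intro i hi; simp at hi; omega) hB (by
      intro j hj
      rw [decide_eq_false_iff_not, List.mem_singleton]
      constructor
      · rintro ⟨ha, hk⟩
        exact hR.inj j hj i hi (hu _ (hR.sub (hR.mem hj)) hk ha.symm)
      · rintro rfl
        exact ⟨hpb.symm, hbK⟩) (fun _ _ _ _ _ => rfl) (tyOK_three hd) (hz false) (hz true)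
    rw [hins] at this
    refine this.fin (hA.fin hx i0 hi0 hit hb (Or.inr ⟨i, hi, ?_, ?_, rfl⟩))
    · rw [← hR.out i hi, hQ, outE_card (S := {q}), Finset.card_singleton]
      intro w
      rw [Finset.mem_singleton, decide_eq_false_iff_not]
      constructor
      · exact fun h => h.1
      · rintro rfl; exact ⟨rfl, hpb.symm, hbK⟩
    · intro j hj hji
      rw [← hR.out j hj, hQ]
      refine Finset.card_eq_zero.mpr (Finset.filter_eq_empty_iff.mpr ?_)
      intro w hw
      rw [Finset.mem_singleton] at hw
      subst hw
      rw [decide_eq_false_iff_not]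
      rintro ⟨ha, hk⟩
      exact hji (hR.inj j hj i hi (hu _ (hR.sub (hR.mem hj)) hk ha.symm))

theorem arc_phase (hG : Good G A fs fu) (hI : IHyp G A.card) (hK : K ⊆ A) (h2 : ∀ w ∈ K, dg G K w = 2) (n : ℕ) :
    ∀ (T : Finset V) (v p : V) (d : List Node) (f : ℕ → V), (A \ T).card ≤ n → InA d →
      Arc G A fs fu K T v c p q d f → Bd G A fs fu := by
  induction n with
  | zero =>
    intro T v p d f hn _ h
    have := Finset.card_pos.mpr ⟨p, h.hp⟩
    omega
  | succ n ih =>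
    intro T v p d f hn hA h
    obtain ⟨r, hr, hrp, hnb⟩ := h.other hK h2
    have hpA := (Finset.mem_sdiff.mp h.hp)
    have hqA := (Finset.mem_sdiff.mp h.hq)
    have hpr : G.Adj p r := (hnb r (h.qK hr)).mpr (Or.inr rfl)
    have hQp : A \ insert p T = (A \ T).erase p := by
      ext y; simp only [Finset.mem_sdiff, Finset.mem_insert, Finset.mem_erase]; tauto
    have hpw : ∀ w ∈ A \ T, G.Adj p w → w = r := by
      intro w hw ha
      rcases (hnb w (h.qK hw)).mp ha with e | e
      · exact absurd (e ▸ h.hv.2) (Finset.mem_sdiff.mp hw).2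
      · exact e
    by_cases hrq : r = q
    · subst hrq
      apply h.close hA hG hK h2 hnb
      have := h.conn.2 {p, r} (by
        intro y hy
        simp only [Finset.mem_insert, Finset.mem_singleton] at hy
        rcases hy with rfl | rfl
        · exact h.hp
        · exact h.hq) (Finset.insert_nonempty _ _) (by
        intro a ha b hb hab
        simp only [Finset.mem_insert, Finset.mem_singleton] at ha ⊢
        rcases ha with rfl | rfl
        · exact Or.inr (hpw b hb hab)
        · left
          have hcq : G.Adj c a := (h.edge c h.hc.1 h.hc.2 a h.hq).mpr (Or.inr ⟨rfl, rfl⟩)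
          have hcp : c ≠ p := fun hc => hpA.2 (hc ▸ h.hc.2)
          have hm := dg_mem (G := G) (A := K) (v := a) (s := {c, p}) (by
            intro y hy
            simp only [Finset.mem_insert, Finset.mem_singleton] at hy
            rcases hy with rfl | rfl
            · exact ⟨h.hc.1, hcq.symm⟩
            · exact ⟨h.qK h.hp, hpr.symm⟩) (by rw [h2 a (h.qK h.hq), Finset.card_pair hcp]) b (h.qK hb) hab
          simp only [Finset.mem_insert, Finset.mem_singleton] at hm
          rcases hm with e | e
          · exact absurd (e ▸ h.hc.2) (Finset.mem_sdiff.mp hb).2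
          · exact e)
      rw [hQp, ← this]
      ext y
      simp only [Finset.mem_erase, Finset.mem_insert, Finset.mem_singleton]
      constructor
      · tauto
      · rintro rfl; exact ⟨hrp, Or.inr rfl⟩
    · obtain ⟨s, hs, hl, hR⟩ := h.ext hG hK h2 hr hrp hnb
      have hrm : r ∈ A \ insert p T := by rw [hQp]; exact Finset.mem_erase.mpr ⟨hrp, hr⟩
      have hqm : q ∈ A \ insert p T := by rw [hQp]; exact Finset.mem_erase.mpr ⟨h.ne.symm, h.hq⟩
      have hconn : Conn G (A \ insert p T) := by
        rw [hQp] at hrm ⊢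
        refine ⟨⟨r, hrm⟩, fun E hE hne hcl => ?_⟩
        by_cases hrE : r ∈ E
        · have := h.conn.2 (insert p E) (Finset.insert_subset h.hp (hE.trans (Finset.erase_subset _ _))) (Finset.insert_nonempty _ _) (by
            intro a ha b hb hab
            rw [Finset.mem_insert] at ha ⊢
            by_cases hbp : b = p
            · exact Or.inl hbp
            right
            rcases ha with rfl | ha
            · rw [hpw b hb hab]; exact hrE
            · exact hcl a ha b (Finset.mem_erase.mpr ⟨hbp, hb⟩) hab)
          rw [← this, Finset.erase_insert (fun hc => Finset.notMem_erase _ _ (hE hc))]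
        · exfalso
          have := h.conn.2 E (hE.trans (Finset.erase_subset _ _)) hne (by
            intro a ha b hb hab
            apply hcl a ha b (Finset.mem_erase.mpr ⟨?_, hb⟩) hab
            rintro rfl
            exact hrE (hpw a (Finset.mem_of_mem_erase (hE ha)) hab.symm ▸ ha))
          exact Finset.notMem_erase _ _ (hE (this ▸ h.hp))
      have harc : Arc G A fs fu K (insert p T) p c r q s (Function.update f d.length p) := by
        refine ⟨hR, by omega, by rw [hl]; simp, ⟨h.qK h.hp, by simp⟩, ⟨h.hc.1, by simp [h.hc.2]⟩, hrm, hqm, hrq, ?_, ?_, hconn⟩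
        · rw [hQp]; exact (Finset.erase_subset _ _).trans h.qK
        · intro x hxK hxT w hw
          rw [hQp, Finset.mem_erase] at hw
          rcases Finset.mem_insert.mp hxT with rfl | hxT
          · constructor
            · exact fun ha => Or.inl ⟨rfl, hpw w hw.2 ha⟩
            · rintro (e | e)
              · rw [e.2]; exact hpr
              · exact absurd (e.1 ▸ h.hc.2) hpA.2
          · rw [h.edge x hxK hxT w hw.2]
            constructor
            · rintro (e | e)
              · exact absurd e.2 hw.1
              · exact Or.inr e
            · rintro (e | e)
              · exact absurd (e.1 ▸ hxT) hpA.2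
              · exact Or.inr e
      rcases hA.step hs with hh | hh
      · refine ih _ _ _ _ _ ?_ hh harc
        rw [hQp, Finset.card_erase_of_mem h.hp]; omega
      · refine hR.red hG hI (arc_frame hG hK h2 hR.sub harc.qK harc.ne harc.edge) hconn hh (Or.inl ?_)
        rw [← Finset.card_pair hrq]
        exact Finset.card_le_card (by
          intro y hy
          simp only [Finset.mem_insert, Finset.mem_singleton] at hy
          rcases hy with rfl | rfl
          · exact hrm
          · exact hqm)
end arc

section noleaf
set_option linter.unusedSectionVars false
variable {V : Type*} [DecidableEq V] {G : SimpleGraph V} [DecidableRel G.Adj]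
variable {A : Finset V} {fs fu : V → Bool}
variable {d : List Node} {f : ℕ → V} {B K T : Finset V} {p : V}

theorem dg_erase {a : V} (ha : a ∈ K) (x : V) : dg G K x = dg G (K.erase a) x + if G.Adj x a then 1 else 0 := by
  unfold dg
  conv_lhs => rw [← Finset.insert_erase ha]
  rw [Finset.filter_insert]
  split_ifs
  · rw [Finset.card_insert_of_notMem (by simp)]
  · rfl

theorem sum_erase {a : V} (ha : a ∈ K) :
    ∑ x ∈ K, dg G K x = ∑ x ∈ K.erase a, dg G (K.erase a) x + 2 * dg G K a := by
  rw [← Finset.add_sum_erase K _ ha, Finset.sum_congr rfl (fun x _ => dg_erase (G := G) ha x), Finset.sum_add_distrib,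
    ← Finset.card_filter]
  have : ((K.erase a).filter fun x => G.Adj x a).card = dg G K a := by
    rw [dg_erase ha a, if_neg (G.loopless.irrefl a)]
    simp only [dg, G.adj_comm]; rfl
  rw [this]; ring

theorem sum_even (n : ℕ) : ∀ K : Finset V, K.card = n → Even (∑ x ∈ K, dg G K x) := by
  induction n with
  | zero => intro K hK; rw [Finset.card_eq_zero.mp hK]; simp
  | succ n ih =>
    intro K hK
    obtain ⟨a, ha⟩ := Finset.card_pos.mp (by omega : 0 < K.card)
    rw [sum_erase ha]
    exact (ih _ (by rw [Finset.card_erase_of_mem ha]; omega)).add (even_two_mul _)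

/-- enough edges force a subset of minimum degree at least two -/
theorem core_exists (n : ℕ) : ∀ Y : Finset V, Y.card = n → Y.Nonempty → 2 * Y.card ≤ ∑ x ∈ Y, dg G Y x + 1 →
    ∃ K ⊆ Y, K.Nonempty ∧ ∀ x ∈ K, 2 ≤ dg G K x := by
  induction n with
  | zero => intro Y hY hne; exact absurd (Finset.card_eq_zero.mp hY) hne.ne_empty
  | succ n ih =>
    intro Y hY hne h
    by_cases hall : ∀ x ∈ Y, 2 ≤ dg G Y x
    · exact ⟨Y, Finset.Subset.refl _, hne, hall⟩
    · push Not at hall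
      obtain ⟨a, ha, hd⟩ := hall
      have h1 := sum_erase (G := G) ha
      have h2 := Finset.card_erase_of_mem ha
      by_cases he : (Y.erase a).Nonempty
      · obtain ⟨K, hK, hh⟩ := ih (Y.erase a) (by omega) he (by omega)
        exact ⟨K, hK.trans (Finset.erase_subset _ _), hh⟩
      · rw [Finset.not_nonempty_iff_eq_empty] at he
        have h3 := dg_erase (G := G) ha a
        rw [he, if_neg (G.loopless.irrefl a)] at h3
        rw [he] at h1 h2
        have : dg G (∅ : Finset V) a = 0 := by simp [dg]
        simp at h1 h2
        omega

theorem cyc_exists {X : Finset V} (hne : X.Nonempty) (h : 2 * X.card ≤ ∑ x ∈ X, dg G X x + 1) :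
    ∃ K ⊆ X, Conn G K ∧ ∀ x ∈ K, dg G K x = 2 := by
  obtain ⟨K0, hK0, hh0⟩ := core_exists _ X rfl hne h
  obtain ⟨K, hKm, hmin⟩ := Finset.exists_min_image (X.powerset.filter fun K => K.Nonempty ∧ ∀ x ∈ K, 2 ≤ dg G K x)
    Finset.card ⟨K0, by rw [Finset.mem_filter, Finset.mem_powerset]; exact ⟨hK0, hh0⟩⟩
  rw [Finset.mem_filter, Finset.mem_powerset] at hKm
  obtain ⟨hKX, hKne, hK2⟩ := hKm
  have hmin' : ∀ D ⊆ K, D.Nonempty → (∀ x ∈ D, 2 ≤ dg G D x) → D = K := by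
    intro D hD hn hd
    exact Finset.eq_of_subset_of_card_le hD (hmin D (by
      rw [Finset.mem_filter, Finset.mem_powerset]; exact ⟨hD.trans hKX, hn, hd⟩))
  refine ⟨K, hKX, ⟨hKne, fun D hD hn hcl => hmin' D hD hn fun x hx => (hK2 x (hD hx)).trans ?_⟩, ?_⟩
  · apply Finset.card_le_card
    intro y hy
    rw [Finset.mem_filter] at hy ⊢
    exact ⟨hcl x hx y hy.1 hy.2, hy.2⟩
  have hno : ∀ a ∈ K, ∑ x ∈ K, dg G K x + 3 < 2 * K.card + 2 * dg G K a := by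
    intro a ha
    by_contra hc
    have h1 := sum_erase (G := G) ha
    have h2 := Finset.card_erase_of_mem ha
    have h4 := hK2 a ha
    have h5 : dg G K a ≤ (K.erase a).card := by
      rw [dg_erase ha a, if_neg (G.loopless.irrefl a)]; exact Finset.card_filter_le _ _
    obtain ⟨D, hD, hn, hd⟩ := core_exists (G := G) _ (K.erase a) rfl (Finset.card_pos.mp (by omega)) (by omega)
    have := hmin' D (hD.trans (Finset.erase_subset _ _)) hn hd
    exact Finset.notMem_erase a K (hD (this ▸ ha))
  obtain ⟨m, hm, hmm⟩ := Finset.exists_min_image K (dg G K) hKne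
  have h1 := hno m hm
  have h2 : K.card * dg G K m ≤ ∑ x ∈ K, dg G K x := by
    have := Finset.card_nsmul_le_sum K (dg G K) _ hmm
    simpa using this
  have h5 : dg G K m < K.card := by
    have : dg G K m ≤ (K.erase m).card := by
      rw [dg_erase hm m, if_neg (G.loopless.irrefl m)]; exact Finset.card_filter_le _ _
    have := Finset.card_erase_of_mem hm
    have := Finset.card_pos.mpr hKne
    omega
  have hm2 : dg G K m = 2 := by
    have := hK2 m hm
    by_contra hc
    have : 3 ≤ dg G K m := by omega
    nlinarith
  intro x hx
  by_contra hc
  have h3 : ∑ y ∈ K, 2 < ∑ y ∈ K, dg G K y :=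
    Finset.sum_lt_sum (fun y hy => hK2 y hy) ⟨x, hx, by have := hK2 x hx; omega⟩
  rw [Finset.sum_const, smul_eq_mul] at h3
  omega

theorem arc_start (hG : Good G A fs fu) (hI : IHyp G A.card) (hK : K ⊆ A) (hKc : Conn G K)
    (h2 : ∀ w ∈ K, dg G K w = 2) (hp : p ∈ K) (hT : A \ T = K.erase p) (hpT : p ∈ T)
    (hR : Real G A fs fu (fun x _ => decide (x ∈ K)) d f T) (hpos : 0 < d.length) (htop : f (d.length - 1) = p)
    (hd : InA d ∨ RedA d) : Bd G A fs fu := by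
  obtain ⟨a, b, hab, he⟩ := Finset.card_eq_two.mp (h2 p hp)
  have hm : ∀ y, (y ∈ K ∧ G.Adj p y) ↔ y = a ∨ y = b := by
    intro y; rw [← Finset.mem_filter (p := fun y => G.Adj p y), he]; simp
  have hmT : ∀ y, y = a ∨ y = b → y ∈ A \ T := by
    intro y hy
    have := (hm y).mpr hy
    rw [hT]; exact Finset.mem_erase.mpr ⟨fun hc => G.loopless.irrefl p (hc ▸ this.2), this.1⟩
  have hconn : Conn G (K.erase p) := by
    refine ⟨⟨a, hT ▸ hmT a (Or.inl rfl)⟩, fun E hE hne hcl => ?_⟩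
    have hEK := hE.trans (Finset.erase_subset _ _)
    have hpE : p ∉ E := fun hc => Finset.notMem_erase _ _ (hE hc)
    have hdg : ∀ x ∈ E, 2 = dg G E x + if G.Adj x p then 1 else 0 := by
      intro x hx
      rw [← h2 x (hEK hx), dg_erase hp x]
      congr 1
      apply congrArg Finset.card
      ext y
      rw [Finset.mem_filter, Finset.mem_filter]
      exact ⟨fun h => ⟨hcl x hx y h.1 h.2, h.2⟩, fun h => ⟨hE h.1, h.2⟩⟩
    have hsum : ∑ x ∈ E, 2 = ∑ x ∈ E, dg G E x + dg G E p := by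
      rw [Finset.sum_congr rfl hdg, Finset.sum_add_distrib, ← Finset.card_filter]
      simp only [dg, G.adj_comm]
    rw [Finset.sum_const, smul_eq_mul] at hsum
    obtain ⟨k, hk⟩ := sum_even (G := G) _ E rfl
    have hle : dg G E p ≤ 2 := by
      rw [← h2 p hp]; exact Finset.card_le_card (Finset.filter_subset_filter _ hEK)
    have h02 : dg G E p = 0 ∨ dg G E p = 2 := by omega
    rcases h02 with h | h
    · have := hKc.2 E hEK hne (by
        intro x hx y hy hxy
        by_cases hyp : y = p
        · subst hyp
          have hmem : x ∈ E.filter fun z => G.Adj y z := Finset.mem_filter.mpr ⟨hx, hxy.symm⟩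
          rw [Finset.card_eq_zero.mp h] at hmem
          simp at hmem
        · exact hcl x hx y (Finset.mem_erase.mpr ⟨hyp, hy⟩) hxy)
      exact absurd (this ▸ hp) hpE
    · have hf : E.filter (fun y => G.Adj p y) = K.filter fun y => G.Adj p y :=
        Finset.eq_of_subset_of_card_le (Finset.filter_subset_filter _ hEK) (by
          have := h2 p hp; unfold dg at this h; omega)
      have := hKc.2 (insert p E) (Finset.insert_subset hp hEK) (Finset.insert_nonempty _ _) (by
        intro x hx y hy hxy
        rw [Finset.mem_insert] at hx ⊢
        by_cases hyp : y = p
        · exact Or.inl hyp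
        right
        rcases hx with rfl | hx
        · have : y ∈ K.filter fun y => G.Adj x y := Finset.mem_filter.mpr ⟨hy, hxy⟩
          rw [← hf] at this
          exact (Finset.mem_filter.mp this).1
        · exact hcl x hx y (Finset.mem_erase.mpr ⟨hyp, hy⟩) hxy)
      rw [← this, Finset.erase_insert hpE]
  have harc : Arc G A fs fu K T p p a b d f := by
    refine ⟨hR, hpos, htop, ⟨hp, hpT⟩, ⟨hp, hpT⟩, hmT a (Or.inl rfl), hmT b (Or.inr rfl), hab,
      hT ▸ Finset.erase_subset _ _, ?_, hT ▸ hconn⟩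
    intro x hxK hxT w hw
    have hxp : x = p := by
      by_contra hc
      have : x ∈ A \ T := hT ▸ Finset.mem_erase.mpr ⟨hc, hxK⟩
      exact (Finset.mem_sdiff.mp this).2 hxT
    subst hxp
    have := hm w
    have hwK : w ∈ K := Finset.mem_of_mem_erase (hT ▸ hw)
    tauto
  rcases hd with hd | hd
  · exact arc_phase hG hI hK h2 _ _ _ _ _ _ le_rfl hd harc
  · refine hR.red hG hI (arc_frame hG hK h2 hR.sub harc.qK hab harc.edge) harc.conn hd (Or.inl ?_)
    rw [hT, Finset.card_erase_of_mem hp]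
    have : dg G K p ≤ (K.erase p).card := by
      rw [dg_erase hp p, if_neg (G.loopless.irrefl p)]; exact Finset.card_filter_le _ _
    rw [h2 p hp, Finset.card_erase_of_mem hp] at this
    exact this

/-- a cycle whose complement is connected (or empty) -/
theorem good_cycle (hG : Good G A fs fu) (hd : ∀ x ∈ A, 2 ≤ dg G A x) :
    ∃ K ⊆ A, Conn G K ∧ (∀ x ∈ K, dg G K x = 2) ∧ (K = A ∨ Conn G (A \ K)) := by
  obtain ⟨K0, hK0, hc0, h20⟩ := cyc_exists (G := G) hG.conn.1 (by
    have : A.card • 2 ≤ ∑ x ∈ A, dg G A x := Finset.card_nsmul_le_sum A (dg G A) 2 hd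
    rw [smul_eq_mul] at this; omega)
  by_cases hA0 : K0 = A
  · exact ⟨K0, hK0, hc0, h20, Or.inl hA0⟩
  have hex : ∀ K ⊆ A, ∀ y ∈ A \ K, Conn G K → (∀ x ∈ K, dg G K x = 2) →
      ∃ B ⊆ A \ K, y ∈ B ∧ Conn G B ∧ ∀ a ∈ B, ∀ b ∈ A \ K, G.Adj a b → b ∈ B := fun K _ y hy _ _ => comp_exists _ hy
  classical
  let P := (A.powerset ×ˢ A.powerset).filter fun x : Finset V × Finset V => (Conn G x.1 ∧ ∀ y ∈ x.1, dg G x.1 y = 2) ∧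
    x.2 ⊆ A \ x.1 ∧ Conn G x.2 ∧ ∀ a ∈ x.2, ∀ b ∈ A \ x.1, G.Adj a b → b ∈ x.2
  have hP : ∀ K B, (K, B) ∈ P ↔ K ⊆ A ∧ (Conn G K ∧ ∀ y ∈ K, dg G K y = 2) ∧
    B ⊆ A \ K ∧ Conn G B ∧ ∀ a ∈ B, ∀ b ∈ A \ K, G.Adj a b → b ∈ B := by
    intro K B
    simp only [P, Finset.mem_filter, Finset.mem_product, Finset.mem_powerset]
    exact ⟨fun h => ⟨h.1.1, h.2⟩, fun h => ⟨⟨h.1, h.2.2.1.trans Finset.sdiff_subset⟩, h.2⟩⟩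
  obtain ⟨y0, hy0⟩ := Finset.sdiff_nonempty.mpr (fun hc => hA0 (Finset.Subset.antisymm hK0 hc))
  obtain ⟨B0, hB0, -, hB0'⟩ := hex K0 hK0 y0 hy0 hc0 h20
  obtain ⟨⟨K, B⟩, hm, hmax⟩ := Finset.exists_max_image P (fun x => x.2.card) ⟨(K0, B0), (hP _ _).mpr ⟨hK0, ⟨hc0, h20⟩, hB0, hB0'⟩⟩
  rw [hP] at hm
  obtain ⟨hK, ⟨hKc, h2⟩, hB, hBc, hcl⟩ := hm
  refine ⟨K, hK, hKc, h2, Or.inr ?_⟩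
  suffices hh : A \ K ⊆ B by rwa [Finset.Subset.antisymm hh hB]
  by_contra hne
  obtain ⟨y1, hy1, hy1B⟩ := Finset.not_subset.mp hne
  have hBA : B ⊆ A := hB.trans Finset.sdiff_subset
  have hBK : ∀ b ∈ B, b ∉ K := fun b hb => (Finset.mem_sdiff.mp (hB hb)).2
  obtain ⟨b0, hb0, a, haK, hba⟩ : ∃ b ∈ B, ∃ a ∈ K, G.Adj b a := by
    by_contra hc
    push Not at hc
    have := hG.conn.2 B hBA hBc.1 (fun x hx y hy hxy => by
      by_cases hyK : y ∈ K
      · exact absurd hxy (hc x hx y hyK)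
      · exact hcl x hx y (Finset.mem_sdiff.mpr ⟨hy, hyK⟩) hxy)
    exact hy1B (this ▸ (Finset.mem_sdiff.mp hy1).1)
  have haA := hK haK
  have haB : a ∉ B := fun h => hBK a h haK
  have haR : ∀ y ∈ A, y ∉ K → G.Adj a y → y = b0 := by
    rcases Knbr hG hK h2 haK with h | ⟨_, b, _, _, _, hu⟩
    · exact absurd hba.symm (h.2 b0 (hBA hb0) (hBK b0 hb0))
    · intro y h1 h3 h4
      rw [hu y h1 h3 h4, hu b0 (hBA hb0) (hBK b0 hb0) hba.symm]
  set R := (A \ K) \ B with hR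
  have hRm : ∀ y, y ∈ R ↔ y ∈ A ∧ y ∉ K ∧ y ∉ B := by
    intro y; simp only [hR, Finset.mem_sdiff]; tauto
  have hRa : ∀ x ∈ R, ∀ y ∈ A, G.Adj x y → y ≠ a ∧ y ∉ B := by
    intro x hx y hy hxy
    have hx' := (hRm x).mp hx
    refine ⟨?_, fun h => hx'.2.2 (hcl y h x (Finset.mem_sdiff.mpr ⟨hx'.1, hx'.2.1⟩) hxy.symm)⟩
    rintro rfl
    exact hx'.2.2 (haR x hx'.1 hx'.2.1 hxy.symm ▸ hb0)
  set Y := R ∪ K.erase a with hY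
  have hdis : Disjoint R (K.erase a) := Finset.disjoint_left.mpr fun x hx hx' =>
    ((hRm x).mp hx).2.1 (Finset.mem_of_mem_erase hx')
  have hYm : ∀ y ∈ A, y ≠ a → y ∉ B → y ∈ Y := by
    intro y h1 h3 h4
    rw [hY, Finset.mem_union, hRm, Finset.mem_erase]; tauto
  have hs1 : 2 * R.card ≤ ∑ x ∈ R, dg G Y x := by
    have : R.card • 2 ≤ ∑ x ∈ R, dg G Y x := Finset.card_nsmul_le_sum R (dg G Y) 2 (fun x hx => (hd x ((hRm x).mp hx).1).trans (by
      apply Finset.card_le_card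
      intro y hy
      rw [Finset.mem_filter] at hy ⊢
      have := hRa x hx y hy.1 hy.2
      exact ⟨hYm y hy.1 this.1 this.2, hy.2⟩))
    rw [smul_eq_mul] at this; omega
  obtain ⟨r0, hr0, k0, hk0, hrk⟩ : ∃ r ∈ R, ∃ k ∈ K, G.Adj r k := by
    by_contra hc
    push Not at hc
    have := hG.conn.2 R (fun x hx => ((hRm x).mp hx).1) ⟨y1, Finset.mem_sdiff.mpr ⟨hy1, hy1B⟩⟩ (fun x hx y hy hxy =>
      (hRm y).mpr ⟨hy, fun h => hc x hx y h hxy, (hRa x hx y hy hxy).2⟩)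
    exact ((hRm a).mp (this ▸ haA)).2.1 haK
  have hs2 : ∑ x ∈ K.erase a, dg G (K.erase a) x < ∑ x ∈ K.erase a, dg G Y x := by
    apply Finset.sum_lt_sum
    · exact fun x _ => Finset.card_le_card (Finset.filter_subset_filter _ Finset.subset_union_right)
    · refine ⟨k0, Finset.mem_erase.mpr ⟨(hRa r0 hr0 k0 (hK hk0) hrk).1, hk0⟩, Finset.card_lt_card ?_⟩
      rw [Finset.ssubset_iff_of_subset (Finset.filter_subset_filter _ Finset.subset_union_right)]
      refine ⟨r0, Finset.mem_filter.mpr ⟨Finset.mem_union_left _ hr0, hrk.symm⟩, fun hc => ?_⟩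
      exact ((hRm r0).mp hr0).2.1 (Finset.mem_of_mem_erase (Finset.mem_filter.mp hc).1)
  have hs3 := sum_erase (G := G) haK
  rw [Finset.sum_congr rfl h2, Finset.sum_const, smul_eq_mul, h2 a haK] at hs3
  have hc1 := Finset.card_union_of_disjoint hdis
  have hc2 := Finset.card_erase_of_mem haK
  obtain ⟨K', hK', hKc', h2'⟩ := cyc_exists (G := G) (X := Y) ⟨r0, Finset.mem_union_left _ hr0⟩ (by
    rw [← hY] at hc1
    have : ∑ x ∈ Y, dg G Y x = ∑ x ∈ R, dg G Y x + ∑ x ∈ K.erase a, dg G Y x := Finset.sum_union hdis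
    omega)
  have hYn : ∀ y ∈ Y, y ∈ A ∧ y ≠ a ∧ y ∉ B := by
    intro y hy
    rw [hY, Finset.mem_union, hRm, Finset.mem_erase] at hy
    rcases hy with hy | hy
    · exact ⟨hy.1, fun hc => hy.2.1 (hc ▸ haK), hy.2.2⟩
    · exact ⟨hK hy.2, hy.1, fun hc => hBK y hc hy.2⟩
  have hBK' : ∀ b ∈ B, b ∈ A \ K' := fun b hb => Finset.mem_sdiff.mpr ⟨hBA hb, fun h => (hYn b (hK' h)).2.2 hb⟩
  have haK' : a ∈ A \ K' := Finset.mem_sdiff.mpr ⟨haA, fun h => (hYn a (hK' h)).2.1 rfl⟩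
  have hKA' : K' ⊆ A := fun y hy => (hYn y (hK' hy)).1
  obtain ⟨D, hD, haD, hDc, hDcl⟩ := hex K' hKA' a haK' hKc' h2'
  have hBD : B ∩ D = B := hBc.2 (B ∩ D) Finset.inter_subset_left
    ⟨b0, Finset.mem_inter.mpr ⟨hb0, hDcl a haD b0 (hBK' b0 hb0) hba.symm⟩⟩ (fun x hx y hy hxy =>
      Finset.mem_inter.mpr ⟨hy, hDcl x (Finset.mem_inter.mp hx).2 y (hBK' y hy) hxy⟩)
  have h1 := hmax (K', D) ((hP _ _).mpr ⟨hKA', ⟨hKc', h2'⟩, hD, hDc, hDcl⟩)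
  have h3 : (insert a B).card ≤ D.card := Finset.card_le_card (Finset.insert_subset haD (Finset.inter_eq_left.mp hBD))
  rw [Finset.card_insert_of_notMem haB] at h3
  simp only at h1
  omega

theorem no_leaf (hG : Good G A fs fu) (hI : IHyp G A.card) (hd : ∀ x ∈ A, 2 ≤ dg G A x) : Bd G A fs fu := by
  obtain ⟨K, hK, hKc, h2, hh⟩ := good_cycle hG hd
  have hz : ∀ p ∈ K, outE G (K.erase p) (fun x _ => decide (x ∈ K)) false p = 0 ∧
      outE G (K.erase p) (fun x _ => decide (x ∈ K)) true p = 2 := by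
    intro p hp
    refine ⟨by unfold outE; simp [hp], ?_⟩
    rw [← h2 p hp, dg_erase hp p, if_neg (G.loopless.irrefl p)]
    unfold outE dg; simp [hp]
  rcases hh with rfl | hBc
  · obtain ⟨p, hp⟩ := hKc.1
    obtain ⟨t, ht, hty⟩ := tyOK_two (fs := fs) (fu := fu) (h2 p hp)
    have hs := Finset.sdiff_singleton_eq_erase p K
    exact arc_start hG hI hK hKc h2 hp hs (by simp)
      (Real.single hp hty (by rw [hs]; exact (hz p hp).1) (by rw [hs]; exact (hz p hp).2)) (by simp) rfl (Or.inl (InA.base ht))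
  set B := A \ K with hB
  have hBm : ∀ y, y ∈ B ↔ y ∈ A ∧ y ∉ K := fun y => by rw [hB, Finset.mem_sdiff]
  have hAB : A \ B = K := by rw [hB, Finset.sdiff_sdiff_eq_self hK]
  obtain ⟨v, hv, p, hp, hvp⟩ : ∃ v ∈ B, ∃ p ∈ K, G.Adj v p := by
    by_contra hc
    push Not at hc
    have := hG.conn.2 B Finset.sdiff_subset hBc.1 (fun x hx y hy hxy =>
      (hBm y).mpr ⟨hy, fun h => hc x hx y h hxy⟩)
    obtain ⟨k, hk⟩ := hKc.1
    exact ((hBm k).mp (this ▸ hK hk)).2 hk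
  have hu : ∀ w ∈ K, ∀ x ∈ B, G.Adj x w → dg G A w = 3 ∧ ∀ x' ∈ B, G.Adj x' w → x' = x := by
    intro w hw x hx hxw
    rw [hBm] at hx
    rcases Knbr hG hK h2 hw with h | ⟨h3, b, _, _, _, hu⟩
    · exact absurd hxw.symm (h.2 x hx.1 hx.2)
    · refine ⟨h3, fun x' hx' ha => ?_⟩
      rw [hBm] at hx'
      rw [hu x hx.1 hx.2 hxw.symm, hu x' hx'.1 hx'.2 ha.symm]
  have hpu := hu p hp v hv hvp
  have hV : Valid G A B v p := by
    refine ⟨hv, hAB ▸ hp, hvp, hBc, hAB ▸ hKc, ⟨Finset.sdiff_subset, ?_, ?_⟩, Or.inl ?_⟩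
    · intro w hw x hx ha _
      rw [hAB] at hw
      exact ⟨(hu w hw x hx ha).1, fun x' hx' ha' _ => (hu w hw x hx ha).2 x' hx' ha'⟩
    · intro w hw x hx x' hx' ha ha' _ _
      exact ((hu w (hAB ▸ hw) x hx ha).2 x' hx' ha').symm
    · rw [hAB, ← h2 p hp]; exact Finset.card_filter_le _ _
  rcases claim hG hI _ _ v p le_rfl hV with h | ⟨d, f, hin, hr⟩
  · exact h
  have hT : A \ insert p B = K.erase p := by rw [Finset.sdiff_insert, hAB]
  have hpB : p ∉ B := fun h => ((hBm p).mp h).2 hp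
  have hr2 := hr.2.1
  have hn := hr.1
  have := hr2.addNode (bd' := fun x _ => decide (x ∈ K)) (t := 0) (out := 0) (bad := 2) (nbB := [d.length - 1])
    (nbO := []) (hK hp) hpB (by simp) (by intro i hi; simp at hi; omega) (by
      intro i hi
      rw [bdp_true, List.mem_singleton]
      constructor
      · rintro ⟨_, h1, _⟩
        exact hr2.inj i hi _ (by omega) (h1.trans hr.2.2.symm)
      · rintro rfl; rw [hr.2.2]; exact ⟨hvp, rfl, rfl⟩) (by
      intro i hi
      simp only [List.not_mem_nil, iff_false, bdp_false]
      rintro ⟨ha, hb⟩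
      exact hb ⟨hpu.2 _ (hr2.mem hi) ha, trivial⟩) (by
      intro x hx w hw _
      have h1 : bdp v p x w = false := by
        rw [bdp_false]; rintro ⟨_, rfl⟩; simp at hw
      rw [h1, decide_eq_false_iff_not]
      exact ((hBm x).mp hx).2) (tyOK_three hpu.1) (by rw [hT]; exact (hz p hp).1) (by rw [hT]; exact (hz p hp).2)
  rw [← addArc_eq] at this
  have hl : (addArc d).length = d.length + 1 := by rw [addArc_eq, addNode_length]
  exact arc_start hG hI hK hKc h2 hp hT (by simp) this (by omega) (by rw [hl]; simp) hin.arc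

theorem bd_all (n : ℕ) : IHyp G n := by
  induction n with
  | zero => intro A fs fu h; omega
  | succ n ih =>
    intro A fs fu hn hG
    have hI : IHyp G A.card := fun A' fs' fu' h => ih A' fs' fu' (by omega)
    by_cases h1 : ∃ p ∈ A, dg G A p = 1
    · obtain ⟨p, hp, hd⟩ := h1
      exact leaf_phase hG hI hp hd
    by_cases h0 : ∃ p ∈ A, dg G A p = 0
    · obtain ⟨p, hp, hd⟩ := h0
      have hd' := hd
      rw [dg, Finset.card_eq_zero, Finset.filter_eq_empty_iff] at hd'
      have : {p} = A := hG.conn.2 {p} (by simpa using hp) (by simp) (by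
        intro x hx y hy hxy
        rw [Finset.mem_singleton] at hx
        subst hx
        exact absurd hxy (hd' hy))
      by_cases hf : fs p = true ∧ fu p = true
      · refine ⟨∅, ⟨by simp, ?_⟩, by simp⟩
        intro x hx _
        rw [← this, Finset.mem_singleton] at hx
        subst hx
        exact ⟨Or.inl hf.1, Or.inl hf.2⟩
      · refine ⟨A, ⟨Finset.Subset.refl _, fun x hx hx' => absurd hx hx'⟩, ?_⟩
        have hw : Wn (dg G A p) (fs p) (fu p) = 20 := by
          rw [hd]; revert hf; generalize fs p = a; generalize fu p = b; revert a b; decide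
        have : ∑ x ∈ A, Wn (dg G A x) (fs x) (fu x) = 20 := by
          rw [← hw, ← Finset.sum_singleton (fun x => Wn (dg G A x) (fs x) (fu x)) p]
          exact Finset.sum_congr this.symm fun _ _ => rfl
        have : A.card = 1 := by rw [← ‹{p} = A›]; simp
        omega
    · push Not at h0 h1
      exact no_leaf hG hI (fun x hx => by have := h0 x hx; have := h1 x hx; omega)
end noleaf

section final
set_option linter.unusedSectionVars false
variable {V : Type*} [DecidableEq V] {G : SimpleGraph V} [DecidableRel G.Adj]

theorem conn_of_reach {A : Finset V} (hne : A.Nonempty) (hr : ∀ x ∈ A, ∀ y ∈ A, G.Reachable x y)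
    (hcl : ∀ x ∈ A, ∀ y, G.Adj x y → y ∈ A) : Conn G A := by
  refine ⟨hne, fun D hD ⟨x, hx⟩ hc => Finset.Subset.antisymm hD fun y hy => ?_⟩
  obtain ⟨w⟩ := hr x (hD hx) y hy
  have key : ∀ a b, G.Walk a b → a ∈ D → b ∈ D := by
    intro a b w
    induction w with
    | nil => exact id
    | cons h _ ih => exact fun ha => ih (hc _ ha _ (hcl _ (hD ha) _ h) h)
  exact key x y w hx
end final

end RDom

/-- If `G` is a finite simple graph with all degrees `2` or `3` and exactly `k`
connected components, then `10·γ_r(G) ≤ 5·n₂(G) + 4·n₃(G) + 5·k`. -/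
theorem ten_mul_restrainedDominationNumber_le_of_components
    {V : Type*} [Fintype V] (G : SimpleGraph V) (k : ℕ)
    (hcomp : Nat.card G.ConnectedComponent = k)
    (hdeg : ∀ v : V, (G.neighborSet v).ncard = 2 ∨ (G.neighborSet v).ncard = 3) :
    10 * restrainedDominationNumber G ≤
      5 * {v : V | (G.neighborSet v).ncard = 2}.ncard
        + 4 * {v : V | (G.neighborSet v).ncard = 3}.ncard + 5 * k := by
  classical
  have hdgA : ∀ A : Finset V, ∀ x, (∀ y, G.Adj x y → y ∈ A) → RDom.dg G A x = (G.neighborSet x).ncard := by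
    intro A x h
    rw [Set.ncard_eq_toFinset_card', RDom.dg]
    congr 1
    ext y
    simp only [Finset.mem_filter, Set.mem_toFinset, SimpleGraph.mem_neighborSet]
    exact ⟨fun hh => hh.2, fun hh => ⟨h y hh, hh⟩⟩
  let comp : V → G.ConnectedComponent := G.connectedComponentMk
  let A : G.ConnectedComponent → Finset V := fun c => Finset.univ.filter fun x => comp x = c
  have hA : ∀ c x, x ∈ A c ↔ comp x = c := by intro c x; simp [A]
  have hcl : ∀ c, ∀ x ∈ A c, ∀ y, G.Adj x y → y ∈ A c := by
    intro c x hx y hxy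
    rw [hA] at hx ⊢
    rw [← hx]
    exact (SimpleGraph.ConnectedComponent.eq.mpr hxy.reachable).symm
  have hB : ∀ c, RDom.Bd G (A c) (fun _ => false) (fun _ => false) := by
    intro c
    refine RDom.bd_all ((A c).card + 1) _ _ _ (by omega) ⟨?_, ?_, ?_⟩
    · refine RDom.conn_of_reach ?_ ?_ (hcl c)
      · obtain ⟨x, hx⟩ := c.exists_rep
        exact ⟨x, (hA c x).mpr hx⟩
      · intro x hx y hy
        rw [hA] at hx hy
        exact SimpleGraph.ConnectedComponent.eq.mp (hx.trans hy.symm)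
    · intro x hx
      rw [hdgA _ x (hcl c x hx)]
      rcases hdeg x with h | h <;> omega
    · intro x hx h
      rw [hdgA _ x (hcl c x hx)] at h
      rcases hdeg x with h' | h' <;> omega
  choose S hS hSc using hB
  let T : Finset V := Finset.univ.filter fun x => x ∈ S (comp x)
  have hT : ∀ x, x ∈ T ↔ x ∈ S (comp x) := by intro x; simp [T]
  have hTc : ∀ c, T.filter (fun x => comp x = c) = S c := by
    intro c
    ext x
    rw [Finset.mem_filter, hT]
    constructor
    · rintro ⟨h, rfl⟩; exact h
    · intro h
      have := (hA c x).mp ((hS c).1 h)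
      exact ⟨this ▸ h, this⟩
  have hle : restrainedDominationNumber G ≤ T.card := by
    apply Nat.sInf_le
    refine ⟨(T : Set V), ⟨fun v hv => ?_, fun v hv => ?_⟩, Set.ncard_coe_finset T⟩ <;>
    · rw [Finset.mem_coe, hT] at hv
      have hm := (hS (comp v)).2 v ((hA _ v).mpr rfl) hv
      first
        | obtain ⟨y, hy, ha⟩ := hm.1.resolve_left (by simp)
          have hyc := (hA _ y).mp ((hS _).1 hy)
          exact ⟨y, by rw [Finset.mem_coe, hT, hyc]; exact hy, ha⟩
        | obtain ⟨y, hyA, hy, ha⟩ := hm.2.resolve_left (by simp)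
          have hyc := (hA _ y).mp hyA
          exact ⟨y, by rw [Finset.mem_coe, hT, hyc]; exact hy, ha⟩
  have hcard : T.card = ∑ c, (S c).card := by
    rw [Finset.card_eq_sum_card_fiberwise (f := comp) (t := Finset.univ) (fun _ _ => by simp)]
    exact Finset.sum_congr rfl fun c _ => by rw [hTc]
  have hk : Fintype.card G.ConnectedComponent = k := by rw [← hcomp, Nat.card_eq_fintype_card]
  let W : V → ℕ := fun x => 10 * (if (G.neighborSet x).ncard = 2 then 1 else 0) + 8 * (if (G.neighborSet x).ncard = 3 then 1 else 0)
  have hW : ∀ c, ∑ x ∈ A c, RDom.Wn (RDom.dg G (A c) x) false false = ∑ x ∈ A c, W x := by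
    intro c
    apply Finset.sum_congr rfl
    intro x hx
    rw [hdgA _ x (hcl c x hx)]
    rcases hdeg x with h | h <;> simp only [W, h] <;> rfl
  have hsum : 20 * T.card ≤ ∑ x, W x + 10 * k := by
    rw [hcard, Finset.mul_sum, ← Finset.sum_fiberwise Finset.univ comp W, ← hk]
    calc ∑ c, 20 * (S c).card ≤ ∑ c, (∑ x ∈ A c, W x + 10) := Finset.sum_le_sum fun c _ => by
          rw [← hW]; exact hSc c
      _ = _ := by rw [Finset.sum_add_distrib]; simp [A, mul_comm]
  have hWs : ∑ x, W x = 10 * {v : V | (G.neighborSet v).ncard = 2}.ncard + 8 * {v : V | (G.neighborSet v).ncard = 3}.ncard := by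
    simp only [W]
    rw [Finset.sum_add_distrib, ← Finset.mul_sum, ← Finset.mul_sum, ← Finset.card_filter, ← Finset.card_filter,
      ← Set.ncard_coe_finset, ← Set.ncard_coe_finset]
    simp
  omega
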